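/- Let m ∈ (m_s, 1), let u be a radial energy solution of the fast diffusion equation with exponent m and extinction time T > 0, and let V be a stationary profile for the same m and T. Then for every integer k ≥ 1 there exists a smooth function F_k : (0,∞) → ℝ with lim_{r→∞} F_k(r) = 1 such that lim_{t → T⁻} sup_{r > 0} | ∂ᵏ_r u(r,t) / ( (−1)ᵏ ((N−1)/m)ᵏ (1 − t/T)^{1/(1−m)} V(r)^{1/m} ) − F_k(r) | = 0. -/

import Mathlib

open MeasureTheory Set Filter Topology

/-- Membership in the radial energy space `H¹_rad` on hyperbolic space `ℍ^N`:
`v` is locally absolutely continuous on `(0,∞)` (expressed via the fundamental theorem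
of calculus for its a.e. derivative) and both `v` and `v'` are square-integrable with
respect to the weight `(sinh s)^(N-1)`. -/
def MemH1rad (N : ℕ) (v : ℝ → ℝ) : Prop :=
  (∀ a b : ℝ, 0 < a → a ≤ b → v b - v a = ∫ s in a..b, deriv v s) ∧
  MeasureTheory.IntegrableOn (fun s => (v s) ^ 2 * Real.sinh s ^ (N - 1)) (Set.Ioi 0) ∧
  MeasureTheory.IntegrableOn (fun s => (deriv v s) ^ 2 * Real.sinh s ^ (N - 1)) (Set.Ioi 0)

/-- The squared `H¹` norm `‖v‖_2² + ‖v'‖_2²` with weight `(sinh s)^(N-1)`. -/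
noncomputable def H1normSq (N : ℕ) (v : ℝ → ℝ) : ℝ :=
  (∫ s in Set.Ioi (0:ℝ), (v s) ^ 2 * Real.sinh s ^ (N - 1)) +
  (∫ s in Set.Ioi (0:ℝ), (deriv v s) ^ 2 * Real.sinh s ^ (N - 1))

/-- A radial energy solution of the fast diffusion equation `u_t = Δ(u^m)` on `ℍ^N`,
with exponent `m`, extinction time `T` (initial datum `u(·,0)`). -/
structure IsRadialEnergySolution (N : ℕ) (m T : ℝ) (u : ℝ → ℝ → ℝ) : Prop where
  continuousOn : ContinuousOn (fun p : ℝ × ℝ => u p.1 p.2) (Set.Ici 0 ×ˢ Set.Icc 0 T)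
  nonneg : ∀ r ∈ Set.Ici (0:ℝ), ∀ t ∈ Set.Icc (0:ℝ) T, 0 ≤ u r t
  smooth : ContDiffOn ℝ (⊤ : ℕ∞) (fun p : ℝ × ℝ => u p.1 p.2) (Set.Ici 0 ×ˢ Set.Ioo 0 T)
  pos : ∀ r ∈ Set.Ici (0:ℝ), ∀ t ∈ Set.Ioo (0:ℝ) T, 0 < u r t
  pde : ∀ r > (0:ℝ), ∀ t ∈ Set.Ioo (0:ℝ) T,
    deriv (fun τ => u r τ) t
      = deriv (deriv (fun ρ => u ρ t ^ m)) r
        + ((N : ℝ) - 1) * (Real.cosh r / Real.sinh r) * deriv (fun ρ => u ρ t ^ m) r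
  neumann : ∀ t ∈ Set.Ioo (0:ℝ) T, deriv (fun ρ => u ρ t ^ m) 0 = 0
  extinction : ∀ r ∈ Set.Ici (0:ℝ), u r T = 0
  energy : ∀ t ∈ Set.Ioo (0:ℝ) T, MemH1rad N (fun ρ => u ρ t ^ m)
  energy_bdd : ∀ ε ∈ Set.Ioo (0:ℝ) T, ∃ C : ℝ, ∀ t ∈ Set.Ico ε T,
    H1normSq N (fun ρ => u ρ t ^ m) ≤ C
  init_bdd : ∃ M : ℝ, ∀ r ∈ Set.Ici (0:ℝ), u r 0 ≤ M
  init_nonzero : ∃ r ∈ Set.Ici (0:ℝ), u r 0 ≠ 0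
  init_energy : MemH1rad N (fun ρ => u ρ 0 ^ m)

/-- A stationary profile for the fast diffusion equation: a smooth positive radial
energy solution of `-ΔV = V^(1/m)/((1-m)T)` on `ℍ^N`, decaying like `e^{-(N-1)r}`
together with all of its derivatives. -/
structure IsStationaryProfile (N : ℕ) (m T : ℝ) (V : ℝ → ℝ) : Prop where
  smooth : ContDiffOn ℝ (⊤ : ℕ∞) V (Set.Ici 0)
  pos : ∀ r ∈ Set.Ici (0:ℝ), 0 < V r
  deriv_zero : deriv V 0 = 0
  mem : MemH1rad N V
  ode : ∀ r > (0:ℝ),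
    deriv (deriv V) r + ((N : ℝ) - 1) * (Real.cosh r / Real.sinh r) * deriv V r
      + V r ^ (1 / m) / ((1 - m) * T) = 0
  asymp : ∃ l > (0:ℝ), ∀ k : ℕ,
    Filter.Tendsto (fun r => Real.exp (((N : ℝ) - 1) * r) * iteratedDeriv k V r)
      Filter.atTop (nhds ((-1 : ℝ) ^ k * ((N : ℝ) - 1) ^ k * l))

set_option autoImplicit false
set_option linter.all false
open scoped ContDiff
open Real (cosh sinh hasDerivAt_sinh sinh_pos_iff log hasDerivAt_cosh cosh_pos cosh_sq one_le_cosh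
  sinh_lt_cosh continuous_sinh sinh_zero rpow_le_rpow rpow_mul rpow_one mul_rpow rpow_add
  rpow_lt_rpow_of_neg hasDerivAt_rpow_const rpow_sub rpow_add_one rpow_pos_of_pos rpow_natCast
  rpow_nonneg rpow_neg div_rpow sqrt_sq sqrt_mul self_le_sinh_iff sinh_le_sinh rpow_zero
  continuous_cosh sinh_nonneg_iff rpow_neg_one rpow_le_rpow_of_nonpos zero_rpow sqrt_pos rpow_sub_one
  rpow_lt_one exp exp_pos exp_nat_mul cosh_eq exp_add exp_le_exp one_rpow rpow_le_one one_le_rpow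
  one_le_exp)

lemma mul_mono_l {a b c : ℝ} (h : b ≤ c) (h0 : 0 ≤ a) : a * b ≤ a * c := mul_le_mul_of_nonneg_left h h0
lemma mul_mono_r {a b c : ℝ} (h : b ≤ c) (h0 : 0 ≤ a) : b * a ≤ c * a := mul_le_mul_of_nonneg_right h h0

noncomputable def pr (φ : ℝ → ℝ → ℝ) : ℝ → ℝ → ℝ := fun r t => deriv (fun ρ => φ ρ t) r
noncomputable def pt (φ : ℝ → ℝ → ℝ) : ℝ → ℝ → ℝ := fun r t => deriv (fun τ => φ r τ) t

def Sm (a b : ℝ) (φ : ℝ → ℝ → ℝ) : Prop :=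
  ∃ ψ : ℝ × ℝ → ℝ, ContDiffOn ℝ ∞ ψ (Ici 0 ×ˢ Ioo a b) ∧
    ∀ r > (0:ℝ), ∀ t ∈ Ioo a b, φ r t = ψ (r, t)

section smlem
variable {a b : ℝ} {φ χ : ℝ → ℝ → ℝ}

lemma sm_nhds {r t : ℝ} (hr : 0 < r) (ht : t ∈ Ioo a b) :
    (Ioi 0 ×ˢ Ioo a b : Set (ℝ × ℝ)) ∈ 𝓝 (r, t) :=
  (isOpen_Ioi.prod isOpen_Ioo).mem_nhds ⟨hr, ht⟩

lemma Sm.cd (h : Sm a b φ) : ContDiffOn ℝ ∞ (fun q : ℝ × ℝ => φ q.1 q.2) (Ioi 0 ×ˢ Ioo a b) := by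
  obtain ⟨ψ, h1, h2⟩ := h
  refine (h1.mono (prod_mono Ioi_subset_Ici_self subset_rfl)).congr ?_
  rintro ⟨r, t⟩ ⟨hr, ht⟩; exact h2 r hr t ht

lemma Sm.cdAt (h : Sm a b φ) {r t : ℝ} (hr : 0 < r) (ht : t ∈ Ioo a b) :
    ContDiffAt ℝ ∞ (fun q : ℝ × ℝ => φ q.1 q.2) (r, t) :=
  h.cd.contDiffAt (sm_nhds hr ht)

lemma Sm.cdr (h : Sm a b φ) {r t : ℝ} (hr : 0 < r) (ht : t ∈ Ioo a b) :
    ContDiffAt ℝ ∞ (fun ρ => φ ρ t) r :=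
  (h.cdAt hr ht).comp (f := fun ρ : ℝ => (ρ, t)) r (by fun_prop)

lemma Sm.cdt (h : Sm a b φ) {r t : ℝ} (hr : 0 < r) (ht : t ∈ Ioo a b) :
    ContDiffAt ℝ ∞ (fun τ => φ r τ) t :=
  (h.cdAt hr ht).comp (f := fun τ : ℝ => (r, τ)) t (by fun_prop)

lemma Sm.hr (h : Sm a b φ) {r t : ℝ} (hr : 0 < r) (ht : t ∈ Ioo a b) :
    HasDerivAt (fun ρ => φ ρ t) (pr φ r t) r :=
  ((h.cdr hr ht).differentiableAt (by simp)).hasDerivAt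

lemma Sm.ht (h : Sm a b φ) {r t : ℝ} (hr : 0 < r) (ht : t ∈ Ioo a b) :
    HasDerivAt (fun τ => φ r τ) (pt φ r t) t :=
  ((h.cdt hr ht).differentiableAt (by simp)).hasDerivAt

lemma Sm.cont (h : Sm a b φ) : ContinuousOn (fun q : ℝ × ℝ => φ q.1 q.2) (Ioi 0 ×ˢ Ioo a b) :=
  h.cd.continuousOn

lemma Sm.pr_eq (h : Sm a b φ) {r t : ℝ} (hr : 0 < r) (ht : t ∈ Ioo a b) :
    pr φ r t = fderiv ℝ (fun q : ℝ × ℝ => φ q.1 q.2) (r, t) (1, 0) := by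
  have h1 := ((h.cdAt hr ht).differentiableAt (by simp)).hasFDerivAt
  have h2 : HasDerivAt (fun ρ : ℝ => (ρ, t)) ((1:ℝ), (0:ℝ)) r :=
    (hasDerivAt_id r).prodMk (hasDerivAt_const r t)
  exact (h1.comp_hasDerivAt r h2).deriv

lemma Sm.pt_eq (h : Sm a b φ) {r t : ℝ} (hr : 0 < r) (ht : t ∈ Ioo a b) :
    pt φ r t = fderiv ℝ (fun q : ℝ × ℝ => φ q.1 q.2) (r, t) (0, 1) := by
  have h1 := ((h.cdAt hr ht).differentiableAt (by simp)).hasFDerivAt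
  have h2 : HasDerivAt (fun τ : ℝ => (r, τ)) ((0:ℝ), (1:ℝ)) t :=
    (hasDerivAt_const t r).prodMk (hasDerivAt_id t)
  exact (h1.comp_hasDerivAt t h2).deriv

lemma Sm.fd (h : Sm a b φ) (v : ℝ × ℝ) :
    Sm a b (fun r t => fderiv ℝ (fun q : ℝ × ℝ => φ q.1 q.2) (r, t) v) := by
  obtain ⟨ψ, h1, h2⟩ := h
  have hu : UniqueDiffOn ℝ (Ici 0 ×ˢ Ioo a b : Set (ℝ × ℝ)) :=
    (uniqueDiffOn_Ici 0).prod (uniqueDiffOn_Ioo a b)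
  refine ⟨fun q => fderivWithin ℝ ψ (Ici 0 ×ˢ Ioo a b) q v,
    (h1.fderivWithin hu (by simp)).clm_apply contDiffOn_const, ?_⟩
  intro r hr t ht
  have hm : (Ici 0 ×ˢ Ioo a b : Set (ℝ × ℝ)) ∈ 𝓝 (r, t) :=
    mem_of_superset (sm_nhds hr ht) (prod_mono Ioi_subset_Ici_self subset_rfl)
  simp only
  rw [fderivWithin_of_mem_nhds hm]
  congr 1
  apply Filter.EventuallyEq.fderiv_eq
  filter_upwards [sm_nhds hr ht] with q hq
  exact h2 q.1 hq.1 q.2 hq.2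

lemma Sm.congr (h : Sm a b φ) (h' : ∀ r > (0:ℝ), ∀ t ∈ Ioo a b, χ r t = φ r t) : Sm a b χ := by
  obtain ⟨ψ, h1, h2⟩ := h
  exact ⟨ψ, h1, fun r hr t ht => (h' r hr t ht).trans (h2 r hr t ht)⟩

lemma Sm.Pr (h : Sm a b φ) : Sm a b (pr φ) := (h.fd (1, 0)).congr fun _ hr _ ht => h.pr_eq hr ht
lemma Sm.Pt (h : Sm a b φ) : Sm a b (pt φ) := (h.fd (0, 1)).congr fun _ hr _ ht => h.pt_eq hr ht

lemma Sm.add (h : Sm a b φ) (h' : Sm a b χ) : Sm a b (fun r t => φ r t + χ r t) := by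
  obtain ⟨ψ, h1, h2⟩ := h
  obtain ⟨ψ', h1', h2'⟩ := h'
  exact ⟨_, h1.add h1', fun r hr t ht => by beta_reduce; rw [h2 r hr t ht, h2' r hr t ht]⟩

lemma Sm.mul (h : Sm a b φ) (h' : Sm a b χ) : Sm a b (fun r t => φ r t * χ r t) := by
  obtain ⟨ψ, h1, h2⟩ := h
  obtain ⟨ψ', h1', h2'⟩ := h'
  exact ⟨_, h1.mul h1', fun r hr t ht => by beta_reduce; rw [h2 r hr t ht, h2' r hr t ht]⟩

lemma Sm.const (c : ℝ) : Sm a b (fun _ _ => c) := ⟨fun _ => c, contDiffOn_const, fun _ _ _ _ => rfl⟩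

lemma Sm.bdd (h : Sm a b φ) (R : ℝ) {t1 t2 : ℝ} (h1 : a < t1) (h2 : t2 < b) :
    ∃ C > 0, ∀ r ∈ Ioc 0 R, ∀ t ∈ Icc t1 t2, |φ r t| ≤ C := by
  obtain ⟨ψ, h3, h4⟩ := h
  have hc : IsCompact (Icc 0 R ×ˢ Icc t1 t2 : Set (ℝ × ℝ)) := isCompact_Icc.prod isCompact_Icc
  have hs : (Icc 0 R ×ˢ Icc t1 t2 : Set (ℝ × ℝ)) ⊆ Ici 0 ×ˢ Ioo a b :=
    prod_mono Icc_subset_Ici_self fun x hx => ⟨h1.trans_le hx.1, hx.2.trans_lt h2⟩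
  obtain ⟨C, hC⟩ := hc.exists_bound_of_continuousOn (h3.continuousOn.mono hs)
  refine ⟨max C 1, by positivity, fun r hr t ht => ?_⟩
  rw [h4 r hr.1 t ⟨h1.trans_le ht.1, ht.2.trans_lt h2⟩]
  exact (hC (r, t) ⟨⟨hr.1.le, hr.2⟩, ht⟩).trans (le_max_left _ _)

lemma Sm.comm (h : Sm a b φ) {r t : ℝ} (hr : 0 < r) (ht : t ∈ Ioo a b) :
    pr (pt φ) r t = pt (pr φ) r t := by
  have hc := h.cdAt hr ht
  set Φ : ℝ × ℝ → ℝ := fun q => φ q.1 q.2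
  have hd : DifferentiableAt ℝ (fderiv ℝ Φ) (r, t) :=
    (hc.fderiv_right (m := 1) (by rw [one_add_one_eq_two]; exact ENat.LEInfty.out)).differentiableAt (by simp)
  have e1 : (fun q : ℝ × ℝ => pt φ q.1 q.2) =ᶠ[𝓝 (r, t)] fun q => fderiv ℝ Φ q (0, 1) := by
    filter_upwards [sm_nhds hr ht] with q hq using h.pt_eq hq.1 hq.2
  have e2 : (fun q : ℝ × ℝ => pr φ q.1 q.2) =ᶠ[𝓝 (r, t)] fun q => fderiv ℝ Φ q (1, 0) := by
    filter_upwards [sm_nhds hr ht] with q hq using h.pr_eq hq.1 hq.2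
  rw [h.Pt.pr_eq hr ht, h.Pr.pt_eq hr ht, e1.fderiv_eq, e2.fderiv_eq,
    fderiv_clm_apply hd (by fun_prop), fderiv_clm_apply hd (by fun_prop)]
  simp only [fderiv_fun_const, Pi.zero_apply, _root_.add_apply,
    ContinuousLinearMap.comp_apply, ContinuousLinearMap.flip_apply, _root_.zero_apply,
    map_zero, zero_add]
  exact (hc.isSymmSndFDerivAt (by simpa using (ENat.LEInfty.out : (2:WithTop ℕ∞) ≤ ∞))) (1, 0) (0, 1)

end smlem

section smint
variable {a b : ℝ} {φ χ : ℝ → ℝ → ℝ}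

lemma Sm.cont_t (h : Sm a b φ) {r : ℝ} (hr : 0 < r) : ContinuousOn (fun t => φ r t) (Ioo a b) :=
  fun _ ht => (h.ht hr ht).continuousAt.continuousWithinAt

lemma Sm.cont_r (h : Sm a b φ) {t : ℝ} (ht : t ∈ Ioo a b) : ContinuousOn (fun r => φ r t) (Ioi 0) :=
  fun _ hr => (h.hr hr ht).continuousAt.continuousWithinAt

lemma Sm.int_t (h : Sm a b φ) {r t1 t2 : ℝ} (hr : 0 < r) (h1 : t1 ∈ Ioo a b) (h2 : t2 ∈ Ioo a b) :
    IntervalIntegrable (fun t => φ r t) volume t1 t2 :=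
  ((h.cont_t hr).mono (ordConnected_Ioo.uIcc_subset h1 h2)).intervalIntegrable

lemma Sm.hint (h : Sm a b φ) {r t1 t2 : ℝ} (hr : 0 < r) (h1 : t1 ∈ Ioo a b) (h2 : t2 ∈ Ioo a b) :
    HasDerivAt (fun ρ => ∫ s in t1..t2, φ ρ s) (∫ s in t1..t2, pr φ r s) r := by
  obtain ⟨C, hC, hb⟩ := h.Pr.bdd (2 * r) (t1 := min t1 t2) (t2 := max t1 t2)
    (lt_min h1.1 h2.1) (max_lt h1.2 h2.2)
  have hs : Ioo 0 (2 * r) ∈ 𝓝 r := Ioo_mem_nhds hr (by linarith)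
  have hsub := ordConnected_Ioo.uIcc_subset h1 h2
  refine (intervalIntegral.hasDerivAt_integral_of_dominated_loc_of_deriv_le (bound := fun _ => C)
    hs ?_ (h.int_t hr h1 h2) (h.Pr.int_t hr h1 h2).aestronglyMeasurable_restrict_uIoc ?_
    intervalIntegrable_const ?_).2
  · filter_upwards [hs] with ρ hρ
    exact (h.int_t hρ.1 h1 h2).aestronglyMeasurable_restrict_uIoc
  · refine Eventually.of_forall fun t ht ρ hρ => ?_
    exact hb ρ ⟨hρ.1, hρ.2.le⟩ t (uIoc_subset_uIcc ht)
  · refine Eventually.of_forall fun t ht ρ hρ => ?_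
    exact h.hr hρ.1 (hsub (uIoc_subset_uIcc ht))

lemma Sm.ftc (h : Sm a b φ) {r t1 t2 : ℝ} (hr : 0 < r) (h1 : t1 ∈ Ioo a b) (h2 : t2 ∈ Ioo a b) :
    ∫ s in t1..t2, pt φ r s = φ r t2 - φ r t1 :=
  intervalIntegral.integral_eq_sub_of_hasDerivAt
    (fun t ht => h.ht hr (ordConnected_Ioo.uIcc_subset h1 h2 ht)) (h.Pt.int_t hr h1 h2)

lemma Sm.hW (h : Sm a b φ) {r t1 t : ℝ} (hr : 0 < r) (h1 : t1 ∈ Ioo a b) (h2 : t ∈ Ioo a b) :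
    HasDerivAt (fun τ => ∫ s in t1..τ, φ r s) (φ r t) t :=
  intervalIntegral.integral_hasDerivAt_right (h.int_t hr h1 h2)
    ((h.cont_t hr).stronglyMeasurableAtFilter isOpen_Ioo t h2) (h.ht hr h2).continuousAt
end smint

structure Sol (n : ℕ) (p a b : ℝ) (f : ℝ → ℝ → ℝ) : Prop where
  hn : 1 ≤ n
  hp : 1 < p
  sm0 : ContDiffOn ℝ ∞ (fun q : ℝ × ℝ => f q.1 q.2) (Ici 0 ×ˢ Ioo a b)
  pos0 : ∀ r ≥ (0:ℝ), ∀ t ∈ Ioo a b, 0 < f r t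
  pde : ∀ r > (0:ℝ), ∀ t ∈ Ioo a b,
    pt (fun r t => f r t ^ p) r t = pr (pr f) r t + n * (cosh r / sinh r) * pr f r t
  dec : ∃ G : ℝ → ℝ, Tendsto G atTop (𝓝 0) ∧ ∀ r > (0:ℝ), ∀ t ∈ Ioo a b, f r t ≤ G r

section sol
variable {n : ℕ} {p a b : ℝ} {f : ℝ → ℝ → ℝ}

lemma Sol.pos (h : Sol n p a b f) {r t : ℝ} (hr : 0 < r) (ht : t ∈ Ioo a b) : 0 < f r t :=
  h.pos0 r hr.le t ht
lemma Sol.smq (h : Sol n p a b f) (q : ℝ) : Sm a b (fun r t => f r t ^ q) :=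
  ⟨fun x => f x.1 x.2 ^ q, h.sm0.rpow_const_of_ne fun x hx => (h.pos0 x.1 hx.1 x.2 hx.2).ne',
    fun _ _ _ _ => rfl⟩
lemma Sol.sm (h : Sol n p a b f) : Sm a b f := ⟨fun x => f x.1 x.2, h.sm0, fun _ _ _ _ => rfl⟩

lemma Sol.p0 (h : Sol n p a b f) : 0 < p := by linarith [h.hp]

lemma Sol.flux (h : Sol n p a b f) {r t : ℝ} (hr : 0 < r) (ht : t ∈ Ioo a b) :
    HasDerivAt (fun ρ => sinh ρ ^ n * pr f ρ t)
      (sinh r ^ n * pt (fun r t => f r t ^ p) r t) r := by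
  have h1 := ((hasDerivAt_sinh r).pow n).mul (h.sm.Pr.hr hr ht)
  refine h1.congr_deriv ?_
  have hS : sinh r ≠ 0 := (sinh_pos_iff.2 hr).ne'
  rw [h.pde r hr t ht]
  obtain ⟨k, rfl⟩ : ∃ k, n = k + 1 := ⟨n - 1, by have := h.hn; omega⟩
  simp only [Nat.add_sub_cancel, pow_succ, Pi.pow_apply]
  field_simp
  ring

lemma Sol.lapW (h : Sol n p a b f) {r t1 t2 : ℝ} (hr : 0 < r) (h1 : t1 ∈ Ioo a b)
    (h2 : t2 ∈ Ioo a b) :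
    (∫ s in t1..t2, pr (pr f) r s) + n * (cosh r / sinh r) * (∫ s in t1..t2, pr f r s)
      = f r t2 ^ p - f r t1 ^ p := by
  rw [← (h.smq p).ftc hr h1 h2, ← intervalIntegral.integral_const_mul,
    ← intervalIntegral.integral_add (h.sm.Pr.Pr.int_t hr h1 h2)
      ((h.sm.Pr.int_t hr h1 h2).const_mul _)]
  refine intervalIntegral.integral_congr fun s hs => ?_
  exact (h.pde r hr s (ordConnected_Ioo.uIcc_subset h1 h2 hs)).symm
end sol

lemma touch_lap {A A1 : ℝ → ℝ} {A2 r : ℝ} (hA : ∀ᶠ ρ in 𝓝 r, HasDerivAt A (A1 ρ) ρ)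
    (hA1 : HasDerivAt A1 A2 r) (hm : IsLocalMax A r) : A1 r = 0 ∧ A2 ≤ 0 := by
  have h0 : A1 r = 0 := hm.hasDerivAt_eq_zero hA.self_of_nhds
  refine ⟨h0, ?_⟩
  by_contra! hc
  have e : deriv A =ᶠ[𝓝 r] A1 := hA.mono fun ρ hρ => hρ.deriv
  have e2 : deriv (deriv A) r = A2 := e.deriv_eq.trans hA1.deriv
  have hmin := isLocalMin_of_deriv_deriv_pos (f := A) (x₀ := r) (by rw [e2]; exact hc)
    (by rw [e.self_of_nhds, h0]) hA.self_of_nhds.continuousAt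
  have e3 : A =ᶠ[𝓝 r] fun _ => A r := by
    filter_upwards [hm, hmin] with x h1 h2 using le_antisymm h1 h2
  have e4 : deriv A =ᶠ[𝓝 r] fun _ => 0 := by
    have := e3.eventuallyEq_nhds
    filter_upwards [this] with x hx
    rw [hx.deriv_eq]; simp
  rw [e4.deriv_eq] at e2; simp at e2; linarith

lemma touch_time {A : ℝ → ℝ} {A1 t δ : ℝ} (hA : HasDerivAt A A1 t) (hδ : δ < t)
    (hm : ∀ s ∈ Icc δ t, A s ≤ A t) : 0 ≤ A1 := by
  by_contra! hc
  have h1 := hA.hasDerivWithinAt (s := Iio t)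
  rw [hasDerivWithinAt_iff_tendsto_slope' (by simp)] at h1
  have h2 := h1.eventually (gt_mem_nhds hc)
  have h3 : ∀ᶠ s in 𝓝[<] t, s ∈ Ioo δ t := Ioo_mem_nhdsLT hδ
  obtain ⟨s, hs1, hs2⟩ := (h2.and h3).exists
  rw [slope_def_field] at hs1
  have := hm s ⟨hs2.1.le, hs2.2.le⟩
  have h4 : 0 ≤ (A s - A t) / (s - t) := div_nonneg_of_nonpos (by linarith) (by linarith [hs2.2])
  linarith

lemma first_touch {Φ : ℝ → ℝ → ℝ} {ρ1 ρ2 a b : ℝ} (h0 : 0 < ρ1)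
    (hc : ContinuousOn (fun q : ℝ × ℝ => Φ q.1 q.2) (Ioi 0 ×ˢ Icc a b))
    (hi : ∀ r > 0, Φ r a < 0)
    (hK : ∀ r > 0, ∀ t ∈ Icc a b, 0 ≤ Φ r t → r ∈ Icc ρ1 ρ2)
    (hT : ∀ r > 0, ∀ t ∈ Ioc a b, Φ r t = 0 → (∀ ρ > 0, ∀ s ∈ Icc a t, Φ ρ s ≤ 0) → False) :
    ∀ r > 0, ∀ t ∈ Icc a b, Φ r t < 0 := by
  by_contra! hcon
  obtain ⟨r0, hr0, t0, ht0, h1⟩ := hcon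
  set K : Set (ℝ × ℝ) := (Icc ρ1 ρ2 ×ˢ Icc a b) ∩ (fun q : ℝ × ℝ => Φ q.1 q.2) ⁻¹' Ici 0
  have hsub : (Icc ρ1 ρ2 ×ˢ Icc a b : Set (ℝ × ℝ)) ⊆ Ioi 0 ×ˢ Icc a b :=
    prod_mono (fun x hx => h0.trans_le hx.1) subset_rfl
  have hKc : IsCompact K := by
    refine (isCompact_Icc.prod isCompact_Icc).of_isClosed_subset ?_ inter_subset_left
    exact (hc.mono hsub).preimage_isClosed_of_isClosed (isClosed_Icc.prod isClosed_Icc) isClosed_Ici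
  obtain ⟨⟨r, t⟩, hrt, hmin⟩ := hKc.exists_isMinOn ⟨(r0, t0), ⟨hK r0 hr0 t0 ht0 h1, ht0⟩, h1⟩
    continuous_snd.continuousOn
  have hr : 0 < r := h0.trans_le hrt.1.1.1
  have ht : t ∈ Icc a b := hrt.1.2
  have hpos : 0 ≤ Φ r t := hrt.2
  have hat : a < t := lt_of_le_of_ne ht.1 fun e => by subst e; linarith [hi r hr]
  have hlt : ∀ ρ > 0, ∀ s ∈ Ico a t, Φ ρ s < 0 := by
    intro ρ hρ s hs
    by_contra! hge
    have hs' : s ∈ Icc a b := ⟨hs.1, hs.2.le.trans ht.2⟩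
    have := hmin (show (ρ, s) ∈ K from ⟨⟨hK ρ hρ s hs' hge, hs'⟩, hge⟩)
    exact absurd this (not_le.2 hs.2)
  have hle : ∀ ρ > 0, ∀ s ∈ Icc a t, Φ ρ s ≤ 0 := by
    intro ρ hρ s hs
    rcases hs.2.lt_or_eq with h | rfl
    · exact (hlt ρ hρ s ⟨hs.1, h⟩).le
    have hcs : ContinuousOn (fun τ => Φ ρ τ) (Icc a b) :=
      hc.comp (f := fun τ => (ρ, τ)) (by fun_prop) fun τ hτ => ⟨hρ, hτ⟩
    have hcl : s ∈ closure (Ico a s) := by rw [closure_Ico hat.ne]; exact hs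
    refine (isClosed_Iic (a := (0:ℝ))).closure_subset_iff.2 ?_
      ((hcs.mono (Icc_subset_Icc_right ht.2)).mono (closure_Ico hat.ne).subset
        |>.image_closure ⟨s, hcl, rfl⟩)
    rintro _ ⟨τ, hτ, rfl⟩
    exact (hlt ρ hρ τ hτ).le
  exact hT r hr t ⟨hat, ht.2⟩ (le_antisymm (hle r hr t ⟨hat.le, le_rfl⟩) hpos) hle

noncomputable def Lt (r : ℝ) : ℝ := log (sinh r) - log (cosh r)

lemma sinh_pos {r : ℝ} (h : 0 < r) : 0 < sinh r := sinh_pos_iff.2 h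

lemma Lt_deriv {r : ℝ} (h : 0 < r) :
    HasDerivAt Lt (cosh r / sinh r - sinh r / cosh r) r :=
  ((hasDerivAt_sinh r).log (sinh_pos h).ne').sub
    ((hasDerivAt_cosh r).log (cosh_pos r).ne')

lemma Lt_deriv2 {r : ℝ} (h : 0 < r) :
    HasDerivAt (fun r => cosh r / sinh r - sinh r / cosh r)
      (-1 / sinh r ^ 2 - 1 / cosh r ^ 2) r := by
  have h1 := sinh_pos h
  have h2 := cosh_pos r
  have h3 := cosh_sq r
  refine (((hasDerivAt_cosh r).div (hasDerivAt_sinh r) h1.ne').sub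
    ((hasDerivAt_sinh r).div (hasDerivAt_cosh r) h2.ne')).congr_deriv ?_
  rw [← pow_two, ← pow_two, h3]; congr 1 <;> congr 1 <;> ring

lemma Lt_lap {r : ℝ} {n : ℕ} (h : 0 < r) (hn : 1 ≤ n) :
    -1 ≤ (-1 / sinh r ^ 2 - 1 / cosh r ^ 2) + n * (cosh r / sinh r) *
      (cosh r / sinh r - sinh r / cosh r) := by
  have h1 := sinh_pos h
  have h2 := cosh_pos r
  have h3 := cosh_sq r
  have e : (n:ℝ) * (cosh r / sinh r) *
      (cosh r / sinh r - sinh r / cosh r) = n * (1 / sinh r ^ 2) := by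
    field_simp; rw [h3]; ring
  rw [e]
  have h4 : 1 / cosh r ^ 2 ≤ 1 := by
    rw [div_le_one (by positivity)]; nlinarith [one_le_cosh r]
  have h5 : (1:ℝ) ≤ n := by exact_mod_cast hn
  have h6 : 0 ≤ 1 / sinh r ^ 2 := by positivity
  have : -1 / sinh r ^ 2 = - (1 / sinh r ^ 2) := by ring
  rw [this]; nlinarith

lemma Lt_nonpos {r : ℝ} (h : 0 < r) : Lt r ≤ 0 :=
  sub_nonpos.2 (Real.log_le_log (sinh_pos h) (sinh_lt_cosh r).le)

lemma Lt_bot (K : ℝ) : ∃ ρ > 0, ∀ r > 0, K ≤ Lt r → ρ ≤ r := by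
  have h1 : Tendsto sinh (𝓝[>] 0) (𝓝[>] 0) := by
    refine tendsto_nhdsWithin_iff.2 ⟨?_, ?_⟩
    · have := continuous_sinh.tendsto 0
      rw [sinh_zero] at this; exact this.mono_left nhdsWithin_le_nhds
    · filter_upwards [self_mem_nhdsWithin] with x hx using sinh_pos hx
  have h2 := (Real.tendsto_log_nhdsGT_zero.comp h1).eventually (eventually_lt_atBot K)
  obtain ⟨ρ, hρ, h⟩ := mem_nhdsGT_iff_exists_Ioo_subset.1 h2
  refine ⟨ρ, hρ, fun r hr hK => ?_⟩
  by_contra! hc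
  have h3 : log (sinh r) < K := h ⟨hr, hc⟩
  have h4 := Real.log_nonneg (one_le_cosh r)
  unfold Lt at hK; linarith

lemma Sm.contW {a b : ℝ} {φ : ℝ → ℝ → ℝ} (h : Sm a b φ) {t1 : ℝ} (h1 : t1 ∈ Ioo a b) :
    ContinuousOn (fun q : ℝ × ℝ => ∫ s in t1..q.2, φ q.1 s) (Ioi 0 ×ˢ Ioo a b) := by
  rintro ⟨r, t⟩ ⟨hr, ht⟩
  replace hr : 0 < r := hr
  obtain ⟨t3, h3⟩ := exists_between ht.1
  obtain ⟨t4, h4⟩ := exists_between ht.2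
  obtain ⟨C, hC, hb⟩ := h.bdd (2 * r) (t1 := t3) (t2 := t4) h3.1 h4.2
  have hn : Ioo 0 (2 * r) ×ˢ Ioo t3 t4 ∈ 𝓝 (r, t) :=
    prod_mem_nhds (Ioo_mem_nhds hr (by linarith)) (Ioo_mem_nhds h3.2 h4.1)
  apply ContinuousAt.continuousWithinAt
  have e : (fun q : ℝ × ℝ => (∫ s in t1..t, φ q.1 s) + ∫ s in t..q.2, φ q.1 s) =ᶠ[𝓝 (r, t)]
      fun q : ℝ × ℝ => ∫ s in t1..q.2, φ q.1 s := by
    filter_upwards [hn] with q hq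
    have hq2 : q.2 ∈ Ioo a b := ⟨h3.1.trans hq.2.1, hq.2.2.trans h4.2⟩
    exact intervalIntegral.integral_add_adjacent_intervals (h.int_t hq.1.1 h1 ht)
      (h.int_t hq.1.1 ht hq2)
  refine ContinuousAt.congr ?_ e
  refine ContinuousAt.add ?_ ?_
  · exact (h.hint hr h1 ht).continuousAt.comp (f := fun q : ℝ × ℝ => q.1) (x := (r, t))
      continuousAt_fst
  · rw [ContinuousAt, intervalIntegral.integral_same]
    refine squeeze_zero_norm' (a := fun q : ℝ × ℝ => C * |q.2 - t|) ?_ ?_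
    · filter_upwards [hn] with q hq
      refine intervalIntegral.norm_integral_le_of_norm_le_const fun s hs => ?_
      refine hb _ ⟨hq.1.1, hq.1.2.le⟩ s ?_
      exact ordConnected_Icc.uIcc_subset ⟨h3.2.le, h4.1.le⟩ ⟨hq.2.1.le, hq.2.2.le⟩
        (uIoc_subset_uIcc hs)
    · have : Continuous fun q : ℝ × ℝ => C * |q.2 - t| := by fun_prop
      have := this.tendsto (r, t)
      simpa using this

section conc
variable {n : ℕ} {p a b κ : ℝ} {f : ℝ → ℝ → ℝ}

lemma W_nonneg (h : Sol n p a b f) {r t1 t2 : ℝ} (hr : 0 < r) (h1 : t1 ∈ Ioo a b)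
    (h2 : t2 ∈ Ioo a b) (h12 : t1 ≤ t2) : 0 ≤ ∫ s in t1..t2, f r s :=
  intervalIntegral.integral_nonneg h12 fun s hs =>
    (h.pos hr ⟨h1.1.trans_le hs.1, hs.2.trans_lt h2.2⟩).le

lemma W_le (h : Sol n p a b f) {r t1 t2 C : ℝ} (hr : 0 < r) (h1 : t1 ∈ Ioo a b)
    (h2 : t2 ∈ Ioo a b) (h12 : t1 ≤ t2) (hC : ∀ s ∈ Icc t1 t2, f r s ≤ C) :
    ∫ s in t1..t2, f r s ≤ (t2 - t1) * C := by
  have := intervalIntegral.integral_mono_on h12 (h.sm.int_t hr h1 h2)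
    (intervalIntegrable_const (c := C)) hC
  simpa using this

lemma conc_alg {A1 A2 A3 B1 B2 B3 c0 L1 L2 μ x3 θ1 θ2 x1 x2 u0 u1 u2 u3 : ℝ}
    (s1 : θ1 * x1 * B1 + θ2 * x2 * B2 - x3 * B3 + μ * L1 = 0)
    (s2 : θ1 * x1 * A1 + θ2 * x2 * A2 - x3 * A3 + μ * L2 ≤ 0)
    (w1 : A1 + c0 * B1 = u1 - u0) (w2 : A2 + c0 * B2 = u2 - u0) (w3 : A3 + c0 * B3 = u3 - u0)
    (w4 : μ * -1 ≤ μ * (L2 + c0 * L1)) (hx : x3 = θ1 * x1 + θ2 * x2) :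
    θ1 * (x1 * u1) + θ2 * (x2 * u2) ≤ x3 * u3 + μ := by
  have e2 : θ1 * x1 * (A1 + c0 * B1) = θ1 * x1 * (u1 - u0) := by rw [w1]
  have e3 : θ2 * x2 * (A2 + c0 * B2) = θ2 * x2 * (u2 - u0) := by rw [w2]
  have e4 : x3 * (A3 + c0 * B3) = x3 * (u3 - u0) := by rw [w3]
  have e5 : c0 * (θ1 * x1 * B1 + θ2 * x2 * B2 - x3 * B3 + μ * L1) = 0 := by rw [s1, mul_zero]
  have e1 : x3 * u0 = θ1 * x1 * u0 + θ2 * x2 * u0 := by rw [hx]; ring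
  nlinarith

set_option maxHeartbeats 800000 in
lemma Sol.concave (h : Sol n p a b f) (hκ : (p - 1) * κ = 1) {t0 l1 l2 l3 θ1 θ2 r0 : ℝ}
    (hr0 : 0 < r0) (ht0 : t0 ∈ Ioo a b)
    (hl1 : 0 < l1) (hl2 : 0 < l2) (hl3 : 0 < l3) (hb1 : t0 + l1 < b) (hb2 : t0 + l2 < b)
    (hb3 : t0 + l3 < b) (hθ1 : 0 ≤ θ1) (hθ2 : 0 ≤ θ2) (hθ : θ1 + θ2 = 1)
    (hx : l3 ^ (-(κ + 1)) = θ1 * l1 ^ (-(κ + 1)) + θ2 * l2 ^ (-(κ + 1))) :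
    θ1 * l1 ^ (-(κ + 1)) * (∫ s in t0..t0 + l1, f r0 s) +
      θ2 * l2 ^ (-(κ + 1)) * (∫ s in t0..t0 + l2, f r0 s) ≤
      l3 ^ (-(κ + 1)) * (∫ s in t0..t0 + l3, f r0 s) := by
  have hp := h.p0
  have hp1 := h.hp
  -- scaled times
  have hin : ∀ l > 0, t0 + l < b → ∀ t ∈ Icc (0:ℝ) 1, t0 + l * t ∈ Ioo a b := by
    intro l hl hb t ht
    have := mul_nonneg hl.le ht.1
    have := mul_mono_l ht.2 hl.le
    exact ⟨by linarith [ht0.1], by linarith⟩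
  refine le_of_forall_pos_le_add fun e he => ?_
  set ε := e / 3 with hε
  have hε0 : 0 < ε := by positivity
  obtain ⟨μ, hμ0, hμ1, hμ2⟩ : ∃ μ > 0, μ ^ (1 / p) < ε ∧ μ * (-Lt r0) ≤ ε := by
    refine ⟨min ((ε / 2) ^ p) (ε / (1 - Lt r0)), ?_, ?_, ?_⟩
    · have := Lt_nonpos hr0
      have : 0 < 1 - Lt r0 := by linarith
      positivity
    · calc _ ≤ ((ε / 2) ^ p) ^ (1 / p) := by
            have := Lt_nonpos hr0
            have : 0 < 1 - Lt r0 := by linarith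
            exact rpow_le_rpow (by positivity) (min_le_left _ _) (by positivity)
        _ = ε / 2 := by rw [← rpow_mul (by positivity), mul_one_div_cancel hp.ne', rpow_one]
        _ < ε := by linarith
    · have := Lt_nonpos hr0
      have h1 : 0 < 1 - Lt r0 := by linarith
      calc _ ≤ ε / (1 - Lt r0) * (-Lt r0) :=
            mul_mono_r (min_le_right _ _) (by linarith)
        _ ≤ ε := by rw [div_mul_eq_mul_div, div_le_iff₀ h1]; nlinarith
  set x1 := l1 ^ (-(κ + 1)) with hx1
  set x2 := l2 ^ (-(κ + 1)) with hx2
  set x3 := l3 ^ (-(κ + 1)) with hx3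
  have hx1p : 0 < x1 := by positivity
  have hx2p : 0 < x2 := by positivity
  have hx3p : 0 < x3 := by positivity
  set W : ℝ → ℝ → ℝ := fun r t => ∫ s in t0..t, f r s with hW
  set Φ : ℝ → ℝ → ℝ := fun r t => θ1 * x1 * W r (t0 + l1 * t) + θ2 * x2 * W r (t0 + l2 * t)
    - x3 * W r (t0 + l3 * t) + μ * Lt r - ε * (1 + t) with hΦ
  have hWc : ∀ l > 0, t0 + l < b → ContinuousOn (fun q : ℝ × ℝ => W q.1 (t0 + l * q.2))
      (Ioi 0 ×ˢ Icc 0 1) := fun l hl hb =>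
    (h.sm.contW ht0).comp (f := fun q : ℝ × ℝ => (q.1, t0 + l * q.2)) (by fun_prop)
      fun q hq => ⟨hq.1, hin l hl hb q.2 hq.2⟩
  have hc : ContinuousOn (fun q : ℝ × ℝ => Φ q.1 q.2) (Ioi 0 ×ˢ Icc 0 1) := by
    have hL : ContinuousOn (fun q : ℝ × ℝ => Lt q.1) (Ioi 0 ×ˢ Icc 0 1) := fun q hq =>
      ((Lt_deriv hq.1).continuousAt.comp (f := Prod.fst) continuousAt_fst).continuousWithinAt
    exact ((((hWc l1 hl1 hb1).const_mul _).add ((hWc l2 hl2 hb2).const_mul _)).sub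
      ((hWc l3 hl3 hb3).const_mul _) |>.add (hL.const_mul _)).sub (by fun_prop)
  have hcb : ∀ r > 0, ∀ C, (∀ s ∈ Ioo a b, t0 ≤ s → s ≤ t0 + max l1 l2 → f r s ≤ C) →
      ∀ t ∈ Icc (0:ℝ) 1, Φ r t ≤ (θ1 * x1 * l1 + θ2 * x2 * l2) * C + μ * Lt r - ε := by
    intro r hr C hC t ht
    have hC0 : 0 ≤ C := (h.pos hr ht0).le.trans (hC t0 ht0 le_rfl (by
      have := le_max_left l1 l2; linarith))
    have key : ∀ l > 0, t0 + l < b → l ≤ max l1 l2 → W r (t0 + l * t) ≤ l * C := by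
      intro l hl hb hm
      have hlt := mul_nonneg hl.le ht.1
      have hlt2 := mul_mono_l ht.2 hl.le
      have h2 := hin l hl hb t ht
      refine (W_le h hr ht0 h2 (by linarith) fun s hs =>
        hC s ⟨ht0.1.trans_le hs.1, hs.2.trans_lt h2.2⟩ hs.1 (by linarith [hs.2])).trans ?_
      exact mul_mono_r (by linarith) hC0
    have k1 := mul_mono_l (key l1 hl1 hb1 (le_max_left _ _))
      (mul_nonneg hθ1 hx1p.le)
    have k2 := mul_mono_l (key l2 hl2 hb2 (le_max_right _ _))
      (mul_nonneg hθ2 hx2p.le)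
    have k3 : 0 ≤ x3 * W r (t0 + l3 * t) := mul_nonneg hx3p.le
      (W_nonneg h hr ht0 (hin l3 hl3 hb3 t ht) (by
        have := mul_nonneg hl3.le ht.1; linarith))
    have k4 := mul_nonneg hε0.le ht.1
    simp only [hΦ]; linarith
  have hlt : t0 + max l1 l2 < b := by
    rcases max_choice l1 l2 with h | h <;> rw [h] <;> assumption
  set c := θ1 * x1 * l1 + θ2 * x2 * l2 with hcd
  have hc0 : 0 ≤ c := by positivity
  obtain ⟨C1, hC1, hbd⟩ := h.sm.bdd 1 ht0.1 hlt
  obtain ⟨G, hG, hfG⟩ := h.dec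
  obtain ⟨ρ2, hρ2⟩ : ∃ ρ2, ∀ r ≥ ρ2, c * G r < ε := by
    have : Tendsto (fun r => c * G r) atTop (𝓝 0) := by simpa using hG.const_mul c
    exact eventually_atTop.1 (this.eventually (gt_mem_nhds hε0))
  obtain ⟨ρ1, hρ1, hρ1'⟩ := Lt_bot (-(c * C1) / μ)
  have main := first_touch (Φ := Φ) (ρ1 := min ρ1 1) (ρ2 := ρ2) (a := 0) (b := 1)
    (by positivity) hc ?_ ?_ ?_ r0 hr0 1 ⟨zero_le_one, le_rfl⟩
  · simp only [hΦ, mul_one] at main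
    simp only [hW] at main
    linarith
  · intro r hr
    simp only [hΦ, hW, mul_zero, add_zero, intervalIntegral.integral_same]
    linarith [mul_nonpos_of_nonneg_of_nonpos hμ0.le (Lt_nonpos hr)]
  · intro r hr t ht hge
    constructor
    · by_contra! hlt'
      have h1 := hcb r hr C1 (fun s _ h2 h3 => (le_abs_self _).trans
        (hbd r ⟨hr, hlt'.le.trans (min_le_right _ _)⟩ s ⟨h2, h3⟩)) t ht
      have h2 : -(c * C1) / μ ≤ Lt r := by
        rw [div_le_iff₀ hμ0]; linarith
      have := hρ1' r hr h2
      have := min_le_left ρ1 1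
      linarith
    · by_contra! hlt'
      have h1 := hcb r hr (G r) (fun s hs _ _ => hfG r hr s hs) t ht
      have := hρ2 r hlt'.le
      linarith [mul_nonpos_of_nonneg_of_nonpos hμ0.le (Lt_nonpos hr)]
  · intro r hr t ht h0 hmax
    have ht' : t ∈ Icc (0:ℝ) 1 := ⟨ht.1.le, ht.2⟩
    have j1 := hin l1 hl1 hb1 t ht'
    have j2 := hin l2 hl2 hb2 t ht'
    have j3 := hin l3 hl3 hb3 t ht'
    -- time derivative
    have dt : ∀ l, t0 + l * t ∈ Ioo a b →
        HasDerivAt (fun τ => W r (t0 + l * τ)) (l * f r (t0 + l * t)) t := by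
      intro l hl
      have e1 : HasDerivAt (fun τ : ℝ => t0 + l * τ) l t := by
        simpa using ((hasDerivAt_id t).const_mul l).const_add t0
      exact ((h.sm.hW hr ht0 hl).comp t e1).congr_deriv (mul_comm _ _)
    have dΦ : HasDerivAt (fun τ => Φ r τ) (θ1 * x1 * (l1 * f r (t0 + l1 * t))
        + θ2 * x2 * (l2 * f r (t0 + l2 * t)) - x3 * (l3 * f r (t0 + l3 * t)) - ε) t := by
      have e4 : HasDerivAt (fun τ : ℝ => ε * (1 + τ)) ε t := by
        simpa using ((hasDerivAt_id t).const_add 1).const_mul ε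
      exact (((((dt l1 j1).const_mul _).add ((dt l2 j2).const_mul _)).sub
        ((dt l3 j3).const_mul _)).add_const _).sub e4
    have ht1 := touch_time dΦ ht.1 fun s hs => by rw [h0]; exact hmax r hr s hs
    -- space
    have hmx : IsLocalMax (fun ρ => Φ ρ t) r := by
      filter_upwards [Ioi_mem_nhds hr] with ρ hρ
      rw [h0]; exact hmax ρ hρ t ⟨ht.1.le, le_rfl⟩
    have hd1 : ∀ᶠ ρ in 𝓝 r, HasDerivAt (fun ρ => Φ ρ t)
        (θ1 * x1 * (∫ s in t0..t0 + l1 * t, pr f ρ s) + θ2 * x2 * (∫ s in t0..t0 + l2 * t, pr f ρ s)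
        - x3 * (∫ s in t0..t0 + l3 * t, pr f ρ s)
        + μ * (cosh ρ / sinh ρ - sinh ρ / cosh ρ)) ρ := by
      filter_upwards [Ioi_mem_nhds hr] with ρ hρ
      exact ((((h.sm.hint hρ ht0 j1).const_mul _).add ((h.sm.hint hρ ht0 j2).const_mul _)).sub
        ((h.sm.hint hρ ht0 j3).const_mul _) |>.add ((Lt_deriv hρ).const_mul _)).sub_const _
    have hd2 := ((((h.sm.Pr.hint hr ht0 j1).const_mul (θ1 * x1)).add
        ((h.sm.Pr.hint hr ht0 j2).const_mul (θ2 * x2))).sub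
        ((h.sm.Pr.hint hr ht0 j3).const_mul x3) |>.add ((Lt_deriv2 hr).const_mul μ))
    obtain ⟨s1, s2⟩ := touch_lap hd1 hd2 hmx
    have w1 := h.lapW hr ht0 j1
    have w2 := h.lapW hr ht0 j2
    have w3 := h.lapW hr ht0 j3
    have w4 := mul_mono_l (Lt_lap (n := n) hr h.hn) hμ0.le
    set u1 := f r (t0 + l1 * t)
    set u2 := f r (t0 + l2 * t)
    set u3 := f r (t0 + l3 * t)
    have hu1 : 0 < u1 := h.pos hr j1
    have hu2 : 0 < u2 := h.pos hr j2
    have hu3 : 0 < u3 := h.pos hr j3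
    have hq : θ1 * (x1 * u1 ^ p) + θ2 * (x2 * u2 ^ p) ≤ x3 * u3 ^ p + μ := by
      exact conc_alg s1 s2 w1 w2 w3 w4 hx
    have hpw : ∀ l > (0:ℝ), ∀ v > (0:ℝ), (l ^ (-(κ + 1)) * v ^ p) ^ (1 / p) = l ^ (-(κ + 1)) * (l * v) := by
      intro l hl v hv
      rw [mul_rpow (by positivity) (by positivity), ← rpow_mul hl.le,
        ← rpow_mul hv.le, mul_one_div_cancel hp.ne', rpow_one]
      have : -(κ + 1) * (1 / p) = -(κ + 1) + 1 := by field_simp; linarith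
      rw [this, rpow_add hl, rpow_one]; ring
    have hcv := (Real.concaveOn_rpow (p := 1 / p) (by positivity)
      (by rw [div_le_one hp]; exact hp1.le)).2
      (show x1 * u1 ^ p ∈ Ici 0 by simp only [mem_Ici]; positivity)
      (show x2 * u2 ^ p ∈ Ici 0 by simp only [mem_Ici]; positivity) hθ1 hθ2 hθ
    simp only [smul_eq_mul] at hcv
    have hm := rpow_le_rpow (by positivity) hq (show 0 ≤ 1 / p by positivity)
    have hs := Real.rpow_add_le_add_rpow (a := x3 * u3 ^ p) (b := μ) (p := 1 / p) (by positivity)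
      hμ0.le (by positivity) (by rw [div_le_one hp]; exact hp1.le)
    rw [hx1, hx2, hpw l1 hl1 u1 hu1, hpw l2 hl2 u2 hu2, ← hx1, ← hx2] at hcv
    rw [hx3, hpw l3 hl3 u3 hu3, ← hx3] at hs
    linarith
end conc

section bc
variable {n : ℕ} {p a b κ : ℝ} {f : ℝ → ℝ → ℝ}

lemma Sol.bc (h : Sol n p a b f) (hκ : (p - 1) * κ = 1) {t0 r s1 s2 : ℝ}
    (hr : 0 < r) (ht0 : t0 ∈ Ioo a b) (h1 : 0 < s1) (h12 : s1 ≤ s2) (h2 : t0 + s2 < b) :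
    f r (t0 + s2) * s2 ^ (-κ) ≤ f r (t0 + s1) * s1 ^ (-κ) := by
  rcases h12.eq_or_lt with rfl | h12
  · exact le_rfl
  have hκ0 : 0 < κ := by
    have := h.hp
    by_contra! hc
    nlinarith
  set q := κ + 1 with hq
  have hq0 : 0 < q := by linarith
  set k : ℝ → ℝ := fun x => x * ∫ s in t0..t0 + x ^ (-(1 / q)), f r s with hk
  have hb0 : 0 < b - t0 := by linarith [ht0.2]
  set xm := (b - t0) ^ (-q)
  have hxm : 0 < xm := by positivity
  have inv1 : ∀ l : ℝ, 0 < l → (l ^ (-q)) ^ (-(1 / q)) = l := by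
    intro l hl
    rw [← rpow_mul hl.le]
    have : -q * -(1 / q) = 1 := by field_simp
    rw [this, rpow_one]
  have inv2 : ∀ x : ℝ, 0 < x → (x ^ (-(1 / q))) ^ (-q) = x := by
    intro l hl
    rw [← rpow_mul hl.le]
    have : -(1 / q) * -q = 1 := by field_simp
    rw [this, rpow_one]
  have hlt : ∀ x, xm < x → t0 + x ^ (-(1 / q)) < b := by
    intro x hx
    have := rpow_lt_rpow_of_neg hxm hx (z := -(1 / q)) (by simp only [neg_lt_zero]; positivity)
    rw [inv1 _ hb0] at this
    linarith
  have hconc : ConcaveOn ℝ (Ioi xm) k := by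
    refine ⟨convex_Ioi _, fun x hx y hy θ1 θ2 h1 h2 h3 => ?_⟩
    have hz : θ1 • x + θ2 • y ∈ Ioi xm := (convex_Ioi xm) hx hy h1 h2 h3
    simp only [smul_eq_mul] at hz ⊢
    have hx0 : 0 < x := hxm.trans hx
    have hy0 : 0 < y := hxm.trans hy
    have hz0 := hxm.trans hz
    have := h.concave hκ hr ht0 (l1 := x ^ (-(1 / q))) (l2 := y ^ (-(1 / q)))
      (l3 := (θ1 * x + θ2 * y) ^ (-(1 / q))) (by positivity) (by positivity) (by positivity)
      (hlt x hx) (hlt y hy) (hlt _ hz) h1 h2 h3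
      (by rw [inv2 _ hx0, inv2 _ hy0, inv2 _ hz0])
    rw [inv2 _ hx0, inv2 _ hy0, inv2 _ hz0] at this
    simpa only [hk, mul_assoc] using this
  have hs : ∀ s, 0 < s → t0 + s < b → xm < s ^ (-q) := by
    intro s hs hb
    exact rpow_lt_rpow_of_neg hs (by linarith) (by linarith)
  have hd : ∀ s, 0 < s → t0 + s < b →
      HasDerivAt k ((∫ x in t0..t0 + s, f r x) - 1 / q * s * f r (t0 + s)) (s ^ (-q)) := by
    intro s hs hb
    have hx0 : 0 < s ^ (-q) := by positivity
    have d1 : HasDerivAt (fun x : ℝ => t0 + x ^ (-(1 / q)))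
        (-(1 / q) * (s ^ (-q)) ^ (-(1 / q) - 1)) (s ^ (-q)) :=
      (hasDerivAt_rpow_const (Or.inl hx0.ne')).const_add _
    have d2 : HasDerivAt (fun τ => ∫ x in t0..τ, f r x) (f r (t0 + s))
        (t0 + (s ^ (-q)) ^ (-(1 / q))) := by
      rw [inv1 s hs]
      exact h.sm.hW hr ht0 ⟨by linarith [ht0.1], hb⟩
    have d3 := (hasDerivAt_id (s ^ (-q))).mul (d2.comp (s ^ (-q)) d1)
    refine d3.congr_deriv ?_
    simp only [id, Function.comp, inv1 s hs, one_mul]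
    have : (s ^ (-q)) ^ (-(1 / q) - 1) = s / s ^ (-q) := by
      rw [rpow_sub hx0, inv1 s hs, rpow_one]
    rw [this]; field_simp; ring
  have a1 := hs s1 h1 (by linarith)
  have a2 := hs s2 (by linarith) h2
  have h20 : 0 < s2 := by linarith
  have hlt' : s2 ^ (-q) < s1 ^ (-q) := rpow_lt_rpow_of_neg h1 h12 (by linarith)
  have e1 := hconc.le_slope_of_hasDerivAt a2 a1 hlt' (hd s1 h1 (by linarith))
  have e2 := hconc.slope_le_of_hasDerivAt a2 a1 hlt' (hd s2 h20 h2)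
  rw [slope_def_field] at e1 e2
  set x1 := s1 ^ (-q)
  set x2 := s2 ^ (-q)
  have hx2 : 0 < x2 := by positivity
  have e3 := e1.trans e2
  rw [le_div_iff₀ (by linarith)] at e1
  have k1 : k x1 = x1 * ∫ x in t0..t0 + s1, f r x := by simp only [hk, x1, inv1 s1 h1]
  have k2 : k x2 = x2 * ∫ x in t0..t0 + s2, f r x := by simp only [hk, x2, inv1 s2 h20]
  have fin : x2 * (1 / q * s2 * f r (t0 + s2)) ≤ x1 * (1 / q * s1 * f r (t0 + s1)) := by
    rw [k1, k2] at e1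
    nlinarith [mul_mono_l e3 hx2.le]
  have p1 : x1 * s1 = s1 ^ (-κ) := by
    simp only [x1]; rw [← rpow_add_one h1.ne']; congr 1; linarith
  have p2 : x2 * s2 = s2 ^ (-κ) := by
    simp only [x2]; rw [← rpow_add_one h20.ne']; congr 1; linarith
  rw [← p1, ← p2]
  have : x2 * (1 / q * s2 * f r (t0 + s2)) * q ≤ x1 * (1 / q * s1 * f r (t0 + s1)) * q := by gcongr
  field_simp at this
  linarith
end bc

lemma mono_Ioi {F F' : ℝ → ℝ} {c : ℝ} (h : ∀ r > c, HasDerivAt F (F' r) r) (h0 : ∀ r > c, 0 ≤ F' r) :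
    MonotoneOn F (Ioi c) := by
  refine monotoneOn_of_deriv_nonneg (convex_Ioi c)
    (fun r hr => (h r hr).continuousAt.continuousWithinAt) ?_ ?_
  · rw [interior_Ioi]; exact fun r hr => (h r hr).differentiableAt.differentiableWithinAt
  · rw [interior_Ioi]; intro r hr; rw [(h r hr).deriv]; exact h0 r hr

lemma mono_ge_lim0 {F : ℝ → ℝ} {L r : ℝ} (h : MonotoneOn F (Ioi 0)) (hl : Tendsto F (𝓝[>] 0) (𝓝 L))
    (hr : 0 < r) : L ≤ F r := by
  refine le_of_tendsto hl ?_
  filter_upwards [Ioo_mem_nhdsGT hr] with x hx using h hx.1 hr hx.2.le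

lemma mono_le_lim {F : ℝ → ℝ} {L r c : ℝ} (h : MonotoneOn F (Ioi c)) (hl : Tendsto F atTop (𝓝 L))
    (hr : c < r) : F r ≤ L := by
  refine ge_of_tendsto hl ?_
  filter_upwards [eventually_ge_atTop r] with x hx using h hr (hr.trans_le hx) hx

noncomputable def Tn (r : ℝ) : ℝ := sinh r / cosh r
noncomputable def Em (A D r : ℝ) : ℝ := Tn r ^ A * cosh r ^ D

lemma Tn_pos {r : ℝ} (h : 0 < r) : 0 < Tn r := div_pos (sinh_pos h) (cosh_pos r)
lemma Tn_lt {r : ℝ} : Tn r < 1 := (div_lt_one (cosh_pos r)).2 (sinh_lt_cosh r)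
lemma Tn_mul (r : ℝ) : Tn r * cosh r = sinh r := div_mul_cancel₀ _ (cosh_pos r).ne'
lemma Tn_sq (r : ℝ) : (cosh r ^ 2)⁻¹ + Tn r ^ 2 = 1 := by
  have := cosh_sq r
  have h0 := (cosh_pos r).ne'
  unfold Tn; field_simp; linarith

lemma Tn_deriv (r : ℝ) : HasDerivAt Tn ((cosh r ^ 2)⁻¹) r := by
  refine ((hasDerivAt_sinh r).div (hasDerivAt_cosh r) (cosh_pos r).ne').congr_deriv ?_
  have := cosh_sq r
  have h0 := (cosh_pos r).ne'
  field_simp; linarith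

lemma Em_pos {A D r : ℝ} (h : 0 < r) : 0 < Em A D r :=
  mul_pos (rpow_pos_of_pos (Tn_pos h) _) (rpow_pos_of_pos (cosh_pos r) _)
lemma Em_pos' (n : ℕ) {r : ℝ} (h : 0 < r) : 0 < Em 0 (-n) r := Em_pos h

lemma Em_mul {A D A' D' r : ℝ} (h : 0 < r) : Em A D r * Em A' D' r = Em (A + A') (D + D') r := by
  unfold Em
  rw [rpow_add (Tn_pos h), rpow_add (cosh_pos r)]; ring

lemma Em_rpow {A D q r : ℝ} (h : 0 < r) : Em A D r ^ q = Em (q * A) (q * D) r := by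
  unfold Em
  rw [mul_rpow (rpow_pos_of_pos (Tn_pos h) _).le (rpow_pos_of_pos (cosh_pos r) _).le,
    ← rpow_mul (Tn_pos h).le, ← rpow_mul (cosh_pos r).le, mul_comm A, mul_comm D]

lemma Em_le {A D A' D' r : ℝ} (h : 0 < r) (hA : A' ≤ A) (hD : D ≤ D') : Em A D r ≤ Em A' D' r := by
  unfold Em
  have h1 := Tn_pos h
  exact mul_le_mul (Real.rpow_le_rpow_of_exponent_ge h1 Tn_lt.le hA)
    (Real.rpow_le_rpow_of_exponent_le (one_le_cosh r) hD)
    (rpow_pos_of_pos (cosh_pos r) _).le (rpow_pos_of_pos h1 _).le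

lemma Em_deriv {A D r : ℝ} (h : 0 < r) :
    HasDerivAt (Em A D) (Em (A - 1) D r * (A * (cosh r ^ 2)⁻¹ + D * Tn r ^ 2)) r := by
  have h1 := Tn_pos h
  refine (((Tn_deriv r).rpow_const (Or.inl h1.ne')).mul
    ((hasDerivAt_cosh r).rpow_const (Or.inl (cosh_pos r).ne'))).congr_deriv ?_
  unfold Em
  rw [rpow_sub h1, rpow_sub (cosh_pos r), rpow_one, rpow_one, ← Tn_mul r]
  have h0 := (cosh_pos r).ne'
  field_simp

lemma Em_S {n : ℕ} {r : ℝ} : Em n n r = sinh r ^ n := by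
  unfold Em; rw [rpow_natCast, rpow_natCast, ← mul_pow, Tn_mul]

lemma Em_S' {n : ℕ} {r : ℝ} (h : 0 < r) : Em (-n) (-n) r = (sinh r ^ n)⁻¹ := by
  rw [← Em_S]; have := Em_mul (A := -n) (D := -n) (A' := n) (D' := n) h
  refine eq_inv_of_mul_eq_one_left ?_
  rw [this]; simp [Em]

lemma conv_ge {x y m r : ℝ} (hx : m ≤ x) (hy : m ≤ y) :
    m ≤ x * (cosh r ^ 2)⁻¹ + y * Tn r ^ 2 := by
  have h1 := Tn_sq r
  have h2 : 0 ≤ (cosh r ^ 2)⁻¹ := by positivity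
  have h3 := sq_nonneg (Tn r)
  have h4 : m = m * (cosh r ^ 2)⁻¹ + m * Tn r ^ 2 := by rw [← mul_add, h1, mul_one]
  linarith [mul_mono_r hx h2, mul_mono_r hy h3]

section barrier
variable {n : ℕ} {p a b κ : ℝ} {f : ℝ → ℝ → ℝ}

lemma S_tendsto {n : ℕ} (hn : 1 ≤ n) : Tendsto (fun r : ℝ => sinh r ^ n) (𝓝[>] 0) (𝓝 0) := by
  have : Continuous (fun r : ℝ => sinh r ^ n) := by fun_prop
  have := this.tendsto 0
  simp only [sinh_zero] at this
  rw [zero_pow (by omega)] at this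
  exact this.mono_left nhdsWithin_le_nhds

lemma S_mul_tendsto {n : ℕ} (hn : 1 ≤ n) {φ : ℝ → ℝ} {C : ℝ} (h : ∀ r ∈ Ioc (0:ℝ) 1, |φ r| ≤ C) :
    Tendsto (fun r => sinh r ^ n * φ r) (𝓝[>] 0) (𝓝 0) := by
  refine (S_tendsto hn).zero_mul_isBoundedUnder_le ⟨C, ?_⟩
  rw [eventually_map]
  filter_upwards [Ioo_mem_nhdsGT (zero_lt_one' ℝ)] with r hr using h r ⟨hr.1, hr.2.le⟩

lemma Sol.W_lim (h : Sol n p a b f) {t1 t2 : ℝ} (h1 : t1 ∈ Ioo a b) (h2 : t2 ∈ Ioo a b) (h12 : t1 ≤ t2) :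
    Tendsto (fun r => ∫ s in t1..t2, f r s) atTop (𝓝 0) := by
  obtain ⟨G, hG, hb⟩ := h.dec
  have hg := hG.mul_const (t2 - t1)
  rw [zero_mul] at hg
  refine squeeze_zero' (t₀ := atTop) ?_ ?_ hg
  · filter_upwards [eventually_gt_atTop 0] with r hr using W_nonneg h hr h1 h2 h12
  · filter_upwards [eventually_gt_atTop 0] with r hr
    rw [mul_comm]
    refine W_le h hr h1 h2 h12 fun s hs => hb r hr s ?_
    exact ⟨h1.1.trans_le hs.1, hs.2.trans_lt h2.2⟩

lemma Sol.barrier (h : Sol n p a b f) {t1 t2 : ℝ} (h1 : t1 ∈ Ioo a b) (h2 : t2 ∈ Ioo a b)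
    (h12 : t1 ≤ t2) {m m' Ψ Ψ' : ℝ → ℝ} (hm : ∀ r > 0, HasDerivAt m (m' r) r)
    (hm0 : ∀ r > 0, 0 ≤ m r) (hm' : ∀ r > 0, sinh r ^ n * f r t1 ^ p ≤ m' r)
    (hΨ : ∀ r > 0, HasDerivAt Ψ (Ψ' r) r) (hΨ0 : ∀ r > 0, 0 ≤ Ψ r)
    (hΨ' : ∀ r > 0, m r * (sinh r ^ n)⁻¹ ≤ - Ψ' r) {r : ℝ} (hr : 0 < r) :
    ∫ s in t1..t2, f r s ≤ Ψ r := by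
  have hsub := ordConnected_Ioo.uIcc_subset h1 h2
  have hfl : ∀ r > 0, HasDerivAt (fun ρ => sinh ρ ^ n * ∫ s in t1..t2, pr f ρ s)
      (sinh r ^ n * (f r t2 ^ p - f r t1 ^ p)) r := by
    intro r hr
    refine (((hasDerivAt_sinh r).pow n).mul (h.sm.Pr.hint hr h1 h2)).congr_deriv ?_
    have hS : sinh r ≠ 0 := (sinh_pos hr).ne'
    rw [← h.lapW hr h1 h2]
    obtain ⟨k, rfl⟩ : ∃ k, n = k + 1 := ⟨n - 1, by have := h.hn; omega⟩
    simp only [Nat.add_sub_cancel, pow_succ, Pi.pow_apply]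
    field_simp
    ring
  have hmono := mono_Ioi (fun r hr => (hfl r hr).add (hm r hr)) (fun r hr => by
    have := hm' r hr
    have h3 : 0 ≤ sinh r ^ n * f r t2 ^ p :=
      mul_nonneg (pow_nonneg (sinh_pos hr).le _) (rpow_nonneg (h.pos hr h2).le _)
    nlinarith)
  obtain ⟨C, hC, hCb⟩ := h.sm.Pr.bdd 1 h1.1 h2.2
  have hlim : Tendsto (fun ρ => sinh ρ ^ n * ∫ s in t1..t2, pr f ρ s) (𝓝[>] 0) (𝓝 0) := by
    refine S_mul_tendsto h.hn (C := C * |t2 - t1|) fun r hr => ?_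
    refine intervalIntegral.norm_integral_le_of_norm_le_const (f := fun s => pr f r s) fun s hs => ?_
    rw [uIoc_of_le h12] at hs
    exact hCb r hr s ⟨hs.1.le, hs.2⟩
  have key : ∀ r > 0, 0 ≤ sinh r ^ n * (∫ s in t1..t2, pr f r s) + m r := by
    intro r hr
    have hle : ∀ x ∈ Ioc 0 r, sinh x ^ n * (∫ s in t1..t2, pr f x s) ≤
        sinh r ^ n * (∫ s in t1..t2, pr f r s) + m r := fun x hx => by
      have := hmono hx.1 hr hx.2
      simp only [Pi.add_apply] at this
      linarith [hm0 x hx.1]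
    refine le_of_tendsto hlim ?_
    filter_upwards [Ioo_mem_nhdsGT hr] with x hx using hle x ⟨hx.1, hx.2.le⟩
  have hmono2 := mono_Ioi (fun r hr => (h.sm.hint hr h1 h2).sub (hΨ r hr)) (fun r hr => by
    have h3 := key r hr
    have h4 := hΨ' r hr
    have hS := pow_pos (sinh_pos hr) n
    have : 0 ≤ (∫ s in t1..t2, pr f r s) + m r * (sinh r ^ n)⁻¹ := by
      have := mul_nonneg h3 (inv_pos.2 hS).le
      field_simp at this ⊢
      linarith
    linarith)
  have hW := h.W_lim h1 h2 h12
  have : ∀ᶠ x in atTop, (∫ s in t1..t2, f r s) - Ψ r ≤ ∫ s in t1..t2, f x s := by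
    filter_upwards [eventually_ge_atTop r] with x hx
    have := hmono2 hr (hr.trans_le hx) hx
    simp only [Pi.sub_apply] at this
    linarith [hΨ0 x (hr.trans_le hx)]
  linarith [ge_of_tendsto hW this]

lemma S_Em {n : ℕ} {A D c x r : ℝ} (hr : 0 < r) (h : x ≤ c * Em A D r) :
    sinh r ^ n * x ≤ c * Em (n + A) (n + D) r := by
  rw [← Em_S, ← Em_mul hr]
  nlinarith [Em_pos (A := n) (D := n) hr]

lemma Sol.fact2 (h : Sol n p a b f) {A D A' D' : ℝ} (hA : A < n + 1) (hA' : A - 2 ≤ A') (hA0 : 0 < A')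
    (hD0 : 0 < D') (hDn : D' < n) (hD : D' ≤ D) :
    ∃ K > 0, ∀ t1 ∈ Ioo a b, ∀ t2 ∈ Ioo a b, t1 ≤ t2 → ∀ c ≥ 0,
      (∀ r > 0, f r t1 ^ p ≤ c * Em (-A) (-D) r) → ∀ r > 0,
      ∫ s in t1..t2, f r s ≤ c * K * Em (-A') (-D') r := by
  set μ := min (n + 1 - A) (n - D') with hμ
  have hμ0 : 0 < μ := lt_min (by linarith) (by linarith)
  set ν := min A' D' with hν
  have hν0 : 0 < ν := lt_min hA0 hD0
  refine ⟨μ⁻¹ * ν⁻¹, by positivity, fun t1 h1 t2 h2 h12 c hc hu r hr => ?_⟩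
  refine h.barrier h1 h2 h12 (m := fun r => c * μ⁻¹ * Em (n + 1 - A) (n - D') r)
    (Ψ := fun r => c * (μ⁻¹ * ν⁻¹) * Em (-A') (-D') r)
    (fun r hr => (Em_deriv hr).const_mul _) (fun r hr => by have := Em_pos (A := n + 1 - A) (D := n - D') hr; positivity)
    (fun r hr => ?_) (fun r hr => (Em_deriv hr).const_mul _)
    (fun r hr => by have := Em_pos (A := -A') (D := -D') hr; positivity) (fun r hr => ?_) hr
  · refine (S_Em hr (hu r hr)).trans ?_
    have e1 := Em_le hr (A := n + -A) (A' := n + 1 - A - 1) (D := n + -D) (D' := n - D') (by linarith) (by linarith)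
    have e2 := conv_ge (r := r) (min_le_left (n + 1 - A) (n - D')) (min_le_right (n + 1 - A) (n - D'))
    rw [← hμ] at e2
    have e3 := Em_pos (A := n + 1 - A - 1) (D := n - D') hr
    calc c * Em (n + -A) (n + -D) r ≤ c * Em (n + 1 - A - 1) (n - D') r := by gcongr
      _ = c * μ⁻¹ * (Em (n + 1 - A - 1) (n - D') r * μ) := by field_simp
      _ ≤ _ := by gcongr
  · rw [← Em_S' hr, mul_assoc, Em_mul hr]
    have e1 := Em_le hr (A := n + 1 - A + -n) (A' := -A' - 1) (D := n - D' + -n) (D' := -D') (by linarith) (by linarith)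
    have e2 := conv_ge (r := r) (min_le_left A' D') (min_le_right A' D')
    rw [← hν] at e2
    have e3 := Em_pos (A := -A' - 1) (D := - D') hr
    calc c * μ⁻¹ * Em (n + 1 - A + -n) (n - D' + -n) r ≤ c * μ⁻¹ * Em (-A' - 1) (-D') r := by gcongr
      _ = c * (μ⁻¹ * ν⁻¹) * (Em (-A' - 1) (-D') r * ν) := by field_simp
      _ ≤ c * (μ⁻¹ * ν⁻¹) * (Em (-A' - 1) (-D') r * (A' * (cosh r ^ 2)⁻¹ + D' * Tn r ^ 2)) := by gcongr
      _ = _ := by ring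

lemma Sol.fact1 (h : Sol n p a b f) {A D : ℝ} (hA0 : 0 ≤ A) (hA : A < 2) (hD : n < D) :
    ∃ K > 0, ∀ t1 ∈ Ioo a b, ∀ t2 ∈ Ioo a b, t1 ≤ t2 → ∀ c ≥ 0,
      (∀ r > 0, f r t1 ^ p ≤ c * Em (-A) (-D) r) → ∀ r > 0,
      ∫ s in t1..t2, f r s ≤ c * K * Em 0 (-n) r := by
  have hn : (1:ℝ) ≤ n := by exact_mod_cast h.hn
  set k := n + 1 - A with hk
  have hk0 : 0 < k := by linarith
  set δ := min 2 (D - n) with hδ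
  have hδ0 : 0 < δ := lt_min (by norm_num) (by linarith)
  have hδ2 : δ ≤ 2 := min_le_left _ _
  have hδD : δ ≤ D - n := min_le_right _ _
  set μ := min k δ with hμ
  have hμ0 : 0 < μ := lt_min hk0 hδ0
  set ν := min (2 - A) n with hν
  have hν0 : 0 < ν := lt_min (by linarith) (by linarith)
  refine ⟨4 * μ⁻¹ * ν⁻¹, by positivity, fun t1 h1 t2 h2 h12 c hc hu r hr => ?_⟩
  have main := h.barrier h1 h2 h12
    (m := fun r => c * μ⁻¹ * (2 * Em k 0 r - Em k (-δ) r))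
    (Ψ := fun r => c * (2 * μ⁻¹ * ν⁻¹) * (2 * Em 0 (-n) r - Em (2 - A) (-n) r))
    (fun r hr => (((Em_deriv hr).const_mul 2).sub (Em_deriv hr)).const_mul _)
    (fun r hr => by
      have e1 := Em_pos (A := k) (D := 0) hr
      have e2 := Em_le (A := k) (A' := k) (D := -δ) (D' := 0) hr le_rfl (by linarith)
      have : 0 ≤ 2 * Em k 0 r - Em k (-δ) r := by linarith
      positivity)
    (fun r hr => ?_) (fun r hr => (((Em_deriv hr).const_mul 2).sub (Em_deriv hr)).const_mul _)
    (fun r hr => by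
      have e1 := Em_pos' n hr
      have e2 := Em_le (A := 2 - A) (A' := 0) (D := -n) (D' := -n) hr (by linarith) le_rfl
      have : 0 ≤ 2 * Em 0 (-n) r - Em (2 - A) (-n) r := by linarith
      positivity) (fun r hr => ?_) hr
  · refine main.trans ?_
    have e1 := Em_pos (A := 2 - A) (D := -n) hr
    have : 0 ≤ c * (2 * μ⁻¹ * ν⁻¹) := by positivity
    nlinarith
  · refine (S_Em hr (hu r hr)).trans ?_
    have e1 := Em_le hr (A := n + -A) (A' := k - 1) (D := n + -D) (D' := -δ) (by linarith) (by linarith)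
    have e2 := conv_ge (r := r) (min_le_left k δ) (min_le_right k δ)
    rw [← hμ] at e2
    have e3 := Em_pos (A := k - 1) (D := -δ) hr
    have e4 := Em_le hr (A := k - 1) (A' := k - 1) (D := -δ) (D' := 0) le_rfl (by linarith)
    have e5 : 0 ≤ (cosh r ^ 2)⁻¹ := by positivity
    calc c * Em (n + -A) (n + -D) r ≤ c * Em (k - 1) (-δ) r := by gcongr
      _ = c * μ⁻¹ * (Em (k - 1) (-δ) r * μ) := by field_simp
      _ ≤ _ := by
        gcongr
        have : Em (k - 1) (-δ) r * μ ≤ Em (k - 1) (-δ) r * (k * (cosh r ^ 2)⁻¹ + δ * Tn r ^ 2) := by gcongr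
        nlinarith [mul_mono_r e4 (mul_nonneg hk0.le e5)]
  · rw [← Em_S' hr]
    have e1 := Em_le hr (A := 1 - A) (A' := 0 + 1 - A) (D := -n) (D' := -n) (by linarith) le_rfl
    have e2 := conv_ge (r := r) (min_le_left (2 - A) n) (min_le_right (2 - A) n)
    rw [← hν] at e2
    have e3 := Em_pos (A := 1 - A) (D := -n) hr
    have e4 : Em (1 - A) (-n) r ≤ Em (0 - 1) (-n) r * 1 := by
      rw [mul_one]; exact Em_le hr (by linarith) le_rfl
    have e5 : Em (0 - 1) (-n) r * Tn r ^ 2 = Em 1 (-n) r := by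
      have : Tn r ^ 2 = Em 2 0 r := by simp [Em]
      rw [this, Em_mul hr]; norm_num
    have e6 : Em (2 - A - 1) (-n) r * Tn r ^ 2 = Em (3 - A) (-n) r := by
      have : Tn r ^ 2 = Em 2 0 r := by simp [Em]
      rw [this, Em_mul hr]; congr 1 <;> ring
    have e7 : Em (3 - A) (-n) r ≤ Em 1 (-n) r := Em_le hr (by linarith) le_rfl
    have e8 : (2 * Em k 0 r - Em k (-δ) r) * Em (-n) (-n) r ≤ 2 * Em (1 - A) (-n) r := by
      have := Em_pos (A := k) (D := -δ) hr
      have h9 := Em_pos (A := -n) (D := -n) hr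
      have h10 : Em k 0 r * Em (-n) (-n) r = Em (1 - A) (-n) r := by
        rw [Em_mul hr]; congr 1 <;> (try rw [hk]) <;> ring
      nlinarith
    have e9 : Em (1 - A) (-n) r * ν ≤ 2 * (n * Em 1 (-n) r) - (-(2 - A) * (Em (1-A) (-n) r * (cosh r ^ 2)⁻¹) + n * Em (3 - A) (-n) r) := by
      have h11 : Em (1 - A) (-n) r * ν ≤ Em (1 - A) (-n) r * ((2 - A) * (cosh r ^ 2)⁻¹ + n * Tn r ^ 2) := by gcongr
      have h12 : Em (1 - A) (-n) r * Tn r ^ 2 = Em (3 - A) (-n) r := by rw [← e6]; congr 2; ring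
      nlinarith
    have e10 : Em (2 - A - 1) (-n) r = Em (1 - A) (-n) r := by congr 1; ring
    rw [e10] at e6 ⊢
    calc _ = c * μ⁻¹ * ((2 * Em k 0 r - Em k (-δ) r) * Em (-n) (-n) r) := by ring
      _ ≤ c * μ⁻¹ * (2 * Em (1 - A) (-n) r) := by gcongr
      _ = c * (2 * μ⁻¹ * ν⁻¹) * (Em (1 - A) (-n) r * ν) := by field_simp
      _ ≤ c * (2 * μ⁻¹ * ν⁻¹) * (2 * (n * Em 1 (-n) r) - (-(2 - A) * (Em (1-A) (-n) r * (cosh r ^ 2)⁻¹) + n * Em (3 - A) (-n) r)) := by gcongr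
      _ = _ := by rw [← e6, ← e5]; ring
end barrier

section iter
variable {n : ℕ} {p a b κ : ℝ} {f : ℝ → ℝ → ℝ}

lemma Sol.κ0 (h : Sol n p a b f) (hκ : (p - 1) * κ = 1) : 0 < κ := by
  have := h.hp
  by_contra! hc
  nlinarith

lemma Sol.bc' (h : Sol n p a b f) (hκ : (p - 1) * κ = 1) {t0 t1 t2 r : ℝ}
    (hr : 0 < r) (ht0 : t0 ∈ Ioo a b) (h1 : t0 < t1) (h12 : t1 ≤ t2) (h2 : t2 < b) :
    f r t2 ≤ ((t2 - t0) / (t1 - t0)) ^ κ * f r t1 := by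
  have := h.bc hκ hr ht0 (sub_pos.2 h1) (sub_le_sub_right h12 t0) (by linarith)
  have e1 : t0 + (t2 - t0) = t2 := by ring
  have e2 : t0 + (t1 - t0) = t1 := by ring
  have p1 : 0 < t1 - t0 := by linarith
  have p2 : 0 < t2 - t0 := by linarith
  rw [e1, e2, rpow_neg p1.le, rpow_neg p2.le] at this
  rw [div_rpow p2.le p1.le]
  have q1 := rpow_pos_of_pos p1 κ
  have q2 := rpow_pos_of_pos p2 κ
  field_simp at this ⊢
  linarith

lemma Sol.bc2 (h : Sol n p a b f) (hκ : (p - 1) * κ = 1) {t0 t1 t2 r : ℝ}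
    (hr : 0 < r) (ht0 : t0 ∈ Ioo a b) (h1 : t0 < t1) (h12 : t1 ≤ t2) (h2 : t2 < b)
    (h3 : t2 - t1 ≤ t1 - t0) : f r t2 ≤ 2 ^ κ * f r t1 := by
  refine (h.bc' hκ hr ht0 h1 h12 h2).trans ?_
  have := h.pos hr (t := t1) ⟨by linarith [ht0.1], by linarith⟩
  have p1 : 0 < t1 - t0 := by linarith
  have hk := h.κ0 hκ
  gcongr
  · exact div_nonneg (by linarith) p1.le
  · rw [div_le_iff₀ p1]; linarith

lemma Sol.avg (h : Sol n p a b f) (hκ : (p - 1) * κ = 1) {t0 t1 t2 r : ℝ}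
    (hr : 0 < r) (ht0 : t0 ∈ Ioo a b) (h1 : t0 < t1) (h12 : t1 ≤ t2) (h2 : t2 < b)
    (h3 : t2 - t1 ≤ t1 - t0) : (t2 - t1) * f r t2 ≤ 2 ^ κ * ∫ s in t1..t2, f r s := by
  have m1 : t1 ∈ Ioo a b := ⟨by linarith [ht0.1], by linarith⟩
  have m2 : t2 ∈ Ioo a b := ⟨by linarith [ht0.1], by linarith⟩
  rw [← intervalIntegral.integral_const_mul]
  have := intervalIntegral.integral_mono_on (f := fun _ => f r t2) h12 intervalIntegrable_const
    ((h.sm.int_t hr m1 m2).const_mul (2 ^ κ)) (fun s hs =>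
      h.bc2 hκ hr ht0 (h1.trans_le hs.1) hs.2 h2 (by linarith [hs.1]))
  simpa using this

lemma Sol.iter_step (h : Sol n p a b f) (hκ : (p - 1) * κ = 1) {w : ℝ → ℝ} {A D X Y : ℝ}
    (hQ : ∀ K > 0, ∃ K' > 0, ∀ t1 ∈ Ioo a b, ∀ s > 0, t1 + s < b →
      (∀ t ∈ Icc t1 (t1 + s), ∀ r > 0, f r t ≤ K * s ^ κ * w r) →
      ∀ r > 0, f r (t1 + s) ≤ K' * s ^ κ * Em (-A) (-D) r)
    (hG : ∃ K > 0, ∀ t1 ∈ Ioo a b, ∀ t2 ∈ Ioo a b, t1 ≤ t2 → ∀ c ≥ 0,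
      (∀ r > 0, f r t1 ^ p ≤ c * Em (-(p * A)) (-(p * D)) r) → ∀ r > 0,
      ∫ s in t1..t2, f r s ≤ c * K * Em X Y r) :
    ∀ K > 0, ∃ K' > 0, ∀ t1 ∈ Ioo a b, ∀ s > 0, t1 + s < b →
      (∀ t ∈ Icc t1 (t1 + s), ∀ r > 0, f r t ≤ K * s ^ κ * w r) →
      ∀ r > 0, f r (t1 + s) ≤ K' * s ^ κ * Em X Y r := by
  intro K hK
  obtain ⟨K', hK', h1⟩ := hQ (K * 2 ^ κ) (by positivity)
  obtain ⟨G, hG0, hG⟩ := hG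
  have hk := h.κ0 hκ
  have hp := h.p0
  refine ⟨2 ^ κ * K' ^ p * G, by positivity, fun t1 ht1 s hs hb hf r hr => ?_⟩
  have hs2 : 0 < s / 2 := by positivity
  have m1 : t1 + s / 2 ∈ Ioo a b := ⟨by linarith [ht1.1], by linarith⟩
  have m2 : t1 + s ∈ Ioo a b := ⟨by linarith [ht1.1], by linarith⟩
  have e0 : K * 2 ^ κ * (s / 2) ^ κ = K * s ^ κ := by
    rw [mul_assoc, ← mul_rpow (by norm_num) hs2.le]; congr 2; ring
  have h2 := h1 t1 ht1 (s / 2) hs2 m1.2 (fun t ht r hr => by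
    rw [e0]; exact hf t ⟨ht.1, ht.2.trans (by linarith)⟩ r hr)
  have h3 := hG _ m1 _ m2 (by linarith) ((K' * (s / 2) ^ κ) ^ p) (by positivity) (fun r hr => by
    have e1 := rpow_le_rpow (h.pos hr m1).le (h2 r hr) hp.le
    rw [mul_rpow (by positivity) (Em_pos hr).le, Em_rpow hr] at e1
    rwa [← mul_neg, ← mul_neg]) r hr
  have h4 := h.avg hκ hr ht1 (t1 := t1 + s / 2) (t2 := t1 + s) (by linarith) (by linarith) hb (by linarith)
  have e2 : (K' * (s / 2) ^ κ) ^ p = K' ^ p * ((s / 2) ^ κ * (s / 2)) := by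
    rw [mul_rpow hK'.le (by positivity), ← rpow_mul hs2.le, ← rpow_add_one hs2.ne']
    congr 2; linarith
  rw [e2] at h3
  have h5 : (s / 2) ^ κ ≤ s ^ κ := rpow_le_rpow hs2.le (by linarith) hk.le
  have h6 : (s / 2) * f r (t1 + s) ≤ (s / 2) * (2 ^ κ * K' ^ p * G * (s / 2) ^ κ * Em X Y r) := by
    calc _ = (t1 + s - (t1 + s / 2)) * f r (t1 + s) := by ring
      _ ≤ _ := h4
      _ ≤ 2 ^ κ * (K' ^ p * ((s / 2) ^ κ * (s / 2)) * G * Em X Y r) := by gcongr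
      _ = _ := by ring
  have h7 := le_of_mul_le_mul_left h6 hs2
  have := Em_pos (A := X) (D := Y) hr
  refine h7.trans ?_
  gcongr

lemma Sol.iter (h : Sol n p a b f) (hκ : (p - 1) * κ = 1) {a0 D0 : ℝ} (ha0 : 0 < a0) (hD0 : 0 < D0)
    (hDn : D0 < n) (hpa : p * a0 < n + 1) (hδ : (p - 1) * a0 < 2) :
    ∀ K > 0, ∃ K' > 0, ∀ t1 ∈ Ioo a b, ∀ s > 0, t1 + s < b →
      (∀ t ∈ Icc t1 (t1 + s), ∀ r > 0, f r t ≤ K * s ^ κ * Em (-a0) (-D0) r) →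
      ∀ r > 0, f r (t1 + s) ≤ K' * s ^ κ * Em 0 (-n) r := by
  have hp := h.hp
  have hp0 := h.p0
  have hn : (1:ℝ) ≤ n := by exact_mod_cast h.hn
  obtain ⟨τ, hτ0, hτ⟩ : ∃ τ > 0, τ < min (min a0 (n - D0)) (min (2 / p) (n * (p - 1) / p)) := by
    apply exists_between
    have : 0 < p - 1 := by linarith
    exact lt_min (lt_min ha0 (by linarith)) (lt_min (by positivity) (by positivity))
  obtain ⟨⟨t1, t2⟩, t3, t4⟩ := by simpa only [lt_min_iff] using hτ
  rw [lt_div_iff₀ hp0] at t3 t4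
  have key : ∀ k : ℕ, ∀ K > 0, ∃ K' > 0, ∀ t1 ∈ Ioo a b, ∀ s > 0, t1 + s < b →
      (∀ t ∈ Icc t1 (t1 + s), ∀ r > 0, f r t ≤ K * s ^ κ * Em (-a0) (-D0) r) →
      ∀ r > 0, f r (t1 + s) ≤ K' * s ^ κ *
        Em (-(max (a0 - k * (2 - (p - 1) * a0)) τ)) (-(min (D0 + k * ((p - 1) * D0)) (n - τ))) r := by
    intro k
    induction k with
    | zero =>
      intro K hK
      refine ⟨K, hK, fun t1 ht1 s hs hb hf r hr => ?_⟩
      have := hf (t1 + s) ⟨by linarith, le_rfl⟩ r hr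
      simp only [Nat.cast_zero, zero_mul, sub_zero, add_zero]
      rwa [max_eq_left (by linarith), min_eq_left (by linarith)]
    | succ k ih =>
      set A := max (a0 - k * (2 - (p - 1) * a0)) τ with hA
      set D := min (D0 + k * ((p - 1) * D0)) (n - τ) with hD
      have hk : (0:ℝ) ≤ k := k.cast_nonneg
      have hAa : A ≤ a0 := max_le (by nlinarith) t1.le
      have hA0 : 0 < A := hτ0.trans_le (le_max_right _ _)
      have hDD : D0 ≤ D := le_min (by
        have : 0 ≤ k * ((p - 1) * D0) := mul_nonneg hk (mul_nonneg (by linarith) hD0.le)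
        linarith) (by linarith)
      refine h.iter_step hκ ih (h.fact2 (by nlinarith) ?_ ?_ ?_ ?_ ?_)
      · rcases le_max_iff.1 (le_refl A) with h1 | h1
        · refine le_trans ?_ (le_max_left _ _)
          push_cast
          nlinarith
        · refine le_trans ?_ (le_max_right _ _)
          nlinarith
      · exact hτ0.trans_le (le_max_right _ _)
      · refine lt_min ?_ (by linarith)
        push_cast
        have : 0 ≤ (k + 1) * ((p - 1) * D0) := mul_nonneg (by linarith) (mul_nonneg (by linarith) hD0.le)
        linarith
      · exact (min_le_right _ _).trans_lt (by linarith)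
      · rcases min_choice (D0 + k * ((p - 1) * D0)) (n - τ) with h1 | h1
        · refine (min_le_left _ _).trans ?_
          rw [hD, h1]
          push_cast
          have : 0 ≤ (p - 1) * (k * ((p - 1) * D0)) :=
            mul_nonneg (by linarith) (mul_nonneg hk (mul_nonneg (by linarith) hD0.le))
          nlinarith
        · refine (min_le_right _ _).trans ?_
          rw [hD, h1]
          nlinarith
  have d1 : 0 < 2 - (p - 1) * a0 := by linarith
  have d2 : 0 < (p - 1) * D0 := mul_pos (by linarith) hD0
  obtain ⟨k1, hk1⟩ := exists_nat_gt (a0 / (2 - (p - 1) * a0))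
  obtain ⟨k2, hk2⟩ := exists_nat_gt (n / ((p - 1) * D0))
  rw [div_lt_iff₀ d1] at hk1
  rw [div_lt_iff₀ d2] at hk2
  have h3 := key (max k1 k2)
  have c1 : (k1:ℝ) ≤ (max k1 k2 : ℕ) := by exact_mod_cast le_max_left _ _
  have c2 : (k2:ℝ) ≤ (max k1 k2 : ℕ) := by exact_mod_cast le_max_right _ _
  rw [max_eq_right (by nlinarith), min_eq_right (by nlinarith)] at h3
  exact h.iter_step hκ h3 (h.fact1 (by positivity) (by nlinarith) (by nlinarith))
end iter

lemma alpha_exists {n : ℕ} {p : ℝ} (hn : 1 ≤ n) (hp : 1 < p) (hs : p * (n - 1) < n + 3) :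
    ∃ α : ℝ, 0 < α ∧ (n:ℝ) - 1 ≤ α ∧ (p - 1) * (α / 2) < 2 ∧ (p + 1) * (α / 2) < n + 1 := by
  have hn' : (1:ℝ) ≤ n := by exact_mod_cast hn
  by_cases h : n = 1
  · subst h
    refine ⟨2 / p, by positivity, by norm_num; positivity, ?_, ?_⟩
    · field_simp; linarith
    · field_simp; norm_num; linarith
  · have : (2:ℝ) ≤ n := by exact_mod_cast (show 2 ≤ n by omega)
    exact ⟨n - 1, by linarith, le_rfl, by linarith, by linarith⟩

lemma ψ_deriv {n : ℕ} (hn : 1 ≤ n) {α r : ℝ} (hα : 0 < α) (hα' : (n:ℝ) - 1 ≤ α) (hr : 0 < r) :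
    (sinh r ^ n)⁻¹ ≤ (min α n)⁻¹ * (Em (-α - 1) (-n) r * (α * (cosh r ^ 2)⁻¹ + n * Tn r ^ 2)) := by
  have hn' : (1:ℝ) ≤ n := by exact_mod_cast hn
  have h0 : 0 < min α (n:ℝ) := lt_min hα (by linarith)
  have h1 := conv_ge (r := r) (min_le_left α (n:ℝ)) (min_le_right α (n:ℝ))
  have h2 := Em_pos (A := -α - 1) (D := -n) hr
  rw [← Em_S' hr, inv_mul_eq_div, le_div_iff₀ h0]
  have := Em_le (A := -n) (A' := -α - 1) (D := -n) (D' := -n) hr (by linarith) le_rfl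
  gcongr

lemma H1_decay {n : ℕ} (hn : 1 ≤ n) {α : ℝ} (hα : 0 < α) (hα' : (n:ℝ) - 1 ≤ α) {v v' : ℝ → ℝ} {e : ℝ}
    (hv : ∀ r > 0, HasDerivAt v (v' r) r) (hc : ContinuousOn v' (Ioi 0))
    (hi : IntegrableOn (fun s => v' s ^ 2 * sinh s ^ n) (Ioi 0)) (he : 0 < e)
    (hle : ∫ s in Ioi (0:ℝ), v' s ^ 2 * sinh s ^ n ≤ e)
    (h0 : ∀ ε > 0, ∃ᶠ r in atTop, v r < ε) {r : ℝ} (hr : 0 < r) :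
    v r ≤ √(e * (min α n)⁻¹) * Em (-(α / 2)) (-(n / 2)) r := by
  have hn' : (1:ℝ) ≤ n := by exact_mod_cast hn
  have hk0 : 0 < min α (n:ℝ) := lt_min hα (by linarith)
  set ψ : ℝ → ℝ := fun r => (min α n)⁻¹ * Em (-α) (-n) r with hψ
  have hψ0 : ∀ r > 0, 0 < ψ r := fun r hr => mul_pos (inv_pos.2 hk0) (Em_pos hr)
  have hψd : ∀ r > 0, HasDerivAt ψ ((min α n)⁻¹ * (Em (-α - 1) (-n) r * (-α * (cosh r ^ 2)⁻¹ + -n * Tn r ^ 2))) r :=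
    fun r hr => (Em_deriv hr).const_mul _
  have hcc : ContinuousOn (fun s => v' s ^ 2 * sinh s ^ n) (Ioi 0) :=
    (hc.pow 2).mul (continuous_sinh.pow n).continuousOn
  have main : ∀ l > 0, v r ≤ (l * e + ψ r / l) / 2 := by
    intro l hl
    set F : ℝ → ℝ := fun ρ => v ρ + l / 2 * (∫ s in r..ρ, v' s ^ 2 * sinh s ^ n) - ψ ρ / (2 * l) with hF
    have hmono := mono_Ioi (c := 0) (F := F) (fun ρ hρ => ((hv ρ hρ).add
      ((intervalIntegral.integral_hasDerivAt_right
        ((hcc.mono (ordConnected_Ioi.uIcc_subset hr hρ)).intervalIntegrable)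
        (hcc.stronglyMeasurableAtFilter isOpen_Ioi ρ hρ)
        (hcc.continuousAt (Ioi_mem_nhds hρ))).const_mul (l / 2))).sub ((hψd ρ hρ).div_const (2 * l)))
      (fun ρ hρ => by
        have h1 := ψ_deriv hn hα hα' hρ
        have hS := pow_pos (sinh_pos hρ) n
        have h2 : 0 ≤ v' ρ + l / 2 * (v' ρ ^ 2 * sinh ρ ^ n) + (sinh ρ ^ n)⁻¹ / (2 * l) := by
          have : v' ρ + l / 2 * (v' ρ ^ 2 * sinh ρ ^ n) + (sinh ρ ^ n)⁻¹ / (2 * l)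
            = (l * v' ρ * sinh ρ ^ n + 1) ^ 2 / (2 * l * sinh ρ ^ n) := by field_simp; ring
          rw [this]; positivity
        have h3 := div_le_div_of_nonneg_right h1 (by positivity : 0 ≤ 2 * l)
        refine h2.trans ?_
        have : (min α n)⁻¹ * (Em (-α - 1) (-n) ρ * (-α * (cosh ρ ^ 2)⁻¹ + -n * Tn ρ ^ 2)) / (2 * l)
          = - ((min α n)⁻¹ * (Em (-α - 1) (-n) ρ * (α * (cosh ρ ^ 2)⁻¹ + n * Tn ρ ^ 2)) / (2 * l)) := by ring
        rw [this]; linarith)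
    refine le_of_forall_pos_le_add fun ε hε => ?_
    obtain ⟨R, hR1, hR2⟩ := ((h0 ε hε).and_eventually (eventually_ge_atTop r)).exists
    have h5 := hmono hr (hr.trans_le hR2) hR2
    simp only [hF, intervalIntegral.integral_same] at h5
    have h6 : ∫ s in r..R, v' s ^ 2 * sinh s ^ n ≤ e := by
      rw [intervalIntegral.integral_of_le hR2]
      refine le_trans (setIntegral_mono_set hi ?_ (Eventually.of_forall fun x hx => hr.trans hx.1)) hle
      filter_upwards [ae_restrict_mem measurableSet_Ioi] with s hs
      exact mul_nonneg (sq_nonneg _) (pow_nonneg (sinh_pos hs).le _)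
    have h7 := div_pos (hψ0 R (hr.trans_le hR2)) (by positivity : 0 < 2 * l)
    have h8 : l / 2 * (∫ s in r..R, v' s ^ 2 * sinh s ^ n) ≤ l / 2 * e := by gcongr
    have : (l * e + ψ r / l) / 2 = l / 2 * e + ψ r / (2 * l) := by field_simp
    rw [this]; linarith
  have hψr := hψ0 r hr
  have h1 := main (√(ψ r / e)) (by positivity)
  have e1 : √(ψ r / e) * e = √(ψ r * e) := by
    rw [← sqrt_sq he.le, ← sqrt_mul (by positivity), sqrt_sq he.le]; congr 1; field_simp
  have e2 : ψ r / √(ψ r / e) = √(ψ r * e) := by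
    rw [div_eq_iff (by positivity), ← sqrt_mul (by positivity)]
    have : ψ r * e * (ψ r / e) = ψ r ^ 2 := by field_simp
    rw [this, sqrt_sq hψr.le]
  rw [e1, e2] at h1
  refine h1.trans (le_of_eq ?_)
  have e3 : ψ r * e = e * (min α n)⁻¹ * (Em (-(α / 2)) (-(n / 2)) r) ^ 2 := by
    rw [sq, Em_mul hr]; simp only [hψ]
    have a1 : -(α / 2) + -(α / 2) = -α := by ring
    have a2 : -((n:ℝ) / 2) + -((n:ℝ) / 2) = -n := by ring
    rw [a1, a2]; ring
  rw [e3, sqrt_mul (by positivity), sqrt_sq (Em_pos hr).le]; ring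

lemma freq_small {n : ℕ} {v : ℝ → ℝ}
    (hi : IntegrableOn (fun s => v s ^ 2 * sinh s ^ n) (Ioi 0)) :
    ∀ ε > 0, ∃ᶠ r in atTop, v r < ε := by
  intro ε hε hcon
  simp only [not_lt] at hcon
  obtain ⟨R, hR⟩ := eventually_atTop.1 (hcon.and (eventually_ge_atTop 1))
  have h1 : IntegrableOn (fun _ : ℝ => ε ^ 2) (Ioi (max R 1)) := by
    refine (hi.mono_set (Ioi_subset_Ioi (le_max_of_le_right zero_le_one))).mono' (by fun_prop) ?_
    filter_upwards [ae_restrict_mem measurableSet_Ioi] with s hs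
    have hs' := max_lt_iff.1 (mem_Ioi.1 hs)
    have h2 := (hR s hs'.1.le).1
    have h3 : 1 ≤ sinh s := by
      have := self_le_sinh_iff.2 (by linarith : 0 ≤ s); linarith
    rw [Real.norm_of_nonneg (by positivity)]
    have h4 : ε ^ 2 ≤ v s ^ 2 := by gcongr
    nlinarith [one_le_pow₀ h3 (n := n), sq_nonneg (v s)]
  rw [integrableOn_const_iff] at h1
  simp at h1
  exact hε.ne' h1

section If
variable {n : ℕ} {p a b κ : ℝ} {f φ : ℝ → ℝ → ℝ}

noncomputable def If (n : ℕ) (φ : ℝ → ℝ → ℝ) (r t : ℝ) : ℝ := ∫ s in (0:ℝ)..r, sinh s ^ n * φ s t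

lemma intble0 {g : ℝ → ℝ} {C r : ℝ} (hr : 0 < r) (hc : ContinuousOn g (Ioi 0))
    (hb : ∀ s ∈ Ioc 0 r, |g s| ≤ C) : IntervalIntegrable g volume 0 r := by
  rw [intervalIntegrable_iff_integrableOn_Ioc_of_le hr.le]
  have hfin : IntegrableOn (fun _ : ℝ => C) (Ioc 0 r) := integrableOn_const (by simp)
  refine hfin.mono' ((hc.mono Ioc_subset_Ioi_self).aestronglyMeasurable measurableSet_Ioc) ?_
  filter_upwards [ae_restrict_mem measurableSet_Ioc] with s hs using hb s hs

lemma Sm.intS (h : Sm a b φ) {r t : ℝ} (hr : 0 < r) (ht : t ∈ Ioo a b) :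
    IntervalIntegrable (fun s => sinh s ^ n * φ s t) volume 0 r := by
  obtain ⟨C, hC, hb⟩ := h.bdd r ht.1 ht.2
  refine intble0 hr (C := sinh r ^ n * C)
    ((continuous_sinh.pow n).continuousOn.mul (h.cont_r ht)) fun s hs => ?_
  rw [abs_mul, abs_of_pos (pow_pos (sinh_pos hs.1) _)]
  have h1 := (sinh_pos hs.1).le
  have h2 := sinh_le_sinh.2 hs.2
  have h3 := hb s hs t ⟨le_rfl, le_rfl⟩
  gcongr

lemma Sm.If_r (h : Sm a b φ) {r t : ℝ} (hr : 0 < r) (ht : t ∈ Ioo a b) :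
    HasDerivAt (fun ρ => If n φ ρ t) (sinh r ^ n * φ r t) r := by
  have hc : ContinuousOn (fun s => sinh s ^ n * φ s t) (Ioi 0) :=
    (continuous_sinh.pow n).continuousOn.mul (h.cont_r ht)
  exact intervalIntegral.integral_hasDerivAt_right (h.intS hr ht)
    (hc.stronglyMeasurableAtFilter isOpen_Ioi r hr) (hc.continuousAt (Ioi_mem_nhds hr))

lemma Sm.If_lim (h : Sm a b φ) {t : ℝ} (ht : t ∈ Ioo a b) :
    Tendsto (fun r => If n φ r t) (𝓝[>] 0) (𝓝 0) := by
  have h1 : IntegrableOn (fun s => sinh s ^ n * φ s t) (uIcc 0 1) := by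
    rw [uIcc_of_le zero_le_one, integrableOn_Icc_iff_integrableOn_Ioc, ← intervalIntegrable_iff_integrableOn_Ioc_of_le zero_le_one]
    exact h.intS zero_lt_one ht
  have := (intervalIntegral.continuousOn_primitive_interval h1).continuousWithinAt (left_mem_uIcc)
  have h2 : Tendsto (fun r => If n φ r t) (𝓝[uIcc 0 1] 0) (𝓝 (If n φ 0 t)) := this
  rw [show If n φ 0 t = 0 by simp [If]] at h2
  refine h2.mono_left (nhdsWithin_le_of_mem ?_)
  rw [uIcc_of_le zero_le_one]
  exact mem_of_superset (Ioo_mem_nhdsGT zero_lt_one) Ioo_subset_Icc_self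

lemma Sm.If_t (h : Sm a b φ) {r t : ℝ} (hr : 0 < r) (ht : t ∈ Ioo a b) :
    HasDerivAt (fun τ => If n φ r τ) (If n (pt φ) r t) t := by
  obtain ⟨t1, h1, h1'⟩ := exists_between ht.1
  obtain ⟨t2, h2, h2'⟩ := exists_between ht.2
  obtain ⟨C, hC, hb⟩ := h.Pt.bdd r h1 h2'
  have hs : Ioo t1 t2 ∈ 𝓝 t := Ioo_mem_nhds h1' h2
  have hsub : ∀ τ ∈ Ioo t1 t2, τ ∈ Ioo a b := fun τ hτ => ⟨h1.trans hτ.1, hτ.2.trans h2'⟩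
  refine (intervalIntegral.hasDerivAt_integral_of_dominated_loc_of_deriv_le
    (F := fun τ s => sinh s ^ n * φ s τ) (F' := fun τ s => sinh s ^ n * pt φ s τ)
    (bound := fun _ => sinh r ^ n * C) hs ?_ (h.intS hr ht)
    (h.Pt.intS hr ht).aestronglyMeasurable_restrict_uIoc ?_ intervalIntegrable_const ?_).2
  · filter_upwards [hs] with τ hτ
    exact (h.intS hr (hsub τ hτ)).aestronglyMeasurable_restrict_uIoc
  · refine Eventually.of_forall fun s hs τ hτ => ?_
    rw [uIoc_of_le hr.le] at hs
    rw [Real.norm_eq_abs, abs_mul, abs_of_pos (pow_pos (sinh_pos hs.1) _)]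
    have h1 := (sinh_pos hs.1).le
    have h2 := sinh_le_sinh.2 hs.2
    have h3 := hb s hs τ ⟨hτ.1.le, hτ.2.le⟩
    gcongr
  · refine Eventually.of_forall fun s hs τ hτ => ?_
    rw [uIoc_of_le hr.le] at hs
    exact (h.ht hs.1 (hsub τ hτ)).const_mul _

lemma eq_of_deriv {F G F' : ℝ → ℝ} (hF : ∀ r > 0, HasDerivAt F (F' r) r) (hG : ∀ r > 0, HasDerivAt G (F' r) r)
    (h1 : Tendsto F (𝓝[>] 0) (𝓝 0)) (h2 : Tendsto G (𝓝[>] 0) (𝓝 0)) {r : ℝ} (hr : 0 < r) : F r = G r := by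
  have a1 := mono_Ioi (c := 0) (fun r hr => (hF r hr).sub (hG r hr)) (fun r _ => by simp)
  have a2 := mono_Ioi (c := 0) (fun r hr => (hG r hr).sub (hF r hr)) (fun r _ => by simp)
  have b1 := mono_ge_lim0 a1 (h1.sub h2) hr
  have b2 := mono_ge_lim0 a2 (h2.sub h1) hr
  simp only [Pi.sub_apply] at b1 b2
  linarith

lemma Sol.flux_eq (h : Sol n p a b f) {r t : ℝ} (hr : 0 < r) (ht : t ∈ Ioo a b) :
    sinh r ^ n * pr f r t = If n (pt (fun r t => f r t ^ p)) r t := by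
  obtain ⟨C, hC, hb⟩ := h.sm.Pr.bdd 1 ht.1 ht.2
  exact eq_of_deriv (F := fun r => sinh r ^ n * pr f r t) (fun r hr => h.flux hr ht)
    (fun r hr => (h.smq p).Pt.If_r hr ht)
    (S_mul_tendsto h.hn (C := C) fun r hr => hb r hr t ⟨le_rfl, le_rfl⟩) ((h.smq p).Pt.If_lim ht) hr

lemma Sol.ut_le (h : Sol n p a b f) (hκ : (p - 1) * κ = 1) {t0 r t : ℝ} (hr : 0 < r)
    (ht0 : t0 ∈ Ioo a b) (ht : t ∈ Ioo t0 b) :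
    pt (fun r t => f r t ^ p) r t ≤ p * κ / (t - t0) * f r t ^ p := by
  have hk := h.κ0 hκ
  have hp := h.p0
  have hsub : Ioo t0 b ⊆ Ioo a b := Ioo_subset_Ioo_left ht0.1.le
  set g : ℝ → ℝ := fun τ => f r τ ^ p * (τ - t0) ^ (-(p * κ)) with hg
  have hanti : AntitoneOn g (Ioo t0 b) := by
    intro x hx y hy hxy
    have h1 := h.bc hκ hr ht0 (sub_pos.2 hx.1) (sub_le_sub_right hxy t0) (by linarith [hy.2])
    simp only [add_sub_cancel] at h1
    have x0 : 0 < x - t0 := by linarith [hx.1]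
    have y0 : 0 < y - t0 := by linarith [hy.1]
    have fx := h.pos hr (hsub hx)
    have fy := h.pos hr (hsub hy)
    have h2 := rpow_le_rpow (by positivity) h1 hp.le
    rw [mul_rpow fy.le (by positivity), mul_rpow fx.le (by positivity),
      ← rpow_mul y0.le, ← rpow_mul x0.le] at h2
    have : -κ * p = -(p * κ) := by ring
    rwa [this] at h2
  have t1 : 0 < t - t0 := by linarith [ht.1]
  have hd : HasDerivAt g (pt (fun r t => f r t ^ p) r t * (t - t0) ^ (-(p * κ)) +
      f r t ^ p * (1 * (-(p * κ)) * (t - t0) ^ (-(p * κ) - 1))) t :=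
    ((h.smq p).ht hr (hsub ht)).mul (((hasDerivAt_id t).sub_const t0).rpow_const (Or.inl t1.ne'))
  have h1 := hanti.derivWithin_nonpos (x := t)
  rw [derivWithin_of_isOpen isOpen_Ioo ht, hd.deriv, rpow_sub t1, rpow_one] at h1
  have h3 : 0 < (t - t0) ^ (-(p * κ)) := by positivity
  have h4 : (pt (fun r t => f r t ^ p) r t - p * κ / (t - t0) * f r t ^ p) * (t - t0) ^ (-(p * κ)) ≤ 0 := by
    refine le_trans (le_of_eq ?_) h1
    field_simp; ring
  nlinarith [nonpos_of_mul_nonpos_left h4 h3]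

lemma Em_lim {D : ℝ} (hD : D < 0) : Tendsto (fun r => Em 0 D r) atTop (𝓝 0) := by
  simp only [Em, rpow_zero, one_mul]
  have : Tendsto cosh atTop atTop :=
    tendsto_atTop_mono' _ (by
      filter_upwards [eventually_ge_atTop 0] with x hx using
        (self_le_sinh_iff.2 hx).trans (sinh_lt_cosh x).le) tendsto_id
  have h2 := (tendsto_rpow_neg_atTop (neg_pos.2 hD)).comp this
  simpa [Function.comp_def] using h2

lemma Sol.mass_le (h : Sol n p a b f) : ∃ c > 0, ∀ t ∈ Ioo a b, ∀ K ≥ 0,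
    (∀ r > 0, f r t ≤ K * Em 0 (-n) r) → ∀ r > 0,
      If n (fun r t => f r t ^ p) r t ≤ c * K ^ p * Em (n + 1) 0 r := by
  have hn : (1:ℝ) ≤ n := by exact_mod_cast h.hn
  have hp := h.hp
  set δ := min 2 (p * n - n) with hδ
  have hδ0 : 0 < δ := lt_min (by norm_num) (by nlinarith)
  have hδ2 : δ ≤ 2 := min_le_left _ _
  have hδD : δ ≤ p * n - n := min_le_right _ _
  set μ := min (n + 1 : ℝ) δ with hμ
  have hμ0 : 0 < μ := lt_min (by linarith) hδ0
  refine ⟨2 * μ⁻¹, by positivity, fun t ht K hK hf r hr => ?_⟩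
  have hmono := mono_Ioi (c := 0) (fun r hr => (((((Em_deriv (A := n + 1) (D := 0) hr).const_mul 2).sub
    (Em_deriv (A := n + 1) (D := -δ) hr)).const_mul (K ^ p * μ⁻¹)).sub ((h.smq p).If_r (n := n) hr ht))) (fun r hr => by
    have hu := rpow_le_rpow (h.pos hr ht).le (hf r hr) h.p0.le
    rw [mul_rpow hK (Em_pos hr).le, Em_rpow hr] at hu
    have h1 := S_Em (n := n) hr hu
    have e1 := Em_le hr (A := n + p * 0) (A' := n + 1 - 1) (D := n + p * (-n)) (D' := -δ) (by linarith) (by linarith)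
    have e2 := conv_ge (r := r) (min_le_left (n + 1 : ℝ) δ) (min_le_right (n + 1 : ℝ) δ)
    rw [← hμ] at e2
    have e3 := Em_pos (A := n + 1 - 1) (D := -δ) hr
    have e4 := Em_le hr (A := n + 1 - 1) (A' := n + 1 - 1) (D := -δ) (D' := 0) le_rfl (by linarith)
    have e5 : 0 ≤ (cosh r ^ 2)⁻¹ := by positivity
    have hKp : 0 ≤ K ^ p := by positivity
    rw [sub_nonneg]
    refine h1.trans ?_
    calc K ^ p * Em (n + p * 0) (n + p * (-n)) r ≤ K ^ p * Em (n + 1 - 1) (-δ) r := by gcongr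
      _ = K ^ p * μ⁻¹ * (Em (n + 1 - 1) (-δ) r * μ) := by field_simp
      _ ≤ _ := by
        gcongr
        have : Em (n + 1 - 1) (-δ) r * μ ≤ Em (n + 1 - 1) (-δ) r * ((n + 1) * (cosh r ^ 2)⁻¹ + δ * Tn r ^ 2) := by gcongr
        have : (0:ℝ) ≤ (n + 1) := by linarith
        nlinarith [mul_mono_r e4 (mul_nonneg this e5)])
  have hl := (h.smq p).If_lim (n := n) ht
  have hKp : 0 ≤ K ^ p * μ⁻¹ := by positivity
  have : 0 ≤ K ^ p * μ⁻¹ * (2 * Em (n + 1) 0 r - Em (n + 1) (-δ) r) - If n (fun r t => f r t ^ p) r t := by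
    have h3 : ∀ᶠ x in 𝓝[>] (0:ℝ), - If n (fun r t => f r t ^ p) x t ≤
        K ^ p * μ⁻¹ * (2 * Em (n + 1) 0 r - Em (n + 1) (-δ) r) - If n (fun r t => f r t ^ p) r t := by
      filter_upwards [Ioo_mem_nhdsGT hr] with x hx
      have h4 := hmono hx.1 hr hx.2.le
      simp only [Pi.sub_apply] at h4
      have e1 := Em_pos (A := n + 1) (D := 0) hx.1
      have e2 := Em_le (A := n + 1) (A' := n + 1) (D := -δ) (D' := 0) hx.1 le_rfl (by linarith)
      have : 0 ≤ K ^ p * μ⁻¹ * (2 * Em (n + 1) 0 x - Em (n + 1) (-δ) x) := mul_nonneg hKp (by linarith)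
      linarith
    have := le_of_tendsto hl.neg h3
    simpa using this
  have e2 := Em_pos (A := n + 1) (D := -δ) hr
  nlinarith [mul_nonneg hKp e2.le]
end If

lemma mono_Ici {F F' : ℝ → ℝ} {c : ℝ} (h : ∀ r ≥ c, HasDerivAt F (F' r) r) (h0 : ∀ r > c, 0 ≤ F' r) :
    MonotoneOn F (Ici c) := by
  refine monotoneOn_of_deriv_nonneg (convex_Ici c)
    (fun r hr => (h r hr).continuousAt.continuousWithinAt) ?_ ?_
  · rw [interior_Ici]; exact fun r hr => (h r (le_of_lt hr)).differentiableAt.differentiableWithinAt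
  · rw [interior_Ici]; intro r hr; rw [(h r (le_of_lt hr)).deriv]; exact h0 r hr

lemma Em_le_one {A D r : ℝ} (hr : 0 < r) (hA : 0 ≤ A) (hD : D ≤ 0) : Em A D r ≤ 1 := by
  refine (Em_le (A' := 0) (D' := 0) hr hA hD).trans ?_
  simp [Em]

lemma Tn_cont : Continuous Tn := continuous_iff_continuousAt.2 fun r => (Tn_deriv r).continuousAt

lemma Em_int {A D : ℝ} (hA : -1 < A) (hD : D < 0) : IntegrableOn (Em A D) (Ioi 0) := by
  set k := A + 1 with hk
  have hk0 : 0 < k := by linarith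
  set δ := min 2 (-D) with hδ
  have hδ0 : 0 < δ := lt_min (by norm_num) (by linarith)
  have hδ2 : δ ≤ 2 := min_le_left _ _
  have hδD : δ ≤ -D := min_le_right _ _
  set μ := min k δ with hμ
  have hμ0 : 0 < μ := lt_min hk0 hδ0
  have hd : ∀ r > 0, HasDerivAt (fun r => 2 * Em k 0 r - Em k (-δ) r) _ r := fun r hr =>
    ((Em_deriv hr).const_mul 2).sub (Em_deriv hr)
  have hlow : ∀ r > 0, μ * Em A D r ≤ 2 * (Em (k - 1) 0 r * (k * (cosh r ^ 2)⁻¹ + 0 * Tn r ^ 2)) -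
      Em (k - 1) (-δ) r * (k * (cosh r ^ 2)⁻¹ + -δ * Tn r ^ 2) := by
    intro r hr
    have e1 := Em_le hr (A := A) (A' := k - 1) (D := D) (D' := -δ) (by linarith) (by linarith)
    have e2 := conv_ge (r := r) (min_le_left k δ) (min_le_right k δ)
    rw [← hμ] at e2
    have e3 := Em_pos (A := k - 1) (D := -δ) hr
    have e4 := Em_le hr (A := k - 1) (A' := k - 1) (D := -δ) (D' := 0) le_rfl (by linarith)
    have e5 : 0 ≤ (cosh r ^ 2)⁻¹ := by positivity
    have : Em (k - 1) (-δ) r * μ ≤ Em (k - 1) (-δ) r * (k * (cosh r ^ 2)⁻¹ + δ * Tn r ^ 2) := by gcongr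
    nlinarith [mul_mono_r e4 (mul_nonneg hk0.le e5)]
  have hcont : Continuous (fun r => 2 * Em k 0 r - Em k (-δ) r) := by
    unfold Em
    have h1 : Continuous fun r => Tn r ^ k := Tn_cont.rpow_const fun _ => Or.inr hk0.le
    have h2 : ∀ q : ℝ, Continuous fun r => cosh r ^ q := fun q =>
      continuous_cosh.rpow_const fun r => Or.inl (cosh_pos r).ne'
    exact ((h1.mul (h2 0)).const_mul 2).sub (h1.mul (h2 _))
  have hpos : ∀ r > 0, 0 ≤ Em A D r := fun r hr => (Em_pos hr).le
  have hmono := mono_Ioi hd (fun r hr => (mul_nonneg hμ0.le (hpos r hr)).trans (hlow r hr))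
  have hbd : ∀ r > 0, 2 * Em k 0 r - Em k (-δ) r ≤ 2 := fun r hr => by
    have := Em_le_one (A := k) (D := 0) hr hk0.le le_rfl
    have := Em_pos (A := k) (D := -δ) hr
    linarith
  obtain ⟨L, hL⟩ : ∃ L, Tendsto (fun r => 2 * Em k 0 r - Em k (-δ) r) atTop (𝓝 L) := by
    have hm : Monotone (fun r => 2 * Em k 0 (max r 1) - Em k (-δ) (max r 1)) := fun x y hxy =>
      hmono (show (0:ℝ) < max x 1 from lt_max_of_lt_right one_pos)
        (show (0:ℝ) < max y 1 from lt_max_of_lt_right one_pos) (max_le_max_right 1 hxy)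
    have := tendsto_atTop_ciSup hm ⟨2, by
      rintro _ ⟨x, rfl⟩
      exact hbd _ (lt_max_of_lt_right one_pos)⟩
    refine ⟨_, this.congr' ?_⟩
    filter_upwards [eventually_ge_atTop 1] with x hx
    rw [max_eq_left hx]
  have h1 := integrableOn_Ioi_deriv_of_nonneg (a := 0) hcont.continuousWithinAt hd
    (fun r hr => (mul_nonneg hμ0.le (hpos r hr)).trans (hlow r hr)) hL
  have h2 : IntegrableOn (fun r => μ * Em A D r) (Ioi 0) := by
    refine h1.mono' ?_ ?_
    · refine ContinuousOn.aestronglyMeasurable (fun r hr => ?_) measurableSet_Ioi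
      exact ((Em_deriv hr).continuousAt.const_mul μ : ContinuousAt (fun r => μ * Em A D r) r).continuousWithinAt
    · filter_upwards [ae_restrict_mem measurableSet_Ioi] with r hr
      rw [Real.norm_of_nonneg (mul_nonneg hμ0.le (hpos r hr))]
      exact hlow r hr
  refine (h2.const_mul μ⁻¹).congr (Eventually.of_forall fun r => ?_)
  simp only; rw [← mul_assoc, inv_mul_cancel₀ hμ0.ne', one_mul]

section flux
variable {n : ℕ} {p a b κ : ℝ} {f : ℝ → ℝ → ℝ}

lemma Sol.If_nonneg (h : Sol n p a b f) {r t : ℝ} (hr : 0 < r) (ht : t ∈ Ioo a b) :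
    0 ≤ If n (fun r t => f r t ^ p) r t := by
  refine intervalIntegral.integral_nonneg_of_ae_restrict hr.le ?_
  rw [EventuallyLE, ae_restrict_iff' measurableSet_Icc]
  refine Eventually.of_forall fun s hs => ?_
  exact mul_nonneg (pow_nonneg (sinh_nonneg_iff.2 hs.1) _) (rpow_nonneg (h.pos0 s hs.1 t ht).le _)

lemma Sol.flux_bd (h : Sol n p a b f) (hκ : (p - 1) * κ = 1) : ∃ c > 0, ∀ t0 ∈ Ioo a b, ∀ t ∈ Ioo t0 b,
    ∀ K ≥ 0, (∀ r > 0, f r t ≤ K * Em 0 (-n) r) → ∀ r > 0,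
      |sinh r ^ n * pr f r t| ≤ c * (K ^ p / (t - t0) + K) := by
  obtain ⟨c, hc, hM⟩ := h.mass_le
  have hk := h.κ0 hκ
  have hp := h.p0
  have hn : (1:ℝ) ≤ n := by exact_mod_cast h.hn
  refine ⟨p * κ * c + n, by positivity, fun t0 ht0 t ht K hK hf r hr => ?_⟩
  have ht' : t ∈ Ioo a b := ⟨ht0.1.trans ht.1, ht.2⟩
  have hs : 0 < t - t0 := by linarith [ht.1]
  set C1 := p * κ / (t - t0) with hC1
  have hC10 : 0 ≤ C1 := by positivity
  have hKp : 0 ≤ K ^ p := by positivity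
  set u : ℝ → ℝ → ℝ := fun r t => f r t ^ p
  have hMb : ∀ r > 0, C1 * If n u r t ≤ p * κ * c * (K ^ p / (t - t0)) := by
    intro r hr
    have h1 := hM t ht' K hK hf r hr
    have h2 := Em_le_one (A := n + 1) (D := 0) hr (by positivity) le_rfl
    calc C1 * If n u r t ≤ C1 * (c * K ^ p * Em (n + 1) 0 r) := by gcongr
      _ ≤ C1 * (c * K ^ p * 1) := by gcongr
      _ = _ := by rw [hC1]; ring
  have hmono := mono_Ioi (c := 0) (fun r hr => (((h.smq p).If_r (n := n) hr ht').const_mul C1).sub (h.flux hr ht'))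
    (fun r hr => by
      have h1 := h.ut_le hκ hr ht0 ht
      have h2 := pow_pos (sinh_pos hr) n
      nlinarith)
  obtain ⟨C, hC, hb⟩ := h.sm.Pr.bdd 1 ht'.1 ht'.2
  have hlim := (((h.smq p).If_lim (n := n) ht').const_mul C1).sub
    (S_mul_tendsto h.hn (C := C) (φ := fun r => pr f r t) fun r hr => hb r hr t ⟨le_rfl, le_rfl⟩)
  simp only [mul_zero, sub_zero] at hlim
  have hD := mono_ge_lim0 hmono hlim hr
  simp only [Pi.sub_apply] at hD
  have hM1 := hMb r hr
  have hMn := h.If_nonneg hr ht'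
  have hx : 0 ≤ K ^ p / (t - t0) := by positivity
  have hy : 0 ≤ (n:ℝ) * (K ^ p / (t - t0)) := by positivity
  have hz : 0 ≤ p * κ * c * K := by positivity
  rw [abs_le]
  constructor
  · set X := C1 * If n u r t - sinh r ^ n * pr f r t with hX
    set Y := X - p * κ * c * (K ^ p / (t - t0)) with hY
    suffices Y ≤ n * K by
      have : 0 ≤ C1 * If n u r t := mul_nonneg hC10 hMn
      nlinarith
    by_contra! hYn
    have hY0 : 0 < Y := lt_of_le_of_lt (by positivity) hYn
    have hmono2 := mono_Ici (c := r) (fun ρ hρ => ((Em_deriv (A := 0) (D := -n) (hr.trans_le hρ)).const_mul (Y / n)).sub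
      (h.sm.hr (hr.trans_le hρ) ht')) (fun ρ hρ => by
        have hρ0 : 0 < ρ := hr.trans hρ
        have h1 := hmono hr hρ0 hρ.le
        simp only [Pi.sub_apply] at h1
        have h2 := hMb ρ hρ0
        have h3 : Y ≤ - (sinh ρ ^ n * pr f ρ t) := by linarith
        have hS := pow_pos (sinh_pos hρ0) n
        have h4 : Y * (sinh ρ ^ n)⁻¹ ≤ - pr f ρ t := by
          rw [← div_eq_mul_inv, div_le_iff₀ hS]; linarith
        rw [← Em_S' hρ0] at h4
        have h5 : Em (0 - 1) (-n) ρ * Tn ρ ^ 2 ≤ Em (-n) (-n) ρ := by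
          have : Tn ρ ^ 2 = Em 2 0 ρ := by simp [Em]
          rw [this, Em_mul hρ0]; exact Em_le hρ0 (by linarith) (by linarith)
        have h6 : Y * (Em (0 - 1) (-n) ρ * Tn ρ ^ 2) ≤ Y * Em (-n) (-n) ρ := by gcongr
        have h7 : Y / n * (Em (0 - 1) (-n) ρ * (0 * (cosh ρ ^ 2)⁻¹ + -n * Tn ρ ^ 2))
          = - (Y * (Em (0 - 1) (-n) ρ * Tn ρ ^ 2)) := by field_simp; ring
        rw [h7]; linarith)
    have hfl : Tendsto (fun ρ => Y / n * Em 0 (-n) ρ - f ρ t) atTop (𝓝 0) := by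
      have e0 := Em_lim (D := -n) (by linarith)
      have e1 : Tendsto (fun ρ => f ρ t) atTop (𝓝 0) := by
        have e2 := e0.const_mul K
        rw [mul_zero] at e2
        refine squeeze_zero' ?_ ?_ e2
        · filter_upwards [eventually_gt_atTop 0] with x hx using (h.pos hx ht').le
        · filter_upwards [eventually_gt_atTop 0] with x hx using hf x hx
      simpa using (e0.const_mul (Y / n)).sub e1
    have h8 : Y / n * Em 0 (-n) r - f r t ≤ 0 := by
      refine ge_of_tendsto hfl ?_
      filter_upwards [eventually_ge_atTop r] with x hx using hmono2 self_mem_Ici hx hx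
    have h9 := hf r hr
    have h10 : Y / n * Em 0 (-n) r ≤ K * Em 0 (-n) r := by linarith
    have h11 := le_of_mul_le_mul_right h10 (Em_pos hr)
    rw [div_le_iff₀ (by linarith)] at h11
    linarith
  · have : 0 ≤ (n:ℝ) * K := by positivity
    nlinarith
end flux

section energies
variable {n : ℕ} {p a T κ : ℝ} {f : ℝ → ℝ → ℝ}

structure Exs (n : ℕ) (p κ a T : ℝ) (f : ℝ → ℝ → ℝ) : Prop where
  sol : Sol n p a T f
  hκ : (p - 1) * κ = 1
  aT : a < T
  sub : p * (n - 1) < n + 3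
  bd : ∃ C > 0, ∀ t ∈ Ioo a T, ∀ r > 0, f r t ≤ C * Em 0 (-n) r ∧ |sinh r ^ n * pr f r t| ≤ C
  ext : ∀ r > 0, Tendsto (fun t => f r t) (𝓝[<] T) (𝓝 0)

noncomputable def Mf (n : ℕ) (p : ℝ) (f : ℝ → ℝ → ℝ) : ℝ → ℝ → ℝ := If n (fun r t => f r t ^ p)
noncomputable def yE (n : ℕ) (p : ℝ) (f : ℝ → ℝ → ℝ) (t : ℝ) : ℝ := ∫ r in Ioi (0:ℝ), sinh r ^ n * f r t ^ (p + 1)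
noncomputable def eE (n : ℕ) (f : ℝ → ℝ → ℝ) (t : ℝ) : ℝ := ∫ r in Ioi (0:ℝ), pr f r t ^ 2 * sinh r ^ n
noncomputable def νE (n : ℕ) (p : ℝ) (f : ℝ → ℝ → ℝ) (t : ℝ) : ℝ := ∫ r in Ioi (0:ℝ), Mf n p f r t ^ 2 * (sinh r ^ n)⁻¹

lemma intb {g : ℝ → ℝ} {K : ℝ} (hc : ContinuousOn g (Ioi 0)) (hb : ∀ r > 0, |g r| ≤ K * Em 0 (-1) r) :
    IntegrableOn g (Ioi 0) := by
  refine ((Em_int (A := 0) (D := -1) (by norm_num) (by norm_num)).const_mul K).mono' 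
    (hc.aestronglyMeasurable measurableSet_Ioi) ?_
  filter_upwards [ae_restrict_mem measurableSet_Ioi] with r hr using hb r hr

lemma S_ct : ContinuousOn (fun r => sinh r ^ n) (Ioi 0) := (continuous_sinh.pow n).continuousOn
lemma S_ne {r : ℝ} (hr : 0 < r) : sinh r ^ n ≠ 0 := (pow_pos (sinh_pos hr) n).ne'
lemma Si_ct : ContinuousOn (fun r => (sinh r ^ n)⁻¹) (Ioi 0) := S_ct.inv₀ fun _ hr => S_ne hr

lemma Sol.M_r (h : Sol n p a T f) {r t : ℝ} (hr : 0 < r) (ht : t ∈ Ioo a T) :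
    HasDerivAt (fun ρ => Mf n p f ρ t) (sinh r ^ n * f r t ^ p) r := (h.smq p).If_r hr ht
lemma Sol.M_t (h : Sol n p a T f) {r t : ℝ} (hr : 0 < r) (ht : t ∈ Ioo a T) :
    HasDerivAt (fun τ => Mf n p f r τ) (sinh r ^ n * pr f r t) t := by
  rw [h.flux_eq hr ht]; exact (h.smq p).If_t hr ht
lemma Sol.M_ct (h : Sol n p a T f) {t : ℝ} (ht : t ∈ Ioo a T) : ContinuousOn (fun ρ => Mf n p f ρ t) (Ioi 0) :=
  fun _ hr => (h.M_r hr ht).continuousAt.continuousWithinAt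
lemma Sol.M0 (h : Sol n p a T f) {r t : ℝ} (hr : 0 < r) (ht : t ∈ Ioo a T) : 0 < Mf n p f r t := by
  have hm := mono_Ioi (c := 0) (fun r hr => h.M_r hr ht) (fun r hr =>
    mul_nonneg (pow_pos (sinh_pos hr) n).le (rpow_nonneg (h.pos hr ht).le _))
  refine (h.If_nonneg hr ht).lt_of_ne' fun h0 => ?_
  have h1 : HasDerivAt (fun ρ => Mf n p f ρ t) 0 (r/2) := by
    refine (hasDerivAt_const (r/2) (0:ℝ)).congr_of_eventuallyEq ?_
    filter_upwards [Ioo_mem_nhds (half_pos hr) (half_lt_self hr)] with x hx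
    have hx0 : 0 < x := by linarith [hx.1]
    have h3 : Mf n p f x t ≤ Mf n p f r t := hm (mem_Ioi.2 hx0) (mem_Ioi.2 hr) hx.2.le
    rw [show Mf n p f r t = 0 from h0] at h3
    exact le_antisymm h3 (h.If_nonneg hx0 ht)
  have h2 := (h.M_r (half_pos hr) ht).unique h1
  have := mul_pos (pow_pos (sinh_pos (half_pos hr)) n) (rpow_pos_of_pos (h.pos (half_pos hr) ht) p)
  linarith

lemma Exs.bd3 (h : Exs n p κ a T f) : ∃ C > 0, ∀ t ∈ Ioo a T, ∀ r > 0, f r t ≤ C * Em 0 (-n) r ∧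
    |sinh r ^ n * pr f r t| ≤ C ∧ Mf n p f r t ≤ C * Em (n + 1) 0 r := by
  obtain ⟨C, hC, hb⟩ := h.bd
  obtain ⟨c, hc, hM⟩ := h.sol.mass_le
  have : 0 < c * C ^ p := by positivity
  refine ⟨C + c * C ^ p, by positivity, fun t ht r hr => ⟨?_, ?_, ?_⟩⟩
  · refine (hb t ht r hr).1.trans ?_
    have := Em_pos' n hr
    gcongr; linarith
  · linarith [(hb t ht r hr).2]
  · refine (hM t ht C hC.le (fun r hr => (hb t ht r hr).1) r hr).trans ?_
    have := Em_pos (A := n + 1) (D := 0) hr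
    gcongr; linarith

lemma Exs.n1 (h : Exs n p κ a T f) : (1:ℝ) ≤ n := by exact_mod_cast h.sol.hn

lemma Exs.b_e (h : Exs n p κ a T f) {t1 t2 : ℝ} (h1 : a < t1) (h2 : t2 < T) : ∃ K, ∀ t ∈ Icc t1 t2, ∀ r > 0,
    |pr f r t ^ 2 * sinh r ^ n| ≤ K * Em 0 (-1) r := by
  obtain ⟨C, hC, hb⟩ := h.bd3
  obtain ⟨D, hD, hbD⟩ := h.sol.sm.Pr.bdd 1 h1 h2
  have hT1 := Tn_pos one_pos
  refine ⟨D ^ 2 * sinh 1 ^ n * cosh 1 + C ^ 2 * Tn 1 ^ (-(n:ℝ)), fun t ht r hr => ?_⟩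
  have hE := Em_pos (A := 0) (D := -1) hr
  have hn := h.n1
  have hs := pow_pos (sinh_pos hr) n
  have hs1 := sinh_pos one_pos
  have hc1 := cosh_pos 1
  rw [abs_of_nonneg (by positivity), add_mul]
  have q1 : 0 ≤ D ^ 2 * sinh 1 ^ n * cosh 1 * Em 0 (-1) r := by positivity
  have q2 : 0 ≤ C ^ 2 * Tn 1 ^ (-(n:ℝ)) * Em 0 (-1) r := by positivity
  rcases le_total r 1 with hr1 | hr1
  · have e1 : pr f r t ^ 2 ≤ D ^ 2 := by rw [← sq_abs]; gcongr; exact hbD r ⟨hr, hr1⟩ t ht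
    have e2 : sinh r ^ n ≤ sinh 1 ^ n := by gcongr; exact sinh_le_sinh.2 hr1
    have e3 : 1 ≤ cosh 1 * Em 0 (-1) r := by
      simp only [Em, rpow_zero, one_mul, rpow_neg_one]
      rw [← div_eq_mul_inv, one_le_div (cosh_pos r), Real.cosh_le_cosh, abs_of_pos hr, abs_one]; exact hr1
    have : pr f r t ^ 2 * sinh r ^ n * 1 ≤ D ^ 2 * sinh 1 ^ n * (cosh 1 * Em 0 (-1) r) := by gcongr
    linarith
  · have e1 : pr f r t ^ 2 * sinh r ^ n = (sinh r ^ n * pr f r t) ^ 2 * Em (-n) (-n) r := by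
      rw [Em_S' hr]; field_simp
    have e2 : (sinh r ^ n * pr f r t) ^ 2 ≤ C ^ 2 := by
      rw [← sq_abs]; gcongr; exact (hb t ⟨h1.trans_le ht.1, ht.2.trans_lt h2⟩ r hr).2.1
    have e3 : Em (-n) (-n) r ≤ Tn 1 ^ (-(n:ℝ)) * Em 0 (-1) r := by
      have : Em (-n) (-n) r = Tn r ^ (-(n:ℝ)) * Em 0 (-n) r := by simp [Em]
      rw [this]
      have e5 : Tn r ^ (-(n:ℝ)) ≤ Tn 1 ^ (-(n:ℝ)) := by
        refine rpow_le_rpow_of_nonpos hT1 ?_ (by linarith)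
        exact mono_Ioi (c := 0) (fun r _ => Tn_deriv r) (fun r _ => by positivity) (mem_Ioi.2 one_pos) (mem_Ioi.2 hr) hr1
      have := Em_le hr (A := 0) (A' := 0) (D := -n) (D' := -1) le_rfl (by linarith)
      have := Em_pos' n hr
      gcongr
    rw [e1]
    have : (sinh r ^ n * pr f r t) ^ 2 * Em (-n) (-n) r ≤ C ^ 2 * (Tn 1 ^ (-(n:ℝ)) * Em 0 (-1) r) := by
      have := Em_pos (A := -n) (D := -n) hr
      gcongr
    linarith

lemma Exs.i_e (h : Exs n p κ a T f) {t : ℝ} (ht : t ∈ Ioo a T) :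
    IntegrableOn (fun r => pr f r t ^ 2 * sinh r ^ n) (Ioi 0) := by
  obtain ⟨K, hK⟩ := h.b_e ht.1 ht.2
  exact intb (((h.sol.sm.Pr.cont_r ht).pow 2).mul S_ct) (hK t ⟨le_rfl, le_rfl⟩)

lemma Exs.b_ν (h : Exs n p κ a T f) : ∃ K, ∀ t ∈ Ioo a T, ∀ r > 0,
    |Mf n p f r t ^ 2 * (sinh r ^ n)⁻¹| ≤ K * Em 0 (-1) r ∧ |Mf n p f r t * pr f r t| ≤ K * Em 0 (-1) r ∧
    |sinh r ^ n * f r t ^ (p + 1)| ≤ K * Em 0 (-1) r ∧ |Mf n p f r t * f r t| ≤ K * Em 1 (-1) r := by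
  obtain ⟨C, hC, hb⟩ := h.bd3
  have hn := h.n1
  have hp := h.sol.hp
  refine ⟨C ^ 2 + C ^ (p + 1), fun t ht r hr => ?_⟩
  obtain ⟨b1, b2, b3⟩ := hb t ht r hr
  have M0 := (h.sol.M0 hr ht).le
  have hs := pow_pos (sinh_pos hr) n
  have hE := Em_pos (A := 0) (D := -1) hr
  have hE1 := Em_pos (A := 1) (D := -1) hr
  have hE2 := Em_pos (A := n + 1) (D := 0) hr
  have hE3 := Em_pos (A := -n) (D := -n) hr
  have hf := (h.sol.pos hr ht)
  have hC2 : 0 < C ^ (p + 1) := by positivity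
  have key : ∀ x, x ≤ C ^ 2 * Em 0 (-1) r → x ≤ (C ^ 2 + C ^ (p + 1)) * Em 0 (-1) r := fun x hx => by
    nlinarith [mul_pos hC2 hE]
  refine ⟨key _ ?_, key _ ?_, ?_, ?_⟩
  · rw [abs_of_nonneg (by positivity), ← Em_S' hr]
    calc Mf n p f r t ^ 2 * Em (-n) (-n) r ≤ (C * Em (n + 1) 0 r) ^ 2 * Em (-n) (-n) r := by gcongr
      _ = C ^ 2 * (Em (n + 1) 0 r * Em (n + 1) 0 r * Em (-n) (-n) r) := by ring
      _ ≤ _ := by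
        rw [Em_mul hr, Em_mul hr]; gcongr; exact Em_le hr (by linarith) (by linarith)
  · have : Mf n p f r t * pr f r t = Mf n p f r t * (sinh r ^ n * pr f r t) * Em (-n) (-n) r := by
      rw [Em_S' hr]; field_simp
    rw [this, abs_mul, abs_mul, abs_of_nonneg M0, abs_of_pos hE3]
    calc _ ≤ C * Em (n + 1) 0 r * C * Em (-n) (-n) r := by gcongr
      _ = C ^ 2 * (Em (n + 1) 0 r * Em (-n) (-n) r) := by ring
      _ ≤ _ := by rw [Em_mul hr]; gcongr; exact Em_le hr (by linarith) (by linarith)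
  · rw [abs_of_nonneg (by positivity)]
    have : f r t ^ (p + 1) ≤ C ^ (p + 1) * Em 0 (-(n * (p + 1))) r := by
      refine (rpow_le_rpow hf.le b1 (by linarith)).trans_eq ?_
      rw [mul_rpow hC.le (Em_pos hr).le, Em_rpow hr]; congr 2 <;> ring
    refine (S_Em hr this).trans ?_
    have e := Em_le hr (A := n + 0) (A' := 0) (D := n + -(n * (p + 1))) (D' := -1) (by linarith) (by nlinarith)
    have : C ^ (p + 1) * Em (n + 0) (n + -(n * (p + 1))) r ≤ C ^ (p + 1) * Em 0 (-1) r := by gcongr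
    nlinarith [mul_pos (pow_pos hC 2) hE]
  · rw [abs_of_nonneg (by positivity)]
    calc Mf n p f r t * f r t ≤ C * Em (n + 1) 0 r * (C * Em 0 (-n) r) := by gcongr
      _ = C ^ 2 * (Em (n + 1) 0 r * Em 0 (-n) r) := by ring
      _ ≤ C ^ 2 * Em 1 (-1) r := by rw [Em_mul hr]; gcongr; exact Em_le hr (by linarith) (by linarith)
      _ ≤ _ := by gcongr; linarith

lemma Exs.i_ν (h : Exs n p κ a T f) {t : ℝ} (ht : t ∈ Ioo a T) :
    IntegrableOn (fun r => Mf n p f r t ^ 2 * (sinh r ^ n)⁻¹) (Ioi 0) ∧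
    IntegrableOn (fun r => Mf n p f r t * pr f r t) (Ioi 0) ∧
    IntegrableOn (fun r => sinh r ^ n * f r t ^ (p + 1)) (Ioi 0) := by
  obtain ⟨K, hK⟩ := h.b_ν
  refine ⟨intb (((h.sol.M_ct ht).pow 2).mul Si_ct) fun r hr => (hK t ht r hr).1,
    intb ((h.sol.M_ct ht).mul (h.sol.sm.Pr.cont_r ht)) fun r hr => (hK t ht r hr).2.1,
    intb (S_ct.mul ((h.sol.smq (p+1)).cont_r ht)) fun r hr => (hK t ht r hr).2.2.1⟩

lemma Exs.parts (h : Exs n p κ a T f) {t : ℝ} (ht : t ∈ Ioo a T) :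
    ∫ r in Ioi (0:ℝ), Mf n p f r t * pr f r t = - yE n p f t := by
  obtain ⟨K, hK⟩ := h.b_ν
  have e : ∀ r ∈ Ioi (0:ℝ), sinh r ^ n * f r t ^ p * f r t = sinh r ^ n * f r t ^ (p + 1) := fun r hr => by
    rw [rpow_add (h.sol.pos hr ht), rpow_one]; ring
  have l : ∀ {F : Filter ℝ}, Tendsto (fun r => K * Em 1 (-1) r) F (𝓝 0) → (∀ᶠ r in F, 0 < r) →
      Tendsto ((fun r => Mf n p f r t) * fun r => f r t) F (𝓝 0) := fun {F} hF h0 => by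
    refine squeeze_zero_norm' ?_ hF
    filter_upwards [h0] with r hr using (hK t ht r hr).2.2.2
  rw [integral_Ioi_mul_deriv_eq_deriv_mul (a' := 0) (b' := 0) (fun r hr => h.sol.M_r hr ht)
    (fun r hr => h.sol.sm.hr hr ht) (h.i_ν ht).2.1 ((h.i_ν ht).2.2.congr_fun (fun r hr => (e r hr).symm) measurableSet_Ioi)
    (l ?_ self_mem_nhdsWithin) (l ?_ (eventually_gt_atTop 0))]
  · rw [yE, setIntegral_congr_fun measurableSet_Ioi e]; ring
  · have : Tendsto (fun r => K * Em 1 (-1) r) (𝓝[>] 0) (𝓝 (K * Em 1 (-1) 0)) := by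
      refine Tendsto.mono_left (ContinuousAt.tendsto ?_) nhdsWithin_le_nhds
      simp only [Em, rpow_one]
      exact continuousAt_const.mul (Tn_cont.continuousAt.mul (continuous_cosh.continuousAt.rpow_const (Or.inl (cosh_pos 0).ne')))
    simpa [Em, Tn] using this
  · have := (Em_lim (D := -1) (by norm_num)).const_mul |K|
    rw [mul_zero] at this
    refine squeeze_zero_norm' ?_ this
    filter_upwards [eventually_gt_atTop 0] with r hr
    rw [norm_mul, Real.norm_eq_abs, Real.norm_of_nonneg (Em_pos hr).le]
    gcongr; exact Em_le hr (by norm_num) le_rfl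

lemma Exs.ν_d (h : Exs n p κ a T f) {t : ℝ} (ht : t ∈ Ioo a T) : HasDerivAt (νE n p f) (-2 * yE n p f t) t := by
  obtain ⟨K, hK⟩ := h.b_ν
  have key := (hasDerivAt_integral_of_dominated_loc_of_deriv_le (μ := volume.restrict (Ioi 0)) (𝕜 := ℝ)
    (F := fun t r => Mf n p f r t ^ 2 * (sinh r ^ n)⁻¹) (F' := fun t r => 2 * (Mf n p f r t * pr f r t))
    (bound := fun r => 2 * (K * Em 0 (-1) r)) (x₀ := t) (Ioo_mem_nhds ht.1 ht.2) ?_ (h.i_ν ht).1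
    ((h.i_ν ht).2.1.const_mul 2).aestronglyMeasurable ?_ ?_ ?_).2
  · refine key.congr_deriv ?_
    rw [integral_const_mul, h.parts ht]; ring
  · filter_upwards [Ioo_mem_nhds ht.1 ht.2] with s hs using (h.i_ν hs).1.aestronglyMeasurable
  · filter_upwards [ae_restrict_mem measurableSet_Ioi] with r hr s hs
    rw [norm_mul, Real.norm_two]; gcongr; exact (hK s hs r hr).2.1
  · exact ((Em_int (by norm_num) (by norm_num)).const_mul K).const_mul 2
  · filter_upwards [ae_restrict_mem measurableSet_Ioi] with r hr s hs
    refine (((h.sol.M_t hr hs).pow 2).mul_const (sinh r ^ n)⁻¹).congr_deriv ?_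
    have := S_ne (n := n) hr
    push_cast; field_simp

lemma Exs.sq_int (h : Exs n p κ a T f) {t : ℝ} (ht : t ∈ Ioo a T) (c : ℝ) :
    IntegrableOn (fun r => (pr f r t + c * (Mf n p f r t * (sinh r ^ n)⁻¹)) ^ 2 * sinh r ^ n) (Ioi 0) ∧
    ∫ r in Ioi (0:ℝ), (pr f r t + c * (Mf n p f r t * (sinh r ^ n)⁻¹)) ^ 2 * sinh r ^ n =
      eE n f t - 2 * c * yE n p f t + c ^ 2 * νE n p f t := by
  obtain ⟨i1, i2, i3⟩ := h.i_ν ht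
  have e : ∀ r ∈ Ioi (0:ℝ), (pr f r t + c * (Mf n p f r t * (sinh r ^ n)⁻¹)) ^ 2 * sinh r ^ n =
    pr f r t ^ 2 * sinh r ^ n + 2 * c * (Mf n p f r t * pr f r t) + c ^ 2 * (Mf n p f r t ^ 2 * (sinh r ^ n)⁻¹) := by
    intro r hr
    have := S_ne (n := n) hr
    field_simp; ring
  have j1 := (h.i_e ht).add (i2.const_mul (2 * c))
  refine ⟨(j1.add (i1.const_mul (c ^ 2))).congr_fun (fun r hr => (e r hr).symm) measurableSet_Ioi, ?_⟩
  rw [setIntegral_congr_fun measurableSet_Ioi e]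
  have := integral_add j1 (i1.const_mul (c ^ 2))
  simp only [Pi.add_apply] at this
  rw [this, integral_add (h.i_e ht) (i2.const_mul (2 * c)), integral_const_mul, integral_const_mul, h.parts ht]
  simp only [eE, νE]; ring
end energies

lemma le_limT {F F' G : ℝ → ℝ} {t T L : ℝ} (ht : t < T) (hd : ∀ s ∈ Ico t T, HasDerivAt F (F' s) s)
    (h0 : ∀ s ∈ Ico t T, 0 ≤ F' s) (hG : ∀ s ∈ Ico t T, F s ≤ G s) (hL : Tendsto G (𝓝[<] T) (𝓝 L)) : F t ≤ L := by
  have hm : MonotoneOn F (Ico t T) := monotoneOn_of_deriv_nonneg (convex_Ico t T)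
    (fun s hs => (hd s hs).continuousAt.continuousWithinAt)
    (fun s hs => (hd s (interior_subset hs)).differentiableAt.differentiableWithinAt)
    (fun s hs => by rw [(hd s (interior_subset hs)).deriv]; exact h0 s (interior_subset hs))
  refine ge_of_tendsto hL ?_
  filter_upwards [Ioo_mem_nhdsLT ht] with s hs
  exact (hm ⟨le_rfl, ht⟩ ⟨hs.1.le, hs.2⟩ hs.1.le).trans (hG s ⟨hs.1.le, hs.2⟩)

section ode
variable {p κ a T K lam : ℝ} {y e ν : ℝ → ℝ}

structure Od (p κ a T K : ℝ) (y e ν : ℝ → ℝ) : Prop where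
  hp : 1 < p
  hκ : (p - 1) * κ = 1
  aT : a < T
  hK : 0 < K
  dν : ∀ t ∈ Ioo a T, HasDerivAt ν (-2 * y t) t
  dy : ∀ t ∈ Ioo a T, HasDerivAt y (-((p + 1) / p) * e t) t
  y0 : ∀ t ∈ Ioo a T, 0 < y t
  ν0 : ∀ t ∈ Ioo a T, 0 < ν t
  cs : ∀ t ∈ Ioo a T, y t ^ 2 ≤ ν t * e t
  νT : Tendsto ν (𝓝[<] T) (𝓝 0)
  ye : ∀ t ∈ Ioo a T, y t ≤ K * e t ^ ((p + 1) / 2)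

lemma Od.dA (h : Od p κ a T K y e ν) (hl : lam = (p + 1) / (2 * p)) {t : ℝ} (ht : t ∈ Ioo a T) :
    HasDerivAt (fun t => y t * ν t ^ (-lam)) (-((p + 1) / p) * (e t - y t ^ 2 / ν t) * ν t ^ (-lam)) t := by
  have hp := h.hp
  have hν := h.ν0 t ht
  refine ((h.dy t ht).mul ((h.dν t ht).rpow_const (p := -lam) (Or.inl hν.ne'))).congr_deriv ?_
  rw [rpow_sub hν, rpow_one, hl]
  field_simp; ring

lemma Od.dξ (h : Od p κ a T K y e ν) {t : ℝ} (ht : t ∈ Ioo a T) :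
    HasDerivAt (fun t => ν t ^ (1 - lam)) (-(2 * (1 - lam)) * (y t * ν t ^ (-lam))) t := by
  refine ((h.dν t ht).rpow_const (p := 1 - lam) (Or.inl (h.ν0 t ht).ne')).congr_deriv ?_
  rw [show 1 - lam - 1 = -lam by ring]; ring

lemma Od.κ0 (h : Od p κ a T K y e ν) : 0 < κ := by
  by_contra! hc
  nlinarith [h.hp, h.hκ]

lemma Od.lm (h : Od p κ a T K y e ν) (hl : lam = (p + 1) / (2 * p)) : 0 < lam ∧ 0 < 1 - lam ∧ 2 * (1 - lam) * (p * κ) = 1 := by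
  have hp := h.hp
  refine ⟨by rw [hl]; positivity, ?_, ?_⟩
  · rw [hl, sub_pos, div_lt_one (by linarith)]; linarith
  · rw [hl]; field_simp; linarith [h.hκ]

lemma Od.anti (h : Od p κ a T K y e ν) (hl : lam = (p + 1) / (2 * p)) :
    AntitoneOn (fun t => y t * ν t ^ (-lam)) (Ioo a T) := by
  have hp := h.hp
  refine antitoneOn_of_deriv_nonpos (convex_Ioo a T) (fun s hs => (h.dA hl hs).continuousAt.continuousWithinAt)
    (fun s hs => (h.dA hl (interior_subset hs)).differentiableAt.differentiableWithinAt) (fun s hs => ?_)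
  rw [(h.dA hl (interior_subset hs)).deriv]
  have hs := interior_subset hs
  have h1 : 0 ≤ e s - y s ^ 2 / ν s := by
    rw [sub_nonneg, div_le_iff₀ (h.ν0 s hs)]; linarith [h.cs s hs]
  have h2 := rpow_pos_of_pos (h.ν0 s hs) (-lam)
  have h3 : 0 < (p + 1) / p := by positivity
  nlinarith [mul_nonneg (mul_nonneg h3.le h1) h2.le]

lemma Od.ξ_lim (h : Od p κ a T K y e ν) (hl : lam = (p + 1) / (2 * p)) (c : ℝ) :
    Tendsto (fun s => ν s ^ (1 - lam) + c * s) (𝓝[<] T) (𝓝 (c * T)) := by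
  have h1 := h.νT.rpow_const (p := 1 - lam) (Or.inr (h.lm hl).2.1.le)
  rw [zero_rpow (h.lm hl).2.1.ne'] at h1
  have h2 : Tendsto (fun s : ℝ => c * s) (𝓝[<] T) (𝓝 (c * T)) :=
    (continuous_const.mul continuous_id).continuousAt.tendsto.mono_left nhdsWithin_le_nhds
  simpa using h1.add h2

lemma Od.ξ_up (h : Od p κ a T K y e ν) (hl : lam = (p + 1) / (2 * p)) {t : ℝ} (ht : t ∈ Ioo a T) :
    ν t ^ (1 - lam) ≤ 2 * (1 - lam) * (y t * ν t ^ (-lam)) * (T - t) := by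
  have hh : ∀ s ∈ Ico t T, s ∈ Ioo a T := fun s hs => ⟨ht.1.trans_le hs.1, hs.2⟩
  have := le_limT (F := fun s => ν s ^ (1 - lam) + 2 * (1 - lam) * (y t * ν t ^ (-lam)) * s) ht.2
    (fun s hs => (h.dξ (hh s hs)).add ((hasDerivAt_id s).const_mul _)) (fun s hs => by
      have h1 : y s * ν s ^ (-lam) ≤ y t * ν t ^ (-lam) := h.anti hl ht (hh s hs) hs.1
      have h2 := (h.lm hl).2.1
      nlinarith) (fun s hs => le_rfl) (h.ξ_lim hl _)
  linarith

lemma Od.ξ_lo (h : Od p κ a T K y e ν) (hl : lam = (p + 1) / (2 * p)) {t c : ℝ} (ht : t ∈ Ioo a T)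
    (hc : ∀ s ∈ Ioo a T, c ≤ y s * ν s ^ (-lam)) : 2 * (1 - lam) * c * (T - t) ≤ ν t ^ (1 - lam) := by
  have hh : ∀ s ∈ Ico t T, s ∈ Ioo a T := fun s hs => ⟨ht.1.trans_le hs.1, hs.2⟩
  have := le_limT (F := fun s => -(ν s ^ (1 - lam) + 2 * (1 - lam) * c * s)) ht.2
    (fun s hs => ((h.dξ (hh s hs)).add ((hasDerivAt_id s).const_mul _)).neg) (fun s hs => by
      have h1 := hc s (hh s hs)
      have h2 := (h.lm hl).2.1
      nlinarith) (fun s hs => le_rfl) (h.ξ_lim hl _).neg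
  linarith

lemma Od.e0 (h : Od p κ a T K y e ν) {t : ℝ} (ht : t ∈ Ioo a T) : 0 < e t :=
  pos_of_mul_pos_right (lt_of_lt_of_le (pow_pos (h.y0 t ht) 2) (h.cs t ht)) (h.ν0 t ht).le

lemma Od.y_lo (h : Od p κ a T K y e ν) : ∃ c > 0, ∀ t ∈ Ioo a T, c * (T - t) ^ ((p + 1) * κ) ≤ y t := by
  have hp := h.hp
  have hk := h.κ0
  have hK := h.hK
  set q := (p - 1) / (p + 1) with hq
  have hq0 : 0 < q := div_pos (by linarith) (by linarith)
  set c1 := (p - 1) / p * K ^ (-(2 / (p + 1))) with hc1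
  have hc10 : 0 < c1 := mul_pos (div_pos (by linarith) (by linarith)) (by positivity)
  have hqi : q * ((p + 1) * κ) = 1 := by
    have := h.hκ
    rw [hq, div_mul_eq_mul_div, div_eq_iff (by positivity)]; linear_combination (p + 1) * this
  refine ⟨c1 ^ ((p + 1) * κ), by positivity, fun t ht => ?_⟩
  have hh : ∀ s ∈ Ico t T, s ∈ Ioo a T := fun s hs => ⟨ht.1.trans_le hs.1, hs.2⟩
  have := le_limT (F := fun s => -(y s ^ q + c1 * s)) (G := fun s => -(c1 * s)) (L := -(c1 * T)) ht.2
    (fun s hs => (((h.dy s (hh s hs)).rpow_const (p := q) (Or.inl (h.y0 s (hh s hs)).ne')).add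
      ((hasDerivAt_id s).const_mul c1)).neg) (fun s hs => by
      have hs := hh s hs
      have hy := h.y0 s hs
      have h1 : (y s / K) ^ (2 / (p + 1)) ≤ e s := by
        have h2 : y s / K ≤ e s ^ ((p + 1) / 2) := by rw [div_le_iff₀ hK]; linarith [h.ye s hs]
        refine (rpow_le_rpow (by positivity) h2 (by positivity)).trans_eq ?_
        rw [← rpow_mul (h.e0 hs).le, show (p + 1) / 2 * (2 / (p + 1)) = 1 by field_simp, rpow_one]
      rw [div_rpow hy.le hK.le] at h1
      have h3 : y s ^ (2 / (p + 1)) * y s ^ (q - 1) = 1 := by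
        rw [← rpow_add hy, show 2 / (p + 1) + (q - 1) = 0 by rw [hq]; field_simp; ring, rpow_zero]
      have h4 := rpow_pos_of_pos hy (q - 1)
      have h5 : K ^ (-(2 / (p + 1))) ≤ e s * y s ^ (q - 1) := by
        calc K ^ (-(2 / (p + 1))) = y s ^ (2 / (p + 1)) / K ^ (2 / (p + 1)) * y s ^ (q - 1) := by
              rw [rpow_neg hK.le, div_mul_eq_mul_div, h3, one_div]
          _ ≤ _ := by gcongr
      have h6 : (p + 1) / p * q = (p - 1) / p := by rw [hq]; field_simp
      have h7 : c1 ≤ (p - 1) / p * (e s * y s ^ (q - 1)) := by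
        rw [hc1]; have : 0 < (p - 1) / p := div_pos (by linarith) (by linarith)
        gcongr
      rw [← h6] at h7
      nlinarith)
    (fun s hs => by have := rpow_pos_of_pos (h.y0 s (hh s hs)) q; linarith)
    ((continuous_const.mul continuous_id).neg.continuousAt.tendsto.mono_left nhdsWithin_le_nhds)
  have hl : 0 < T - t := by linarith [ht.2]
  have h8 : c1 * (T - t) ≤ y t ^ q := by linarith
  have h9 := rpow_le_rpow (by positivity) h8 (z := (p + 1) * κ) (by positivity)
  rwa [mul_rpow hc10.le hl.le, ← rpow_mul (h.y0 t ht).le, hqi, rpow_one] at h9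

lemma Od.main (h : Od p κ a T K y e ν) : ∃ t1 ∈ Ioo a T, ∃ c > 0, ∃ C > 0,
    (∀ t ∈ Ico t1 T, c * (T - t) ^ ((p + 1) * κ) ≤ y t ∧ y t ≤ C * (T - t) ^ ((p + 1) * κ)) ∧
    Tendsto (fun t => (T - t) * (y t / ν t)) (𝓝[<] T) (𝓝 (p * κ)) ∧
    (∀ s1 s2, t1 ≤ s1 → s1 < s2 → s2 < T → ∃ ξ ∈ Ioo s1 s2, e ξ * (s2 - s1) ≤ C * (T - s1) ^ ((p + 1) * κ)) ∧
    (∀ q ∈ Ioo (0:ℝ) 1, ∀ δ > 0, ∀ᶠ s in 𝓝[<] T, ∃ ξ ∈ Ioo s (T - q * (T - s)),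
      e ξ - y ξ ^ 2 / ν ξ ≤ δ * (T - s) ^ (2 * κ)) := by
  obtain ⟨c, hc, hy⟩ := h.y_lo
  obtain ⟨lam, hl⟩ : ∃ lam, lam = (p + 1) / (2 * p) := ⟨_, rfl⟩
  obtain ⟨l0, l1, l2⟩ := h.lm hl
  have hp := h.hp
  have hk := h.κ0
  set A := fun t => y t * ν t ^ (-lam) with hA
  have hanti : AntitoneOn A (Ioo a T) := h.anti hl
  have haT := h.aT
  set t1 := (a + T) / 2
  have ht1 : t1 ∈ Ioo a T := ⟨by simp only [t1]; linarith, by simp only [t1]; linarith⟩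
  have hI : ∀ t ∈ Ico t1 T, t ∈ Ioo a T := fun t ht => ⟨ht1.1.trans_le ht.1, ht.2⟩
  have hA0 : ∀ t ∈ Ioo a T, 0 < A t := fun t ht => mul_pos (h.y0 t ht) (rpow_pos_of_pos (h.ν0 t ht) _)
  set B := 2 * (1 - lam) * A t1 with hB
  have hB0 : 0 < B := by have := hA0 t1 ht1; positivity
  have hll : (1 - lam) * ((p + 1) * κ) = lam := by
    have : lam * (2 * p) = p + 1 := by rw [hl]; field_simp
    have h4 : 2 * p * ((1 - lam) * ((p + 1) * κ)) = 2 * p * lam := by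
      linear_combination (p + 1) * l2 - this
    exact mul_left_cancel₀ (by positivity) h4
  -- ν^lam ≤ (B ℓ)^((p+1)κ)
  have hν : ∀ t ∈ Ico t1 T, ν t ^ lam ≤ (B * (T - t)) ^ ((p + 1) * κ) := fun t ht => by
    have h0 := h.ν0 t (hI t ht)
    have hlt : 0 < T - t := by linarith [ht.2]
    rw [← hll, rpow_mul h0.le]
    refine rpow_le_rpow (by positivity) ((h.ξ_up hl (hI t ht)).trans ?_) (by positivity)
    rw [hB]
    have : y t * ν t ^ (-lam) ≤ A t1 := hanti ht1 (hI t ht) ht.1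
    gcongr
  set Bp := B ^ ((p + 1) * κ) with hBp
  have hBp0 : 0 < Bp := by positivity
  have hνB : ∀ t ∈ Ico t1 T, ν t ^ lam ≤ Bp * (T - t) ^ ((p + 1) * κ) := fun t ht => by
    rw [← mul_rpow hB0.le (by linarith [ht.2])]; exact hν t ht
  have hyA : ∀ t ∈ Ioo a T, y t = A t * ν t ^ lam := fun t ht => by
    have := h.ν0 t ht
    rw [hA]; simp only; rw [mul_assoc, ← rpow_add this]; simp
  have hAlo : ∀ t ∈ Ioo a T, c / Bp ≤ A t := by
    have key : ∀ t ∈ Ico t1 T, c / Bp ≤ A t := fun t ht => by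
      have h1 := hy t (hI t ht)
      rw [hyA t (hI t ht)] at h1
      have hlt : 0 < (T - t) ^ ((p + 1) * κ) := rpow_pos_of_pos (by linarith [ht.2]) _
      have h2 := mul_mono_l (hνB t ht) (hA0 t (hI t ht)).le
      rw [div_le_iff₀ hBp0]
      refine le_of_mul_le_mul_right ?_ hlt
      linarith
    intro t ht
    rcases le_total t1 t with h1 | h1
    · exact key t ⟨h1, ht.2⟩
    · exact (key t1 ⟨le_rfl, ht1.2⟩).trans (hanti ht ht1 h1)
  -- limit of A
  obtain ⟨Ai, hAi⟩ : ∃ L, IsGLB (A '' Ioo a T) L :=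
    Real.exists_isGLB ⟨_, mem_image_of_mem A ht1⟩ ⟨c / Bp, by rintro _ ⟨t, ht, rfl⟩; exact hAlo t ht⟩
  have hAle : ∀ t ∈ Ioo a T, Ai ≤ A t := fun t ht => hAi.1 (mem_image_of_mem A ht)
  have hApos : 0 < Ai := lt_of_lt_of_le (div_pos hc hBp0) (hAi.2 (by rintro _ ⟨t, ht, rfl⟩; exact hAlo t ht))
  have hAlim : ∀ δ > 0, ∃ t2 ∈ Ico t1 T, ∀ t ∈ Ico t2 T, A t ≤ Ai + δ := fun δ hδ => by
    obtain ⟨_, ⟨t2, ht2, rfl⟩, h3⟩ := hAi.exists_between (show Ai < Ai + δ by linarith)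
    refine ⟨max t1 t2, ⟨le_max_left _ _, max_lt ht1.2 ht2.2⟩, fun t ht => ?_⟩
    exact (hanti ht2 ⟨ht2.1.trans_le ((le_max_right _ _).trans ht.1), ht.2⟩ ((le_max_right _ _).trans ht.1)).trans h3.2.le
  have hyU : ∀ t ∈ Ico t1 T, y t ≤ A t1 * Bp * (T - t) ^ ((p + 1) * κ) := fun t ht => by
    rw [hyA t (hI t ht), mul_assoc (A t1)]
    have h1 := hanti ht1 (hI t ht) ht.1
    have h2 := hνB t ht
    have h3 := hA0 t1 ht1
    have := h.ν0 t (hI t ht)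
    exact mul_le_mul h1 h2 (by positivity) h3.le
  refine ⟨t1, ht1, c, hc, A t1 * Bp, mul_pos (hA0 t1 ht1) hBp0, fun t ht => ⟨hy t (hI t ht), hyU t ht⟩, ?_, ?_, ?_⟩
  · -- ℓ y / ν
    have hq : ∀ t ∈ Ioo a T, (T - t) * (y t / ν t) = (T - t) * A t / ν t ^ (1 - lam) := fun t ht => by
      have h0 := h.ν0 t ht
      rw [hA]; simp only
      rw [rpow_sub h0, rpow_one, rpow_neg h0.le]
      have := (rpow_pos_of_pos h0 lam).ne'
      field_simp
    rw [tendsto_order]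
    have hpk : p * κ = 1 / (2 * (1 - lam)) := by rw [eq_div_iff (by positivity)]; linarith
    constructor
    · intro x hx
      filter_upwards [Ioo_mem_nhdsLT ht1.2] with t ht
      have ht' := hI t ⟨ht.1.le, ht.2⟩
      refine hx.trans_le ?_
      rw [hq t ht', hpk, div_le_div_iff₀ (by positivity) (rpow_pos_of_pos (h.ν0 t ht') _)]
      have := h.ξ_up hl ht'
      simp only [hA]; linarith
    · intro x hx
      have h6 : 0 < x / (p * κ) - 1 := by rw [sub_pos, one_lt_div (by positivity)]; exact hx
      obtain ⟨t2, ht2, hδ⟩ := hAlim (Ai * (x / (p * κ) - 1) / 2) (by positivity)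
      filter_upwards [Ioo_mem_nhdsLT ht2.2] with t ht
      have ht' := hI t ⟨ht2.1.trans ht.1.le, ht.2⟩
      have hlt : 0 < T - t := by linarith [ht.2]
      rw [hq t ht', div_lt_iff₀ (rpow_pos_of_pos (h.ν0 t ht') _)]
      have h7 := h.ξ_lo hl ht' hAle
      have h8 := hδ t ⟨ht.1.le, ht.2⟩
      have hx0 : 0 < x := lt_trans (by positivity) hx
      have h9 : A t < Ai * (x / (p * κ)) := by nlinarith
      have h10 : x * (2 * (1 - lam) * Ai * (T - t)) ≤ x * ν t ^ (1 - lam) := by gcongr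
      have h11 : x / (p * κ) = x * (2 * (1 - lam)) := by rw [hpk]; field_simp
      rw [h11] at h9
      nlinarith
  · intro s1 s2 h1 h12 h2
    have hs : ∀ s ∈ Icc s1 s2, s ∈ Ico t1 T := fun s hs => ⟨h1.trans hs.1, hs.2.trans_lt h2⟩
    obtain ⟨ξ, hξ, he⟩ := exists_hasDerivAt_eq_slope y (fun s => -((p + 1) / p) * e s) h12
      (fun s hs' => (h.dy s (hI s (hs s hs'))).continuousAt.continuousWithinAt)
      (fun s hs' => h.dy s (hI s (hs s ⟨hs'.1.le, hs'.2.le⟩)))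
    refine ⟨ξ, hξ, ?_⟩
    have hd : 0 < s2 - s1 := by linarith
    rw [eq_div_iff hd.ne'] at he
    have h3 := hyU s1 (hs s1 ⟨le_rfl, h12.le⟩)
    have h4 := h.y0 s2 (hI _ (hs s2 ⟨h12.le, le_rfl⟩))
    have hξ' := hI _ (hs ξ ⟨hξ.1.le, hξ.2.le⟩)
    have h5 := (h.e0 hξ').le
    have h6 : 1 ≤ (p + 1) / p := by rw [one_le_div (by positivity)]; linarith
    have h7 : 0 ≤ e ξ * (s2 - s1) := by positivity
    nlinarith
  · intro q hq δ hδ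
    have h1q : 0 < 1 - q := by linarith [hq.2]
    obtain ⟨t2, ht2, hA2⟩ := hAlim (δ * (1 - q) / Bp) (by positivity)
    filter_upwards [Ioo_mem_nhdsLT ht2.2] with s hs
    have hls : 0 < T - s := by linarith [hs.2]
    have h12 : s < T - q * (T - s) := by nlinarith
    have hs' : ∀ x ∈ Icc s (T - q * (T - s)), x ∈ Ico t1 T := fun x hx =>
      ⟨ht2.1.trans (hs.1.le.trans hx.1), hx.2.trans_lt (by nlinarith [hq.1])⟩
    obtain ⟨ξ, hξ, he⟩ := exists_hasDerivAt_eq_slope A _ h12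
      (fun x hx => (h.dA hl (hI x (hs' x hx))).continuousAt.continuousWithinAt)
      (fun x hx => h.dA hl (hI x (hs' x ⟨hx.1.le, hx.2.le⟩)))
    refine ⟨ξ, hξ, ?_⟩
    have hξ' := hs' ξ ⟨hξ.1.le, hξ.2.le⟩
    have hd : 0 < T - q * (T - s) - s := by linarith
    rw [eq_div_iff hd.ne'] at he
    have h3 := hA2 s ⟨hs.1.le, hs.2⟩
    have h4 := hAle _ (hI _ (hs' (T - q * (T - s)) ⟨h12.le, le_rfl⟩))
    have hν0 := h.ν0 ξ (hI _ hξ')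
    have h5 := hνB ξ hξ'
    set X := e ξ - y ξ ^ 2 / ν ξ with hX
    have hX0 : 0 ≤ X := by
      rw [hX, sub_nonneg, div_le_iff₀ hν0]; linarith [h.cs ξ (hI _ hξ')]
    have h6 : 1 ≤ (p + 1) / p := by rw [one_le_div (by positivity)]; linarith
    have hN := rpow_pos_of_pos hν0 (-lam)
    have hN2 := rpow_pos_of_pos hν0 lam
    have h7 : X * ν ξ ^ (-lam) * ((1 - q) * (T - s)) ≤ δ * (1 - q) / Bp := by
      have h8 : 0 ≤ X * ν ξ ^ (-lam) * ((1 - q) * (T - s)) := by positivity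
      nlinarith
    have h9 : X * ((1 - q) * (T - s)) ≤ δ * (1 - q) * (T - s) ^ ((p + 1) * κ) := by
      have e1 : X * ((1 - q) * (T - s)) = X * ν ξ ^ (-lam) * ((1 - q) * (T - s)) * ν ξ ^ lam := by
        rw [rpow_neg hν0.le]; field_simp
      have e2 : (T - ξ) ^ ((p + 1) * κ) ≤ (T - s) ^ ((p + 1) * κ) :=
        rpow_le_rpow (by linarith [hξ'.2]) (by linarith [hξ.1]) (by positivity)
      rw [e1]
      calc _ ≤ δ * (1 - q) / Bp * (Bp * (T - ξ) ^ ((p + 1) * κ)) := by gcongr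
        _ = δ * (1 - q) * (T - ξ) ^ ((p + 1) * κ) := by field_simp
        _ ≤ _ := by gcongr
    have h10 : (T - s) ^ ((p + 1) * κ) = (T - s) ^ (2 * κ) * (T - s) := by
      rw [← rpow_add_one hls.ne']; congr 1; linarith [h.hκ]
    rw [h10] at h9
    have h11 : X * ((1 - q) * (T - s)) ≤ δ * (T - s) ^ (2 * κ) * ((1 - q) * (T - s)) := by linarith
    exact le_of_mul_le_mul_right h11 (by positivity)
end ode

section
variable {n : ℕ} {p a T κ : ℝ} {f : ℝ → ℝ → ℝ}

lemma ipos {g : ℝ → ℝ} (hi : IntegrableOn g (Ioi 0)) (h0 : ∀ r > 0, 0 < g r) : 0 < ∫ r in Ioi (0:ℝ), g r := by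
  rw [setIntegral_pos_iff_support_of_nonneg_ae ?_ hi]
  · refine lt_of_lt_of_le ?_ (measure_mono (show Ioi (0:ℝ) ⊆ Function.support g ∩ Ioi 0 from fun r hr => ⟨(h0 r hr).ne', hr⟩))
    simp
  · filter_upwards [ae_restrict_mem measurableSet_Ioi] with r hr using (h0 r hr).le

lemma Exs.yR (h : Exs n p κ a T f) {R t : ℝ} (hR : 0 < R) (ht : t ∈ Ioo a T) :
    If n (pt (fun r t => f r t ^ (p + 1))) R t =
      (p + 1) / p * (f R t * (sinh R ^ n * pr f R t) - If n (fun r t => pr f r t * pr f r t) R t) := by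
  have hs := h.sol
  have hp := hs.p0
  refine eq_of_deriv (G := fun R => (p + 1) / p * (f R t * (sinh R ^ n * pr f R t) - If n (fun r t => pr f r t * pr f r t) R t))
    (fun r hr => (hs.smq (p+1)).Pt.If_r hr ht) (fun r hr => ?_) ((hs.smq (p+1)).Pt.If_lim ht) ?_ hR
  · refine ((((hs.sm.hr hr ht).mul (hs.flux hr ht)).sub ((hs.sm.Pr.mul hs.sm.Pr).If_r hr ht)).const_mul _).congr_deriv ?_
    have h0 := hs.pos hr ht
    have e1 : pt (fun r t => f r t ^ p) r t = pt f r t * p * f r t ^ (p - 1) :=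
      ((hs.sm.ht hr ht).rpow_const (p := p) (Or.inl h0.ne')).deriv
    have e2 : pt (fun r t => f r t ^ (p + 1)) r t = pt f r t * (p + 1) * f r t ^ (p + 1 - 1) :=
      ((hs.sm.ht hr ht).rpow_const (p := p + 1) (Or.inl h0.ne')).deriv
    rw [e1, e2, show p + 1 - 1 = (p - 1) + 1 by ring, rpow_add_one h0.ne']
    field_simp; ring
  · obtain ⟨C, hC, hb⟩ := (hs.sm.mul hs.sm.Pr).bdd 1 ht.1 ht.2
    have e1 := S_mul_tendsto hs.hn (φ := fun r => f r t * pr f r t) fun r hr => hb r hr t ⟨le_rfl, le_rfl⟩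
    have := (e1.sub ((hs.sm.Pr.mul hs.sm.Pr).If_lim (n := n) ht)).const_mul ((p + 1) / p)
    simp only [sub_zero, mul_zero] at this
    exact this.congr fun r => by ring_nf

lemma Exs.y_d (h : Exs n p κ a T f) {t : ℝ} (ht : t ∈ Ioo a T) :
    HasDerivAt (yE n p f) (-((p + 1) / p) * eE n f t) t := by
  have hs := h.sol
  have hp := hs.p0
  obtain ⟨t1, h1, h1'⟩ := exists_between ht.1
  obtain ⟨t2, h2, h2'⟩ := exists_between ht.2
  have hI : ∀ s ∈ Ioo t1 t2, s ∈ Ioo a T := fun s hs => ⟨h1.trans hs.1, hs.2.trans h2'⟩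
  obtain ⟨K, hK⟩ := h.b_e h1 h2'
  obtain ⟨C, hC, hb⟩ := h.bd
  have hn := h.n1
  refine hasDerivAt_of_tendstoUniformlyOn (l := atTop) (f := fun R t => If n (fun r t => f r t ^ (p + 1)) R t)
    (f' := fun R t => If n (pt (fun r t => f r t ^ (p + 1))) R t) (g := yE n p f)
    (g' := fun t => -((p + 1) / p) * eE n f t) (isOpen_Ioo (a := t1) (b := t2)) ?_ ?_ ?_ ⟨h1', h2⟩
  · rw [Metric.tendstoUniformlyOn_iff]
    intro ε hε
    have iE : IntegrableOn (fun r => K * Em 0 (-1) r) (Ioi 0) := (Em_int (A := 0) (D := -1) (by norm_num) (by norm_num)).const_mul K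
    have l1 := intervalIntegral_tendsto_integral_Ioi 0 iE tendsto_id
    have l2 := ((l1.const_sub (∫ r in Ioi (0:ℝ), K * Em 0 (-1) r)).add
      ((Em_lim (D := -n) (by linarith)).const_mul (C * C))).const_mul ((p + 1) / p)
    simp only [sub_self, mul_zero, add_zero, id] at l2
    filter_upwards [l2.eventually_lt_const hε, eventually_gt_atTop 0] with R hR hR0 s hs
    have hs' := hI s hs
    have hsub : Ioi R ⊆ Ioi 0 := Ioi_subset_Ioi hR0.le
    rw [h.yR hR0 hs', dist_eq_norm, Real.norm_eq_abs]
    have j1 : eE n f s = If n (fun r t => pr f r t * pr f r t) R s + ∫ r in Ioi R, pr f r s ^ 2 * sinh r ^ n := by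
      rw [eE, ← intervalIntegral.integral_interval_add_Ioi (h.i_e hs') ((h.i_e hs').mono_set hsub), If]
      congr 1
      exact intervalIntegral.integral_congr fun r _ => by ring
    have j2 := intervalIntegral.integral_interval_add_Ioi iE (iE.mono_set hsub)
    have j3 : ‖∫ r in Ioi R, pr f r s ^ 2 * sinh r ^ n‖ ≤ ∫ r in Ioi R, K * Em 0 (-1) r := by
      refine norm_integral_le_of_norm_le (iE.mono_set hsub) ?_
      filter_upwards [ae_restrict_mem measurableSet_Ioi] with r hr using hK s ⟨hs.1.le, hs.2.le⟩ r (hR0.trans hr)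
    have j4 : |f R s * (sinh R ^ n * pr f R s)| ≤ C * C * Em 0 (-n) R := by
      obtain ⟨b1, b2⟩ := hb s hs' R hR0
      rw [abs_mul, abs_of_pos (h.sol.pos hR0 hs')]
      calc _ ≤ C * Em 0 (-n) R * C := by gcongr; exact (mul_pos hC (Em_pos hR0)).le
        _ = _ := by ring
    rw [Real.norm_eq_abs] at j3
    set X := ∫ r in Ioi R, pr f r s ^ 2 * sinh r ^ n
    rw [j1]
    have : -((p + 1) / p) * (If n (fun r t => pr f r t * pr f r t) R s + X) - (p + 1) / p *
      (f R s * (sinh R ^ n * pr f R s) - If n (fun r t => pr f r t * pr f r t) R s) =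
      -((p + 1) / p) * (X + f R s * (sinh R ^ n * pr f R s)) := by ring
    rw [this, abs_mul, abs_neg, abs_of_pos (by positivity)]
    refine lt_of_le_of_lt ?_ hR
    gcongr
    refine (abs_add_le _ _).trans (add_le_add (j3.trans ?_) j4)
    linarith
  · filter_upwards [eventually_gt_atTop 0] with R hR s hs' using (hs.smq (p+1)).If_t hR (hI s hs')
  · intro s hs
    exact intervalIntegral_tendsto_integral_Ioi 0 (h.i_ν (hI s hs)).2.2 tendsto_id

lemma Exs.M_T (h : Exs n p κ a T f) {r : ℝ} (hr : 0 < r) : Tendsto (fun t => Mf n p f r t) (𝓝[<] T) (𝓝 0) := by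
  obtain ⟨C, hC, hb⟩ := h.bd
  have hp := h.sol.p0
  have : Tendsto (fun t => ∫ s in (0:ℝ)..r, sinh s ^ n * f s t ^ p) (𝓝[<] T) (𝓝 (∫ s in (0:ℝ)..r, (0:ℝ))) := by
    refine intervalIntegral.tendsto_integral_filter_of_dominated_convergence (fun s => sinh s ^ n * C ^ p) ?_ ?_ ?_ ?_
    · filter_upwards [Ioo_mem_nhdsLT h.aT] with t ht
      exact ((h.sol.smq p).intS hr ht).aestronglyMeasurable.mono_measure (by rw [uIoc_of_le hr.le])
    · filter_upwards [Ioo_mem_nhdsLT h.aT] with t ht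
      refine Eventually.of_forall fun s hs => ?_
      rw [uIoc_of_le hr.le] at hs
      have h0 := h.sol.pos hs.1 ht
      have := pow_pos (sinh_pos hs.1) n
      rw [Real.norm_of_nonneg (by positivity)]
      gcongr
      refine (hb t ht s hs.1).1.trans ?_
      have := Em_le_one (A := 0) (D := -n) hs.1 le_rfl (by linarith [h.n1])
      nlinarith
    · exact ((continuous_sinh.pow n).mul continuous_const).intervalIntegrable _ _
    · refine Eventually.of_forall fun s hs => ?_
      rw [uIoc_of_le hr.le] at hs
      have := ((h.ext s hs.1).rpow_const (p := p) (Or.inr hp.le)).const_mul (sinh s ^ n)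
      simpa [zero_rpow hp.ne'] using this
  rw [intervalIntegral.integral_zero] at this
  exact this

lemma Exs.ν_T (h : Exs n p κ a T f) : Tendsto (νE n p f) (𝓝[<] T) (𝓝 0) := by
  obtain ⟨K, hK⟩ := h.b_ν
  have : Tendsto (νE n p f) (𝓝[<] T) (𝓝 (∫ r in Ioi (0:ℝ), (0:ℝ))) := by
    refine tendsto_integral_filter_of_dominated_convergence (fun r => K * Em 0 (-1) r) ?_ ?_ 
      ((Em_int (by norm_num) (by norm_num)).const_mul K) ?_
    · filter_upwards [Ioo_mem_nhdsLT h.aT] with t ht using (h.i_ν ht).1.aestronglyMeasurable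
    · filter_upwards [Ioo_mem_nhdsLT h.aT] with t ht
      filter_upwards [ae_restrict_mem measurableSet_Ioi] with r hr using (hK t ht r hr).1
    · filter_upwards [ae_restrict_mem measurableSet_Ioi] with r hr
      simpa using ((h.M_T hr).pow 2).mul_const (sinh r ^ n)⁻¹
  simpa using this

lemma Exs.f_inf (h : Exs n p κ a T f) {t : ℝ} (ht : t ∈ Ioo a T) : Tendsto (fun r => f r t) atTop (𝓝 0) := by
  obtain ⟨G, hG, hf⟩ := h.sol.dec
  refine squeeze_zero' ?_ ?_ hG
  · filter_upwards [eventually_gt_atTop 0] with r hr using (h.sol.pos hr ht).le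
  · filter_upwards [eventually_gt_atTop 0] with r hr using hf r hr t ht

lemma Exs.f_e (h : Exs n p κ a T f) {α e : ℝ} (hα : 0 < α) (hα' : (n:ℝ) - 1 ≤ α) {t : ℝ} (ht : t ∈ Ioo a T)
    (he : 0 < e) (hle : eE n f t ≤ e) {r : ℝ} (hr : 0 < r) : f r t ≤ √(e * (min α n)⁻¹) * Em (-(α / 2)) (-(n / 2)) r :=
  H1_decay h.sol.hn hα hα' (fun r hr => h.sol.sm.hr hr ht) (h.sol.sm.Pr.cont_r ht) (h.i_e ht) he hle
    (fun ε hε => ((h.f_inf ht).eventually_lt_const hε).frequently) hr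

lemma Exs.od (h : Exs n p κ a T f) : ∃ K, Od p κ a T K (yE n p f) (eE n f) (νE n p f) := by
  obtain ⟨α, a0, a1, a2, a3⟩ := alpha_exists h.sol.hn h.sol.hp h.sub
  have hp := h.sol.hp
  have hn := h.n1
  set g := (min α (n:ℝ))⁻¹ with hg
  have hg0 : 0 < g := inv_pos.2 (lt_min a0 (by linarith))
  have iE := Em_int (A := n + -((p + 1) * (α / 2))) (D := n + -((p + 1) * (n / 2))) (by linarith) (by nlinarith)
  have y0 : ∀ t ∈ Ioo a T, 0 < yE n p f t := fun t ht => ipos (h.i_ν ht).2.2 fun r hr =>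
    mul_pos (pow_pos (sinh_pos hr) n) (rpow_pos_of_pos (h.sol.pos hr ht) _)
  have ν0 : ∀ t ∈ Ioo a T, 0 < νE n p f t := fun t ht => ipos (h.i_ν ht).1 fun r hr =>
    mul_pos (pow_pos (h.sol.M0 hr ht) 2) (inv_pos.2 (pow_pos (sinh_pos hr) n))
  have cs : ∀ t ∈ Ioo a T, yE n p f t ^ 2 ≤ νE n p f t * eE n f t := fun t ht => by
    have hν := ν0 t ht
    have h1 : 0 ≤ eE n f t - 2 * (yE n p f t / νE n p f t) * yE n p f t + (yE n p f t / νE n p f t) ^ 2 * νE n p f t := by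
      rw [← (h.sq_int ht _).2]
      exact setIntegral_nonneg measurableSet_Ioi fun r hr => mul_nonneg (sq_nonneg _) (pow_pos (sinh_pos hr) n).le
    have h2 : eE n f t - 2 * (yE n p f t / νE n p f t) * yE n p f t + (yE n p f t / νE n p f t) ^ 2 * νE n p f t =
      eE n f t - yE n p f t ^ 2 / νE n p f t := by field_simp; ring
    rw [h2, sub_nonneg, div_le_iff₀ hν] at h1
    linarith
  refine ⟨g ^ ((p + 1) / 2) * ∫ r in Ioi (0:ℝ), Em (n + -((p + 1) * (α / 2))) (n + -((p + 1) * (n / 2))) r,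
    hp, h.hκ, h.aT, mul_pos (by positivity) (ipos iE fun r hr => Em_pos hr), fun t ht => h.ν_d ht, fun t ht => h.y_d ht,
    y0, ν0, cs, h.ν_T, fun t ht => ?_⟩
  have e0 : 0 < eE n f t := pos_of_mul_pos_right (lt_of_lt_of_le (pow_pos (y0 t ht) 2) (cs t ht)) (ν0 t ht).le
  have hb : ∀ r > 0, sinh r ^ n * f r t ^ (p + 1) ≤ (eE n f t * g) ^ ((p + 1) / 2) *
      Em (n + -((p + 1) * (α / 2))) (n + -((p + 1) * (n / 2))) r := fun r hr => by
    refine S_Em hr ((rpow_le_rpow (h.sol.pos hr ht).le (h.f_e a0 a1 ht e0 le_rfl hr) (by linarith)).trans_eq ?_)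
    rw [mul_rpow (Real.sqrt_nonneg _) (Em_pos hr).le, Em_rpow hr, Real.sqrt_eq_rpow, ← rpow_mul (by positivity)]
    congr 2 <;> ring
  rw [yE]
  calc _ ≤ ∫ r in Ioi (0:ℝ), (eE n f t * g) ^ ((p + 1) / 2) * Em (n + -((p + 1) * (α / 2))) (n + -((p + 1) * (n / 2))) r :=
        setIntegral_mono_on (h.i_ν ht).2.2 (iE.const_mul _) measurableSet_Ioi hb
    _ = _ := by rw [integral_const_mul, mul_rpow e0.le hg0.le]; ring

end

lemma Em_lim' {A D : ℝ} (hA : 0 ≤ A) (hD : D < 0) : Tendsto (fun r => Em (-A) D r) atTop (𝓝 0) := by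
  have h1 : MonotoneOn Tn (Ioi 0) := mono_Ioi (fun r _ => Tn_deriv r) fun r _ => by positivity
  have h2 := (Em_lim hD).const_mul (Tn 1 ^ (-A))
  rw [mul_zero] at h2
  refine squeeze_zero' ?_ ?_ h2
  · filter_upwards [eventually_gt_atTop 0] with r hr using (Em_pos hr).le
  · filter_upwards [eventually_gt_atTop 1] with r hr
    have hr0 : 0 < r := by linarith
    rw [Em, Em, rpow_zero, one_mul]
    have := rpow_le_rpow_of_nonpos (Tn_pos one_pos) (h1 (by norm_num : (1:ℝ) ∈ Ioi 0) hr0 hr.le) (neg_nonpos.2 hA)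
    have := rpow_nonneg (cosh_pos r).le D
    gcongr

lemma Sol.mono {n : ℕ} {p a b a' : ℝ} {f : ℝ → ℝ → ℝ} (h : Sol n p a b f) (h1 : a ≤ a') : Sol n p a' b f := by
  have hI : ∀ t ∈ Ioo a' b, t ∈ Ioo a b := fun t ht => ⟨h1.trans_lt ht.1, ht.2⟩
  obtain ⟨s1, s2, s3, s4, s5, ⟨G, s6, s7⟩⟩ := h
  exact ⟨s1, s2, s3.mono (prod_mono subset_rfl hI), fun r hr t ht => s4 r hr t (hI t ht),
    fun r hr t ht => s5 r hr t (hI t ht), ⟨G, s6, fun r hr t ht => s7 r hr t (hI t ht)⟩⟩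

lemma exs_of {n : ℕ} (hn : 1 ≤ n) {m T : ℝ} (hm : ((n:ℝ) - 1) / (n + 3) < m) (hm1 : m < 1) (hT : 0 < T)
    {u : ℝ → ℝ → ℝ} (h : IsRadialEnergySolution (n + 1) m T u) :
    ∃ a > 0, Exs n (1 / m) (m / (1 - m)) a T (fun r t => u r t ^ m) := by
  have hn1 : (1:ℝ) ≤ n := by exact_mod_cast hn
  have hm0 : 0 < m := lt_of_le_of_lt (div_nonneg (by linarith) (by linarith)) hm
  have hm2 : 0 < 1 - m := by linarith
  have hp : 1 < 1 / m := by rw [lt_div_iff₀ hm0]; linarith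
  have hκ : (1 / m - 1) * (m / (1 - m)) = 1 := by field_simp
  have sub : 1 / m * (n - 1) < n + 3 := by
    rw [div_lt_iff₀ (by linarith)] at hm
    rw [one_div, inv_mul_lt_iff₀ hm0]; linarith
  set f : ℝ → ℝ → ℝ := fun r t => u r t ^ m with hf
  set p := 1 / m with hpp
  set κ := m / (1 - m)
  obtain ⟨α, a0, a1, a2, a3⟩ := alpha_exists hn hp sub
  have hT2 : T / 2 ∈ Ioo 0 T := ⟨by linarith, by linarith⟩
  obtain ⟨C, hC⟩ := h.energy_bdd (T / 2) hT2
  have hI : ∀ t ∈ Ioo (T / 2) T, t ∈ Ioo 0 T := fun t ht => ⟨by linarith [ht.1], ht.2⟩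
  have sm0 : ContDiffOn ℝ ∞ (fun q : ℝ × ℝ => f q.1 q.2) (Ici 0 ×ˢ Ioo (T / 2) T) := by
    refine (h.smooth.mono (prod_mono subset_rfl hI)).rpow_const_of_ne fun q hq => (h.pos q.1 hq.1 q.2 (hI _ hq.2)).ne'
  have smf : Sm (T / 2) T f := ⟨_, sm0, fun r _ t _ => rfl⟩
  have key : ∃ K1 > 0, ∀ t ∈ Ioo (T / 2) T, ∀ r > 0, f r t ≤ K1 * Em (-(α / 2)) (-(n / 2)) r := by
    refine ⟨√((|C| + 1) * (min α n)⁻¹), sqrt_pos.2 (mul_pos (by positivity) (inv_pos.2 (lt_min a0 (by linarith)))), fun t ht r hr => ?_⟩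
    obtain ⟨e1, e2, e3⟩ := h.energy t (hI t ht)
    have e4 := hC t ⟨ht.1.le, ht.2⟩
    rw [H1normSq] at e4
    simp only [Nat.add_sub_cancel] at e2 e3 e4
    have e5 : 0 ≤ ∫ s in Ioi (0:ℝ), (u s t ^ m) ^ 2 * sinh s ^ n :=
      setIntegral_nonneg measurableSet_Ioi fun r hr => mul_nonneg (sq_nonneg _) (pow_pos (sinh_pos hr) n).le
    exact H1_decay hn a0 a1 (fun r hr => smf.hr hr ht) (smf.Pr.cont_r ht) e3 (by positivity)
      (by have := le_abs_self C; simp only [pr, hf]; linarith) (freq_small e2) hr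
  obtain ⟨K1, hK1, key⟩ := key
  have sol : Sol n p (T / 2) T f := by
    refine ⟨hn, hp, sm0, fun r hr t ht => rpow_pos_of_pos (h.pos r hr t (hI t ht)) _, fun r hr t ht => ?_,
      ⟨fun r => K1 * Em (-(α / 2)) (-(n / 2)) r, by simpa using (Em_lim' (A := α / 2) (D := -(n/2)) (by linarith) (by linarith)).const_mul K1, fun r hr t ht => key t ht r hr⟩⟩
    have := h.pde r hr t (hI t ht)
    push_cast at this
    rw [add_sub_cancel_right] at this
    refine Eq.trans ?_ this
    refine EventuallyEq.deriv_eq ?_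
    filter_upwards [isOpen_Ioo.mem_nhds ht] with τ hτ
    simp only [hf]
    rw [← rpow_mul (h.pos r hr.le τ (hI τ hτ)).le, hpp, mul_one_div_cancel hm0.ne', rpow_one]
  set s := T / 8 with hs
  have hs0 : 0 < s := by positivity
  have hsκ : 0 < s ^ κ := rpow_pos_of_pos hs0 _
  obtain ⟨K', hK', it⟩ := sol.iter hκ (a0 := α / 2) (D0 := n / 2) (by linarith) (by linarith) (by linarith)
    (by linarith) (by linarith) (K1 / s ^ κ) (by positivity)
  obtain ⟨c, hc, fl⟩ := sol.flux_bd hκ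
  have up : ∀ t ∈ Ioo (T * (3/4)) T, ∀ r > 0, f r t ≤ K' * s ^ κ * Em 0 (-n) r := fun t ht r hr => by
    have := it (t - s) ⟨by linarith [ht.1], by linarith [ht.2]⟩ s hs0 (by linarith [ht.2]) (fun t' ht' r hr => by
      rw [div_mul_cancel₀ _ hsκ.ne']
      exact key t' ⟨by linarith [ht'.1, ht.1], by linarith [ht'.2, ht.2]⟩ r hr) r hr
    rwa [sub_add_cancel] at this
  refine ⟨T * (3/4), by positivity, sol.mono (by linarith), hκ, by linarith, sub,
    ⟨K' * s ^ κ + c * ((K' * s ^ κ) ^ p / s + K' * s ^ κ), by positivity, fun t ht r hr => ⟨?_, ?_⟩⟩, fun r hr => ?_⟩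
  · refine (up t ht r hr).trans ?_
    have := Em_pos' n hr
    gcongr
    have : 0 ≤ c * ((K' * s ^ κ) ^ p / s + K' * s ^ κ) := by positivity
    linarith
  · refine (fl (t - s) ⟨by linarith [ht.1], by linarith [ht.2]⟩ t ⟨by linarith, ht.2⟩ (K' * s ^ κ) (by positivity) (up t ht) r hr).trans ?_
    rw [sub_sub_cancel]
    have : 0 ≤ K' * s ^ κ := by positivity
    linarith
  · have h1 := h.continuousOn (r, T) ⟨hr.le, hT.le, le_rfl⟩
    have h2 : Tendsto (fun t => (r, t)) (𝓝[<] T) (𝓝[Ici 0 ×ˢ Icc 0 T] (r, T)) := by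
      refine tendsto_nhdsWithin_of_tendsto_nhds_of_eventually_within _ ?_ ?_
      · exact ((Continuous.prodMk_right r).tendsto T).mono_left nhdsWithin_le_nhds
      · filter_upwards [Ioo_mem_nhdsLT hT] with t ht using ⟨hr.le, ht.1.le, ht.2.le⟩
    have h3 := (h1.tendsto.comp h2).rpow_const (p := m) (Or.inr hm0.le)
    simpa [h.extinction r hr.le, zero_rpow hm0.ne'] using h3

section
variable {n : ℕ} {p a T κ : ℝ} {f : ℝ → ℝ → ℝ}

lemma Exs.pκ (h : Exs n p κ a T f) : p * κ = κ + 1 := by linarith [h.hκ]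

lemma Exs.sharp (h : Exs n p κ a T f) : ∃ t1 ∈ Ioo a T, ∃ C > 0, ∀ t ∈ Ioo t1 T, ∀ r > 0,
    f r t ≤ C * (T - t) ^ κ * Em 0 (-n) r ∧ |sinh r ^ n * pr f r t| ≤ C * (T - t) ^ κ ∧
    Mf n p f r t ≤ C * (T - t) ^ (p * κ) * Em (n + 1) 0 r := by
  obtain ⟨K, od⟩ := h.od
  obtain ⟨t1, ht1, -, -, C, hC, -, -, hE, -⟩ := od.main
  obtain ⟨α, a0, a1, a2, a3⟩ := alpha_exists h.sol.hn h.sol.hp h.sub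
  have hn := h.n1
  have hκ := h.hκ
  have hp := h.sol.hp
  have κ0 := h.sol.κ0 hκ
  set g := (min α (n:ℝ))⁻¹ with hg
  have hg0 : 0 < g := inv_pos.2 (lt_min a0 (by linarith))
  set K1 := √(C * 3 ^ ((p + 1) * κ) * g) with hK1
  have hK10 : 0 < K1 := by positivity
  obtain ⟨K', hK', it⟩ := h.sol.iter hκ (a0 := α / 2) (D0 := n / 2) (by linarith) (by linarith) (by linarith)
    (by linarith) (by linarith) (2 ^ κ * K1) (by positivity)
  obtain ⟨c, hc, fl⟩ := h.sol.flux_bd hκ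
  obtain ⟨c', hc', ms⟩ := h.sol.mass_le
  have hl : (T - t1) / 5 > 0 := by linarith [ht1.2]
  have up : ∀ t ∈ Ioo (T - (T - t1) / 5) T, ∀ r > 0, f r t ≤ (K' * 2 ^ κ * (T - t) ^ κ) * Em 0 (-n) r := fun t ht r hr => by
    set ℓ := T - t with hℓ
    have hℓ0 : 0 < ℓ := by linarith [ht.2]
    have hℓ1 : ℓ < (T - t1) / 5 := by linarith [ht.1]
    have ta := ht1.1
    obtain ⟨ξ, hξ, he⟩ := hE (T - 3 * ℓ) (T - 2 * ℓ) (by linarith) (by linarith) (by linarith)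
    have ξI : ξ ∈ Ioo a T := ⟨by linarith [hξ.1], by linarith [hξ.2]⟩
    have he' : eE n f ξ ≤ C * 3 ^ ((p + 1) * κ) * ℓ ^ (2 * κ) := by
      rw [show T - 2 * ℓ - (T - 3 * ℓ) = ℓ by ring, show T - (T - 3 * ℓ) = 3 * ℓ by ring,
        mul_rpow (by norm_num) hℓ0.le, show (p + 1) * κ = 2 * κ + 1 by linarith, rpow_add_one hℓ0.ne'] at he
      rw [show (p + 1) * κ = 2 * κ + 1 by linarith]
      refine le_of_mul_le_mul_right (he.trans_eq ?_) hℓ0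
      ring
    have e0 : 0 < C * 3 ^ ((p + 1) * κ) * ℓ ^ (2 * κ) := by positivity
    have fξ : ∀ r > 0, f r ξ ≤ K1 * ℓ ^ κ * Em (-(α / 2)) (-(n / 2)) r := fun r hr => by
      refine (h.f_e a0 a1 ξI e0 he' hr).trans_eq ?_
      congr 1
      rw [show C * 3 ^ ((p + 1) * κ) * ℓ ^ (2 * κ) * (min α (n:ℝ))⁻¹ = (C * 3 ^ ((p + 1) * κ) * g) * (ℓ ^ κ) ^ 2 by
        rw [← rpow_natCast (ℓ ^ κ), ← rpow_mul hℓ0.le, mul_comm κ]; push_cast; ring]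
      rw [sqrt_mul (by positivity), sqrt_sq (by positivity)]
    have hs : ℓ < T - ℓ - ξ := by linarith [hξ.2]
    have hs2 : T - ℓ - ξ < 2 * ℓ := by linarith [hξ.1]
    have := it ξ ξI (T - ℓ - ξ) (by linarith) (by linarith) (fun t' ht' r hr => ?_) r hr
    · rw [show ξ + (T - ℓ - ξ) = t by simp [hℓ]] at this
      refine this.trans ?_
      have := Em_pos' n hr
      rw [mul_assoc K' (2 ^ κ), ← mul_rpow (by norm_num) hℓ0.le]
      gcongr; linarith
    · refine (h.sol.bc2 hκ hr (t0 := ξ - 2 * ℓ) (t1 := ξ) ⟨by linarith [hξ.1], by linarith [ξI.2]⟩ (by linarith) ht'.1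
        (by linarith [ht'.2]) (by linarith [ht'.2])).trans ?_
      rw [mul_assoc (2 ^ κ), mul_assoc (2 ^ κ)]
      have := Em_pos (A := -(α / 2)) (D := -(n/2)) hr
      gcongr
      refine (fξ r hr).trans ?_
      gcongr
  set K2 := K' * 2 ^ κ
  have hK2 : 0 < K2 := by positivity
  refine ⟨T - (T - t1) / 5, ⟨by linarith [ht1.1], by linarith⟩, K2 + c * (K2 ^ p + K2) + c' * K2 ^ p, by positivity,
    fun t ht r hr => ?_⟩
  have hℓ0 : 0 < T - t := by linarith [ht.2]
  have ℓκ : 0 < (T - t) ^ κ := by positivity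
  have tI : t ∈ Ioo a T := ⟨by linarith [ht1.1, ht.1], ht.2⟩
  have q1 : 0 ≤ c * (K2 ^ p + K2) := by positivity
  have q2 : 0 ≤ c' * K2 ^ p := by positivity
  have e1 : (K2 * (T - t) ^ κ) ^ p = K2 ^ p * (T - t) ^ (p * κ) := by
    rw [mul_rpow hK2.le ℓκ.le, ← rpow_mul hℓ0.le, mul_comm κ]
  refine ⟨(up t ht r hr).trans ?_, ?_, ?_⟩
  · have := Em_pos' n hr
    gcongr; linarith
  · refine (fl (t - (T - t)) ⟨by linarith [ht.1, ht1.1], by linarith [ht.2]⟩ t ⟨by linarith, ht.2⟩ (K2 * (T - t) ^ κ) (by positivity) (up t ht) r hr).trans ?_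
    rw [sub_sub_cancel, e1, h.pκ, rpow_add_one hℓ0.ne', ← mul_assoc, mul_div_cancel_right₀ _ hℓ0.ne', ← add_mul, ← mul_assoc]
    gcongr; linarith
  · refine (ms t tI (K2 * (T - t) ^ κ) (by positivity) (up t ht) r hr).trans ?_
    rw [e1, ← mul_assoc]
    have := Em_pos (A := n + 1) (D := 0) hr
    gcongr; linarith
end

structure Prof (n : ℕ) (p c : ℝ) (v M : ℝ → ℝ) : Prop where
  hn : 1 ≤ n
  hp : 1 < p
  hc : 0 < c
  sub : p * (n - 1) < n + 3
  pos : ∀ r > 0, 0 < v r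
  hv : ∀ r > 0, HasDerivAt v (-(c * (M r * (sinh r ^ n)⁻¹))) r
  hM : ∀ r > 0, HasDerivAt M (sinh r ^ n * v r ^ p) r
  bd : ∃ C > 0, ∀ r > 0, v r ≤ C * Em 0 (-n) r ∧ 0 < M r ∧ M r ≤ C * Em (n + 1) 0 r

lemma smono {F F' : ℝ → ℝ} {s : Set ℝ} (hs : Convex ℝ s) (h : ∀ r ∈ s, HasDerivAt F (F' r) r)
    (h0 : ∀ r ∈ interior s, 0 < F' r) : StrictMonoOn F s :=
  strictMonoOn_of_deriv_pos hs (fun r hr => (h r hr).continuousAt.continuousWithinAt)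
    fun r hr => by rw [(h r (interior_subset hr)).deriv]; exact h0 r hr

lemma lim_inf_of {F : ℝ → ℝ} {K A D : ℝ} (hA : -2 ≤ A) (hD : D < 0) (h : ∀ r > 0, |F r| ≤ K * Em A D r) :
    Tendsto F atTop (𝓝 0) := by
  have h1 := (Em_lim' (A := 2) (by norm_num) hD).const_mul |K|
  rw [mul_zero] at h1
  refine squeeze_zero_norm' ?_ h1
  filter_upwards [eventually_gt_atTop 0] with r hr
  refine (h r hr).trans ?_
  have := Em_pos (A := A) (D := D) hr
  exact mul_le_mul (le_abs_self K) (Em_le hr hA le_rfl) this.le (abs_nonneg _)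

lemma lim_zero_of {F : ℝ → ℝ} {K A D : ℝ} (hA : 0 < A) (hD : D < 0) (h : ∀ r > 0, |F r| ≤ K * Em A D r) :
    Tendsto F (𝓝[>] 0) (𝓝 0) := by
  have h1 : Tendsto (fun r => |K| * Tn r ^ A) (𝓝[>] 0) (𝓝 (|K| * 0)) := by
    refine Tendsto.const_mul _ ?_
    have := (Tn_cont.tendsto 0).rpow_const (p := A) (Or.inr hA.le)
    rw [show Tn 0 = 0 by simp [Tn], zero_rpow hA.ne'] at this
    exact this.mono_left nhdsWithin_le_nhds
  rw [mul_zero] at h1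
  refine squeeze_zero_norm' ?_ h1
  filter_upwards [self_mem_nhdsWithin] with r hr
  refine (h r hr).trans ?_
  have := Em_pos (A := A) (D := D) hr
  refine mul_le_mul (le_abs_self K) ((Em_le hr le_rfl hD.le).trans ?_) this.le (abs_nonneg _)
  rw [Em, rpow_zero, mul_one]

section
variable {n : ℕ} {p c : ℝ} {v M v1 M1 v2 M2 : ℝ → ℝ}

lemma Prof.n1 (h : Prof n p c v M) : (1:ℝ) ≤ n := by exact_mod_cast h.hn

noncomputable def wv (n : ℕ) (c : ℝ) (M : ℝ → ℝ) (r : ℝ) : ℝ := -(c * (M r * (sinh r ^ n)⁻¹))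

lemma Prof.hw (h : Prof n p c v M) {r : ℝ} (hr : 0 < r) :
    HasDerivAt (wv n c M) (-(n * (cosh r / sinh r) * wv n c M r) - c * v r ^ p) r := by
  have hS := sinh_pos hr
  refine (((h.hM r hr).mul (((hasDerivAt_sinh r).pow n).inv (pow_pos hS n).ne')).const_mul c).neg.congr_deriv ?_
  obtain ⟨k, rfl⟩ : ∃ k, n = k + 1 := ⟨n - 1, by have := h.hn; omega⟩
  simp only [wv, Pi.inv_apply, Pi.pow_apply]
  rw [Nat.add_sub_cancel]
  field_simp
  ring

lemma Prof.w_bd (h : Prof n p c v M) : ∃ C > 0, ∀ r > 0, |wv n c M r| ≤ C * Em 1 (-n) r ∧ v r ≤ C * Em 0 (-n) r := by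
  obtain ⟨C, hC, hb⟩ := h.bd
  have hc := h.hc
  refine ⟨c * C + C, by positivity, fun r hr => ?_⟩
  obtain ⟨b1, b2, b3⟩ := hb r hr
  have e := Em_pos (A := 1) (D := -n) hr
  have e' := Em_pos' n hr
  constructor
  · have hS := pow_pos (sinh_pos hr) n
    rw [wv, abs_neg, abs_of_pos (by positivity), ← Em_S' hr]
    calc c * (M r * Em (-n) (-n) r) ≤ c * (C * Em (n+1) 0 r * Em (-n) (-n) r) := by
          have := Em_pos (A := -n) (D := -n) hr
          gcongr
      _ = c * C * Em 1 (-n) r := by rw [mul_assoc C, Em_mul hr]; ring_nf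
      _ ≤ _ := by gcongr; linarith
  · refine b1.trans ?_
    gcongr
    nlinarith

lemma Prof.v_lo (h : Prof n p c v M) : ∃ l > 0, ∀ r > 0, l * Em 0 (-n) r ≤ v r := by
  obtain ⟨C, hC, hb⟩ := h.bd
  have hn := h.n1
  have hc := h.hc
  set l := c * M 1 / n with hl
  have M1 := (hb 1 one_pos).2.1
  have l0 : 0 < l := by positivity
  have Mm : MonotoneOn M (Ioi 0) := mono_Ioi h.hM fun r hr =>
    mul_nonneg (pow_pos (sinh_pos hr) n).le (rpow_nonneg (h.pos r hr).le _)
  have va : AntitoneOn v (Ioi 0) := by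
    have := mono_Ioi (F := fun r => - v r) (fun r hr => (h.hv r hr).neg) (c := 0) fun r hr => by
      have := (hb r hr).2.1
      have := sinh_pos hr
      rw [neg_neg]; positivity
    intro x hx y hy hxy
    linarith [this hx hy hxy]
  have hm : MonotoneOn (fun r => l * Em 0 (-n) r - v r) (Ioi 1) := by
    refine mono_Ioi (fun r hr => ((Em_deriv (by linarith)).const_mul l).sub (h.hv r (by linarith))) fun r hr => ?_
    have hr0 : 0 < r := by linarith
    have e1 : Em (0 - 1) (-n) r * Tn r ^ 2 = Em 1 (-n) r := by
      have : Tn r ^ 2 = Em 2 0 r := by rw [Em, rpow_zero, mul_one]; norm_cast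
      rw [this, Em_mul hr0]; norm_num
    have e2 := Em_le (A := 1) (D := -n) (A' := -n) (D' := -n) hr0 (by linarith) le_rfl
    have e3 : M 1 ≤ M r := Mm (by norm_num : (1:ℝ) ∈ Ioi 0) hr0 hr.le
    have e4 : l * n = c * M 1 := by rw [hl]; field_simp
    have e5 : c * M 1 * Em 1 (-n) r ≤ c * (M r * (sinh r ^ n)⁻¹) := by
      rw [← Em_S' hr0, mul_assoc]
      have := Em_pos (A := 1) (D := -n) hr0
      have := M1.le.trans e3
      gcongr
    have : l * (Em (0 - 1) (-n) r * (0 * (cosh r ^ 2)⁻¹ + -n * Tn r ^ 2)) = - (l * n * (Em (0 - 1) (-n) r * Tn r ^ 2)) := by ring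
    rw [this, e1, e4]; linarith
  have v0 : Tendsto v atTop (𝓝 0) := lim_inf_of (A := 0) (D := -n) (K := C) (by norm_num) (by linarith) fun r hr => by
    rw [abs_of_pos (h.pos r hr)]; exact (hb r hr).1
  have hlim : Tendsto (fun r => l * Em 0 (-n) r - v r) atTop (𝓝 (l * 0 - 0)) := ((Em_lim (by linarith)).const_mul l).sub v0
  rw [mul_zero, sub_zero] at hlim
  have big : ∀ r > 1, l * Em 0 (-n) r ≤ v r := fun r hr => by linarith [mono_le_lim hm hlim hr]
  have e0 := Em_pos' n two_pos
  have e1 := Em_le_one (A := 0) (D := -n) two_pos le_rfl (by linarith)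
  refine ⟨l * Em 0 (-n) 2, by positivity, fun r hr => ?_⟩
  have e2 := Em_pos' n hr
  rcases lt_or_ge 1 r with h1 | h1
  · refine le_trans ?_ (big r h1)
    gcongr
    exact mul_le_of_le_one_right l0.le e1
  · refine le_trans ?_ ((big 2 (by norm_num)).trans (va hr (by norm_num : (2:ℝ) ∈ Ioi 0) (by linarith)))
    exact mul_le_of_le_one_right (by positivity) (Em_le_one hr le_rfl (by linarith))

noncomputable def Pz (γ α k1 k2 p c : ℝ) (v w : ℝ → ℝ) (r : ℝ) : ℝ :=
  sinh r ^ γ * (1 / 2 * w r ^ 2 + α * (cosh r / sinh r * (v r * w r)) +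
    (k1 + k2 * (sinh r ^ 2)⁻¹) * v r ^ 2 + c / (p + 1) * v r ^ (p + 1))

lemma Prof.Pz_d (h : Prof n p c v M) {γ α k1 k2 r : ℝ} (h1 : γ = 2 * n - 2 * α) (h2 : γ = α * (p + 1))
    (h3 : k1 = - α * (γ - n) / 2) (h4 : k2 = α * (n + 1 - γ) / 2) (hr : 0 < r) :
    HasDerivAt (Pz γ α k1 k2 p c v (wv n c M))
      (cosh r / sinh r * (sinh r ^ γ * (sinh r ^ 2)⁻¹) * (γ * k1 * sinh r ^ 2 + (γ - 2) * k2) * v r ^ 2) r := by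
  have hS := sinh_pos hr
  have hv := h.pos r hr
  have hp : 0 < p := by linarith [h.hp]
  have dv : HasDerivAt v (wv n c M r) r := h.hv r hr
  have dw := h.hw hr
  have dS := hasDerivAt_sinh r
  have dC := hasDerivAt_cosh r
  have d1 := ((dw.pow 2).const_mul (1/2)).add (((dC.div dS hS.ne').mul (dv.mul dw)).const_mul α)
  have d2 := ((((dS.pow 2).inv (pow_pos hS 2).ne').const_mul k2).const_add k1).mul (dv.pow 2)
  have d3 := (dv.rpow_const (p := p + 1) (Or.inl hv.ne')).const_mul (c / (p + 1))
  refine ((dS.rpow_const (p := γ) (Or.inl hS.ne')).mul ((d1.add d2).add d3)).congr_deriv ?_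
  simp only [Pi.add_apply, Pi.mul_apply, Pi.pow_apply, Pi.inv_apply, Pi.div_apply]
  rw [rpow_sub_one hS.ne', show p + 1 - 1 = p by ring, rpow_add_one hv.ne']
  have hC : cosh r ^ 2 = sinh r ^ 2 + 1 := cosh_sq r
  generalize wv n c M r = w
  generalize v r ^ p = y
  generalize sinh r ^ γ = z
  generalize v r = x
  generalize sinh r = S at *
  generalize cosh r = C at *
  obtain ⟨d, hd⟩ : ∃ d, d = c / (p + 1) := ⟨_, rfl⟩
  have hc : c = d * (p + 1) := by rw [hd]; field_simp
  rw [← hd, hc]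
  have hnn : (n:ℝ) = α * (p + 3) / 2 := by linarith
  rw [h3, h4, hnn, h2]
  rw [← sub_eq_zero]
  trans (z * x * w * α * (α * (p + 1) - 1 - α * (p + 3) / 2) / S ^ 2 * (C ^ 2 - (S ^ 2 + 1)))
  · field_simp
    ring
  · rw [hC]; ring

lemma S_rp {γ r : ℝ} (hr : 0 < r) : sinh r ^ γ = Em γ γ r := by
  rw [Em, ← mul_rpow (Tn_pos hr).le (cosh_pos r).le, Tn_mul]

lemma Prof.Pz0_bd (h : Prof n p c v M) (γ α : ℝ) : ∃ K > 0, ∀ r > 0, |Pz γ α 0 0 p c v (wv n c M) r| ≤ K * Em γ (γ - 2 * n) r ∧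
    v r ^ 2 ≤ K * Em 0 (-2 * n) r := by
  obtain ⟨C, hC, hb⟩ := h.w_bd
  have hp := h.hp
  have hc := h.hc
  have hn := h.n1
  refine ⟨1 / 2 * C ^ 2 + |α| * C ^ 2 + c / (p + 1) * (C ^ (p - 1) * C ^ 2) + C ^ 2, by positivity, fun r hr => ?_⟩
  obtain ⟨b1, b2⟩ := hb r hr
  have v0 := h.pos r hr
  have e0 := Em_pos' n hr
  have e1 := Em_pos (A := 1) (D := -n) hr
  have eγ := Em_pos (A := γ) (D := γ) hr
  have eE := Em_pos (A := 0) (D := -2 * n) hr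
  set w := wv n c M r with hw
  have q0 : Em 0 (-n) r * Em 0 (-n) r = Em 0 (-2 * n) r := by rw [Em_mul hr]; ring_nf
  have q1 : Em 1 (-n) r * Em 1 (-n) r ≤ Em 0 (-2 * n) r := by rw [Em_mul hr]; exact Em_le hr (by norm_num) (by linarith)
  have q2 : cosh r / sinh r * (Em 0 (-n) r * Em 1 (-n) r) = Em 0 (-2 * n) r := by
    have : cosh r / sinh r = Em (-1) 0 r := by
      rw [Em, rpow_zero, mul_one, rpow_neg_one, Tn, inv_div]
    rw [this, Em_mul hr, Em_mul hr]; ring_nf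
  have hv2 : v r ^ 2 ≤ C ^ 2 * Em 0 (-2 * n) r := by
    calc v r ^ 2 ≤ (C * Em 0 (-n) r) ^ 2 := by gcongr
      _ = _ := by rw [← q0]; ring
  have hw2 : w ^ 2 ≤ C ^ 2 * Em 0 (-2 * n) r := by
    rw [← sq_abs]
    calc |w| ^ 2 ≤ (C * Em 1 (-n) r) ^ 2 := by gcongr
      _ = C ^ 2 * (Em 1 (-n) r * Em 1 (-n) r) := by ring
      _ ≤ _ := by gcongr
  have hcs : 0 < cosh r / sinh r := div_pos (cosh_pos r) (sinh_pos hr)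
  have hvw : |α * (cosh r / sinh r * (v r * w))| ≤ |α| * C ^ 2 * Em 0 (-2 * n) r := by
    rw [abs_mul, abs_mul, abs_mul, abs_of_pos hcs, abs_of_pos v0, ← q2, mul_assoc]
    calc _ ≤ |α| * (cosh r / sinh r * (C * Em 0 (-n) r * (C * Em 1 (-n) r))) := by gcongr
      _ = _ := by ring
  have hvp : v r ^ (p + 1) ≤ C ^ (p - 1) * C ^ 2 * Em 0 (-2 * n) r := by
    rw [show p + 1 = (p - 1) + 2 by ring, rpow_add v0, mul_assoc]
    have : v r ≤ C := b2.trans (mul_le_of_le_one_right hC.le (Em_le_one hr le_rfl (by linarith)))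
    have h3 : v r ^ (2:ℝ) = v r ^ 2 := by norm_cast
    rw [h3]
    gcongr
  constructor
  swap
  · refine hv2.trans ?_
    gcongr
    have : 0 ≤ 1 / 2 * C ^ 2 + |α| * C ^ 2 + c / (p + 1) * (C ^ (p - 1) * C ^ 2) := by positivity
    linarith
  · rw [Pz, S_rp hr, abs_mul, abs_of_pos eγ]
    have hsp : Em γ (γ - 2 * n) r = Em γ γ r * Em 0 (-2 * n) r := by rw [Em_mul hr]; ring_nf
    rw [hsp]
    refine (mul_mono_l (?_ : _ ≤ (1 / 2 * C ^ 2 + |α| * C ^ 2 + c / (p + 1) * (C ^ (p - 1) * C ^ 2) + C ^ 2) * Em 0 (-2 * n) r) eγ.le).trans (le_of_eq (by ring))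
    rw [zero_mul, add_zero, zero_mul, add_zero]
    have vp0 : 0 ≤ v r ^ (p + 1) := by positivity
    have cp : 0 < c / (p + 1) := by positivity
    have t3 : c / (p + 1) * v r ^ (p + 1) ≤ c / (p + 1) * (C ^ (p - 1) * C ^ 2 * Em 0 (-2 * n) r) := by gcongr
    have t4 : 0 ≤ c / (p + 1) * v r ^ (p + 1) := by positivity
    have t5 : 0 < C ^ 2 * Em 0 (-2 * n) r := by positivity
    rw [abs_le] at hvw ⊢
    constructor <;> nlinarith [hvw.1, hvw.2, sq_nonneg w]

lemma Pz_split {γ α k1 k2 p c r : ℝ} {v w : ℝ → ℝ} : Pz γ α k1 k2 p c v w r =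
    Pz γ α 0 0 p c v w r + sinh r ^ γ * (k1 + k2 * (sinh r ^ 2)⁻¹) * v r ^ 2 := by
  simp only [Pz]; ring

lemma Prof.Pz_bd (h : Prof n p c v M) (γ α k1 k2 : ℝ) :
    ∃ K, ∀ r > 0, |Pz γ α k1 k2 p c v (wv n c M) r| ≤ K * Em (γ - 2) (γ - 2 * n) r := by
  obtain ⟨K, hK, hb⟩ := h.Pz0_bd γ α
  refine ⟨K + (|k1| + |k2|) * K, fun r hr => ?_⟩
  obtain ⟨b1, b2⟩ := hb r hr
  rw [Pz_split]
  refine (abs_add_le _ _).trans ?_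
  rw [add_mul]
  have eγ := Em_pos (A := γ) (D := γ) hr
  refine add_le_add (b1.trans ?_) ?_
  · gcongr; exact Em_le hr (by linarith) le_rfl
  · rw [abs_mul, abs_mul, S_rp hr, abs_of_pos eγ, abs_of_nonneg (sq_nonneg (v r))]
    have e2 : (sinh r ^ 2)⁻¹ = Em (-2) (-2) r := by have := Em_S' (n := 2) hr; push_cast at this; rw [this]
    have e3 : |k1 + k2 * (sinh r ^ 2)⁻¹| ≤ (|k1| + |k2|) * Em (-2) 0 r := by
      have i1 : 1 ≤ Em (-2) 0 r := by
        have := Em_le (A := 0) (D := 0) (A' := -2) (D' := 0) hr (by norm_num) le_rfl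
        simpa [Em] using this
      have i2 : Em (-2) (-2) r ≤ Em (-2) 0 r := Em_le hr le_rfl (by norm_num)
      refine (abs_add_le _ _).trans ?_
      rw [abs_mul, e2, abs_of_pos (Em_pos hr), add_mul]
      gcongr
      exact le_mul_of_one_le_right (abs_nonneg _) i1
    have e4 := Em_pos (A := -2) (D := 0) hr
    calc _ ≤ Em γ γ r * ((|k1| + |k2|) * Em (-2) 0 r) * (K * Em 0 (-2 * n) r) := by gcongr
      _ = (|k1| + |k2|) * K * (Em γ γ r * Em (-2) 0 r * Em 0 (-2 * n) r) := by ring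
      _ = _ := by rw [Em_mul hr, Em_mul hr]; ring_nf

lemma params {n : ℕ} {p : ℝ} (hn : 1 ≤ n) (hp : 1 < p) (hs : p * (n - 1) < n + 3) : ∃ γ α k1 k2 : ℝ,
    γ = 2 * n - 2 * α ∧ γ = α * (p + 1) ∧ k1 = - α * (γ - n) / 2 ∧ k2 = α * (n + 1 - γ) / 2 ∧ 0 < α ∧ 0 < γ ∧ γ < 2 * n ∧
    k1 < 0 ∧ 0 < k2 := by
  have hn1 : (1:ℝ) ≤ n := by exact_mod_cast hn
  obtain ⟨α, hα⟩ : ∃ α, α * (p + 3) = 2 * n := ⟨2 * n / (p + 3), by field_simp⟩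
  have a0 : 0 < α := by
    by_contra hh
    nlinarith
  have a1 : 2 * α < n := by nlinarith
  have a2 : n - 1 < 2 * α := by
    by_contra hh
    nlinarith
  refine ⟨2 * n - 2 * α, α, _, _, rfl, by linarith, rfl, rfl, a0, by linarith, by linarith, ?_, ?_⟩
  · nlinarith
  · have : 0 < α * (n + 1 - (2 * n - 2 * α)) := mul_pos a0 (by linarith)
    linarith

lemma Prof.Pz_pos (h : Prof n p c v M) {γ α k1 k2 : ℝ} (h1 : γ = 2 * n - 2 * α) (h2 : γ = α * (p + 1))
    (h3 : k1 = - α * (γ - n) / 2) (h4 : k2 = α * (n + 1 - γ) / 2) (g0 : 0 < γ) (g2 : γ < 2 * n) (k10 : k1 < 0) (k20 : 0 < k2)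
    {r : ℝ} (hr : 0 < r) : 0 < Pz γ α k1 k2 p c v (wv n c M) r := by
  obtain ⟨K, hK⟩ := h.Pz_bd γ α k1 k2
  have hd := fun r hr => h.Pz_d h1 h2 h3 h4 (r := r) hr
  have hpos : ∀ r > 0, 0 < cosh r / sinh r * (sinh r ^ γ * (sinh r ^ 2)⁻¹) := fun r hr => by
    have := sinh_pos hr
    have := cosh_pos r
    positivity
  rcases le_or_gt (γ * k1 * sinh r ^ 2 + (γ - 2) * k2) 0 with hQ | hQ
  · have hneg : ∀ ρ > r, γ * k1 * sinh ρ ^ 2 + (γ - 2) * k2 < 0 := fun ρ hρ => by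
      have s1 := sinh_pos hr
      have s2 := Real.sinh_lt_sinh.2 hρ
      have : sinh r ^ 2 < sinh ρ ^ 2 := by gcongr
      nlinarith [mul_neg_of_pos_of_neg g0 k10]
    have hA : StrictMonoOn (fun r => - Pz γ α k1 k2 p c v (wv n c M) r) (Ici r) :=
      smono (convex_Ici r) (fun ρ hρ => (hd ρ (lt_of_lt_of_le hr hρ)).neg) fun ρ hρ => by
        rw [interior_Ici] at hρ
        have a := hpos ρ (hr.trans hρ)
        have b := hneg ρ hρ
        have c := pow_pos (h.pos ρ (hr.trans hρ)) 2
        have := mul_pos (mul_pos a (neg_pos.2 b)) c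
        linarith
    have hlim : Tendsto (fun r => - Pz γ α k1 k2 p c v (wv n c M) r) atTop (𝓝 (-0)) :=
      (lim_inf_of (A := γ - 2) (D := γ - 2 * n) (by linarith) (by linarith) hK).neg
    rw [neg_zero] at hlim
    have i1 := hA self_mem_Ici (show r + 1 ∈ Ici r by simp) (by linarith)
    have i2 := mono_le_lim (hA.monotoneOn.mono Ioi_subset_Ici_self) hlim (show r < r + 1 by linarith)
    simp only at i1 i2
    linarith
  · have γ2 : 2 < γ := by
      by_contra hh
      have : 0 ≤ sinh r ^ 2 := sq_nonneg _
      nlinarith [mul_neg_of_pos_of_neg g0 k10, mul_nonneg (sub_nonneg.2 (not_lt.1 hh)) k20.le]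
    have hm : StrictMonoOn (Pz γ α k1 k2 p c v (wv n c M)) (Ioc 0 r) :=
      smono (convex_Ioc 0 r) (fun ρ hρ => hd ρ hρ.1) fun ρ hρ => by
        replace hρ := interior_subset hρ
        have a := hpos ρ hρ.1
        have b : 0 < γ * k1 * sinh ρ ^ 2 + (γ - 2) * k2 := by
          have s1 := sinh_pos hρ.1
          have s2 := sinh_le_sinh.2 hρ.2
          have : sinh ρ ^ 2 ≤ sinh r ^ 2 := by gcongr
          nlinarith [mul_neg_of_pos_of_neg g0 k10]
        have c := pow_pos (h.pos ρ hρ.1) 2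
        positivity
    have hl := lim_zero_of (A := γ - 2) (by linarith) (by linarith) hK
    have i1 : 0 ≤ Pz γ α k1 k2 p c v (wv n c M) (r / 2) := by
      refine le_of_tendsto hl ?_
      filter_upwards [Ioo_mem_nhdsGT (show (0:ℝ) < r / 2 by linarith)] with x hx
      exact hm.monotoneOn ⟨hx.1, by linarith [hx.2]⟩ ⟨by linarith, by linarith⟩ hx.2.le
    exact i1.trans_lt (hm ⟨by linarith, by linarith⟩ ⟨hr, le_rfl⟩ (by linarith))
end

lemma anti_Ioc {F F' : ℝ → ℝ} {r : ℝ} (h : ∀ x > 0, HasDerivAt F (F' x) x) (h0 : ∀ x ∈ Ioo 0 r, F' x ≤ 0) :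
    AntitoneOn F (Ioc 0 r) :=
  antitoneOn_of_deriv_nonpos (convex_Ioc 0 r) (fun x hx => (h x hx.1).continuousAt.continuousWithinAt)
    (fun x hx => (h x (interior_subset hx).1).differentiableAt.differentiableWithinAt)
    fun x hx => by rw [interior_Ioc] at hx; rw [(h x hx.1).deriv]; exact h0 x hx

lemma rpow_lip {p C x y : ℝ} (hp : 1 ≤ p) (hx : x ∈ Icc 0 C) (hy : y ∈ Icc 0 C) :
    |x ^ p - y ^ p| ≤ p * C ^ (p - 1) * |x - y| := by
  refine (convex_Icc 0 C).norm_image_sub_le_of_norm_hasDerivWithin_le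
    (fun z _ => (hasDerivAt_rpow_const (p := p) (x := z) (Or.inr hp)).hasDerivWithinAt) (fun z hz => ?_) hy hx
  have := hz.1
  rw [Real.norm_of_nonneg (by positivity)]
  gcongr
  exact hz.2

section
variable {n : ℕ} {p c : ℝ} {v M v1 M1 v2 M2 : ℝ → ℝ}

lemma Prof.v0 (h : Prof n p c v M) : ∃ b > 0, Tendsto v (𝓝[>] 0) (𝓝 b) := by
  obtain ⟨C, hC, hb⟩ := h.bd
  have hm : MonotoneOn (fun r => - v r) (Ioi 0) := mono_Ioi (fun r hr => (h.hv r hr).neg) fun r hr => by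
    have := (hb r hr).2.1
    have := sinh_pos hr
    have := h.hc
    rw [neg_neg]; positivity
  have h1 := hm.tendsto_nhdsGT (x := 0) ⟨-C, by
    rintro _ ⟨r, hr, rfl⟩
    have := (hb r hr).1.trans (mul_le_of_le_one_right hC.le (Em_le_one hr le_rfl (by linarith [h.n1])))
    simp only; linarith⟩
  have h2 := h1.neg
  simp only [neg_neg] at h2
  refine ⟨_, (h.pos 1 one_pos).trans_le ?_, h2⟩
  refine ge_of_tendsto h2 ?_
  filter_upwards [Ioo_mem_nhdsGT one_pos] with x hx
  linarith [hm hx.1 (by norm_num : (1:ℝ) ∈ Ioi 0) hx.2.le]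

lemma Prof.M0 (h : Prof n p c v M) : Tendsto M (𝓝[>] 0) (𝓝 0) := by
  obtain ⟨C, hC, hb⟩ := h.bd
  have hn := h.n1
  have h1 : Tendsto (fun r => C * Tn r ^ ((n:ℝ) + 1)) (𝓝[>] 0) (𝓝 (C * 0)) := by
    refine Tendsto.const_mul _ ?_
    have := (Tn_cont.tendsto 0).rpow_const (p := (n:ℝ) + 1) (Or.inr (by linarith))
    rw [show Tn 0 = 0 by simp [Tn], zero_rpow (by linarith)] at this
    exact this.mono_left nhdsWithin_le_nhds
  rw [mul_zero] at h1
  refine squeeze_zero' ?_ ?_ h1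
  · filter_upwards [self_mem_nhdsWithin] with r hr using (hb r hr).2.1.le
  · filter_upwards [self_mem_nhdsWithin] with r hr
    have := (hb r hr).2.2
    rwa [Em, rpow_zero, mul_one] at this

lemma Prof.lt_false (h1 : Prof n p c v1 M1) (h2 : Prof n p c v2 M2) {b1 b2 : ℝ} (b10 : 0 < b1)
    (l1 : Tendsto v1 (𝓝[>] 0) (𝓝 b1)) (l2 : Tendsto v2 (𝓝[>] 0) (𝓝 b2)) (hlt : b1 < b2) : False := by
  obtain ⟨γ, α, k1, k2, e1, e2, e3, e4, α0, g0, g2, k10, k20⟩ := params h1.hn h1.hp h1.sub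
  have hp := h1.hp
  have hc := h1.hc
  set D : ℝ → ℝ := fun r => v2 r * M1 r - v1 r * M2 r with hD
  have dD : ∀ r > 0, HasDerivAt D (sinh r ^ n * (v2 r * v1 r ^ p - v1 r * v2 r ^ p)) r := fun r hr => by
    refine (((h2.hv r hr).mul (h1.hM r hr)).sub ((h1.hv r hr).mul (h2.hM r hr))).congr_deriv ?_
    ring
  have sgn : ∀ r > 0, v1 r ≤ v2 r → sinh r ^ n * (v2 r * v1 r ^ p - v1 r * v2 r ^ p) ≤ 0 := fun r hr hle => by
    have p1 := h1.pos r hr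
    have p2 := h2.pos r hr
    have : v1 r ^ (p - 1) ≤ v2 r ^ (p - 1) := rpow_le_rpow p1.le hle (by linarith)
    rw [show p = (p - 1) + 1 by ring, rpow_add_one p1.ne', rpow_add_one p2.ne']
    have h3 := mul_nonneg (mul_pos p1 p2).le (sub_nonneg.2 this)
    have := mul_nonneg (pow_pos (sinh_pos hr) n).le h3
    nlinarith
  have sgn' : ∀ r > 0, v1 r < v2 r → sinh r ^ n * (v2 r * v1 r ^ p - v1 r * v2 r ^ p) < 0 := fun r hr hle => by
    have p1 := h1.pos r hr
    have p2 := h2.pos r hr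
    have : v1 r ^ (p - 1) < v2 r ^ (p - 1) := Real.rpow_lt_rpow p1.le hle (by linarith)
    rw [show p = (p - 1) + 1 by ring, rpow_add_one p1.ne', rpow_add_one p2.ne']
    have h3 := mul_pos (mul_pos p1 p2) (sub_pos.2 this)
    have := mul_pos (pow_pos (sinh_pos hr) n) h3
    nlinarith
  have D0 : Tendsto D (𝓝[>] 0) (𝓝 0) := by
    have := (l2.mul h1.M0).sub (l1.mul h2.M0)
    simpa using this
  set om : ℝ → ℝ := fun r => v2 r / v1 r with hom
  have dom : ∀ r > 0, HasDerivAt om (c * (sinh r ^ n)⁻¹ * (v1 r ^ 2)⁻¹ * D r) r := fun r hr => by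
    have p1 := h1.pos r hr
    refine ((h2.hv r hr).div (h1.hv r hr) p1.ne').congr_deriv ?_
    simp only [hD]; field_simp; ring
  have om0 : ∀ r > 0, 0 < om r := fun r hr => div_pos (h2.pos r hr) (h1.pos r hr)
  set P1 := Pz γ α k1 k2 p c v1 (wv n c M1) with hP1
  set P2 := Pz γ α k1 k2 p c v2 (wv n c M2) with hP2
  have P1p : ∀ r > 0, 0 < P1 r := fun r hr => h1.Pz_pos e1 e2 e3 e4 g0 g2 k10 k20 hr
  set X : ℝ → ℝ := fun r => om r ^ 2 * P1 r - P2 r with hX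
  have vom : ∀ r > 0, v2 r = om r * v1 r := fun r hr => by rw [hom]; exact (div_mul_cancel₀ _ (h1.pos r hr).ne').symm
  have dX : ∀ r > 0, HasDerivAt X (2 * om r * (c * (sinh r ^ n)⁻¹ * (v1 r ^ 2)⁻¹ * D r) * P1 r) r := fun r hr => by
    refine ((((dom r hr).pow 2).mul (h1.Pz_d e1 e2 e3 e4 hr)).sub (h2.Pz_d e1 e2 e3 e4 hr)).congr_deriv ?_
    simp only [Pi.pow_apply]
    rw [vom r hr, ← hP1]; ring
  have Xf : ∀ r > 0, 2 * om r * (c * (sinh r ^ n)⁻¹ * (v1 r ^ 2)⁻¹) * P1 r > 0 := fun r hr => by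
    have := om0 r hr; have := sinh_pos hr; have := h1.pos r hr; have := P1p r hr
    positivity
  have Xeq : ∀ r > 0, X r = om r ^ 2 * Pz γ α 0 0 p c v1 (wv n c M1) r - Pz γ α 0 0 p c v2 (wv n c M2) r := fun r hr => by
    simp only [hX, hP1, hP2]
    rw [Pz_split (v := v1), Pz_split (v := v2)]
    nth_rw 1 [vom r hr]; ring
  obtain ⟨l, hl, lo⟩ := h1.v_lo
  obtain ⟨C, hC, up⟩ := h2.bd
  have omb : ∀ r > 0, om r ≤ C / l := fun r hr => by
    have e := Em_pos' n hr
    rw [hom, div_le_div_iff₀ (h1.pos r hr) hl]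
    have a := lo r hr
    have b := (up r hr).1
    nlinarith
  obtain ⟨K1, hK1, kb1⟩ := h1.Pz0_bd γ α
  obtain ⟨K2, hK2, kb2⟩ := h2.Pz0_bd γ α
  have Xb : ∀ r > 0, |X r| ≤ ((C / l) ^ 2 * K1 + K2) * Em γ (γ - 2 * n) r := fun r hr => by
    rw [Xeq r hr, add_mul]
    refine (abs_sub _ _).trans (add_le_add ?_ (kb2 r hr).1)
    rw [abs_mul, abs_of_pos (pow_pos (om0 r hr) 2), mul_assoc]
    have := omb r hr
    have := om0 r hr
    have := (kb1 r hr).1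
    gcongr
  have X0 := lim_zero_of g0 (by linarith) Xb
  have Xi := lim_inf_of (by linarith) (by linarith) Xb
  have step : ∀ r > 0, (∀ x ∈ Ioo 0 r, D x < 0) → D r < 0 := fun r hr hx => by
    have lim_le : ∀ {F : ℝ → ℝ}, AntitoneOn F (Ioc 0 r) → Tendsto F (𝓝[>] 0) (𝓝 0) → F r ≤ 0 := fun {F} ha hl => by
      refine ge_of_tendsto hl ?_
      filter_upwards [Ioo_mem_nhdsGT hr] with x hx using ha ⟨hx.1, hx.2.le⟩ ⟨hr, le_rfl⟩ hx.2.le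
    have Xr : X r ≤ 0 := lim_le (anti_Ioc dX fun x hx' => by
      have := Xf x hx'.1
      have := mul_neg_of_pos_of_neg this (hx x hx')
      linarith) X0
    by_contra hge
    push Not at hge
    have hle : D r ≤ 0 := by
      have : Tendsto D (𝓝[<] r) (𝓝 (D r)) := (dD r hr).continuousAt.tendsto.mono_left nhdsWithin_le_nhds
      refine le_of_tendsto this ?_
      filter_upwards [Ioo_mem_nhdsLT hr] with x hx' using (hx x hx').le
    have D00 : v2 r * M1 r - v1 r * M2 r = 0 := le_antisymm hle hge
    have p1 := h1.pos r hr
    have p2 := h2.pos r hr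
    have w2 : wv n c M2 r = om r * wv n c M1 r := by
      simp only [wv, hom]
      field_simp
      linarith
    have v12 : v1 r ≤ v2 r := by
      rw [Xeq r hr, Pz, Pz, w2, vom r hr] at Xr
      have hS := rpow_pos_of_pos (sinh_pos hr) γ
      have : om r ^ 2 * v1 r ^ (p + 1) ≤ (om r * v1 r) ^ (p + 1) := by
        have h3 : 0 < sinh r ^ γ * (c / (p + 1)) := by positivity
        refine le_of_mul_le_mul_left ?_ h3
        linarith
      rw [mul_rpow (om0 r hr).le p1.le, show p + 1 = (p - 1) + 2 by ring, rpow_add (om0 r hr),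
        show om r ^ (2:ℝ) = om r ^ 2 by norm_cast] at this
      have h4 : 1 ≤ om r ^ (p - 1) := by
        have h5 : 0 < om r ^ 2 * v1 r ^ (p - 1 + 2) := by have := om0 r hr; positivity
        refine le_of_mul_le_mul_right ?_ h5
        linarith
      have h5 : 1 ≤ om r := by
        by_contra hh
        have := rpow_lt_one (om0 r hr).le (not_le.1 hh) (show 0 < p - 1 by linarith)
        linarith
      rw [hom] at h5
      rwa [one_le_div p1] at h5
    have oma : AntitoneOn om (Ioc 0 r) := anti_Ioc dom fun x hx' => by
      have h3 : 0 < c * (sinh x ^ n)⁻¹ * (v1 x ^ 2)⁻¹ := by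
        have := sinh_pos hx'.1; have := h1.pos x hx'.1; positivity
      exact (mul_neg_of_pos_of_neg h3 (hx x hx')).le
    have Da : AntitoneOn D (Ioc 0 r) := anti_Ioc dD fun x hx' => by
      refine sgn x hx'.1 ?_
      have h3 := oma ⟨hx'.1, hx'.2.le⟩ ⟨hr, le_rfl⟩ hx'.2.le
      have h4 : 1 ≤ om r := by rw [hom]; exact (one_le_div p1).2 v12
      have h5 := h4.trans h3
      rw [hom] at h5
      exact (one_le_div (h1.pos x hx'.1)).1 h5
    have h3 := Da (a := r / 2) (b := r) ⟨by linarith, by linarith⟩ ⟨hr, le_rfl⟩ (by linarith)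
    have h4 := hx (r / 2) ⟨by linarith, by linarith⟩
    linarith
  have all : ∀ r > 0, D r < 0 := by
    have hev := (l1.eventually_lt l2 hlt)
    rw [eventually_nhdsWithin_iff, Metric.eventually_nhds_iff] at hev
    obtain ⟨δ, hδ, hev⟩ := hev
    have hev' : ∀ x ∈ Ioo 0 δ, v1 x < v2 x := fun x hx => hev (by simp [abs_of_pos hx.1, hx.2]) hx.1
    have Dδ : ∀ x ∈ Ioo 0 δ, D x < 0 := fun x hx => by
      have hm : StrictMonoOn (fun x => - D x) (Ioo 0 δ) := smono (convex_Ioo 0 δ) (fun x hx => (dD x hx.1).neg) fun x hx => by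
        rw [interior_Ioo] at hx
        linarith [sgn' x hx.1 (hev' x hx)]
      have h3 := hm (a := x / 2) (b := x) ⟨by linarith [hx.1], by linarith [hx.1, hx.2]⟩ hx (by linarith [hx.1])
      have h4 : D (x / 2) ≤ 0 := by
        refine ge_of_tendsto D0 ?_
        filter_upwards [Ioo_mem_nhdsGT (show 0 < x / 2 by linarith [hx.1])] with z hz
        have := hm (a := z) (b := x / 2) ⟨hz.1, by linarith [hz.2, hx.1, hx.2]⟩ ⟨by linarith [hx.1], by linarith [hx.1, hx.2]⟩ hz.2
        simp only at this; linarith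
      simp only at h3; linarith
    intro r hr
    by_contra hge
    push Not at hge
    set A := {x : ℝ | 0 < x ∧ 0 ≤ D x} with hA
    have hne : A.Nonempty := ⟨r, hr, hge⟩
    have hlb : ∀ x ∈ A, δ ≤ x := fun x hx => by
      by_contra hh
      exact absurd (Dδ x ⟨hx.1, not_le.1 hh⟩) (not_lt.2 hx.2)
    have hbdd : BddBelow A := ⟨δ, hlb⟩
    have s0 : 0 < sInf A := hδ.trans_le (le_csInf hne hlb)
    have Ds := step (sInf A) s0 fun x hx => by
      by_contra hh
      exact absurd (csInf_le hbdd ⟨hx.1, not_lt.1 hh⟩) (not_le.2 hx.2)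
    have hev2 := (dD _ s0).continuousAt.eventually_lt_const Ds
    rw [Metric.eventually_nhds_iff] at hev2
    obtain ⟨η, hη, hev2⟩ := hev2
    obtain ⟨x, hx, hxs⟩ := exists_lt_of_csInf_lt hne (show sInf A < sInf A + η by linarith)
    have := csInf_le hbdd hx
    have h3 := hev2 (y := x) (by rw [Real.dist_eq, abs_of_nonneg (by linarith)]; linarith)
    linarith [hx.2]
  have Xm : StrictMonoOn (fun r => - X r) (Ioi 0) := smono (convex_Ioi 0) (fun r hr => (dX r hr).neg) fun r hr => by
    have hr := interior_subset hr
    have := mul_neg_of_pos_of_neg (Xf r hr) (all r hr)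
    linarith
  have a1 := mono_ge_lim0 Xm.monotoneOn (by simpa using X0.neg) (one_pos)
  have a2 := mono_le_lim Xm.monotoneOn (by simpa using Xi.neg) (two_pos)
  have a3 := Xm (a := 1) (b := 2) (by simp) (by simp) (by norm_num)
  simp only at a1 a2 a3
  linarith

lemma Prof.eq_of (h1 : Prof n p c v1 M1) (h2 : Prof n p c v2 M2) {b : ℝ}
    (l1 : Tendsto v1 (𝓝[>] 0) (𝓝 b)) (l2 : Tendsto v2 (𝓝[>] 0) (𝓝 b)) : ∀ r > 0, v1 r = v2 r := by
  obtain ⟨C1, hC1, u1⟩ := h1.bd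
  obtain ⟨C2, hC2, u2⟩ := h2.bd
  have hc := h1.hc
  have hp := h1.hp
  have hn := h1.n1
  set C := C1 + C2
  set L := p * C ^ (p - 1) with hL
  have L0 : 0 < L := by positivity
  have i1 : ∀ r > 0, v1 r ∈ Icc 0 C := fun r hr => ⟨(h1.pos r hr).le, by
    have := (u1 r hr).1.trans (mul_le_of_le_one_right hC1.le (Em_le_one hr le_rfl (by linarith))); linarith⟩
  have i2 : ∀ r > 0, v2 r ∈ Icc 0 C := fun r hr => ⟨(h2.pos r hr).le, by
    have := (u2 r hr).1.trans (mul_le_of_le_one_right hC2.le (Em_le_one hr le_rfl (by linarith))); linarith⟩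
  have ct : ContinuousOn (fun r => |v1 r - v2 r|) (Ioi 0) := fun r hr =>
    ((h1.hv r hr).continuousAt.sub (h2.hv r hr).continuousAt).abs.continuousWithinAt
  have bb : ∀ r > 0, |v1 r - v2 r| ≤ C := fun r hr => abs_le.2 ⟨by linarith [(i1 r hr).1, (i2 r hr).2], by linarith [(i1 r hr).2, (i2 r hr).1]⟩
  have ii : ∀ r > 0, IntervalIntegrable (fun r => |v1 r - v2 r|) volume 0 r := fun r hr =>
    intble0 hr ct (C := C) fun s hs => by rw [abs_abs]; exact bb s hs.1
  set I : ℝ → ℝ := fun r => ∫ s in (0:ℝ)..r, |v1 s - v2 s| with hI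
  have dI : ∀ r > 0, HasDerivAt I |v1 r - v2 r| r := fun r hr =>
    intervalIntegral.integral_hasDerivAt_right (ii r hr) (ct.stronglyMeasurableAtFilter isOpen_Ioi r hr)
      (ct.continuousAt (Ioi_mem_nhds hr))
  have I0 : ∀ r > 0, 0 ≤ I r := fun r hr => intervalIntegral.integral_nonneg hr.le fun _ _ => abs_nonneg _
  have Il : Tendsto I (𝓝[>] 0) (𝓝 0) := by
    have : Tendsto (fun r => C * r) (𝓝[>] 0) (𝓝 (C * 0)) := (tendsto_id.mono_left nhdsWithin_le_nhds).const_mul C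
    rw [mul_zero] at this
    refine squeeze_zero' ?_ ?_ this
    · filter_upwards [self_mem_nhdsWithin] with r hr using I0 r hr
    · filter_upwards [self_mem_nhdsWithin] with r hr
      have hr : 0 < r := hr
      have h3 := intervalIntegral.norm_integral_le_of_norm_le_const (a := 0) (b := r) (f := fun s => |v1 s - v2 s|) (C := C) fun s hs => by
        rw [uIoc_of_le hr.le] at hs
        rw [Real.norm_eq_abs, abs_abs]; exact bb s hs.1
      rw [sub_zero, abs_of_pos hr] at h3
      exact (le_abs_self _).trans h3
  have cmp : ∀ {F G F' G' : ℝ → ℝ}, (∀ r > 0, HasDerivAt F (F' r) r) → (∀ r > 0, HasDerivAt G (G' r) r) →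
      (∀ r > 0, |F' r| ≤ G' r) → Tendsto F (𝓝[>] 0) (𝓝 0) → Tendsto G (𝓝[>] 0) (𝓝 0) → ∀ r > 0, |F r| ≤ G r := by
    intro F G F' G' hF hG hle lF lG r hr
    have m1 := mono_ge_lim0 (F := fun r => G r - F r) (mono_Ioi (fun r hr => (hG r hr).sub (hF r hr)) fun r hr => by linarith [(abs_le.1 (hle r hr)).2]) (by simpa using lG.sub lF) hr
    have m2 := mono_ge_lim0 (F := fun r => G r + F r) (mono_Ioi (fun r hr => (hG r hr).add (hF r hr)) fun r hr => by linarith [(abs_le.1 (hle r hr)).1]) (by simpa using lG.add lF) hr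
    rw [abs_le]
    constructor <;> linarith
  have A1 : ∀ r > 0, |M1 r - M2 r| ≤ L * (sinh r ^ n * I r) := by
    refine cmp (fun r hr => (h1.hM r hr).sub (h2.hM r hr)) (fun r hr => (((hasDerivAt_sinh r).pow n).mul (dI r hr)).const_mul L) ?_ ?_ ?_
    · intro r hr
      have hS := sinh_pos hr
      have hC := cosh_pos r
      have := I0 r hr
      rw [← mul_sub, abs_mul, abs_of_pos (pow_pos hS n)]
      have h3 := rpow_lip hp.le (i1 r hr) (i2 r hr)
      have h4 : 0 ≤ L * (n * sinh r ^ (n - 1) * cosh r * I r) := by positivity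
      have h5 := mul_mono_l h3 (pow_pos hS n).le
      simp only [Pi.pow_apply]
      nlinarith
    · simpa using h1.M0.sub h2.M0
    · simpa using ((S_tendsto h1.hn).mul Il).const_mul L
  have A2 : ∀ r > 0, |v1 r - v2 r| ≤ c * L * (r * I r) := by
    refine cmp (fun r hr => (h1.hv r hr).sub (h2.hv r hr)) (fun r hr => ((hasDerivAt_id r).mul (dI r hr)).const_mul (c * L)) ?_ ?_ ?_
    · intro r hr
      have hS := pow_pos (sinh_pos hr) n
      have h3 := A1 r hr
      have h4 : -(c * (M1 r * (sinh r ^ n)⁻¹)) - -(c * (M2 r * (sinh r ^ n)⁻¹)) = -(c * ((M1 r - M2 r) * (sinh r ^ n)⁻¹)) := by ring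
      rw [h4, abs_neg, abs_mul, abs_mul, abs_of_pos hc, abs_of_pos (inv_pos.2 hS)]
      have h5 : |M1 r - M2 r| * (sinh r ^ n)⁻¹ ≤ L * I r := by
        rw [← div_eq_mul_inv, div_le_iff₀ hS]; linarith
      have h6 : 0 ≤ c * L * (r * |v1 r - v2 r|) := by positivity
      have h7 := mul_mono_l h5 hc.le
      simp only [id]
      linarith
    · simpa using l1.sub l2
    · have : Tendsto (fun r : ℝ => r) (𝓝[>] 0) (𝓝 0) := tendsto_id.mono_left nhdsWithin_le_nhds
      simpa using (this.mul Il).const_mul (c * L)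
  have A3 : ∀ r > 0, I r * exp (-(c * L * r ^ 2 / 2)) ≤ 0 := by
    intro r hr
    have hd : ∀ r > 0, HasDerivAt (fun r => - (I r * exp (-(c * L * r ^ 2 / 2)))) (-(|v1 r - v2 r| * exp (-(c * L * r ^ 2 / 2)) +
        I r * (exp (-(c * L * r ^ 2 / 2)) * (-(c * L * (2 * r) / 2))))) r := fun r hr => by
      refine ((dI r hr).mul (HasDerivAt.exp ((((hasDerivAt_pow 2 r).const_mul (c * L)).div_const 2).neg))).neg.congr_deriv ?_
      simp
    have hm := mono_Ioi hd fun r hr => by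
      have := A2 r hr
      have e := exp_pos (-(c * L * r ^ 2 / 2))
      nlinarith
    have hl : Tendsto (fun r => - (I r * exp (-(c * L * r ^ 2 / 2)))) (𝓝[>] 0) (𝓝 0) := by
      have h3 : Tendsto (fun r : ℝ => exp (-(c * L * r ^ 2 / 2))) (𝓝[>] 0) (𝓝 (exp (-(c * L * 0 ^ 2 / 2)))) :=
        (Continuous.tendsto (by fun_prop) 0).mono_left nhdsWithin_le_nhds
      simpa using (Il.mul h3).neg
    have := mono_ge_lim0 hm hl hr
    linarith
  intro r hr
  have e := exp_pos (-(c * L * r ^ 2 / 2))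
  have h3 : I r ≤ 0 := by
    by_contra hh
    exact absurd (A3 r hr) (not_le.2 (mul_pos (not_le.1 hh) e))
  have h4 : I r = 0 := le_antisymm h3 (I0 r hr)
  have := A2 r hr
  rw [h4, mul_zero, mul_zero] at this
  exact sub_eq_zero.1 (abs_nonpos_iff.1 this)

theorem Prof.uniq (h1 : Prof n p c v1 M1) (h2 : Prof n p c v2 M2) : ∀ r > 0, v1 r = v2 r := by
  obtain ⟨b1, b10, l1⟩ := h1.v0
  obtain ⟨b2, b20, l2⟩ := h2.v0
  rcases lt_trichotomy b1 b2 with h | h | h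
  · exact (h1.lt_false h2 b10 l1 l2 h).elim
  · subst h; exact h1.eq_of h2 l1 l2
  · exact (h2.lt_false h1 b20 l2 l1 h).elim
end

lemma subseq_pt {g : ℕ → ℝ → ℝ} {C : ℝ} {L : ℝ → ℝ} (h0 : ∀ k, ∀ r > 0, g k r ∈ Icc 0 C)
    (hL : ∀ k, ∀ r > 0, ∀ x ≥ r, ∀ y ≥ r, |g k x - g k y| ≤ L r * |x - y|) :
    ∃ φ : ℕ → ℕ, StrictMono φ ∧ ∀ r > 0, ∃ l, Tendsto (fun k => g (φ k) r) atTop (𝓝 l) := by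
  have hK : IsCompact (Set.pi univ fun _ : ℚ => Icc (0:ℝ) C) := isCompact_univ_pi fun _ => isCompact_Icc
  have hC : 0 ≤ C := (h0 0 1 one_pos).1.trans (h0 0 1 one_pos).2
  obtain ⟨z, -, φ, hφ, hz⟩ := hK.tendsto_subseq (x := fun k (q : ℚ) => if (0:ℝ) < q then g k q else 0)
    (fun k q _ => by
      by_cases hq : (0:ℝ) < q
      · simp only [hq, if_true]; exact h0 k q hq
      · simp only [hq, if_false]; exact ⟨le_rfl, hC⟩)
  refine ⟨φ, hφ, fun r hr => ?_⟩
  rw [tendsto_pi_nhds] at hz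
  refine cauchySeq_tendsto_of_complete (Metric.cauchySeq_iff'.2 fun ε hε => ?_)
  have hl : 0 < |L r| + 1 := by positivity
  obtain ⟨q, hq1, hq2⟩ := exists_rat_btwn (show r < r + ε / (4 * (|L r| + 1)) by
    have : 0 < ε / (4 * (|L r| + 1)) := by positivity
    linarith)
  have hq0 : (0:ℝ) < q := hr.trans hq1
  have hq := hz q
  simp only [Function.comp_def, hq0, if_true] at hq
  obtain ⟨K, hK⟩ := Metric.cauchySeq_iff'.1 hq.cauchySeq (ε / 4) (by positivity)
  refine ⟨K, fun k hk => ?_⟩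
  have h1 := hK k hk
  have hb : ∀ k, |g k r - g k q| ≤ ε / 4 := fun k => by
    refine (hL k r hr r le_rfl q hq1.le).trans ?_
    rw [abs_sub_comm, abs_of_pos (by linarith : 0 < (q:ℝ) - r)]
    have h3 : (q:ℝ) - r ≤ ε / (4 * (|L r| + 1)) := by linarith
    calc L r * (q - r) ≤ (|L r| + 1) * (ε / (4 * (|L r| + 1))) := by
          have := le_abs_self (L r)
          have : 0 < (q:ℝ) - r := by linarith
          gcongr; linarith
      _ = ε / 4 := by field_simp
  have h2 := hb (φ k)
  have h3 := hb (φ K)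
  rw [Real.dist_eq] at h1 ⊢
  rw [abs_lt] at h1 ⊢
  rw [abs_le] at h2 h3
  constructor <;> linarith [h1.1, h1.2, h2.1, h2.2, h3.1, h3.2]

lemma tail_int {n : ℕ} (hn : 1 ≤ n) {r : ℝ} (hr : 0 < r) : ∫ s in Ioi r, Em 0 (-n) s ≤ 2 ^ n * Em 0 (-n) r := by
  have n1 : (1:ℝ) ≤ n := by exact_mod_cast hn
  have e1 : ∀ s, Em 0 (-n) s = (cosh s ^ n)⁻¹ := fun s => by
    rw [Em, rpow_zero, one_mul, rpow_neg (cosh_pos s).le, rpow_natCast]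
  have hi : IntegrableOn (fun s => 2 ^ n * exp (-n * s)) (Ioi r) := (exp_neg_integrableOn_Ioi r (by linarith)).const_mul _
  have h1 : ∫ s in Ioi r, Em 0 (-n) s ≤ ∫ s in Ioi r, 2 ^ n * exp (-n * s) := by
    refine setIntegral_mono_on ((Em_int (by norm_num) (by linarith)).mono_set (Ioi_subset_Ioi hr.le)) hi measurableSet_Ioi fun s _ => ?_
    rw [e1, show -(n:ℝ) * s = n * (-s) by ring, exp_nat_mul, ← mul_pow, ← inv_pow]
    refine pow_le_pow_left₀ (inv_nonneg.2 (cosh_pos s).le) ?_ n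
    rw [inv_le_iff_one_le_mul₀ (cosh_pos s), cosh_eq]
    have := exp_pos (-s)
    have h3 : exp (-s) * exp s = 1 := by rw [← exp_add]; simp
    nlinarith
  refine h1.trans ?_
  rw [integral_const_mul, integral_exp_mul_Ioi (by linarith)]
  refine mul_mono_l ?_ (by positivity)
  rw [e1, neg_div_neg_eq, show -(n:ℝ) * r = n * (-r) by ring, exp_nat_mul, ← inv_pow]
  refine (div_le_self (by positivity) n1).trans (pow_le_pow_left₀ (exp_pos _).le ?_ n)
  rw [Real.exp_neg]
  refine inv_anti₀ (cosh_pos r) ?_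
  rw [cosh_eq]
  have : exp (-r) ≤ exp r := exp_le_exp.2 (by linarith)
  linarith

noncomputable def mI (n : ℕ) (p : ℝ) (g : ℝ → ℝ) (r : ℝ) : ℝ := ∫ s in (0:ℝ)..r, sinh s ^ n * g s ^ p
noncomputable def hI (n : ℕ) (p : ℝ) (g : ℝ → ℝ) (r : ℝ) : ℝ := ∫ s in Ioi r, mI n p g s * (sinh s ^ n)⁻¹

section
variable {n : ℕ} {p C : ℝ} {g : ℝ → ℝ}

lemma sg_bd (hp : 1 < p) (b : ∀ r > 0, g r ∈ Icc 0 (C * Em 0 (-n) r)) (hC : 0 < C) {r : ℝ} (hr : 0 < r) :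
    |sinh r ^ n * g r ^ p| ≤ C ^ p * Em n (n - n * p) r := by
  obtain ⟨h1, h2⟩ := b r hr
  have hS := sinh_pos hr
  rw [abs_of_nonneg (by positivity)]
  have e := Em_pos' n hr
  calc _ ≤ sinh r ^ n * (C * Em 0 (-n) r) ^ p := by gcongr
    _ = C ^ p * (Em n n r * Em 0 (-n) r ^ p) := by rw [mul_rpow hC.le e.le, Em_S]; ring
    _ = _ := by rw [Em_rpow hr, Em_mul hr]; ring_nf

lemma sg_int (hn : 1 ≤ n) (hp : 1 < p) (hC : 0 < C) (b : ∀ r > 0, g r ∈ Icc 0 (C * Em 0 (-n) r))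
    (hm : AEStronglyMeasurable g (volume.restrict (Ioi 0))) : IntegrableOn (fun s => sinh s ^ n * g s ^ p) (Ioi 0) := by
  have n1 : (1:ℝ) ≤ n := by exact_mod_cast hn
  refine Integrable.mono' ((Em_int (A := n) (D := n - n * p) (by linarith) (by nlinarith)).const_mul (C ^ p)) ?_ ?_
  · exact (continuous_sinh.pow n).aestronglyMeasurable.mul (hm.aemeasurable.pow_const p).aestronglyMeasurable
  · filter_upwards [ae_restrict_mem measurableSet_Ioi] with r hr using sg_bd hp b hC hr

lemma mI_eq {r : ℝ} (hr : 0 < r) : mI n p g r = ∫ s in Ioc 0 r, sinh s ^ n * g s ^ p :=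
  intervalIntegral.integral_of_le hr.le

lemma mI_bd (hp : 1 < p) (hC : 0 < C) (b : ∀ r > 0, g r ∈ Icc 0 (C * Em 0 (-n) r))
    (hi : IntegrableOn (fun s => sinh s ^ n * g s ^ p) (Ioi 0)) {r : ℝ} (hr : 0 < r) :
    0 ≤ mI n p g r := by
  rw [mI_eq hr]
  refine setIntegral_nonneg measurableSet_Ioc fun s hs => ?_
  have := (b s hs.1).1
  have := sinh_pos hs.1
  positivity

lemma mI_ct (hi : IntegrableOn (fun s => sinh s ^ n * g s ^ p) (Ioi 0)) : ContinuousOn (mI n p g) (Ioi 0) := by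
  intro r hr
  have h1 : IntegrableOn (fun s => sinh s ^ n * g s ^ p) (uIcc 0 (r + 1)) := by
    rw [uIcc_of_le (by linarith [mem_Ioi.1 hr]), integrableOn_Icc_iff_integrableOn_Ioc]
    exact hi.mono_set Ioc_subset_Ioi_self
  have h2 := intervalIntegral.continuousOn_primitive_interval h1
  rw [uIcc_of_le (by linarith [mem_Ioi.1 hr])] at h2
  exact (h2.continuousAt (Icc_mem_nhds hr (by linarith))).continuousWithinAt

lemma hI_d {M : ℝ → ℝ} (hc : ContinuousOn M (Ioi 0)) (hi : IntegrableOn M (Ioi 0)) {r : ℝ} (hr : 0 < r) :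
    HasDerivAt (fun r => ∫ s in Ioi r, M s) (-M r) r := by
  have h1 : ∀ x > 0, ∫ s in Ioi x, M s = (∫ s in Ioi 0, M s) - ∫ s in (0:ℝ)..x, M s := fun x hx => by
    rw [eq_sub_iff_add_eq, add_comm, intervalIntegral.integral_of_le hx.le,
      ← setIntegral_union (Ioc_disjoint_Ioi le_rfl) measurableSet_Ioi (hi.mono_set Ioc_subset_Ioi_self) (hi.mono_set (Ioi_subset_Ioi hx.le)), Ioc_union_Ioi_eq_Ioi hx.le]
  have h2 : HasDerivAt (fun x => ∫ s in (0:ℝ)..x, M s) (M r) r :=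
    intervalIntegral.integral_hasDerivAt_right ((intervalIntegrable_iff_integrableOn_Ioc_of_le hr.le).2 (hi.mono_set Ioc_subset_Ioi_self))
      (hc.stronglyMeasurableAtFilter isOpen_Ioi r hr) (hc.continuousAt (Ioi_mem_nhds hr))
  refine (h2.const_sub (∫ s in Ioi 0, M s)).congr_of_eventuallyEq ?_
  filter_upwards [Ioi_mem_nhds hr] with x hx using h1 x hx

lemma mS_bd {M : ℝ → ℝ} {r : ℝ} (hr : 0 < r) (hb : M r ∈ Icc 0 (C * Em (n + 1) 0 r)) :
    |M r * (sinh r ^ n)⁻¹| ≤ C * Em 1 (-n) r := by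
  have hS := sinh_pos hr
  rw [abs_of_nonneg (mul_nonneg hb.1 (by positivity)), ← Em_S' hr]
  calc _ ≤ C * Em (n + 1) 0 r * Em (-n) (-n) r := mul_mono_r hb.2 (Em_pos hr).le
    _ = _ := by rw [mul_assoc, Em_mul hr]; ring_nf

lemma mS_int (hn : 1 ≤ n) {M : ℝ → ℝ} (hc : ContinuousOn M (Ioi 0)) (hb : ∀ r > 0, M r ∈ Icc 0 (C * Em (n + 1) 0 r)) :
    IntegrableOn (fun r => M r * (sinh r ^ n)⁻¹) (Ioi 0) := by
  have n1 : (1:ℝ) ≤ n := by exact_mod_cast hn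
  refine Integrable.mono' ((Em_int (A := 1) (D := -n) (by norm_num) (by linarith)).const_mul C)
    ((hc.mul Si_ct).aestronglyMeasurable measurableSet_Ioi) ?_
  filter_upwards [ae_restrict_mem measurableSet_Ioi] with r hr using mS_bd hr (hb r hr)
end

lemma cpt {n : ℕ} {p C c y0 δ : ℝ} (hn : 1 ≤ n) (hp : 1 < p) (sub : p * (n - 1) < n + 3) (hc : 0 < c) (hC : 0 < C)
    {g : ℕ → ℝ → ℝ} {L E V W : ℝ → ℝ} {c' ε : ℕ → ℝ}
    (gp : ∀ k, ∀ r > 0, g k r ∈ Icc 0 (C * Em 0 (-n) r)) (gc : ∀ k, ContinuousOn (g k) (Ioi 0))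
    (gL : ∀ k, ∀ r > 0, ∀ x ≥ r, ∀ y ≥ r, |g k x - g k y| ≤ L r * |x - y|)
    (gm : ∀ k, ∀ r > 0, mI n p (g k) r ≤ C * Em (n + 1) 0 r)
    (ge : ∀ k, ∀ r > 0, |g k r - c' k * hI n p (g k) r| ≤ ε k * E r)
    (cl : Tendsto c' atTop (𝓝 c)) (εl : Tendsto ε atTop (𝓝 0)) (hy : 0 < y0)
    (gy : ∀ k, y0 ≤ ∫ r in Ioi (0:ℝ), sinh r ^ n * g k r ^ (p + 1)) (hV : Prof n p c V W) (hδ : 0 < δ)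
    (bad : ∀ k, ∃ r > 0, δ * Em 0 (-n) r < |hI n p (g k) r - V r / c|) : False := by
  have n1 : (1:ℝ) ≤ n := by exact_mod_cast hn
  have b1 : ∀ r > 0, Em 0 (-n) r ≤ 1 := fun r hr => Em_le_one hr le_rfl (by linarith)
  obtain ⟨φ, hφ, hlim⟩ := subseq_pt (C := C) (fun k r hr => ⟨(gp k r hr).1, (gp k r hr).2.trans (mul_le_of_le_one_right hC.le (b1 r hr))⟩) gL
  choose! G hG using hlim
  have φl := hφ.tendsto_atTop
  have Gp : ∀ r > 0, G r ∈ Icc 0 (C * Em 0 (-n) r) := fun r hr =>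
    isClosed_Icc.mem_of_tendsto (hG r hr) (Eventually.of_forall fun k => gp (φ k) r hr)
  have gmeas : ∀ k, AEStronglyMeasurable (g k) (volume.restrict (Ioi 0)) := fun k => (gc k).aestronglyMeasurable measurableSet_Ioi
  have Gmeas : AEStronglyMeasurable G (volume.restrict (Ioi 0)) := by
    refine aestronglyMeasurable_of_tendsto_ae atTop (fun k => gmeas (φ k)) ?_
    filter_upwards [ae_restrict_mem measurableSet_Ioi] with r hr using hG r hr
  have gi := fun k => sg_int hn hp hC (gp k) (gmeas k)
  have Gi := sg_int hn hp hC Gp Gmeas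
  have m0 := fun k r (hr : 0 < r) => mI_bd hp hC (gp k) (gi k) hr
  have M0 := fun r (hr : 0 < r) => mI_bd hp hC Gp Gi hr
  -- convergence of masses
  have hI0 : Tendsto (fun k => ∫ r in Ioi (0:ℝ), |sinh r ^ n * g (φ k) r ^ p - sinh r ^ n * G r ^ p|) atTop (𝓝 0) := by
    have := tendsto_integral_of_dominated_convergence (μ := volume.restrict (Ioi (0:ℝ)))
      (F := fun k r => |sinh r ^ n * g (φ k) r ^ p - sinh r ^ n * G r ^ p|) (f := fun _ => 0)
      (fun r => 2 * (C ^ p * Em n (n - n * p) r)) (fun k => ((gi (φ k)).sub Gi).abs.aestronglyMeasurable)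
      (((Em_int (A := n) (D := n - n * p) (by linarith) (by nlinarith)).const_mul (C ^ p)).const_mul 2)
      (fun k => by
        filter_upwards [ae_restrict_mem measurableSet_Ioi] with r hr
        have h1 := sg_bd hp (gp (φ k)) hC hr
        have h2 := sg_bd hp Gp hC hr
        rw [Real.norm_eq_abs, abs_abs]
        exact (abs_sub _ _).trans (by linarith))
      (by
        filter_upwards [ae_restrict_mem measurableSet_Ioi] with r hr
        have h1 : Tendsto (fun k => g (φ k) r ^ p) atTop (𝓝 (G r ^ p)) := (hG r hr).rpow_const (Or.inr (by linarith))
        have := ((h1.const_mul (sinh r ^ n)).sub_const (sinh r ^ n * G r ^ p)).abs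
        simpa using this)
    simpa using this
  set I : ℕ → ℝ := fun k => ∫ r in Ioi (0:ℝ), |sinh r ^ n * g (φ k) r ^ p - sinh r ^ n * G r ^ p| with hI'
  have I0 : ∀ k, 0 ≤ I k := fun k => integral_nonneg fun _ => abs_nonneg _
  have mdiff : ∀ k, ∀ r > 0, |mI n p (g (φ k)) r - mI n p G r| ≤ I k := fun k r hr => by
    rw [mI_eq hr, mI_eq hr, ← integral_sub ((gi _).mono_set Ioc_subset_Ioi_self) (Gi.mono_set Ioc_subset_Ioi_self)]
    refine (abs_integral_le_integral_abs).trans ?_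
    exact setIntegral_mono_set ((gi (φ k)).sub Gi).abs (Eventually.of_forall fun _ => abs_nonneg _)
      (HasSubset.Subset.eventuallyLE Ioc_subset_Ioi_self)
  have mlim : ∀ r > 0, Tendsto (fun k => mI n p (g (φ k)) r) atTop (𝓝 (mI n p G r)) := fun r hr => by
    rw [tendsto_iff_dist_tendsto_zero]
    exact squeeze_zero (fun _ => dist_nonneg) (fun k => mdiff k r hr) hI0
  have Mm : ∀ r > 0, mI n p G r ∈ Icc 0 (C * Em (n + 1) 0 r) := fun r hr =>
    isClosed_Icc.mem_of_tendsto (mlim r hr) (Eventually.of_forall fun k => ⟨m0 _ r hr, gm _ r hr⟩)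
  have mS := fun k => mS_int hn (mI_ct (gi k)) fun r hr => ⟨m0 k r hr, gm k r hr⟩
  have MS := mS_int hn (mI_ct Gi) Mm
  -- uniform convergence of potentials
  set θ : ℝ := n / (n + 1) with hθ
  have θ0 : 0 < 1 - θ := by rw [hθ, one_sub_div (by linarith)]; ring_nf; positivity
  set J : ℕ → ℝ := fun k => C ^ θ * I k ^ (1 - θ) with hJ
  have hJ0 : Tendsto J atTop (𝓝 0) := by
    have := (hI0.rpow_const (p := 1 - θ) (Or.inr θ0.le)).const_mul (C ^ θ)
    rwa [zero_rpow θ0.ne', mul_zero] at this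
  have hdiff : ∀ k, ∀ r > 0, |hI n p (g (φ k)) r - hI n p G r| ≤ J k * (2 ^ n * Em 0 (-n) r) := fun k r hr => by
    have hs := Ioi_subset_Ioi hr.le
    rw [hI, hI, ← integral_sub ((mS _).mono_set hs) (MS.mono_set hs)]
    rw [← Real.norm_eq_abs]
    refine le_trans (norm_integral_le_of_norm_le (g := fun s => J k * Em 0 (-n) s) (((Em_int (by norm_num) (by linarith)).mono_set hs).const_mul _) ?_) ?_
    · filter_upwards [ae_restrict_mem measurableSet_Ioi] with s hs
      have s0 : 0 < s := hr.trans hs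
      have hS := pow_pos (sinh_pos s0) n
      rw [← sub_mul, Real.norm_eq_abs, abs_mul, abs_of_pos (inv_pos.2 hS)]
      have e1 := mdiff k s s0
      have e2 : |mI n p (g (φ k)) s - mI n p G s| ≤ C * Em (n + 1) 0 s := by
        have := m0 (φ k) s s0; have := gm (φ k) s s0; have := Mm s s0
        rw [abs_le]; constructor <;> linarith [this.1, this.2]
      have e3 : |mI n p (g (φ k)) s - mI n p G s| ≤ (C * Em (n + 1) 0 s) ^ θ * I k ^ (1 - θ) := by
        rcases (abs_nonneg (mI n p (g (φ k)) s - mI n p G s)).eq_or_lt with h | h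
        · rw [← h]; have := Em_pos (A := n + 1) (D := 0) s0; have := I0 k; positivity
        · calc _ = |mI n p (g (φ k)) s - mI n p G s| ^ θ * |mI n p (g (φ k)) s - mI n p G s| ^ (1 - θ) := by
                rw [← rpow_add h]; simp
            _ ≤ _ := by
                have : 0 ≤ θ := by positivity
                have := Em_pos (A := n + 1) (D := 0) s0
                have : 0 ≤ (C * Em (n + 1) 0 s) ^ θ := by positivity
                gcongr
      have e4 := Em_pos (A := n + 1) (D := 0) s0
      calc _ ≤ (C * Em (n + 1) 0 s) ^ θ * I k ^ (1 - θ) * (sinh s ^ n)⁻¹ := by gcongr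
        _ = C ^ θ * I k ^ (1 - θ) * (Em (n + 1) 0 s ^ θ * Em (-n) (-n) s) := by rw [mul_rpow hC.le e4.le, Em_S' s0]; ring
        _ = _ := by
          rw [Em_rpow s0, Em_mul s0, hJ, show θ * (n + 1) + -(n:ℝ) = 0 by rw [hθ]; field_simp; ring]; simp
    · rw [integral_const_mul]
      exact mul_mono_l (tail_int hn hr) (by have := I0 k; positivity)
  have hlim : ∀ r > 0, Tendsto (fun k => hI n p (g (φ k)) r) atTop (𝓝 (hI n p G r)) := fun r hr => by
    rw [tendsto_iff_dist_tendsto_zero]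
    refine squeeze_zero (fun _ => dist_nonneg) (fun k => hdiff k r hr) ?_
    simpa using hJ0.mul_const (2 ^ n * Em 0 (-n) r)
  have Geq : ∀ r > 0, G r = c * hI n p G r := fun r hr => by
    have h1 : Tendsto (fun k => g (φ k) r - c' (φ k) * hI n p (g (φ k)) r) atTop (𝓝 (G r - c * hI n p G r)) :=
      (hG r hr).sub ((cl.comp φl).mul (hlim r hr))
    have h2 : Tendsto (fun k => g (φ k) r - c' (φ k) * hI n p (g (φ k)) r) atTop (𝓝 0) := by
      refine squeeze_zero_norm (fun k => ge (φ k) r hr) ?_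
      simpa using (εl.comp φl).mul_const (E r)
    exact sub_eq_zero.1 (tendsto_nhds_unique h1 h2)
  have hd : ∀ r > 0, HasDerivAt (hI n p G) (-(mI n p G r * (sinh r ^ n)⁻¹)) r := fun r hr =>
    hI_d ((mI_ct Gi).mul Si_ct) MS hr
  have Gd : ∀ r > 0, HasDerivAt G (-(c * (mI n p G r * (sinh r ^ n)⁻¹))) r := fun r hr => by
    refine (((hd r hr).const_mul c).congr_of_eventuallyEq ?_).congr_deriv (by ring)
    filter_upwards [Ioi_mem_nhds hr] with x hx using Geq x hx
  have Gc : ContinuousOn G (Ioi 0) := fun r hr => (Gd r hr).continuousAt.continuousWithinAt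
  have sGc : ContinuousOn (fun s => sinh s ^ n * G s ^ p) (Ioi 0) :=
    S_ct.mul (Gc.rpow_const fun _ _ => Or.inr (by linarith))
  have Md : ∀ r > 0, HasDerivAt (mI n p G) (sinh r ^ n * G r ^ p) r := fun r hr =>
    intervalIntegral.integral_hasDerivAt_right ((intervalIntegrable_iff_integrableOn_Ioc_of_le hr.le).2 (Gi.mono_set Ioc_subset_Ioi_self))
      (sGc.stronglyMeasurableAtFilter isOpen_Ioi r hr) (sGc.continuousAt (Ioi_mem_nhds hr))
  -- nontrivial
  have hnt : ∃ r0 > 0, 0 < G r0 := by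
    by_contra hh
    push Not at hh
    have hz : ∀ r > 0, G r = 0 := fun r hr => le_antisymm (hh r hr) (Gp r hr).1
    have := tendsto_integral_of_dominated_convergence (μ := volume.restrict (Ioi (0:ℝ)))
      (F := fun k r => sinh r ^ n * g (φ k) r ^ (p + 1)) (f := fun _ => 0)
      (fun r => C ^ (p + 1) * Em n (n - n * (p + 1)) r)
      (fun k => (sg_int hn (by linarith) hC (gp (φ k)) (gmeas _)).aestronglyMeasurable)
      ((Em_int (A := n) (D := n - n * (p + 1)) (by linarith) (by nlinarith)).const_mul _)
      (fun k => by
        filter_upwards [ae_restrict_mem measurableSet_Ioi] with r hr using sg_bd (by linarith) (gp (φ k)) hC hr)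
      (by
        filter_upwards [ae_restrict_mem measurableSet_Ioi] with r hr
        have h1 : Tendsto (fun k => g (φ k) r ^ (p + 1)) atTop (𝓝 (G r ^ (p + 1))) := (hG r hr).rpow_const (Or.inr (by linarith))
        rw [hz r hr, zero_rpow (by linarith)] at h1
        simpa using h1.const_mul (sinh r ^ n))
    rw [integral_zero] at this
    have := ge_of_tendsto this (Eventually.of_forall fun k => gy (φ k))
    linarith
  obtain ⟨r0, hr0, G0⟩ := hnt
  have Ganti : ∀ r > 0, ∀ r' ≥ r, G r' ≤ G r := fun r hr r' hr' => by
    have := mono_Ioi (fun r hr => (Gd r hr).neg) (fun r hr => by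
      have := (Mm r hr).1; have := sinh_pos hr
      rw [neg_neg]; positivity) hr (lt_of_lt_of_le hr hr' : 0 < r') hr'
    simp only [Pi.neg_apply] at this
    linarith
  have Mpos : ∀ r > 0, 0 < mI n p G r := by
    have Mmono : MonotoneOn (mI n p G) (Ioi 0) := mono_Ioi Md fun r hr => by
      have := (Gp r hr).1; have := sinh_pos hr; positivity
    have Ms : StrictMonoOn (mI n p G) (Ioc 0 r0) := smono (convex_Ioc 0 r0) (fun r hr => Md r hr.1) fun r hr => by
      rw [interior_Ioc] at hr
      have := G0.trans_le (Ganti r hr.1 r0 hr.2.le); have := sinh_pos hr.1; positivity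
    intro r hr
    have hm : 0 < min r r0 := lt_min hr hr0
    have h1 := Ms (a := min r r0 / 2) (b := min r r0) ⟨by linarith, by linarith [min_le_right r r0]⟩ ⟨hm, min_le_right _ _⟩ (by linarith)
    exact ((M0 _ (by linarith)).trans_lt h1).trans_le (Mmono hm hr (min_le_left _ _))
  have Gpos : ∀ r > 0, 0 < G r := fun r hr => by
    have := smono (convex_Ioi 0) (fun r hr => (Gd r hr).neg) (fun r hr => by
      have hr := interior_subset hr
      have := Mpos r hr; have := sinh_pos hr
      rw [neg_neg]; positivity) hr (by simp; linarith : r + 1 ∈ Ioi 0) (by linarith)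
    simp only [Pi.neg_apply] at this
    linarith [(Gp (r + 1) (by linarith)).1]
  have hP : Prof n p c G (mI n p G) := ⟨hn, hp, hc, sub, Gpos, Gd, Md, C, hC, fun r hr => ⟨(Gp r hr).2, Mpos r hr, (Mm r hr).2⟩⟩
  have hu := hP.uniq hV
  have hev : ∀ᶠ k in atTop, J k * 2 ^ n < δ := by
    have := hJ0.mul_const (2 ^ n)
    rw [zero_mul] at this
    exact this.eventually_lt_const hδ
  obtain ⟨k, hk⟩ := hev.exists
  obtain ⟨r, hr, hlt⟩ := bad (φ k)
  have h1 := hdiff k r hr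
  rw [← hu r hr, Geq r hr, mul_div_cancel_left₀ _ hc.ne'] at hlt
  have e := Em_pos' n hr
  nlinarith

lemma mI_scale {n : ℕ} {p x r : ℝ} {g : ℝ → ℝ} (hg : ∀ s > 0, 0 ≤ g s) (hx : 0 ≤ x) (hr : 0 < r) :
    mI n p (fun s => g s * x) r = mI n p g r * x ^ p := by
  rw [mI_eq hr, mI_eq hr, ← integral_mul_const]
  refine setIntegral_congr_fun measurableSet_Ioc fun s hs => ?_
  rw [mul_rpow (hg s hs.1) hx]; ring

lemma hI_scale {n : ℕ} {p x r : ℝ} {g : ℝ → ℝ} (hg : ∀ s > 0, 0 ≤ g s) (hx : 0 ≤ x) (hr : 0 < r) :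
    hI n p (fun s => g s * x) r = hI n p g r * x ^ p := by
  rw [hI, hI, ← integral_mul_const]
  refine setIntegral_congr_fun measurableSet_Ioi fun s hs => ?_
  rw [mI_scale hg hx (hr.trans hs)]; ring

section
variable {n : ℕ} {p a T κ : ℝ} {f : ℝ → ℝ → ℝ} {V W : ℝ → ℝ}

lemma Exs.mS (h : Exs n p κ a T f) {t : ℝ} (ht : t ∈ Ioo a T) : IntegrableOn (fun r => Mf n p f r t * (sinh r ^ n)⁻¹) (Ioi 0) := by
  obtain ⟨C, hC, hb⟩ := h.bd3
  exact mS_int h.sol.hn (h.sol.M_ct ht) fun r hr => ⟨(h.sol.M0 hr ht).le, (hb t ht r hr).2.2⟩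

lemma Exs.H_d (h : Exs n p κ a T f) {t r : ℝ} (ht : t ∈ Ioo a T) (hr : 0 < r) :
    HasDerivAt (hI n p fun s => f s t) (-(Mf n p f r t * (sinh r ^ n)⁻¹)) r :=
  hI_d ((h.sol.M_ct ht).mul Si_ct) (h.mS ht) hr

lemma Exs.H_nonneg (h : Exs n p κ a T f) {t r : ℝ} (ht : t ∈ Ioo a T) (hr : 0 < r) : 0 ≤ hI n p (fun s => f s t) r :=
  setIntegral_nonneg measurableSet_Ioi fun s hs => by
    have s0 : 0 < s := hr.trans hs
    exact mul_nonneg (h.sol.M0 s0 ht).le (inv_nonneg.2 (pow_pos (sinh_pos s0) n).le)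

lemma Exs.H_inf (h : Exs n p κ a T f) {t : ℝ} (ht : t ∈ Ioo a T) : Tendsto (hI n p fun s => f s t) atTop (𝓝 0) := by
  obtain ⟨C, hC, hb⟩ := h.bd3
  have n1 := h.n1
  have h1 : Tendsto (fun r => C * (2 ^ n * Em 0 (-n) r)) atTop (𝓝 0) := by
    simpa using ((Em_lim (D := -n) (by linarith)).const_mul (2 ^ n)).const_mul C
  refine squeeze_zero' ?_ ?_ h1
  · filter_upwards [eventually_gt_atTop 0] with r hr using h.H_nonneg ht hr
  · filter_upwards [eventually_gt_atTop 0] with r hr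
    have hs := Ioi_subset_Ioi hr.le
    refine le_trans ?_ (mul_mono_l (tail_int h.sol.hn hr) hC.le)
    rw [← integral_const_mul]
    refine setIntegral_mono_on ((h.mS ht).mono_set hs) (((Em_int (by norm_num) (by linarith)).mono_set hs).const_mul _) measurableSet_Ioi fun s hs => ?_
    have s0 : 0 < s := hr.trans hs
    refine (le_abs_self _).trans ((mS_bd (M := fun r => Mf n p f r t) s0 ⟨(h.sol.M0 s0 ht).le, (hb t ht s s0).2.2⟩).trans ?_)
    exact mul_mono_l (Em_le s0 (by norm_num) le_rfl) hC.le

lemma Exs.H_diff (h : Exs n p κ a T f) {t1 t2 r : ℝ} (h1 : t1 ∈ Ioo a T) (h2 : t2 ∈ Ioo a T) (h12 : t1 ≤ t2) (hr : 0 < r) :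
    hI n p (fun s => f s t1) r - hI n p (fun s => f s t2) r = ∫ s in t1..t2, f r s := by
  have hM : ∀ r > 0, Mf n p f r t2 - Mf n p f r t1 = sinh r ^ n * ∫ s in t1..t2, pr f r s := fun r hr => by
    rw [← intervalIntegral.integral_const_mul]
    refine (intervalIntegral.integral_eq_sub_of_hasDerivAt (fun t ht => h.sol.M_t hr ?_) ?_).symm
    · rw [uIcc_of_le h12] at ht; exact ⟨h1.1.trans_le ht.1, ht.2.trans_lt h2.2⟩
    · exact (h.sol.sm.Pr.int_t hr h1 h2).const_mul _
  have hd : ∀ r > 0, HasDerivAt (fun r => hI n p (fun s => f s t1) r - hI n p (fun s => f s t2) r - ∫ s in t1..t2, f r s) 0 r := fun r hr => by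
    refine (((h.H_d h1 hr).sub (h.H_d h2 hr)).sub (h.sol.sm.hint hr h1 h2)).congr_deriv ?_
    have := hM r hr
    have hS := S_ne (n := n) hr
    have e : Mf n p f r t2 = Mf n p f r t1 + sinh r ^ n * ∫ s in t1..t2, pr f r s := by linarith
    rw [e]; field_simp; ring
  have hl : Tendsto (fun r => hI n p (fun s => f s t1) r - hI n p (fun s => f s t2) r - ∫ s in t1..t2, f r s) atTop (𝓝 0) := by
    simpa using ((h.H_inf h1).sub (h.H_inf h2)).sub (h.sol.W_lim h1 h2 h12)
  have a1 := mono_le_lim (mono_Ioi hd fun _ _ => le_rfl) hl hr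
  have a2 := mono_le_lim (mono_Ioi (fun r hr => (hd r hr).neg) fun _ _ => by simp) (L := 0) (neg_zero (G := ℝ) ▸ hl.neg) hr
  simp only [Pi.neg_apply] at a2
  linarith

lemma Exs.H_anti (h : Exs n p κ a T f) {t1 t2 r : ℝ} (h1 : t1 ∈ Ioo a T) (h2 : t2 ∈ Ioo a T) (h12 : t1 ≤ t2) (hr : 0 < r) :
    hI n p (fun s => f s t2) r ≤ hI n p (fun s => f s t1) r := by
  have e := h.H_diff h1 h2 h12 hr
  have : 0 ≤ ∫ s in t1..t2, f r s := intervalIntegral.integral_nonneg h12 fun s hs =>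
    (h.sol.pos hr ⟨h1.1.trans_le hs.1, hs.2.trans_lt h2.2⟩).le
  linarith

lemma Exs.fH (h : Exs n p κ a T f) {α e t : ℝ} (hα : 0 < α) (hα' : (n:ℝ) - 1 ≤ α) (ht : t ∈ Ioo a T) (he : 0 < e)
    (hle : eE n f t - yE n p f t ^ 2 / νE n p f t ≤ e) {r : ℝ} (hr : 0 < r) :
    |f r t - yE n p f t / νE n p f t * hI n p (fun s => f s t) r| ≤ √(e * (min α n)⁻¹) * Em (-(α / 2)) (-(n / 2)) r := by
  have hν : 0 < νE n p f t := ipos (h.i_ν ht).1 fun r hr => by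
    have := h.sol.M0 hr ht; have := sinh_pos hr; positivity
  set c := yE n p f t / νE n p f t with hc
  obtain ⟨i1, i2⟩ := h.sq_int ht c
  have hle' : ∫ r in Ioi (0:ℝ), (pr f r t + c * (Mf n p f r t * (sinh r ^ n)⁻¹)) ^ 2 * sinh r ^ n ≤ e := by
    rw [i2]; refine le_trans (le_of_eq ?_) hle
    rw [hc]; field_simp; ring
  have d1 : ∀ r > 0, HasDerivAt (fun r => f r t - c * hI n p (fun s => f s t) r) (pr f r t + c * (Mf n p f r t * (sinh r ^ n)⁻¹)) r := fun r hr =>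
    ((h.sol.sm.hr hr ht).sub ((h.H_d ht hr).const_mul c)).congr_deriv (by ring)
  have l1 : Tendsto (fun r => f r t - c * hI n p (fun s => f s t) r) atTop (𝓝 0) := by
    simpa using (h.f_inf ht).sub ((h.H_inf ht).const_mul c)
  have ct : ContinuousOn (fun r => pr f r t + c * (Mf n p f r t * (sinh r ^ n)⁻¹)) (Ioi 0) :=
    (h.sol.sm.Pr.cont_r ht).add (((h.sol.M_ct ht).mul Si_ct).const_smul c)
  rw [abs_le']
  constructor
  · exact H1_decay h.sol.hn hα hα' d1 ct i1 he hle' (fun ε hε => (l1.eventually_lt_const hε).frequently) hr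
  · refine H1_decay h.sol.hn hα hα' (v := fun r => -(f r t - c * hI n p (fun s => f s t) r)) (fun r hr => (d1 r hr).neg) ct.neg ?_ he ?_ (fun ε hε => ?_) hr
    · simpa only [neg_sq] using i1
    · simpa only [neg_sq] using hle'
    · have l2 := l1.neg
      rw [neg_zero] at l2
      exact (l2.eventually_lt_const hε).frequently

theorem Exs.good (h : Exs n p κ a T f) (hV : Prof n p (p * κ) V W) {ε : ℝ} (hε : 0 < ε) :
    ∃ δ > 0, ∀ᶠ ξ in 𝓝[<] T, eE n f ξ - yE n p f ξ ^ 2 / νE n p f ξ ≤ δ * (T - ξ) ^ (2 * κ) →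
      ∀ r > 0, |hI n p (fun s => f s ξ) r - (T - ξ) ^ (p * κ) * (V r / (p * κ))| ≤ ε * (T - ξ) ^ (p * κ) * Em 0 (-n) r := by
  obtain ⟨K, od⟩ := h.od
  obtain ⟨t1, ht1, c1, hc1, C1, hC1, o1, o2, -, -⟩ := od.main
  obtain ⟨t2, ht2, C, hC, hsh⟩ := h.sharp
  obtain ⟨α, hα, hα', -, -⟩ := alpha_exists h.sol.hn h.sol.hp h.sub
  have n1 := h.n1
  have hp := h.sol.hp
  by_contra hcon
  push Not at hcon
  have hx : ∀ k : ℕ, ∃ ξ, ξ ∈ Ioo (max t1 t2) T ∧ T - 1 / ((k:ℝ) + 1) < ξ ∧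
      eE n f ξ - yE n p f ξ ^ 2 / νE n p f ξ ≤ 1 / ((k:ℝ) + 1) * (T - ξ) ^ (2 * κ) ∧
      ∃ r > 0, ε * (T - ξ) ^ (p * κ) * Em 0 (-n) r < |hI n p (fun s => f s ξ) r - (T - ξ) ^ (p * κ) * (V r / (p * κ))| := fun k => by
    have hk : 0 < 1 / ((k:ℝ) + 1) := by positivity
    obtain ⟨ξ, ⟨h1, h2⟩, h3, h4⟩ := (((hcon _ hk).and_eventually
      (Ioo_mem_nhdsLT (show max t1 t2 < T from max_lt ht1.2 ht2.2))).and_eventually (Ioo_mem_nhdsLT (show T - 1 / ((k:ℝ) + 1) < T by linarith))).exists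
    exact ⟨ξ, h2, h3, h1⟩
  choose ξ hξ hξk hξe hξb using hx
  have l0 : ∀ k, 0 < T - ξ k := fun k => by linarith [(hξ k).2]
  have ξ1 : ∀ k, ξ k ∈ Ioo t1 T := fun k => ⟨(le_max_left _ _).trans_lt (hξ k).1, (hξ k).2⟩
  have ξ2 : ∀ k, ξ k ∈ Ioo t2 T := fun k => ⟨(le_max_right _ _).trans_lt (hξ k).1, (hξ k).2⟩
  have ξa : ∀ k, ξ k ∈ Ioo a T := fun k => ⟨ht1.1.trans (ξ1 k).1, (hξ k).2⟩
  have ξT : Tendsto ξ atTop (𝓝[<] T) := by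
    refine tendsto_nhdsWithin_iff.2 ⟨?_, Eventually.of_forall fun k => (hξ k).2⟩
    have h1 : Tendsto (fun k : ℕ => T - 1 / ((k:ℝ) + 1)) atTop (𝓝 T) := by
      simpa using tendsto_one_div_add_atTop_nhds_zero_nat.const_sub T
    exact tendsto_of_tendsto_of_tendsto_of_le_of_le h1 tendsto_const_nhds (fun k => (hξk k).le) fun k => (hξ k).2.le
  set x : ℕ → ℝ := fun k => ((T - ξ k) ^ κ)⁻¹ with hxd
  have x0 : ∀ k, 0 < x k := fun k => inv_pos.2 (rpow_pos_of_pos (l0 k) _)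
  have xp : ∀ k q, x k ^ q = ((T - ξ k) ^ (q * κ))⁻¹ := fun k q => by
    rw [hxd, Real.inv_rpow (rpow_pos_of_pos (l0 k) _).le, ← rpow_mul (l0 k).le, mul_comm]
  have fp : ∀ k, ∀ s > 0, 0 ≤ f s (ξ k) := fun k s hs => (h.sol.pos hs (ξa k)).le
  have xk : ∀ k, (T - ξ k) ^ κ * x k = 1 := fun k => mul_inv_cancel₀ (rpow_pos_of_pos (l0 k) _).ne'
  have hκ0 := h.sol.κ0 h.hκ
  refine cpt (g := fun k s => f s (ξ k) * x k) (c := p * κ) (C := C) (V := V) (W := W) (y0 := c1) (δ := ε)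
    (c' := fun k => (T - ξ k) * (yE n p f (ξ k) / νE n p f (ξ k)))
    (ε := fun k => √(1 / ((k:ℝ) + 1) * (min α n)⁻¹)) (E := Em (-(α / 2)) (-(n / 2))) (L := fun r => C * (sinh r ^ n)⁻¹)
    h.sol.hn hp h.sub hV.hc hC ?_ ?_ ?_ ?_ ?_ ?_ ?_ hc1 ?_ hV hε ?_
  · intro k r hr
    refine ⟨mul_nonneg (fp k r hr) (x0 k).le, ?_⟩
    calc _ ≤ C * (T - ξ k) ^ κ * Em 0 (-n) r * x k := mul_mono_r (hsh _ (ξ2 k) r hr).1 (x0 k).le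
      _ = C * Em 0 (-n) r * ((T - ξ k) ^ κ * x k) := by ring
      _ = _ := by rw [xk, mul_one]
  · exact fun k => (h.sol.sm.cont_r (ξa k)).mul continuousOn_const
  · intro k r hr y hy z hz
    refine (convex_Ici r).norm_image_sub_le_of_norm_hasDerivWithin_le (f := fun s => f s (ξ k) * x k)
      (fun w hw => ((h.sol.sm.hr (lt_of_lt_of_le hr hw) (ξa k)).mul_const (x k)).hasDerivWithinAt) (fun w hw => ?_) hz hy
    have w0 : 0 < w := lt_of_lt_of_le hr hw
    have hS := pow_pos (sinh_pos w0) n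
    have hS' := pow_pos (sinh_pos hr) n
    have hb := (hsh _ (ξ2 k) w w0).2.1
    rw [abs_mul, abs_of_pos hS] at hb
    rw [Real.norm_eq_abs, abs_mul, abs_of_pos (x0 k)]
    have h3 : |pr f w (ξ k)| ≤ C * (T - ξ k) ^ κ * (sinh w ^ n)⁻¹ := by
      rw [← div_eq_mul_inv, le_div_iff₀ hS]; linarith
    calc _ ≤ C * (T - ξ k) ^ κ * (sinh w ^ n)⁻¹ * x k := mul_mono_r h3 (x0 k).le
      _ = C * (sinh w ^ n)⁻¹ * ((T - ξ k) ^ κ * x k) := by ring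
      _ = C * (sinh w ^ n)⁻¹ := by rw [xk, mul_one]
      _ ≤ _ := by
        have := sinh_pos hr
        have : sinh r ≤ sinh w := sinh_le_sinh.2 hw
        gcongr
  · intro k r hr
    rw [mI_scale (fp k) (x0 k).le hr, xp]
    rw [← div_eq_mul_inv, div_le_iff₀ (rpow_pos_of_pos (l0 k) _)]
    have := (hsh _ (ξ2 k) r hr).2.2
    calc _ ≤ _ := this
      _ = _ := by ring
  · intro k r hr
    have hl : (0:ℝ) < 1 / ((k:ℝ) + 1) * (T - ξ k) ^ (2 * κ) := by have := l0 k; positivity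
    have := h.fH hα hα' (ξa k) hl (hξe k) hr
    rw [hI_scale (fp k) (x0 k).le hr, xp]
    have e1 : f r (ξ k) * x k - (T - ξ k) * (yE n p f (ξ k) / νE n p f (ξ k)) * (hI n p (fun s => f s (ξ k)) r * ((T - ξ k) ^ (p * κ))⁻¹)
        = (f r (ξ k) - yE n p f (ξ k) / νE n p f (ξ k) * hI n p (fun s => f s (ξ k)) r) * x k := by
      have : (T - ξ k) ^ (p * κ) = (T - ξ k) ^ κ * (T - ξ k) := by rw [h.pκ, rpow_add_one (l0 k).ne']
      rw [this, hxd]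
      have := (rpow_pos_of_pos (l0 k) κ).ne'
      have := (l0 k).ne'
      simp only
      generalize yE n p f (ξ k) / νE n p f (ξ k) = c
      field_simp
    rw [e1, abs_mul, abs_of_pos (x0 k)]
    have e2 : √(1 / ((k:ℝ) + 1) * (T - ξ k) ^ (2 * κ) * (min α n)⁻¹) = √(1 / ((k:ℝ) + 1) * (min α n)⁻¹) * (T - ξ k) ^ κ := by
      rw [mul_right_comm, sqrt_mul (by positivity), mul_comm 2 κ, rpow_mul (l0 k).le,
        show ((T - ξ k) ^ κ) ^ (2:ℝ) = ((T - ξ k) ^ κ) ^ 2 by norm_cast, sqrt_sq (rpow_pos_of_pos (l0 k) _).le]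
    calc _ ≤ _ := mul_mono_r this (x0 k).le
      _ = √(1 / ((k:ℝ) + 1) * (min α n)⁻¹) * Em (-(α / 2)) (-(n / 2)) r * ((T - ξ k) ^ κ * x k) := by rw [e2]; ring
      _ = _ := by rw [xk, mul_one]
  · exact o2.comp ξT
  · have := ((tendsto_one_div_add_atTop_nhds_zero_nat (𝕜 := ℝ)).mul_const (min α n)⁻¹).sqrt
    simpa using this
  · intro k
    have e : ∫ r in Ioi (0:ℝ), sinh r ^ n * (f r (ξ k) * x k) ^ (p + 1) = yE n p f (ξ k) * x k ^ (p + 1) := by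
      rw [yE, ← integral_mul_const]
      refine setIntegral_congr_fun measurableSet_Ioi fun s hs => ?_
      rw [mul_rpow (fp k s hs) (x0 k).le]; ring
    rw [e, xp, ← div_eq_mul_inv, le_div_iff₀ (rpow_pos_of_pos (l0 k) _)]
    exact (o1 _ ⟨(ξ1 k).1.le, (ξ1 k).2⟩).1
  · intro k
    obtain ⟨r, hr, hb⟩ := hξb k
    refine ⟨r, hr, ?_⟩
    rw [hI_scale (fp k) (x0 k).le hr, xp]
    have hl := rpow_pos_of_pos (l0 k) (p * κ)
    have e : hI n p (fun s => f s (ξ k)) r * ((T - ξ k) ^ (p * κ))⁻¹ - V r / (p * κ)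
        = (hI n p (fun s => f s (ξ k)) r - (T - ξ k) ^ (p * κ) * (V r / (p * κ))) * ((T - ξ k) ^ (p * κ))⁻¹ := by
      rw [sub_mul, mul_comm ((T - ξ k) ^ (p * κ)) (V r / (p * κ)), mul_inv_cancel_right₀ hl.ne']
    rw [e, abs_mul, abs_of_pos (inv_pos.2 hl), ← div_eq_mul_inv, lt_div_iff₀ hl]
    linarith
end

section
variable {n : ℕ} {p a T κ : ℝ} {f : ℝ → ℝ → ℝ} {V W : ℝ → ℝ}

set_option maxHeartbeats 1000000 in
theorem Exs.Hconv (h : Exs n p κ a T f) (hV : Prof n p (p * κ) V W) {ε : ℝ} (hε : 0 < ε) :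
    ∀ᶠ t in 𝓝[<] T, ∀ r > 0, |hI n p (fun s => f s t) r - (T - t) ^ (p * κ) * (V r / (p * κ))| ≤
      ε * (T - t) ^ (p * κ) * Em 0 (-n) r := by
  obtain ⟨K, od⟩ := h.od
  obtain ⟨-, -, -, -, -, -, -, -, -, o4⟩ := od.main
  obtain ⟨CV, hCV, bV⟩ := hV.bd
  have pk := hV.hc
  set CX := CV / (p * κ) with hCX
  have CX0 : 0 < CX := by positivity
  have bX : ∀ r > 0, V r / (p * κ) ≤ CX * Em 0 (-n) r := fun r hr => by
    rw [hCX, div_mul_eq_mul_div]; exact div_le_div_of_nonneg_right (bV r hr).1 pk.le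
  obtain ⟨δ, hδ, hg⟩ := h.good hV (show 0 < ε / 4 by positivity)
  set η := min 1 (ε / (2 * CX)) with hη
  have η0 : 0 < η := lt_min one_pos (by positivity)
  have η1 : η ≤ 1 := min_le_left _ _
  have η2 : η * CX ≤ ε / 2 := by
    have := min_le_right 1 (ε / (2 * CX))
    calc η * CX ≤ ε / (2 * CX) * CX := by gcongr
      _ = ε / 2 := by field_simp
  set q : ℝ := (1 + η)⁻¹ ^ (p * κ)⁻¹ with hq
  have i0 : 0 < (1 + η)⁻¹ := by positivity
  have i1 : (1 + η)⁻¹ < 1 := inv_lt_one_of_one_lt₀ (by linarith)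
  have q0 : 0 < q := rpow_pos_of_pos i0 _
  have q1 : q < 1 := rpow_lt_one i0.le i1 (by positivity)
  have qp : q ^ (p * κ) = (1 + η)⁻¹ := by rw [hq, Real.rpow_inv_rpow i0.le pk.ne']
  clear_value q η
  have hg2 := o4 q ⟨q0, q1⟩ (δ * q ^ (2 * κ)) (by positivity)
  rw [eventually_iff, mem_nhdsLT_iff_exists_Ioo_subset] at hg hg2
  obtain ⟨g1, g1T, hg⟩ := hg
  obtain ⟨g2, g2T, hg2⟩ := hg2
  set g := max a (max g1 g2) with hgd
  have gT : g < T := max_lt h.aT (max_lt g1T g2T)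
  have ga : a ≤ g := le_max_left _ _
  have gg1 : g1 ≤ g := (le_max_left _ _).trans (le_max_right _ _)
  have gg2 : g2 ≤ g := (le_max_right _ _).trans (le_max_right _ _)
  clear_value g
  -- good time after any s
  have key : ∀ s ∈ Ioo g T, ∃ ξ ∈ Ioo s (T - q * (T - s)), ∀ r > 0, |hI n p (fun s => f s ξ) r - (T - ξ) ^ (p * κ) * (V r / (p * κ))| ≤
      ε / 4 * (T - ξ) ^ (p * κ) * Em 0 (-n) r := fun s hs => by
    have s1 : g1 < s := gg1.trans_lt hs.1
    have s2 : g2 < s := gg2.trans_lt hs.1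
    obtain ⟨ξ, hξ, he⟩ := hg2 ⟨s2, hs.2⟩
    refine ⟨ξ, hξ, ?_⟩
    have ls : 0 < T - s := by linarith [hs.2]
    have lx : q * (T - s) < T - ξ := by linarith [hξ.2]
    have ξT : ξ < T := by have := mul_pos q0 ls; linarith
    have hκ0 := h.sol.κ0 h.hκ
    refine hg ⟨s1.trans hξ.1, ξT⟩ (he.trans ?_)
    rw [mul_assoc, ← mul_rpow q0.le ls.le]
    have : 0 < q * (T - s) := by positivity
    gcongr
  have hq1 : q * (T - g) < T - g := mul_lt_of_lt_one_left (by linarith) q1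
  filter_upwards [Ioo_mem_nhdsLT (show T - q * (T - g) < T by have := mul_pos q0 (sub_pos.2 gT); linarith)] with t ht r hr
  have lt : 0 < T - t := by linarith [ht.2]
  have gt : g < t := by linarith [ht.1]
  have ta : t ∈ Ioo a T := ⟨by linarith, ht.2⟩
  have b0 := Em_pos' n hr
  have X0 : 0 < V r / (p * κ) := div_pos (hV.pos r hr) pk
  have hX := bX r hr
  set X := V r / (p * κ) with hXd
  set b := Em 0 (-n) r with hbd
  set H := hI n p (fun s => f s t) r
  have L0 : 0 < (T - t) ^ (p * κ) := rpow_pos_of_pos lt _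
  clear_value X b
  have hη3 : (1 + η)⁻¹ * (1 + η) = 1 := inv_mul_cancel₀ (by positivity)
  have xb : η * X ≤ ε / 2 * b := (mul_mono_l hX η0.le).trans (by
    rw [← mul_assoc]; exact mul_mono_r η2 b0.le)
  have εb := mul_pos hε b0
  rw [abs_le]
  constructor
  · obtain ⟨ξ, hξ, he⟩ := key t ⟨gt, ht.2⟩
    have lx : q * (T - t) < T - ξ := by linarith [hξ.2]
    have ξT : ξ < T := by have := mul_pos q0 lt; linarith
    have hH := h.H_anti ta ⟨ta.1.trans hξ.1, ξT⟩ hξ.1.le hr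
    have he := (abs_le.1 (he r hr)).1
    rw [← hXd, ← hbd] at he
    have hl : (1 + η)⁻¹ * (T - t) ^ (p * κ) ≤ (T - ξ) ^ (p * κ) := by
      rw [← qp, ← mul_rpow q0.le lt.le]
      have : 0 < q * (T - t) := by positivity
      gcongr
    have H0 : 0 ≤ H := h.H_nonneg ta hr
    have hP : (T - ξ) ^ (p * κ) * (X - ε / 4 * b) ≤ H := by linarith
    by_cases hs : X - ε / 4 * b ≤ 0
    · have := mul_mono_l (show X ≤ ε * b by linarith) L0.le
      linarith
    · push Not at hs
      have h1 := (mul_mono_r hl hs.le).trans hP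
      have h2 : (1 - η) ≤ (1 + η)⁻¹ := by
        rw [← one_div, le_div_iff₀ (by linarith)]; have := mul_self_nonneg η; linarith
      have h3 : (1 - η) * ((T - t) ^ (p * κ) * (X - ε / 4 * b)) ≤ H := by
        refine le_trans ?_ h1
        rw [mul_assoc]
        exact mul_mono_r h2 (mul_pos L0 hs).le
      have h4 : X - ε * b ≤ (1 - η) * (X - ε / 4 * b) := by
        have : 0 ≤ η * (ε / 4 * b) := by positivity
        linarith
      have := mul_mono_l h4 L0.le
      linarith
  · obtain ⟨ξ, hξ, he⟩ := key (T - (T - t) / q) ⟨by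
      have : (T - t) / q < T - g := by rw [div_lt_iff₀ q0]; linarith [ht.1]
      linarith, by have : 0 < (T - t) / q := by positivity
                   linarith⟩
    have e1 : q * (T - (T - (T - t) / q)) = T - t := by field_simp; ring
    rw [e1] at hξ
    have ξt : ξ < t := by linarith [hξ.2]
    have ξa : a < ξ := by
      have : (T - t) / q < T - g := by rw [div_lt_iff₀ q0]; linarith [ht.1]
      linarith [hξ.1]
    have hH := h.H_anti ⟨ξa, by linarith⟩ ta ξt.le hr
    have he := (abs_le.1 (he r hr)).2
    rw [← hXd, ← hbd] at he
    have lξ : 0 < T - ξ := by linarith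
    have hl : (1 + η)⁻¹ * (T - ξ) ^ (p * κ) ≤ (T - t) ^ (p * κ) := by
      rw [← qp, ← mul_rpow q0.le lξ.le]
      have : 0 < q * (T - ξ) := by positivity
      have : q * (T - ξ) ≤ T - t := by
        have := mul_lt_mul_of_pos_left hξ.1 q0
        have e2 : q * ((T - t) / q) = T - t := by field_simp
        linarith
      gcongr
    have hl' : (T - ξ) ^ (p * κ) ≤ (1 + η) * (T - t) ^ (p * κ) := by
      rw [inv_mul_le_iff₀ (by linarith)] at hl; exact hl
    have hs : 0 < X + ε / 4 * b := by positivity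
    have h1 := mul_mono_r hl' hs.le
    have h4 : (1 + η) * (X + ε / 4 * b) ≤ X + ε * b := by
      have : η * (ε / 4 * b) ≤ 1 * (ε / 4 * b) := by gcongr
      linarith
    have := mul_mono_l h4 L0.le
    linarith

set_option maxHeartbeats 2000000 in
theorem Exs.fconv (h : Exs n p κ a T f) (hV : Prof n p (p * κ) V W) {ε : ℝ} (hε : 0 < ε) :
    ∀ᶠ t in 𝓝[<] T, ∀ r > 0, |f r t - (T - t) ^ κ * V r| ≤ ε * (T - t) ^ κ * Em 0 (-n) r := by
  obtain ⟨CV, hCV, bV⟩ := hV.bd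
  obtain ⟨t2, ht2, C, hC, hsh⟩ := h.sharp
  have pk := hV.hc
  have κ0 := h.sol.κ0 h.hκ
  set CX := CV / (p * κ) with hCX
  have CX0 : 0 < CX := by positivity
  have bX : ∀ r > 0, V r / (p * κ) ≤ CX * Em 0 (-n) r := fun r hr => by
    rw [hCX, div_mul_eq_mul_div]; exact div_le_div_of_nonneg_right (bV r hr).1 pk.le
  set δ := ε / 3 with hδ
  have δ0 : 0 < δ := by positivity
  set η := δ / CX with hη
  have η0 : 0 < η := by positivity
  have ηC : η * CX = δ := by rw [hη]; field_simp
  clear_value δ η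
  have hder : HasDerivAt (fun x : ℝ => (1 + x) ^ (p * κ)) (p * κ) 0 := by
    have := (((hasDerivAt_id (0:ℝ)).const_add 1).rpow_const (p := p * κ) (Or.inl (by simp)))
    simpa using this
  have hlo := hder.isLittleO.def η0
  simp only [add_zero, one_rpow, sub_zero, smul_eq_mul, Real.norm_eq_abs] at hlo
  rw [Metric.eventually_nhds_iff] at hlo
  obtain ⟨q1, hq1, hlo⟩ := hlo
  set q := min q1 1 / 2 with hq
  have m0 : 0 < min q1 1 := lt_min hq1 one_pos
  have q0 : 0 < q := by positivity
  have qq : q < q1 := by have := min_le_left q1 1; linarith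
  have ql : q < 1 := by have := min_le_right q1 1; linarith
  clear_value q
  have lo1 := hlo (y := q) (by simp [abs_of_pos q0, qq])
  have lo2 := hlo (y := -q) (by simp [abs_of_pos q0, qq])
  rw [abs_neg] at lo2
  rw [abs_of_pos q0] at lo1 lo2
  set Pp := (1 + q) ^ (p * κ) with hPp
  set Pm := (1 + -q) ^ (p * κ) with hPm
  have Pp0 : 0 < Pp := rpow_pos_of_pos (by linarith) _
  have Pm0 : 0 < Pm := rpow_pos_of_pos (by linarith) _
  have Pm1 : Pm ≤ 1 := rpow_le_one (by linarith) (by linarith) pk.le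
  have Pp1 : 1 ≤ Pp := one_le_rpow (by linarith) pk.le
  set ε' := δ * q / (Pp + 1) with hε'
  have ε'0 : 0 < ε' := by positivity
  have εe : ε' * (Pp + 1) = δ * q := by rw [hε']; field_simp
  set η' := δ / (CV + 2 * δ + C) with hη'
  have η'0 : 0 < η' := by positivity
  have ηe : η' * (CV + 2 * δ + C) = δ := by rw [hη']; field_simp
  clear_value ε' η' CX
  have hH := h.Hconv hV ε'0
  rw [eventually_iff, mem_nhdsLT_iff_exists_Ioo_subset] at hH
  obtain ⟨g1, g1T, hH⟩ := hH
  set t0 := max t2 g1 with ht0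
  have t0T : t0 < T := max_lt ht2.2 g1T
  have t0a : t0 ∈ Ioo a T := ⟨ht2.1.trans_le (le_max_left _ _), t0T⟩
  have hH : ∀ t ∈ Ioo t0 T, ∀ r > 0, |hI n p (fun s => f s t) r - (T - t) ^ (p * κ) * (V r / (p * κ))| ≤
      ε' * (T - t) ^ (p * κ) * Em 0 (-n) r := fun t ht => hH ⟨(le_max_right _ _).trans_lt ht.1, ht.2⟩
  have ev1 : ∀ᶠ t in 𝓝[<] T, t0 < t - q * (T - t) := by
    have : Tendsto (fun t => t - q * (T - t)) (𝓝[<] T) (𝓝 (T - q * (T - T))) :=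
      (Continuous.tendsto (by fun_prop) T).mono_left nhdsWithin_le_nhds
    refine this.eventually_const_lt (by simpa using t0T)
  have hne : T - t0 ≠ 0 := by linarith
  have ev2 : ∀ᶠ t in 𝓝[<] T, ((t + q * (T - t) - t0) / (t - t0)) ^ κ < 1 + η' := by
    have : Tendsto (fun t => ((t + q * (T - t) - t0) / (t - t0)) ^ κ) (𝓝[<] T) (𝓝 (((T + q * (T - T) - t0) / (T - t0)) ^ κ)) := by
      refine Tendsto.rpow_const (Tendsto.div ?_ ?_ hne) (Or.inr κ0.le)
      all_goals exact (Continuous.tendsto (by fun_prop) T).mono_left nhdsWithin_le_nhds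
    refine this.eventually_lt_const ?_
    rw [sub_self, mul_zero, add_zero, div_self hne, one_rpow]; linarith
  have ev3 : ∀ᶠ t in 𝓝[<] T, ((t - t0) / (t - q * (T - t) - t0)) ^ κ < 1 + η' := by
    have : Tendsto (fun t => ((t - t0) / (t - q * (T - t) - t0)) ^ κ) (𝓝[<] T) (𝓝 (((T - t0) / (T - q * (T - T) - t0)) ^ κ)) := by
      refine Tendsto.rpow_const (Tendsto.div ?_ ?_ (by simpa using hne)) (Or.inr κ0.le)
      all_goals exact (Continuous.tendsto (by fun_prop) T).mono_left nhdsWithin_le_nhds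
    refine this.eventually_lt_const ?_
    rw [sub_self, mul_zero, sub_zero, div_self hne, one_rpow]; linarith
  filter_upwards [ev1, ev2, ev3, self_mem_nhdsWithin] with t e1 e2 e3 tT r hr
  have tT : t < T := tT
  have l0 : 0 < T - t := by linarith
  have ql0 : 0 < q * (T - t) := by positivity
  have qlT : q * (T - t) < T - t := mul_lt_of_lt_one_left l0 ql
  have tt : t ∈ Ioo t0 T := ⟨by linarith, tT⟩
  have ta : t ∈ Ioo a T := ⟨t0a.1.trans tt.1, tT⟩
  have b0 := Em_pos' n hr
  have X0 : 0 < V r / (p * κ) := div_pos (hV.pos r hr) pk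
  have hX := bX r hr
  have hVX : p * κ * (V r / (p * κ)) = V r := mul_div_cancel₀ _ pk.ne'
  have vb := (bV r hr).1
  have fb := (hsh t ⟨(le_max_left _ _).trans_lt tt.1, tT⟩ r hr).1
  have f0 := h.sol.pos hr ta
  have hk : (T - t) ^ (p * κ) = (T - t) ^ κ * (T - t) := by rw [h.pκ, rpow_add_one l0.ne']
  have L0 : 0 < (T - t) ^ κ := rpow_pos_of_pos l0 _
  have hH0 := abs_le.1 (hH t tt r hr)
  set X := V r / (p * κ) with hXd
  set b := Em 0 (-n) r with hbd
  set L := (T - t) ^ κ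
  clear_value X b
  have ηX : η * X ≤ δ * b := by rw [← ηC, mul_assoc]; gcongr
  rw [hk] at hH0
  -- upper
  have up : f r t ≤ L * (V r + 2 * δ * b) * (1 + η') := by
    have tm : t - q * (T - t) ∈ Ioo t0 T := ⟨e1, by linarith⟩
    have tma : t - q * (T - t) ∈ Ioo a T := ⟨t0a.1.trans e1, by linarith⟩
    have hh := abs_le.1 (hH _ tm r hr)
    have el : (T - (t - q * (T - t))) ^ (p * κ) = Pp * (L * (T - t)) := by
      rw [← hk, ← mul_rpow (by linarith) l0.le]; ring_nf
    rw [el, ← hXd, ← hbd] at hh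
    have hd := h.H_diff tma ta (by linarith) hr
    have hi : (q * (T - t)) * (f r t / (1 + η')) ≤ ∫ s in (t - q * (T - t))..t, f r s := by
      have := intervalIntegral.integral_mono_on (a := t - q * (T - t)) (b := t) (f := fun _ => f r t / (1 + η')) (g := fun s => f r s)
        (by linarith) intervalIntegrable_const (h.sol.sm.int_t hr tma ta) fun s hs => by
          have s0 : t0 < s := e1.trans_le hs.1
          have h1 := h.sol.bc' h.hκ hr t0a s0 hs.2 tT
          have h2 : ((t - t0) / (s - t0)) ^ κ ≤ ((t - t0) / (t - q * (T - t) - t0)) ^ κ := by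
            have := tt.1
            have : 0 < t - t0 := by linarith
            have : 0 < s - t0 := by linarith
            have : 0 < t - q * (T - t) - t0 := by linarith
            gcongr
            exact hs.1
          have fs := h.sol.pos hr (⟨t0a.1.trans s0, hs.2.trans_lt tT⟩ : s ∈ Ioo a T)
          rw [div_le_iff₀ (by linarith), mul_comm]
          exact h1.trans (mul_mono_r (h2.trans e3.le) fs.le)
      rw [intervalIntegral.integral_const, smul_eq_mul] at this
      convert this using 2; ring
    have e5 : q * (T - t) * (f r t / (1 + η')) ≤ q * (T - t) * (L * (V r + 2 * δ * b)) := by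
      refine hi.trans ?_
      rw [← hd]
      have h6 : (Pp - 1) * X ≤ (p * κ * q + η * q) * X := by
        have := (abs_le.1 lo1).2
        gcongr; linarith
      have h7 : (p * κ * q + η * q) * X ≤ q * (V r + δ * b) := by
        rw [← hVX]; have := mul_mono_l ηX q0.le; linarith
      have h8 : (Pp - 1) * X + ε' * (Pp + 1) * b ≤ q * (V r + 2 * δ * b) := by rw [εe]; linarith
      have := mul_mono_l h8 (mul_pos L0 l0).le
      linarith [hh.2, hH0.1]
    have e6 := le_of_mul_le_mul_left e5 ql0
    rwa [div_le_iff₀ (by linarith)] at e6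
  have low : L * (V r - 2 * δ * b) ≤ f r t * (1 + η') := by
    have tm : t + q * (T - t) ∈ Ioo t0 T := ⟨by linarith [tt.1], by linarith⟩
    have tma : t + q * (T - t) ∈ Ioo a T := ⟨t0a.1.trans tm.1, tm.2⟩
    have hh := abs_le.1 (hH _ tm r hr)
    have el : (T - (t + q * (T - t))) ^ (p * κ) = Pm * (L * (T - t)) := by
      rw [← hk, ← mul_rpow (by linarith) l0.le]; ring_nf
    rw [el, ← hXd, ← hbd] at hh
    have hd := h.H_diff ta tma (by linarith) hr
    have hi : ∫ s in t..(t + q * (T - t)), f r s ≤ (q * (T - t)) * (f r t * (1 + η')) := by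
      have := intervalIntegral.integral_mono_on (a := t) (b := t + q * (T - t)) (g := fun _ => f r t * (1 + η')) (f := fun s => f r s)
        (by linarith) (h.sol.sm.int_t hr ta tma) intervalIntegrable_const fun s hs => by
          have s0 : t0 < s := tt.1.trans_le hs.1
          have sT : s < T := by linarith [hs.2]
          have h1 := h.sol.bc' h.hκ hr t0a tt.1 hs.1 sT
          have h2 : ((s - t0) / (t - t0)) ^ κ ≤ ((t + q * (T - t) - t0) / (t - t0)) ^ κ := by
            have := tt.1
            have : 0 < t - t0 := by linarith
            have : 0 < s - t0 := by linarith
            gcongr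
            exact hs.2
          rw [mul_comm]
          exact h1.trans (mul_mono_r (h2.trans e2.le) f0.le)
      rw [intervalIntegral.integral_const, smul_eq_mul] at this
      convert this using 2; ring
    have e5 : q * (T - t) * (L * (V r - 2 * δ * b)) ≤ q * (T - t) * (f r t * (1 + η')) := by
      refine le_trans ?_ hi
      rw [← hd]
      have h6 : (p * κ * q - η * q) * X ≤ (1 - Pm) * X := by
        have := (abs_le.1 lo2).2
        exact mul_mono_r (by linarith) X0.le
      have h7 : q * (V r - δ * b) ≤ (p * κ * q - η * q) * X := by
        rw [← hVX]; have := mul_mono_l ηX q0.le; linarith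
      have h9 : ε' * (Pm + 1) * b ≤ δ * q * b := by rw [← εe]; gcongr; linarith
      have h8 : q * (V r - 2 * δ * b) ≤ (1 - Pm) * X - ε' * (Pm + 1) * b := by linarith
      have := mul_mono_l h8 (mul_pos L0 l0).le
      linarith [hh.2, hH0.1]
    exact le_of_mul_le_mul_left e5 ql0
  have Lb : 0 < L * b := mul_pos L0 b0
  have s1 : L * (V r + 2 * δ * b) * η' ≤ δ * (L * b) := by
    have : L * (V r + 2 * δ * b) ≤ L * ((CV + 2 * δ + C) * b) := by
      gcongr
      have := mul_pos hC b0; linarith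
    calc _ ≤ L * ((CV + 2 * δ + C) * b) * η' := by gcongr
      _ = η' * (CV + 2 * δ + C) * (L * b) := by ring
      _ = _ := by rw [ηe]
  have s2 : f r t * η' ≤ δ * (L * b) := by
    calc _ ≤ (CV + 2 * δ + C) * (L * b) * η' := by
          gcongr
          have : 0 ≤ (CV + 2 * δ) * (L * b) := by positivity
          linarith
      _ = η' * (CV + 2 * δ + C) * (L * b) := by ring
      _ = _ := by rw [ηe]
  have e3 : ε = 3 * δ := by rw [hδ]; ring
  rw [e3, abs_le]
  constructor <;> linarith
end

lemma stat_bd {n : ℕ} {m T : ℝ} {V : ℝ → ℝ} (h : IsStationaryProfile (n + 1) m T V) :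
    ∃ C > 0, ∀ r ≥ 0, V r ≤ C * cosh r ^ (-(n:ℝ)) := by
  obtain ⟨l, hl, ha⟩ := h.asymp
  have h0 := ha 0
  simp only [Nat.cast_add, Nat.cast_one, add_sub_cancel_right, iteratedDeriv_zero, pow_zero, one_mul] at h0
  have h1 := h0.eventually_lt_const (show l < l + 1 by linarith)
  obtain ⟨R, hR⟩ := eventually_atTop.1 h1
  obtain ⟨C, hC⟩ := (isCompact_Icc (a := (0:ℝ)) (b := R)).exists_bound_of_continuousOn
    (f := fun r => V r * cosh r ^ n)
    ((h.smooth.continuousOn.mono Icc_subset_Ici_self).mul (continuous_cosh.pow n).continuousOn)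
  refine ⟨max C (l + 1), by positivity, fun r hr => ?_⟩
  rw [rpow_neg (cosh_pos r).le, rpow_natCast, ← div_eq_mul_inv, le_div_iff₀ (pow_pos (cosh_pos r) n)]
  rcases le_or_gt r R with h2 | h2
  · exact (le_abs_self _).trans ((hC r ⟨hr, h2⟩).trans (le_max_left _ _))
  · refine le_trans ?_ ((hR r h2.le).le.trans (le_max_right _ _))
    rw [mul_comm, exp_nat_mul]
    have : cosh r ≤ exp r := by
      rw [cosh_eq]; have := exp_le_exp.2 (show -r ≤ r by linarith); linarith
    have := h.pos r hr
    have := cosh_pos r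
    gcongr

lemma stat_sol {n : ℕ} (hn : 1 ≤ n) {m T A : ℝ} (hm0 : 0 < m) (hm1 : m < 1) (hT : 0 < T)
    {V : ℝ → ℝ} (h : IsStationaryProfile (n + 1) m T V) :
    Sol n (1 / m) A T (fun r t => (T - t) ^ (m / (1 - m)) * (T ^ (-(m / (1 - m))) * V r)) := by
  have hm2 : 0 < 1 - m := by linarith
  set κ := m / (1 - m) with hκ
  have κ0 : 0 < κ := by positivity
  set p := 1 / m with hp
  have pκ : p * κ = κ + 1 := by rw [hp, hκ]; field_simp; ring
  have pκ' : p * κ = 1 / (1 - m) := by rw [hp, hκ]; field_simp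
  have p1 : 1 < p := by rw [hp, lt_div_iff₀ hm0]; linarith
  have c0 : 0 < T ^ (-κ) := rpow_pos_of_pos hT _
  refine ⟨hn, p1, ?_, ?_, ?_, ?_⟩
  · refine ContDiffOn.mul (ContDiffOn.rpow_const_of_ne (by fun_prop) fun q hq => ?_)
      (contDiffOn_const.mul (h.smooth.comp (by fun_prop) fun q hq => hq.1))
    have := hq.2.2; exact (by linarith : (0:ℝ) < T - q.2).ne'
  · intro r hr t ht
    have := h.pos r hr
    have : 0 < (T - t) ^ κ := rpow_pos_of_pos (by linarith [ht.2]) _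
    positivity
  · intro r hr t ht
    have l0 : 0 < T - t := by linarith [ht.2]
    have v0 := h.pos r hr.le
    have e1 : pr (fun r t => (T - t) ^ κ * (T ^ (-κ) * V r)) = fun r t => (T - t) ^ κ * (T ^ (-κ) * deriv V r) := by
      funext r t; simp only [pr, deriv_const_mul_field]
    have e2 : pr (fun r t => (T - t) ^ κ * (T ^ (-κ) * deriv V r)) = fun r t => (T - t) ^ κ * (T ^ (-κ) * deriv (deriv V) r) := by
      funext r t; simp only [pr, deriv_const_mul_field]
    rw [e1, e2]
    have e3 : HasDerivAt (fun τ => ((T - τ) ^ κ * (T ^ (-κ) * V r)) ^ p)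
        (-1 * (p * κ) * (T - t) ^ (p * κ - 1) * (T ^ (-κ) * V r) ^ p) t := by
      have d1 : HasDerivAt (fun τ : ℝ => T - τ) (-1) t := by simpa using (hasDerivAt_id t).const_sub T
      refine ((d1.rpow_const (p := p * κ) (Or.inl l0.ne')).mul_const _).congr_of_eventuallyEq ?_
      filter_upwards [Iio_mem_nhds ht.2] with τ hτ
      have : 0 ≤ T - τ := by have : τ < T := hτ; linarith
      rw [mul_rpow (by positivity) (by positivity), ← rpow_mul this, mul_comm κ p]
    have e4 : pt (fun r t => ((T - t) ^ κ * (T ^ (-κ) * V r)) ^ p) r t = _ := e3.deriv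
    rw [e4, mul_rpow c0.le v0.le, ← rpow_mul hT.le, show p * κ - 1 = κ by linarith,
      show -κ * p = -κ - 1 by linarith, rpow_sub_one hT.ne', pκ']
    have := h.ode r hr
    push_cast at this
    rw [add_sub_cancel_right] at this
    have e5 : deriv (deriv V) r = -(V r ^ p / ((1 - m) * T)) - n * (cosh r / sinh r) * deriv V r := by linarith
    beta_reduce
    rw [e5]
    field_simp
    ring
  · obtain ⟨C, hC, hb⟩ := stat_bd h
    have hn' : (1:ℝ) ≤ n := by exact_mod_cast hn
    refine ⟨fun r => (T - A) ^ κ * (T ^ (-κ) * (C * Em 0 (-n) r)), ?_, fun r hr t ht => ?_⟩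
    · have := (((Em_lim (D := -n) (by linarith)).const_mul C).const_mul (T ^ (-κ))).const_mul ((T - A) ^ κ)
      simpa using this
    · have := hb r hr.le
      have l0 : 0 < T - t := by linarith [ht.2]
      have v0 := h.pos r hr.le
      have := ht.1
      have eE : Em 0 (-n) r = cosh r ^ (-(n:ℝ)) := by simp [Em]
      beta_reduce
      rw [eE]
      have : 0 ≤ (T - A) ^ κ := rpow_nonneg (by linarith) _
      gcongr

lemma stat_prof {n : ℕ} (hn : 1 ≤ n) {m T : ℝ} (hm : ((n:ℝ) - 1) / (n + 3) < m) (hm0 : 0 < m) (hm1 : m < 1) (hT : 0 < T)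
    {V : ℝ → ℝ} (h : IsStationaryProfile (n + 1) m T V) :
    ∃ W, Prof n (1 / m) (1 / m * (m / (1 - m))) (fun r => T ^ (-(m / (1 - m))) * V r) W := by
  have hm2 : 0 < 1 - m := by linarith
  have hs := stat_sol (A := T - 2) hn hm0 hm1 hT h
  obtain ⟨C, hC, hb⟩ := stat_bd h
  obtain ⟨c', hc', ms⟩ := hs.mass_le
  set κ := m / (1 - m) with hκ
  have κ0 : 0 < κ := by positivity
  set p := 1 / m with hp
  have p1 : 1 < p := by rw [hp, lt_div_iff₀ hm0]; linarith
  have c0 : 0 < T ^ (-κ) := rpow_pos_of_pos hT _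
  have pk : 0 < p * κ := by positivity
  set F : ℝ → ℝ → ℝ := fun r t => (T - t) ^ κ * (T ^ (-κ) * V r) with hF
  have ht1 : T - 1 ∈ Ioo (T - 2) T := ⟨by linarith, by linarith⟩
  have F1 : ∀ r, F r (T - 1) = T ^ (-κ) * V r := fun r => by simp [hF]
  have hn' : (1:ℝ) ≤ n := by exact_mod_cast hn
  have sub : p * (n - 1) < n + 3 := by
    rw [hp, one_div_mul_eq_div, div_lt_iff₀ hm0]
    rw [div_lt_iff₀ (by linarith)] at hm; linarith
  refine ⟨fun r => If n (fun r t => F r t ^ p) r (T - 1), hn, p1, pk, sub, fun r hr => ?_, fun r hr => ?_, fun r hr => ?_, ?_⟩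
  · have := h.pos r (le_of_lt hr); positivity
  · have h1 := hs.flux_eq hr ht1
    have h2 := hs.sm.hr hr ht1
    refine (h2.congr_deriv ?_).congr_of_eventuallyEq (Eventually.of_forall fun r => (F1 r).symm)
    have h3 : If n (pt (fun r t => F r t ^ p)) r (T - 1) = -(p * κ) * If n (fun r t => F r t ^ p) r (T - 1) := by
      simp only [If]
      rw [← intervalIntegral.integral_const_mul]
      refine intervalIntegral.integral_congr_ae (Eventually.of_forall fun s hs' => ?_)
      rw [uIoc_of_le hr.le] at hs'
      have v0 := h.pos s hs'.1.le
      have e3 : HasDerivAt (fun τ => F s τ ^ p) (-(p * κ) * F s (T - 1) ^ p) (T - 1) := by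
        have d1 : HasDerivAt (fun τ : ℝ => T - τ) (-1) (T - 1) := by simpa using (hasDerivAt_id (T - 1)).const_sub T
        refine (((d1.rpow_const (p := p * κ) (Or.inl (by simp))).mul_const ((T ^ (-κ) * V s) ^ p)).congr_of_eventuallyEq ?_).congr_deriv ?_
        · filter_upwards [Iio_mem_nhds ht1.2] with τ hτ
          have : 0 ≤ T - τ := by have : τ < T := hτ; linarith
          simp only [hF]
          rw [mul_rpow (by positivity) (by positivity), ← rpow_mul this, mul_comm κ p]
        · rw [F1]; simp
      have e4 : pt (fun r t => F r t ^ p) s (T - 1) = _ := e3.deriv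
      rw [e4]; ring
    have hS : 0 < sinh r ^ n := pow_pos (sinh_pos hr) n
    rw [h3] at h1
    field_simp
    linarith
  · have := (hs.smq p).If_r (n := n) hr ht1
    rw [F1] at this; exact this
  · have hm := ms (T - 1) ht1 (T ^ (-κ) * C) (by positivity) fun r hr => by
      have := F1 r
      simp only [hF] at this
      rw [this, mul_assoc]
      have eE : Em 0 (-n) r = cosh r ^ (-(n:ℝ)) := by simp [Em]
      rw [eE]; have := hb r (le_of_lt hr); gcongr
    refine ⟨max (T ^ (-κ) * C) (c' * (T ^ (-κ) * C) ^ p), by positivity, fun r hr => ⟨?_, ?_, ?_⟩⟩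
    · have eE : Em 0 (-n) r = cosh r ^ (-(n:ℝ)) := by simp [Em]
      rw [eE]
      have := hb r (le_of_lt hr)
      calc T ^ (-κ) * V r ≤ T ^ (-κ) * (C * cosh r ^ (-(n:ℝ))) := by gcongr
        _ = (T ^ (-κ) * C) * cosh r ^ (-(n:ℝ)) := by ring
        _ ≤ _ := by have := cosh_pos r; gcongr; exact le_max_left _ _
    · simp only [If]
      refine intervalIntegral.intervalIntegral_pos_of_pos_on ((hs.smq p).intS (n := n) hr ht1) (fun s hs' => ?_) hr
      have v0 := hs.pos hs'.1 ht1
      have := sinh_pos hs'.1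
      exact mul_pos (pow_pos this n) (rpow_pos_of_pos v0 p)
    · have := Em_pos (A := n + 1) (D := 0) hr
      refine (hm r hr).trans ?_
      gcongr; exact le_max_right _ _

lemma two_abs_le {z A B : ℝ} (hA : 0 ≤ A) (hB : 0 ≤ B) (h : z ^ 2 ≤ A * B) : 2 * |z| ≤ A + B := by
  have : (2 * |z|) ^ 2 ≤ (A + B) ^ 2 := by
    rw [mul_pow, sq_abs]; nlinarith [sq_nonneg (A - B)]
  exact abs_le_of_sq_le_sq' this (by positivity) |>.2

lemma le_one_sq (x : ℝ) : x ≤ 1 + x ^ 2 := by linarith [sq_nonneg (x - 1/2)]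

noncomputable def MC (n : ℕ) (d a' ρ τ C : ℝ) : ℝ :=
  2 / τ + 3 * C + (8 + 16 * n) / (d * ρ ^ 2) + 256 / (a' * d ^ 2 * ρ ^ 2) + 128 / (d ^ 2 * ρ ^ 2)

lemma M_alg {n : ℕ} {Λ D d a' γ β ε C ρ τ Y Y1 Y2 Yt N W h h1 h2 ht w w1 w2 wt ct : ℝ}
    (hΛ : 0 < Λ) (hd : 0 < d) (ha : 0 < a') (hγ : 0 < γ) (hβ0 : 0 ≤ β) (hβ1 : β ≤ 1)
    (hβ : 32 * β ≤ a' * d ^ 2) (hε : 8 * ε ≤ γ) (hε0 : 0 ≤ ε) (hC : 0 ≤ C) (hρ : 0 < ρ) (hτ : 0 < τ)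
    (hD1 : 0 < D) (hD2 : D ≤ Λ / d) (hY : 0 ≤ Y) (hN : 0 ≤ N) (hh1 : 1 ≤ h) (hh2 : h ≤ 2)
    (H1 : Y1 ^ 2 ≤ 4 * Y * N)
    (H2 : Yt - D * (Y2 + n * ct * Y1) ≤ Λ * (-(2 * a' * N) + ε * Y ^ 2 + C * (Y + 1)))
    (H3 : ht - D * (h2 + n * ct * h1) ≤ Λ * (-W + C)) (H4 : h1 ^ 2 ≤ β * W) (H5 : γ * Y ≤ W)
    (hw0 : 0 < w) (hw1 : w ≤ 1) (hwt : wt ≤ Λ / τ) (hww : w1 ^ 2 ≤ 16 * w / ρ ^ 2)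
    (hwl : -(w2 + n * ct * w1) ≤ (4 + 8 * n) / ρ ^ 2) :
    (wt * (Y * h) + w * (Yt * h + Y * ht)) - D * ((w2 * (Y * h) + 2 * (w1 * (Y1 * h + Y * h1))
      + w * (Y2 * h + 2 * (Y1 * h1) + Y * h2)) + n * ct * (w1 * (Y * h) + w * (Y1 * h + Y * h1)))
      ≤ Λ * (-(γ / 2 * (w * Y ^ 2)) + MC n d a' ρ τ C * (Y + 1)) := by
  have hW : 0 ≤ W := le_trans (by positivity) H5
  obtain ⟨δ, rfl⟩ : ∃ δ, D = Λ * δ := ⟨D / Λ, by field_simp⟩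
  have hδ : 0 < δ := by
    rcases pos_and_pos_or_neg_and_neg_of_mul_pos hD1 with h | h
    · exact h.2
    · linarith
  have hδ2 : δ ≤ 1 / d := by
    have : Λ * δ ≤ Λ * (1 / d) := by rw [mul_one_div]; exact hD2
    exact le_of_mul_le_mul_left this hΛ
  have hδs : δ ^ 2 ≤ 1 / d ^ 2 := by
    rw [← one_div_pow]; exact pow_le_pow_left₀ hδ.le hδ2 2
  have I1 := mul_mono_l H2 (show 0 ≤ w * h by positivity)
  have I2 := mul_mono_l H3 (show 0 ≤ w * Y by positivity)
  have I3 : -(Λ * δ * (Y * h) * (w2 + n * ct * w1)) ≤ Λ * Y * ((8 + 16 * n) / (d * ρ ^ 2)) := by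
    have e1 := mul_mono_l hwl (show 0 ≤ Λ * δ * (Y * h) by positivity)
    have e2 : Λ * δ * (Y * h) ≤ Λ * (1 / d) * (Y * 2) := by gcongr
    have e3 := mul_mono_r e2 (show 0 ≤ (4 + 8 * (n:ℝ)) / ρ ^ 2 by positivity)
    have e4 : Λ * (1 / d) * (Y * 2) * ((4 + 8 * n) / ρ ^ 2) = Λ * Y * ((8 + 16 * n) / (d * ρ ^ 2)) := by
      field_simp; ring
    linarith
  have I4 : 2 * |δ * w1 * Y1| ≤ a' / 2 * (w * N) + 128 / (a' * d ^ 2 * ρ ^ 2) * Y := by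
    refine two_abs_le (by positivity) (by positivity) ?_
    calc (δ * w1 * Y1) ^ 2 = δ ^ 2 * w1 ^ 2 * Y1 ^ 2 := by ring
      _ ≤ 1 / d ^ 2 * (16 * w / ρ ^ 2) * (4 * Y * N) := by gcongr
      _ = _ := by field_simp; ring
  have I5 : 2 * |δ * w1 * h1| ≤ 1 / 8 * (w * W) + 128 / (d ^ 2 * ρ ^ 2) := by
    refine two_abs_le (by positivity) (by positivity) ?_
    calc (δ * w1 * h1) ^ 2 = δ ^ 2 * w1 ^ 2 * h1 ^ 2 := by ring
      _ ≤ 1 / d ^ 2 * (16 * w / ρ ^ 2) * (1 * W) := by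
        gcongr
        exact H4.trans (by gcongr)
      _ = _ := by field_simp; ring
  have I6 : 2 * |δ * Y1 * h1| ≤ a' * N + 1 / 8 * (Y * W) := by
    refine two_abs_le (by positivity) (by positivity) ?_
    calc (δ * Y1 * h1) ^ 2 = δ ^ 2 * Y1 ^ 2 * h1 ^ 2 := by ring
      _ ≤ 1 / d ^ 2 * (4 * Y * N) * (β * W) := by gcongr
      _ = (32 * β) * (1 / d ^ 2 * (Y * N * W) / 8) := by ring
      _ ≤ (a' * d ^ 2) * (1 / d ^ 2 * (Y * N * W) / 8) := by gcongr
      _ = _ := by field_simp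
  have J4 := mul_mono_l I4 (show 0 ≤ Λ * h by positivity)
  have J5 := mul_mono_l I5 (show 0 ≤ Λ * Y by positivity)
  have J6 := mul_mono_l I6 (show 0 ≤ Λ * w by positivity)
  have K4 := mul_mono_l (neg_abs_le (δ * w1 * Y1)) (show 0 ≤ 2 * (Λ * h) by positivity)
  have K5 := mul_mono_l (neg_abs_le (δ * w1 * h1)) (show 0 ≤ 2 * (Λ * Y) by positivity)
  have K6 := mul_mono_l (neg_abs_le (δ * Y1 * h1)) (show 0 ≤ 2 * (Λ * w) by positivity)
  have I7 : wt * (Y * h) ≤ Λ * Y * (2 / τ) := by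
    have e1 := mul_mono_r hwt (show 0 ≤ Y * h by positivity)
    have e2 : Λ / τ * (Y * h) ≤ Λ / τ * (Y * 2) := by gcongr
    have e3 : Λ / τ * (Y * 2) = Λ * Y * (2 / τ) := by field_simp
    linarith
  have hwh : w * h ≤ 2 := by
    have : w * h ≤ 1 * 2 := mul_le_mul hw1 hh2 (by linarith) (by norm_num)
    linarith
  -- bounds of remaining terms
  have B1 : Λ * (w * h * (ε * Y ^ 2)) ≤ Λ * (γ / 4 * (w * Y ^ 2)) := by
    have : h * ε ≤ γ / 4 := by
      have := mul_mono_r hh2 hε0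
      linarith
    have e := mul_mono_r this (show 0 ≤ Λ * (w * Y ^ 2) by positivity)
    linarith
  have B2 : Λ * (w * h * (C * (Y + 1))) ≤ Λ * (2 * C * (Y + 1)) := by
    have e := mul_mono_r hwh (show 0 ≤ Λ * (C * (Y + 1)) by positivity)
    linarith
  have B3 : Λ * (w * Y * C) ≤ Λ * (C * (Y + 1)) := by
    have e := mul_mono_r hw1 (show 0 ≤ Λ * (Y * C) by positivity)
    have e2 : 0 ≤ Λ * C := by positivity
    linarith
  have B4 : Λ * (w * (a' * N)) ≤ Λ * (w * h * (a' * N)) := by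
    have e := mul_mono_r hh1 (show 0 ≤ Λ * (w * (a' * N)) by positivity)
    linarith
  have B4' : 0 ≤ Λ * (w * h * (a' * N)) := by positivity
  have B5 : Λ * (w * (γ * Y ^ 2)) ≤ Λ * (w * (Y * W)) := by
    have e := mul_mono_l H5 (show 0 ≤ Λ * (w * Y) by positivity)
    linarith
  have B6 : Λ * h * (128 / (a' * d ^ 2 * ρ ^ 2) * Y) ≤ Λ * (256 / (a' * d ^ 2 * ρ ^ 2) * Y) := by
    have e := mul_mono_r hh2 (show 0 ≤ Λ * (128 / (a' * d ^ 2 * ρ ^ 2) * Y) by positivity)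
    have e2 : 2 * (Λ * (128 / (a' * d ^ 2 * ρ ^ 2) * Y)) = Λ * (256 / (a' * d ^ 2 * ρ ^ 2) * Y) := by ring
    linarith
  have B7 : 0 ≤ Λ * (2 / τ + (8 + 16 * n) / (d * ρ ^ 2) + 256 / (a' * d ^ 2 * ρ ^ 2) + 128 / (d ^ 2 * ρ ^ 2)) := by
    positivity
  unfold MC
  generalize 256 / (a' * d ^ 2 * ρ ^ 2) = G1 at *
  generalize 128 / (a' * d ^ 2 * ρ ^ 2) = G2 at *
  generalize 128 / (d ^ 2 * ρ ^ 2) = G3 at *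
  generalize (8 + 16 * (n:ℝ)) / (d * ρ ^ 2) = G4 at *
  generalize 2 / τ = G5 at *
  generalize (n:ℝ) * ct = nc at *
  clear H1 H2 H3 H4 hww hwl hδs hδ2 hD2 hβ
  linarith

noncomputable def lap (n : ℕ) (φ : ℝ → ℝ → ℝ) : ℝ → ℝ → ℝ := fun r t =>
  pr (pr φ) r t + n * (cosh r / sinh r) * pr φ r t

structure MP (n : ℕ) (Λ d a' γ β ε C : ℝ) (D Y N W h : ℝ → ℝ → ℝ) (r t : ℝ) : Prop where
  D1 : 0 < D r t
  D2 : D r t ≤ Λ / d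
  Y0 : 0 ≤ Y r t
  N0 : 0 ≤ N r t
  h1 : 1 ≤ h r t
  h2 : h r t ≤ 2
  H1 : pr Y r t ^ 2 ≤ 4 * Y r t * N r t
  H2 : pt Y r t - D r t * lap n Y r t ≤ Λ * (-(2 * a' * N r t) + ε * Y r t ^ 2 + C * (Y r t + 1))
  H3 : pt h r t - D r t * lap n h r t ≤ Λ * (-W r t + C)
  H4 : pr h r t ^ 2 ≤ β * W r t
  H5 : γ * Y r t ≤ W r t

lemma coth_le {r R : ℝ} (hr : 0 < r) (hR : 0 ≤ R) (h : r - R ≤ 1) :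
    (r - R) * (cosh r / sinh r) ≤ 2 := by
  have hS := sinh_pos hr
  rw [← mul_div_assoc, div_le_iff₀ hS]
  rcases le_or_gt (r - R) 0 with h0 | h0
  · have := mul_nonneg (neg_nonneg.2 h0) (cosh_pos r).le
    linarith
  have e1 : cosh r = sinh r + exp (-r) := by
    rw [cosh_eq, Real.sinh_eq]; ring
  have e2 : exp (-r) ≤ 1 := Real.exp_le_one_iff.2 (by linarith)
  have e3 : r ≤ sinh r := self_le_sinh_iff.2 hr.le
  have e4 := mul_mono_l e2 h0.le
  have e5 := mul_mono_r h hS.le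
  rw [e1]; linarith

lemma lemM {n : ℕ} {a b Λ d a' γ β ε C ρ τ R t0 : ℝ} {D Y N W h : ℝ → ℝ → ℝ} (hn : 1 ≤ n)
    (hΛ : 0 < Λ) (hd : 0 < d) (ha : 0 < a') (hγ : 0 < γ) (hβ0 : 0 ≤ β) (hβ1 : β ≤ 1)
    (hβ : 32 * β ≤ a' * d ^ 2) (hε : 8 * ε ≤ γ) (hε0 : 0 ≤ ε) (hC : 0 ≤ C) (hρ : 0 < ρ)
    (hρ1 : ρ ≤ 1) (hτ : 0 < τ) (hR : 0 < R) (hat : a < t0 - τ / Λ) (htb : t0 < b)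
    (hY : Sm a b Y) (hh : Sm a b h)
    (H : ∀ r > 0, |r - R| < ρ → ∀ t ∈ Icc (t0 - τ / Λ) t0, MP n Λ d a' γ β ε C D Y N W h r t) :
    Y R t0 ≤ 2 + (8 * MC n d a' ρ τ C + 8) / γ := by
  have hτΛ : 0 < τ / Λ := by positivity
  set M := MC n d a' ρ τ C with hMd
  set lam := 2 + (8 * M + 8) / γ with hlam
  have hM0 : 0 ≤ M := by rw [hMd]; unfold MC; positivity
  have hlam2 : 2 ≤ lam := by rw [hlam]; have : 0 ≤ (8 * M + 8) / γ := by positivity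
                             linarith
  have hlamγ : 8 * M + 8 ≤ γ * lam := by
    rw [hlam, mul_add, mul_div_cancel₀ _ hγ.ne']; linarith
  clear_value M lam
  set q : ℝ → ℝ := fun r => 1 - ((r - R) / ρ) ^ 2 with hq
  set s : ℝ → ℝ := fun t => (t - (t0 - τ / Λ)) * (Λ / τ) with hs
  have hqp : ∀ r, 0 < q r → |r - R| < ρ := by
    intro r h0
    rw [hq] at h0
    have h1 : ((r - R) / ρ) ^ 2 < 1 := by
      have : 0 < 1 - ((r - R) / ρ) ^ 2 := h0
      linarith
    have h2 := (sq_lt_one_iff_abs_lt_one _).1 h1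
    rwa [abs_div, abs_of_pos hρ, div_lt_one hρ] at h2
  have hq1 : ∀ r, q r ≤ 1 := fun r => by
    have := sq_nonneg ((r - R) / ρ)
    show 1 - ((r - R) / ρ) ^ 2 ≤ 1
    linarith
  have hs01 : ∀ t ∈ Icc (t0 - τ / Λ) t0, 0 ≤ s t ∧ s t ≤ 1 := by
    intro t ht
    refine ⟨mul_nonneg (by linarith [ht.1]) (by positivity), ?_⟩
    have : (t - (t0 - τ / Λ)) * (Λ / τ) ≤ (τ / Λ) * (Λ / τ) := by
      gcongr; linarith [ht.2]
    refine this.trans_eq (by field_simp)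
  have hqd : ∀ r, HasDerivAt q (-(2 * (r - R) / ρ ^ 2)) r := by
    intro r
    refine ((((hasDerivAt_id r).sub_const R).div_const ρ).pow 2).const_sub 1 |>.congr_deriv ?_
    have := hρ.ne'
    simp only [id, Nat.cast_ofNat, Nat.add_one_sub_one, pow_one]; field_simp
  have hqd2 : ∀ r, HasDerivAt (fun r => -(2 * (r - R) / ρ ^ 2)) (-(2 / ρ ^ 2)) r := by
    intro r
    refine (((((hasDerivAt_id r).sub_const R).const_mul 2).div_const (ρ ^ 2)).neg).congr_deriv ?_
    ring
  have hsd : ∀ t, HasDerivAt s (Λ / τ) t := fun t => by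
    refine (((hasDerivAt_id t).sub_const _).mul_const (Λ / τ)).congr_deriv ?_
    ring
  clear_value q s
  obtain ⟨CY, hCY, hYb⟩ := hY.bdd (R + 1) hat htb
  have main : ∀ μ > 0, μ ≤ d → (max (q R) 0) ^ 2 * s t0 * (Y R t0 * h R t0) + μ * Lt R - lam < 0 := by
    intro μ hμ hμd
    obtain ⟨ρ1, hρ1', hLt⟩ := Lt_bot (-(CY * 2) / μ)
    refine first_touch (Φ := fun r t => (max (q r) 0) ^ 2 * s t * (Y r t * h r t) + μ * Lt r - lam)
      (ρ1 := ρ1) (ρ2 := R + 1) (a := t0 - τ / Λ) (b := t0) hρ1' ?_ ?_ ?_ ?_ R hR t0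
      ⟨by linarith, le_rfl⟩
    · have hsub : (Ioi 0 ×ˢ Icc (t0 - τ / Λ) t0 : Set (ℝ × ℝ)) ⊆ Ioi 0 ×ˢ Ioo a b :=
        prod_mono subset_rfl fun t ht => ⟨hat.trans_le ht.1, ht.2.trans_lt htb⟩
      have cq : Continuous q := continuous_iff_continuousAt.2 fun r => (hqd r).continuousAt
      have cs : Continuous s := continuous_iff_continuousAt.2 fun r => (hsd r).continuousAt
      have cL : ContinuousOn (fun x : ℝ × ℝ => Lt x.1) (Ioi 0 ×ˢ Icc (t0 - τ / Λ) t0) :=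
        fun x hx => ((Lt_deriv hx.1).continuousAt.comp continuousAt_fst).continuousWithinAt
      have c1 := hY.cont.mono hsub
      have c2 := hh.cont.mono hsub
      exact ((((((cq.comp continuous_fst).max continuous_const).pow 2).mul
        (cs.comp continuous_snd)).continuousOn.mul (c1.mul c2)).add
        (continuousOn_const.mul cL)).sub continuousOn_const
    · intro r hr
      have : s (t0 - τ / Λ) = 0 := by rw [hs]; simp
      simp only [this, mul_zero, zero_mul, zero_add]
      have := mul_nonneg hμ.le (neg_nonneg.2 (Lt_nonpos hr))
      linarith
    · intro r hr t ht hge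
      have hge : 0 ≤ (max (q r) 0) ^ 2 * s t * (Y r t * h r t) + μ * Lt r - lam := hge
      have hL := mul_nonneg hμ.le (neg_nonneg.2 (Lt_nonpos hr))
      have hq0 : 0 < q r := by
        by_contra! hc
        rw [max_eq_right hc] at hge
        simp only [ne_eq, OfNat.ofNat_ne_zero, not_false_eq_true, zero_pow, zero_mul, zero_add] at hge
        linarith
      have hb := hqp r hq0
      have hrR : r ≤ R + 1 := by linarith [(abs_lt.1 hb).2]
      refine ⟨hLt r hr ?_, hrR⟩
      have P := H r hr hb t ht
      have e1 : (max (q r) 0) ^ 2 * s t * (Y r t * h r t) ≤ 1 * 1 * (CY * 2) := by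
        have : |Y r t| ≤ CY := hYb r ⟨hr, hrR⟩ t ht
        have hYC := (le_abs_self _).trans this
        have := hs01 t ht
        have hm : (max (q r) 0) ^ 2 ≤ 1 := pow_le_one₀ (le_max_right _ _) (max_le (hq1 r) zero_le_one)
        have := P.Y0; have := P.h2
        have := P.h1
        have h3 : Y r t * h r t ≤ CY * 2 := by gcongr
        have h4 : (max (q r) 0) ^ 2 * s t ≤ 1 * 1 := by gcongr; exacts [(hs01 t ht).1, (hs01 t ht).2]
        exact mul_le_mul h4 h3 (by positivity) (by norm_num)
      rw [div_le_iff₀ hμ]; linarith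
    · intro r hr t ht h0 hle
      have ht' : t ∈ Icc (t0 - τ / Λ) t0 := ⟨ht.1.le, ht.2⟩
      have htab : t ∈ Ioo a b := ⟨hat.trans ht.1, ht.2.trans_lt htb⟩
      have h0 : (max (q r) 0) ^ 2 * s t * (Y r t * h r t) + μ * Lt r - lam = 0 := h0
      have hL := mul_nonneg hμ.le (neg_nonneg.2 (Lt_nonpos hr))
      have hq0 : 0 < q r := by
        by_contra! hc
        rw [max_eq_right hc] at h0
        simp only [ne_eq, OfNat.ofNat_ne_zero, not_false_eq_true, zero_pow, zero_mul, zero_add] at h0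
        linarith
      have hb := hqp r hq0
      have P := H r hr hb t ht'
      rw [max_eq_left hq0.le] at h0
      have hst : 0 < s t := by rw [hs]; exact mul_pos (by linarith [ht.1]) (by positivity)
      have hev : ∀ᶠ x in 𝓝 r, 0 < x ∧ 0 < q x :=
        (lt_mem_nhds hr).and ((hqd r).continuousAt.eventually (lt_mem_nhds hq0))
      have hA : ∀ᶠ x in 𝓝 r, HasDerivAt
          (fun x => q x ^ 2 * s t * (Y x t * h x t) + μ * Lt x - lam)
          (2 * q x * (-(2 * (x - R) / ρ ^ 2)) * s t * (Y x t * h x t)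
            + q x ^ 2 * s t * (pr Y x t * h x t + Y x t * pr h x t)
            + μ * (cosh x / sinh x - sinh x / cosh x)) x := by
        filter_upwards [hev] with x hx
        refine ((((((hqd x).pow 2).mul_const (s t)).mul ((hY.hr hx.1 htab).mul (hh.hr hx.1 htab))).add
          ((Lt_deriv hx.1).const_mul μ)).sub_const lam).congr_deriv ?_
        simp only [Nat.cast_ofNat, Nat.add_one_sub_one, pow_one, Pi.pow_apply, Pi.mul_apply]
      have hA1 := (((((hqd r).const_mul 2).mul (hqd2 r)).mul_const (s t)).mul
        ((hY.hr hr htab).mul (hh.hr hr htab))).add ((((hqd r).pow 2).mul_const (s t)).mul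
        (((hY.Pr.hr hr htab).mul (hh.hr hr htab)).add ((hY.hr hr htab).mul (hh.Pr.hr hr htab))))
        |>.add ((Lt_deriv2 hr).const_mul μ)
      have hmax : IsLocalMax (fun x => q x ^ 2 * s t * (Y x t * h x t) + μ * Lt x - lam) r := by
        filter_upwards [hev] with x hx
        have := hle x hx.1 t ⟨ht.1.le, le_rfl⟩
        rw [max_eq_left hx.2.le] at this
        rw [h0]; exact this
      obtain ⟨T1, T2⟩ := touch_lap hA hA1 hmax
      have T3 := touch_time (δ := t0 - τ / Λ)
        ((((hsd t).const_mul (q r ^ 2)).mul ((hY.ht hr htab).mul (hh.ht hr htab))).add_const (μ * Lt r - lam))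
        ht.1 (by
          intro σ hσ
          have := hle r hr σ hσ
          rw [max_eq_left hq0.le] at this
          simp only [Pi.mul_apply]
          linarith)
      have hw0 : 0 < q r ^ 2 * s t := by positivity
      have hq1r := hq1 r
      have hs1 := (hs01 t ht').2
      have hq21 : q r ^ 2 ≤ 1 := pow_le_one₀ hq0.le hq1r
      have hw1 : q r ^ 2 * s t ≤ 1 := by
        have := mul_le_mul hq21 hs1 hst.le zero_le_one
        linarith
      obtain ⟨hb1, hb2⟩ := abs_lt.1 hb
      have hrR : (r - R) ^ 2 ≤ ρ ^ 2 := sq_le_sq' hb1.le hb2.le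
      have hco := coth_le hr hR.le (by linarith : r - R ≤ 1)
      have key := M_alg (n := n) (ct := cosh r / sinh r)
        (w := q r ^ 2 * s t) (w1 := 2 * q r * (-(2 * (r - R) / ρ ^ 2)) * s t)
        (w2 := (2 * (-(2 * (r - R) / ρ ^ 2)) * (-(2 * (r - R) / ρ ^ 2)) + 2 * q r * (-(2 / ρ ^ 2))) * s t)
        (wt := q r ^ 2 * (Λ / τ)) hΛ hd ha hγ hβ0 hβ1 hβ hε hε0 hC hρ hτ
        P.D1 P.D2 P.Y0 P.N0 P.h1 P.h2 P.H1 P.H2 P.H3 P.H4 P.H5 hw0 hw1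
        (mul_le_of_le_one_left (by positivity) hq21) (by
          have e : (2 * q r * (-(2 * (r - R) / ρ ^ 2)) * s t) ^ 2
            = 16 * (q r ^ 2 * s t) * (s t * ((r - R) ^ 2 / ρ ^ 2)) / ρ ^ 2 := by field_simp; ring
          rw [e]
          refine div_le_div_of_nonneg_right (mul_le_of_le_one_right (by positivity) ?_) (by positivity)
          exact mul_le_one₀ hs1 (by positivity) ((div_le_one (by positivity)).2 hrR)) (by
          have e : -((2 * (-(2 * (r - R) / ρ ^ 2)) * (-(2 * (r - R) / ρ ^ 2)) + 2 * q r * (-(2 / ρ ^ 2))) * s t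
              + n * (cosh r / sinh r) * (2 * q r * (-(2 * (r - R) / ρ ^ 2)) * s t))
            = (q r * s t * (4 + 4 * n * ((r - R) * (cosh r / sinh r)))) / ρ ^ 2
              - 8 * (r - R) ^ 2 * s t / ρ ^ 4 := by field_simp; ring
          rw [e]
          have h8 : 0 ≤ 8 * (r - R) ^ 2 * s t / ρ ^ 4 := by positivity
          have hqs : q r * s t ≤ 1 := mul_le_one₀ hq1r hst.le hs1
          have h9 : q r * s t * (4 + 4 * n * ((r - R) * (cosh r / sinh r))) ≤ 4 + 8 * n := by
            have g1 : 4 + 4 * n * ((r - R) * (cosh r / sinh r)) ≤ 4 + 8 * n := by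
              have := mul_mono_l hco (show 0 ≤ 4 * (n:ℝ) by positivity)
              linarith
            have g2 := mul_mono_l g1 (show 0 ≤ q r * s t by positivity)
            have g3 := mul_mono_r hqs (show 0 ≤ 4 + 8 * (n:ℝ) by positivity)
            linarith
          have := div_le_div_of_nonneg_right h9 (show 0 ≤ ρ ^ 2 by positivity)
          linarith)
      rw [← hMd] at key
      have hLap := Lt_lap hr hn
      -- size of Y
      have hYw : lam ≤ 2 * (q r ^ 2 * s t * Y r t) := by
        have := mul_mono_l P.h2 (show 0 ≤ q r ^ 2 * s t * Y r t from mul_nonneg hw0.le P.Y0)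
        linarith
      have hY1 : 1 ≤ Y r t := by
        have := mul_mono_r hw1 P.Y0
        linarith
      have hfin : -(γ / 2 * (q r ^ 2 * s t * Y r t ^ 2)) + M * (Y r t + 1) ≤ -2 := by
        have e1 := mul_mono_l hYw (show 0 ≤ γ / 4 * Y r t by positivity)
        have e2 := mul_mono_r hlamγ (show 0 ≤ Y r t / 4 by positivity)
        have e3 := mul_nonneg hM0 (sub_nonneg.2 hY1)
        linarith
      have hfin2 := mul_mono_l hfin hΛ.le
      have hD := mul_mono_l P.D2 hμ.le
      have hμΛ : μ * (Λ / d) ≤ Λ := by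
        rw [mul_div_assoc', div_le_iff₀ hd]
        have := mul_mono_r hμd hΛ.le
        linarith
      have g1 := mul_mono_l hLap (mul_nonneg P.D1.le hμ.le)
      have g2 := mul_nonpos_of_nonneg_of_nonpos P.D1.le T2
      simp only [Pi.mul_apply, Pi.pow_apply, Pi.add_apply, Nat.cast_ofNat, Nat.add_one_sub_one, pow_one] at T1 T2 T3 g2
      have T1' := congrArg (fun x => D r t * (n * (cosh r / sinh r)) * x) T1
      simp only [mul_zero] at T1'
      clear T1 T2 hA hA1 hev hle hmax
      generalize cosh r / sinh r = ct at *
      generalize sinh r / cosh r = ct' at *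
      clear P
      linarith
  have hbox : q R = 1 := by rw [hq]; simp
  have hsb : s t0 = 1 := by rw [hs]; simp; field_simp
  have PR := H R hR (by simpa using hρ) t0 ⟨by linarith, le_rfl⟩
  have hYh : Y R t0 ≤ Y R t0 * h R t0 := le_mul_of_one_le_right PR.Y0 PR.h1
  refine le_of_forall_pos_le_add fun e he => ?_
  have hLn := Lt_nonpos hR
  set μ := min d (e / (1 - Lt R)) with hμ
  have hμ0 : 0 < μ := lt_min hd (div_pos he (by linarith))
  have := main μ hμ0 (min_le_left _ _)
  have h2 : μ * (1 - Lt R) ≤ e := by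
    rw [← le_div_iff₀ (by linarith)]; exact min_le_right _ _
  rw [hbox, hsb] at this
  simp only [zero_le_one, sup_of_le_left, one_pow, one_mul] at this
  linarith

section calc2
variable {a b : ℝ} {φ χ g z D E : ℝ → ℝ → ℝ} {n : ℕ} {r t : ℝ}

lemma pr_congr (h : ∀ r > (0:ℝ), ∀ t ∈ Ioo a b, φ r t = χ r t) (hr : 0 < r) (ht : t ∈ Ioo a b) :
    pr φ r t = pr χ r t := by
  refine Filter.EventuallyEq.deriv_eq ?_
  filter_upwards [lt_mem_nhds hr] with x hx using h x hx t ht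
lemma pt_congr (h : ∀ r > (0:ℝ), ∀ t ∈ Ioo a b, φ r t = χ r t) (hr : 0 < r) (ht : t ∈ Ioo a b) :
    pt φ r t = pt χ r t := by
  refine Filter.EventuallyEq.deriv_eq ?_
  filter_upwards [isOpen_Ioo.mem_nhds ht] with x hx using h r hr x hx

lemma pr_mul (h : Sm a b φ) (h' : Sm a b χ) (hr : 0 < r) (ht : t ∈ Ioo a b) :
    pr (fun r t => φ r t * χ r t) r t = pr φ r t * χ r t + φ r t * pr χ r t :=
  ((h.hr hr ht).mul (h'.hr hr ht)).deriv
lemma pt_mul (h : Sm a b φ) (h' : Sm a b χ) (hr : 0 < r) (ht : t ∈ Ioo a b) :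
    pt (fun r t => φ r t * χ r t) r t = pt φ r t * χ r t + φ r t * pt χ r t :=
  ((h.ht hr ht).mul (h'.ht hr ht)).deriv
lemma pr_add (h : Sm a b φ) (h' : Sm a b χ) (hr : 0 < r) (ht : t ∈ Ioo a b) :
    pr (fun r t => φ r t + χ r t) r t = pr φ r t + pr χ r t :=
  ((h.hr hr ht).add (h'.hr hr ht)).deriv
lemma pt_add (h : Sm a b φ) (h' : Sm a b χ) (hr : 0 < r) (ht : t ∈ Ioo a b) :
    pt (fun r t => φ r t + χ r t) r t = pt φ r t + pt χ r t :=
  ((h.ht hr ht).add (h'.ht hr ht)).deriv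

lemma lap_hr (h : Sm a b z) (hr : 0 < r) (ht : t ∈ Ioo a b) :
    HasDerivAt (fun ρ => lap n z ρ t) (lap n (pr z) r t - n * pr z r t / sinh r ^ 2) r := by
  have hS := (sinh_pos hr).ne'
  refine ((h.Pr.Pr.hr hr ht).add ((((hasDerivAt_cosh r).div (hasDerivAt_sinh r) hS).const_mul
    (n:ℝ)).mul (h.Pr.hr hr ht))).congr_deriv ?_
  unfold lap
  have := cosh_sq r
  simp only [Pi.div_apply]
  field_simp
  linear_combination (-n * pr z r t) * this

lemma lap_ht (h : Sm a b z) (hr : 0 < r) (ht : t ∈ Ioo a b) :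
    HasDerivAt (fun τ => lap n z r τ) (lap n (pt z) r t) t := by
  refine ((h.Pr.Pr.ht hr ht).add ((h.Pr.ht hr ht).const_mul (n * (cosh r / sinh r)))).congr_deriv ?_
  unfold lap
  rw [h.comm hr ht, pr_congr (fun r hr t ht => h.comm hr ht) hr ht, h.Pr.comm hr ht]

lemma sq_sm (h : Sm a b g) (c k : ℝ) : Sm a b (fun r t => c + k * g r t ^ 2) :=
  ((Sm.const c).add ((Sm.const k).mul (h.mul h))).congr fun r _ t _ => by rw [sq]

lemma sq_r (h : Sm a b g) (c k : ℝ) (hr : 0 < r) (ht : t ∈ Ioo a b) :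
    pr (fun r t => c + k * g r t ^ 2) r t = 2 * k * (g r t * pr g r t) :=
  (((((h.hr hr ht).pow 2).const_mul k).const_add c).congr_deriv (by push_cast; ring)).deriv
lemma sq_t (h : Sm a b g) (c k : ℝ) (hr : 0 < r) (ht : t ∈ Ioo a b) :
    pt (fun r t => c + k * g r t ^ 2) r t = 2 * k * (g r t * pt g r t) :=
  (((((h.ht hr ht).pow 2).const_mul k).const_add c).congr_deriv (by push_cast; ring)).deriv
lemma sq_lap (h : Sm a b g) (c k : ℝ) (hr : 0 < r) (ht : t ∈ Ioo a b) :
    lap n (fun r t => c + k * g r t ^ 2) r t = 2 * k * (g r t * lap n g r t + pr g r t ^ 2) := by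
  unfold lap
  rw [sq_r h c k hr ht, pr_congr (fun r hr t ht => sq_r h c k hr ht) hr ht]
  have : pr (fun r t => 2 * k * (g r t * pr g r t)) r t
      = 2 * k * (pr g r t * pr g r t + g r t * pr (pr g) r t) :=
    (((h.hr hr ht).mul (h.Pr.hr hr ht)).const_mul (2 * k)).deriv
  rw [this]; ring

lemma eq_r (hz : Sm a b z) (hD : Sm a b D) (hE : Sm a b E)
    (he : ∀ r > (0:ℝ), ∀ t ∈ Ioo a b, pt z r t = D r t * lap n z r t + E r t)
    (hr : 0 < r) (ht : t ∈ Ioo a b) :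
    pt (pr z) r t = pr D r t * lap n z r t + D r t * (lap n (pr z) r t - n * pr z r t / sinh r ^ 2)
      + pr E r t := by
  rw [← hz.comm hr ht, pr_congr he hr ht]
  exact (((hD.hr hr ht).mul (lap_hr hz hr ht)).add (hE.hr hr ht)).deriv
lemma eq_t (hz : Sm a b z) (hD : Sm a b D) (hE : Sm a b E)
    (he : ∀ r > (0:ℝ), ∀ t ∈ Ioo a b, pt z r t = D r t * lap n z r t + E r t)
    (hr : 0 < r) (ht : t ∈ Ioo a b) :
    pt (pt z) r t = pt D r t * lap n z r t + D r t * lap n (pt z) r t + pt E r t := by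
  rw [pt_congr he hr ht]
  exact (((hD.ht hr ht).mul (lap_ht hz hr ht)).add (hE.ht hr ht)).deriv

lemma bern (hn : 1 ≤ n) (hz : Sm a b z) (hD : Sm a b D) (hE : Sm a b E)
    (he : ∀ r > (0:ℝ), ∀ t ∈ Ioo a b, pt z r t = D r t * lap n z r t + E r t)
    (hr : 0 < r) (ht : t ∈ Ioo a b) (hD0 : 0 < D r t) (c k : ℝ) (hk : 0 ≤ k) :
    pt (fun r t => c + k * pr z r t ^ 2) r t - D r t * lap n (fun r t => c + k * pr z r t ^ 2) r t ≤
      k * (2 * (pr z r t * (pr D r t * lap n z r t + pr E r t)) - D r t * pr (pr z) r t ^ 2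
        - D r t * lap n z r t ^ 2 / (n + 1) + n * D r t * pr z r t ^ 2) := by
  rw [sq_t hz.Pr c k hr ht, sq_lap hz.Pr c k hr ht, eq_r hz hD hE he hr ht]
  have hS := sinh_pos hr
  have hl : lap n z r t = pr (pr z) r t + n * (cosh r / sinh r) * pr z r t := rfl
  have hc : (cosh r / sinh r) ^ 2 = 1 + 1 / sinh r ^ 2 := by
    rw [div_pow, cosh_sq]; field_simp
  have hcs : lap n z r t ^ 2 / (n + 1) ≤ pr (pr z) r t ^ 2
      + n * (pr z r t ^ 2 + pr z r t ^ 2 / sinh r ^ 2) := by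
    rw [div_le_iff₀ (by positivity), hl]
    have : pr z r t ^ 2 + pr z r t ^ 2 / sinh r ^ 2 = (cosh r / sinh r) ^ 2 * pr z r t ^ 2 := by
      rw [hc]; ring
    rw [this]
    have h0 := mul_nonneg (Nat.cast_nonneg n (α := ℝ)) (sq_nonneg (pr (pr z) r t - (cosh r / sinh r) * pr z r t))
    linarith
  have h1 := mul_mono_l hcs (mul_nonneg hk hD0.le)
  have h2 : 0 ≤ k * D r t * (n * pr z r t ^ 2 / sinh r ^ 2) := by positivity
  have e1 : n * (pr z r t ^ 2 + pr z r t ^ 2 / sinh r ^ 2) = n * pr z r t ^ 2 + n * pr z r t ^ 2 / sinh r ^ 2 := by ring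
  have e2 : pr z r t * (n * pr z r t / sinh r ^ 2) = n * pr z r t ^ 2 / sinh r ^ 2 := by ring
  rw [e1] at h1
  have e3 : k * (D r t * lap n z r t ^ 2 / (n + 1)) = k * D r t * (lap n z r t ^ 2 / (n + 1)) := by ring
  have e4 : pr z r t * (pr D r t * lap n z r t + D r t * (lap n (pr z) r t - n * pr z r t / sinh r ^ 2) + pr E r t)
    = pr z r t * (pr D r t * lap n z r t + pr E r t) + D r t * (pr z r t * lap n (pr z) r t)
     - D r t * (pr z r t * (n * pr z r t / sinh r ^ 2)) := by ring
  rw [e4, e2]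
  generalize n * pr z r t ^ 2 / sinh r ^ 2 = G at *
  linarith
end calc2

lemma lemA {n : ℕ} {d ρ τ M c c1 k : ℝ} (hn : 1 ≤ n) (hd : 0 < d) (hd1 : d ≤ 1) (hρ : 0 < ρ)
    (hρ1 : ρ ≤ 1) (hτ : 0 < τ) (hM : 0 ≤ M) (hc : 0 ≤ c) (hk : 0 < k)
    (hk1 : 8 * (n + 1) * c1 ^ 2 ≤ k * d ^ 2) (hk2 : 128 * (k * M ^ 2) ≤ d ^ 4) :
    ∃ lam > 0, ∀ (a b Λ R t0 : ℝ) (D z E : ℝ → ℝ → ℝ), 0 < Λ → 0 < R → a < t0 - τ / Λ → t0 < b →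
      Sm a b z → Sm a b D → Sm a b E →
      (∀ r > (0:ℝ), ∀ t ∈ Ioo a b, pt z r t = D r t * lap n z r t + E r t) →
      (∀ r > 0, |r - R| < ρ → ∀ t ∈ Icc (t0 - τ / Λ) t0, d * Λ ≤ D r t ∧ D r t ≤ Λ / d ∧
        |z r t| ≤ M ∧ |pr D r t| ≤ Λ * (c + c1 * |pr z r t|) ∧ |E r t| ≤ Λ * c ∧
        |pr E r t| ≤ Λ * (c * (1 + |pr z r t|))) → |pr z R t0| ≤ lam := by
  set C := n / d + 2 * (n + 1) * c ^ 2 / d + 3 * c + 2 * k * M * c with hCd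
  have hC0 : 0 ≤ C := by positivity
  have hd3 : d ^ 4 ≤ d := by
    calc d ^ 4 ≤ d ^ 1 := pow_le_pow_of_le_one hd.le hd1 (by norm_num)
      _ = d := pow_one d
  have hMC : 0 ≤ MC n d (d / 2) ρ τ C := by unfold MC; positivity
  refine ⟨1 + (2 + (8 * MC n d (d / 2) ρ τ C + 8) / (2 * k * d)), by positivity, ?_⟩
  intro a b Λ R t0 D z E hΛ hR hat htb hz hD hE he H
  suffices hs : (fun r t => 0 + 1 * pr z r t ^ 2) R t0 ≤ 2 + (8 * MC n d (d / 2) ρ τ C + 8) / (2 * k * d) by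
    simp only [zero_add, one_mul] at hs
    have : |pr z R t0| ≤ 1 + pr z R t0 ^ 2 := by
      rw [← sq_abs]; exact le_one_sq _
    linarith
  refine lemM (a := a) (b := b) (Λ := Λ) (R := R) (t0 := t0) (Y := fun r t => 0 + 1 * pr z r t ^ 2) (β := 2 * k * M ^ 2 / d) (ε := 2 * (n + 1) * c1 ^ 2 / d) (D := D)
    (N := fun r t => pr (pr z) r t ^ 2) (W := fun r t => 2 * k * d * pr z r t ^ 2)
    (h := fun r t => 1 + k * z r t ^ 2) hn hΛ hd (by positivity) (by positivity) (by positivity)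
    ?_ ?_ ?_ (by positivity) hC0 hρ hρ1 hτ hR hat htb (sq_sm hz.Pr 0 1) (sq_sm hz 1 k) ?_
  · rw [div_le_one hd]; linarith
  · rw [mul_div_assoc', div_le_iff₀ hd]; linarith
  · rw [mul_div_assoc', div_le_iff₀ hd]; linarith
  intro r hr hrR t ht
  obtain ⟨h1, h2, h3, h4, h5, h6⟩ := H r hr hrR t ht
  have htab : t ∈ Ioo a b := ⟨hat.trans_le ht.1, ht.2.trans_lt htb⟩
  have hdΛ : 0 < d * Λ := by positivity
  have hD0 : 0 < D r t := hdΛ.trans_le h1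
  have hz2 : z r t ^ 2 ≤ M ^ 2 := sq_le_sq.2 (by rwa [abs_of_nonneg hM])
  have hkz : k * z r t ^ 2 ≤ k * M ^ 2 := mul_mono_l hz2 hk.le
  refine ⟨hD0, h2, by positivity, by positivity, ?_, ?_, ?_, ?_, ?_, ?_, ?_⟩
  · have : 0 ≤ k * z r t ^ 2 := by positivity
    simpa using this
  · linarith
  · rw [sq_r hz.Pr 0 1 hr htab]
    apply le_of_eq; ring
  · have hb := bern hn hz hD hE he hr htab hD0 0 1 zero_le_one
    refine hb.trans ?_
    simp only [zero_add, one_mul]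
    set y := pr z r t
    set X := lap n z r t
    set y2 := pr (pr z) r t
    set D1 := pr D r t
    set E1 := pr E r t
    set Dv := D r t
    have g1 : 2 * |y * D1 * X| ≤ Dv * X ^ 2 / (n + 1) + (n + 1) * (y ^ 2 * D1 ^ 2 / Dv) := by
      refine two_abs_le (by positivity) (by positivity) (le_of_eq ?_)
      field_simp
    have g2 : D1 ^ 2 / Dv ≤ Λ * (2 * c ^ 2 + 2 * c1 ^ 2 * y ^ 2) / d := by
      rw [div_le_div_iff₀ hD0 hd]
      have q1 : D1 ^ 2 ≤ Λ ^ 2 * (2 * c ^ 2 + 2 * c1 ^ 2 * y ^ 2) := by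
        calc D1 ^ 2 = |D1| ^ 2 := (sq_abs _).symm
          _ ≤ (Λ * (c + c1 * |y|)) ^ 2 := pow_le_pow_left₀ (abs_nonneg _) h4 2
          _ = Λ ^ 2 * (2 * c ^ 2 + 2 * c1 ^ 2 * |y| ^ 2 - (c - c1 * |y|) ^ 2) := by ring
          _ ≤ _ := by rw [sq_abs]; gcongr; linarith [sq_nonneg (c - c1 * |y|)]
      calc D1 ^ 2 * d ≤ Λ ^ 2 * (2 * c ^ 2 + 2 * c1 ^ 2 * y ^ 2) * d := by gcongr
        _ = Λ * (2 * c ^ 2 + 2 * c1 ^ 2 * y ^ 2) * (d * Λ) := by ring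
        _ ≤ _ := by gcongr
    have g3 : 2 * (y * E1) ≤ Λ * (3 * c * (y ^ 2 + 1)) := by
      have q1 : 2 * (y * E1) ≤ 2 * (|y| * (Λ * (c * (1 + |y|)))) := by
        have := le_abs_self (y * E1)
        rw [abs_mul] at this
        have := mul_mono_l h6 (abs_nonneg y)
        linarith
      have q2 : 2 * (|y| * (1 + |y|)) ≤ 3 * (y ^ 2 + 1) := by
        rw [← sq_abs y]; have := sq_nonneg (|y| - 1); linarith
      have q3 := mul_mono_l q2 (show 0 ≤ Λ * c by positivity)
      linarith
    have g4 : Dv * (n * y ^ 2) ≤ Λ / d * (n * y ^ 2) := by gcongr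
    have g5 : d * Λ * y2 ^ 2 ≤ Dv * y2 ^ 2 := by gcongr
    have g6 := mul_mono_l g2 (show 0 ≤ (n + 1) * y ^ 2 by positivity)
    have g7 := le_abs_self (y * D1 * X)
    have g8 : 0 ≤ Λ * (n / d + 2 * (n + 1) * c ^ 2 / d + 2 * k * M * c * (y ^ 2 + 1)) := by positivity
    rw [hCd]
    have e1 : (n + 1) * (y ^ 2 * D1 ^ 2 / Dv) = (n + 1) * y ^ 2 * (D1 ^ 2 / Dv) := by ring
    have e2 : Λ * (-(2 * (d / 2) * y2 ^ 2) + 2 * (n + 1) * c1 ^ 2 / d * (y ^ 2) ^ 2 +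
      (n / d + 2 * (n + 1) * c ^ 2 / d + 3 * c + 2 * k * M * c) * (y ^ 2 + 1)) =
      -(d * Λ * y2 ^ 2) + Λ / d * (n * y ^ 2) + Λ * (3 * c * (y ^ 2 + 1))
       + (n + 1) * y ^ 2 * (Λ * (2 * c ^ 2 + 2 * c1 ^ 2 * y ^ 2) / d)
       + Λ * (n / d + 2 * (n + 1) * c ^ 2 / d + 2 * k * M * c * (y ^ 2 + 1)) := by ring
    rw [e2]; rw [e1] at g1
    linarith
  · rw [sq_t hz 1 k hr htab, sq_lap hz 1 k hr htab, he r hr t htab]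
    have q1 : z r t * E r t ≤ M * (Λ * c) := by
      refine (le_abs_self _).trans ?_
      rw [abs_mul]; exact mul_le_mul h3 h5 (abs_nonneg _) hM
    have q2 := mul_mono_l q1 (show 0 ≤ 2 * k by positivity)
    have q3 := mul_mono_r h1 (show 0 ≤ 2 * k * pr z r t ^ 2 by positivity)
    have q4 : 0 ≤ Λ * (n / d + 2 * (n + 1) * c ^ 2 / d + 3 * c) := by positivity
    rw [hCd]; linarith
  · rw [sq_r hz 1 k hr htab]
    have e : 2 * k * M ^ 2 / d * (2 * k * d * pr z r t ^ 2) = 4 * k ^ 2 * pr z r t ^ 2 * M ^ 2 := by field_simp; ring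
    rw [e]
    calc (2 * k * (z r t * pr z r t)) ^ 2 = 4 * k ^ 2 * pr z r t ^ 2 * z r t ^ 2 := by ring
      _ ≤ _ := by gcongr
  · simp

lemma lemB {n : ℕ} {d ρ τ c : ℝ} (hn : 1 ≤ n) (hd : 0 < d) (hd1 : d ≤ 1) (hρ : 0 < ρ)
    (hρ1 : ρ ≤ 1) (hτ : 0 < τ) (hc : 0 < c) :
    ∃ lam > 0, ∀ (a b Λ R t0 : ℝ) (D z E : ℝ → ℝ → ℝ), 0 < Λ → 0 < R → a < t0 - τ / Λ → t0 < b →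
      Sm a b z → Sm a b D → Sm a b E →
      (∀ r > (0:ℝ), ∀ t ∈ Ioo a b, pt z r t = D r t * lap n z r t + E r t) →
      (∀ r > 0, |r - R| < ρ → ∀ t ∈ Icc (t0 - τ / Λ) t0, d * Λ ≤ D r t ∧ D r t ≤ Λ / d ∧
        |pr z r t| ≤ c ∧ |pr D r t| ≤ Λ * c ∧ |E r t| ≤ Λ * c ∧ |pr E r t| ≤ Λ * c ∧
        |pt D r t * lap n z r t + pt E r t| ≤ Λ ^ 2 * (c * (1 + (pt z r t / Λ) ^ 2))) →
      |pt z R t0| ≤ lam * Λ := by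
  obtain ⟨k, hk, hkc⟩ : ∃ k > 0, 128 * (k * c ^ 2) = d ^ 4 :=
    ⟨d ^ 4 / (128 * c ^ 2), by positivity, by field_simp⟩
  have hd3 : d ^ 4 ≤ d := by
    calc d ^ 4 ≤ d ^ 1 := pow_le_pow_of_le_one hd.le hd1 (by norm_num)
      _ = d := pow_one d
  obtain ⟨γ, hγ, hγd⟩ : ∃ γ > 0, γ = k * d / (4 * (n + 1)) := ⟨_, by positivity, rfl⟩
  set C := (c + c ^ 2 / (γ / 8)) + k * (2 * (n + 1) * c ^ 4 / d + 2 * c ^ 2 + n * c ^ 2 / d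
    + d * c ^ 2) with hCd
  have hC0 : 0 ≤ C := by positivity
  have hMC : 0 ≤ MC n d d ρ τ C := by unfold MC; positivity
  refine ⟨1 + (2 + (8 * MC n d d ρ τ C + 8) / γ), by positivity, ?_⟩
  intro a b Λ R t0 D z E hΛ hR hat htb hz hD hE he H
  suffices hs : (fun r t => 0 + (Λ ^ 2)⁻¹ * pt z r t ^ 2) R t0 ≤ 2 + (8 * MC n d d ρ τ C + 8) / γ by
    have e : (0:ℝ) + (Λ ^ 2)⁻¹ * pt z R t0 ^ 2 = (|pt z R t0| / Λ) ^ 2 := by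
      rw [div_pow, sq_abs]; field_simp; ring
    have : |pt z R t0| / Λ ≤ 1 + (|pt z R t0| / Λ) ^ 2 := le_one_sq _
    rw [← div_le_iff₀ hΛ]
    beta_reduce at hs
    linarith
  refine lemM (a := a) (b := b) (Λ := Λ) (R := R) (t0 := t0) (Y := fun r t => 0 + (Λ ^ 2)⁻¹ * pt z r t ^ 2)
    (β := 4 * k * c ^ 2 / d) (ε := γ / 8) (D := D)
    (N := fun r t => (Λ ^ 2)⁻¹ * pr (pt z) r t ^ 2)
    (W := fun r t => k * d * pr (pr z) r t ^ 2 + γ * ((Λ ^ 2)⁻¹ * pt z r t ^ 2))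
    (h := fun r t => 1 + k * pr z r t ^ 2) hn hΛ hd hd hγ (by positivity)
    ?_ ?_ (by linarith) (by positivity) hC0 hρ hρ1 hτ hR hat htb (sq_sm hz.Pt 0 _) (sq_sm hz.Pr 1 k) ?_
  · rw [div_le_one hd]; linarith
  · rw [mul_div_assoc', div_le_iff₀ hd]; linarith
  intro r hr hrR t ht
  obtain ⟨h1, h2, h3, h4, h5, h6, h7⟩ := H r hr hrR t ht
  have htab : t ∈ Ioo a b := ⟨hat.trans_le ht.1, ht.2.trans_lt htb⟩
  have hdΛ : 0 < d * Λ := by positivity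
  have hD0 : 0 < D r t := hdΛ.trans_le h1
  have hz2 : pr z r t ^ 2 ≤ c ^ 2 := sq_le_sq.2 (by rwa [abs_of_nonneg hc.le])
  have hkz : k * pr z r t ^ 2 ≤ k * c ^ 2 := mul_mono_l hz2 hk.le
  have hgx : (Λ ^ 2)⁻¹ * pt z r t ^ 2 = (pt z r t / Λ) ^ 2 := by field_simp
  refine ⟨hD0, h2, by positivity, by positivity, ?_, ?_, ?_, ?_, ?_, ?_, ?_⟩
  · have : 0 ≤ k * pr z r t ^ 2 := by positivity
    simpa using this
  · linarith
  · rw [sq_r hz.Pt 0 _ hr htab]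
    apply le_of_eq; ring
  · rw [sq_t hz.Pt 0 _ hr htab, sq_lap hz.Pt 0 _ hr htab, eq_t hz hD hE he hr htab]
    simp only [zero_add]
    have q1 := mul_mono_r h1 (show 0 ≤ 2 * ((Λ ^ 2)⁻¹ * pr (pt z) r t ^ 2) by positivity)
    set x := |pt z r t / Λ| with hx
    have hx2 : (pt z r t / Λ) ^ 2 = x ^ 2 := (sq_abs _).symm
    have hx0 : 0 ≤ x := abs_nonneg _
    have q2 : (Λ ^ 2)⁻¹ * pt z r t * (pt D r t * lap n z r t + pt E r t) ≤ Λ * (x * (c * (1 + x ^ 2))) := by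
      have e : (Λ ^ 2)⁻¹ * pt z r t = (pt z r t / Λ) * Λ⁻¹ := by field_simp
      rw [e]
      refine (le_abs_self _).trans ?_
      rw [abs_mul, abs_mul, ← hx, abs_of_pos (inv_pos.2 hΛ)]
      calc _ ≤ x * Λ⁻¹ * (Λ ^ 2 * (c * (1 + (pt z r t / Λ) ^ 2))) := by gcongr
        _ = _ := by rw [hx2]; field_simp
    rw [hgx, hx2]
    have q3 : 2 * |c * x| ≤ c + c * x ^ 2 := two_abs_le hc.le (by positivity) (by apply le_of_eq; ring)
    have q4 : 2 * |c * x| ≤ c ^ 2 / (γ / 8) + γ / 8 * x ^ 2 :=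
      two_abs_le (by positivity) (by positivity) (by apply le_of_eq; field_simp)
    rw [abs_of_nonneg (by positivity)] at q3 q4
    have q5 := mul_mono_r q4 (sq_nonneg x)
    have q6 : 2 * (x * (c * (1 + x ^ 2))) ≤ γ / 8 * (x ^ 2) ^ 2 + C * (x ^ 2 + 1) := by
      have q7 : (c + c ^ 2 / (γ / 8)) * (x ^ 2 + 1) ≤ C * (x ^ 2 + 1) := by
        rw [hCd]
        refine mul_mono_r ?_ (by positivity)
        exact le_add_of_nonneg_right (by positivity)
      have : 0 ≤ c ^ 2 / (γ / 8) := by positivity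
      linarith
    have q8 := mul_mono_l q6 hΛ.le
    linarith
  · have hb := bern hn hz hD hE he hr htab hD0 1 k hk.le
    refine hb.trans ?_
    have hze := he r hr t htab
    set y := pr z r t
    set X := lap n z r t
    set y2 := pr (pr z) r t
    set D1 := pr D r t
    set E1 := pr E r t
    set Dv := D r t
    set Ev := E r t
    have g1 : 2 * |y * D1 * X| ≤ Dv * X ^ 2 / (2 * (n + 1)) + 2 * (n + 1) * (y ^ 2 * D1 ^ 2 / Dv) := by
      refine two_abs_le (by positivity) (by positivity) (le_of_eq ?_)
      field_simp
    have g2 : y ^ 2 * D1 ^ 2 / Dv ≤ Λ * c ^ 4 / d := by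
      have q1 : D1 ^ 2 ≤ (Λ * c) ^ 2 := sq_le_sq.2 (by rwa [abs_of_nonneg (show 0 ≤ Λ * c by positivity)])
      rw [div_le_div_iff₀ hD0 hd]
      calc y ^ 2 * D1 ^ 2 * d ≤ c ^ 2 * (Λ * c) ^ 2 * d := by gcongr
        _ = Λ * c ^ 4 * (d * Λ) := by ring
        _ ≤ _ := by gcongr
    have g3 : y * E1 ≤ c * (Λ * c) := by
      refine (le_abs_self _).trans ?_
      rw [abs_mul]; exact mul_le_mul h3 h6 (abs_nonneg _) hc.le
    have g4 : n * Dv * y ^ 2 ≤ n * (Λ / d) * c ^ 2 := by gcongr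
    have g5 : d * Λ * y2 ^ 2 ≤ Dv * y2 ^ 2 := by gcongr
    have g6 : d * Λ * ((pt z r t / Λ) ^ 2 / 2 - c ^ 2) ≤ Dv * X ^ 2 := by
      have e1 : Dv * X ^ 2 = (pt z r t - Ev) ^ 2 / Dv := by
        rw [hze]; field_simp; ring
      have e2 : d * Λ * ((pt z r t / Λ) ^ 2 / 2 - c ^ 2) ≤ (pt z r t - Ev) ^ 2 * (d / Λ) := by
        have q1 : Ev ^ 2 ≤ (Λ * c) ^ 2 := sq_le_sq.2 (by rwa [abs_of_nonneg (show 0 ≤ Λ * c by positivity)])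
        have q2 : pt z r t ^ 2 / 2 - (Λ * c) ^ 2 ≤ (pt z r t - Ev) ^ 2 := by
          have := sq_nonneg (pt z r t - 2 * Ev)
          linarith
        have q3 := mul_mono_r q2 (show 0 ≤ d / Λ by positivity)
        refine le_trans (le_of_eq ?_) q3
        field_simp
      rw [e1]
      refine e2.trans ?_
      rw [div_eq_mul_inv _ Dv]
      refine mul_mono_l ?_ (by positivity)
      rw [← one_div, div_le_div_iff₀ hΛ hD0]
      have := (le_div_iff₀ hd).1 h2
      linarith
    have g7 := le_abs_self (y * D1 * X)
    have e0 : Dv * X ^ 2 / (n + 1) = Dv * X ^ 2 / (2 * (n + 1)) + Dv * X ^ 2 / (2 * (n + 1)) := by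
      field_simp; ring
    have g8 := div_le_div_of_nonneg_right g6 (show 0 ≤ 2 * ((n:ℝ) + 1) by positivity)
    have g9 := mul_mono_l g2 (show 0 ≤ 2 * ((n:ℝ) + 1) by positivity)
    have g10 : d * Λ * c ^ 2 / (2 * (n + 1)) ≤ d * Λ * c ^ 2 := by
      refine div_le_self (by positivity) ?_
      have : (0:ℝ) ≤ n := Nat.cast_nonneg n
      linarith
    have e3 : d * Λ * ((pt z r t / Λ) ^ 2 / 2 - c ^ 2) / (2 * (n + 1)) =
      Λ * (d / (4 * (n + 1)) * (pt z r t / Λ) ^ 2) - d * Λ * c ^ 2 / (2 * (n + 1)) := by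
      field_simp; ring
    have e4 : 0 ≤ Λ * (c + c ^ 2 / (γ / 8)) := by positivity
    rw [e3] at g8
    have big : 2 * (y * (D1 * X + E1)) - Dv * y2 ^ 2 - Dv * X ^ 2 / (n + 1) + n * Dv * y ^ 2 ≤
      Λ * (-(d * y2 ^ 2 + d / (4 * (n + 1)) * (pt z r t / Λ) ^ 2) + (2 * (n + 1) * c ^ 4 / d + 2 * c ^ 2 + n * c ^ 2 / d
    + d * c ^ 2)) := by
      rw [e0]
      have e5 : Λ * (-(d * y2 ^ 2 + d / (4 * (n + 1)) * (pt z r t / Λ) ^ 2) + (2 * (n + 1) * c ^ 4 / d + 2 * c ^ 2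
        + n * c ^ 2 / d + d * c ^ 2)) = - (d * Λ * y2 ^ 2) - Λ * (d / (4 * (n + 1)) * (pt z r t / Λ) ^ 2)
        + 2 * (n + 1) * (Λ * c ^ 4 / d) + 2 * (c * (Λ * c)) + n * (Λ / d) * c ^ 2 + d * Λ * c ^ 2 := by ring
      rw [e5]
      linarith
    have := mul_mono_l big hk.le
    refine this.trans ?_
    rw [hCd, hgx, hγd] at *
    have e6 : k * d / (4 * (n + 1)) * (pt z r t / Λ) ^ 2 = k * (d / (4 * (n + 1)) * (pt z r t / Λ) ^ 2) := by ring
    rw [e6]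
    linarith
  · rw [sq_r hz.Pr 1 k hr htab]
    calc (2 * k * (pr z r t * pr (pr z) r t)) ^ 2 = 4 * k ^ 2 * pr (pr z) r t ^ 2 * pr z r t ^ 2 := by ring
      _ ≤ 4 * k ^ 2 * pr (pr z) r t ^ 2 * c ^ 2 := by gcongr
      _ = 4 * k * c ^ 2 / d * (k * d * pr (pr z) r t ^ 2) := by field_simp
      _ ≤ _ := by
        refine mul_mono_l ?_ (by positivity)
        exact le_add_of_nonneg_right (by positivity)
  · simp only [zero_add]
    exact le_add_of_nonneg_left (by positivity)

noncomputable def Kw (n : ℕ) (κ T r t : ℝ) : ℝ := (T - t) ^ κ * cosh r ^ (-(n:ℝ))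

lemma cosh_win {r R : ℝ} (h : |r - R| ≤ 1) : cosh r ≤ exp 1 * cosh R := by
  obtain ⟨h1, h2⟩ := abs_le.1 h
  rw [cosh_eq, cosh_eq]
  have e1 : exp r ≤ exp 1 * exp R := by
    rw [← exp_add]; exact exp_le_exp.2 (by linarith)
  have e2 : exp (-r) ≤ exp 1 * exp (-R) := by
    rw [← exp_add]; exact exp_le_exp.2 (by linarith)
  linarith

lemma rpow_cmp {x y q : ℝ} (hx : 0 < x) (hy : 0 < y) (hq : 1 ≤ q) (h1 : x ≤ q * y) (h2 : y ≤ q * x)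
    (s : ℝ) : x ^ s ≤ q ^ |s| * y ^ s := by
  have hq0 : 0 < q := by linarith
  rcases le_total 0 s with hs | hs
  · rw [abs_of_nonneg hs, ← mul_rpow hq0.le hy.le]
    exact rpow_le_rpow hx.le h1 hs
  · rw [abs_of_nonpos hs]
    have h3 : y ^ (-s) ≤ q ^ (-s) * x ^ (-s) := by
      rw [← mul_rpow hq0.le hx.le]; exact rpow_le_rpow hy.le h2 (by linarith)
    rw [rpow_neg hx.le, rpow_neg hy.le] at h3
    have hxs : 0 < x ^ s := by positivity
    have hys : 0 < y ^ s := by positivity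
    have := mul_mono_r h3 (show 0 ≤ x ^ s * y ^ s by positivity)
    have e1 : (y ^ s)⁻¹ * (x ^ s * y ^ s) = x ^ s := by field_simp
    have e2 : q ^ (-s) * (x ^ s)⁻¹ * (x ^ s * y ^ s) = q ^ (-s) * y ^ s := by field_simp
    rwa [e1, e2] at this

lemma Kw_pos {n : ℕ} {κ T r t : ℝ} (ht : t < T) : 0 < Kw n κ T r t :=
  mul_pos (rpow_pos_of_pos (by linarith) _) (rpow_pos_of_pos (cosh_pos r) _)
lemma Kw_pos' (n : ℕ) (κ r : ℝ) {T t : ℝ} (ht : t < T) : 0 < Kw n κ T r t := Kw_pos ht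

lemma cosh_b_le {n : ℕ} {r R : ℝ} (h : |r - R| ≤ 1) :
    cosh r ^ (-(n:ℝ)) ≤ exp 1 ^ (n:ℝ) * cosh R ^ (-(n:ℝ)) := by
  have := rpow_cmp (cosh_pos r) (cosh_pos R) (one_le_exp zero_le_one)
    (cosh_win h) (cosh_win (by rwa [abs_sub_comm])) (-(n:ℝ))
  rwa [abs_neg, abs_of_nonneg (Nat.cast_nonneg n)] at this

lemma Kw_win {n : ℕ} {κ T r R t t0 : ℝ} (hκ : 0 < κ) (h : |r - R| ≤ 1) (ht0 : t0 < T)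
    (ht : t ∈ Icc (2 * t0 - T) t0) (s : ℝ) :
    Kw n κ T r t ^ s ≤ (2 ^ κ * exp 1 ^ (n:ℝ)) ^ |s| * Kw n κ T R t0 ^ s ∧
    Kw n κ T R t0 ^ s ≤ (2 ^ κ * exp 1 ^ (n:ℝ)) ^ |s| * Kw n κ T r t ^ s := by
  have hl0 : 0 < T - t0 := by linarith
  have hl1 : T - t0 ≤ T - t := by linarith [ht.2]
  have hl2 : T - t ≤ 2 * (T - t0) := by linarith [ht.1]
  have htT : t < T := by linarith [ht.2]
  have h2 : (1:ℝ) ≤ 2 ^ κ := one_le_rpow (by norm_num) hκ.le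
  have he : (1:ℝ) ≤ exp 1 ^ (n:ℝ) :=
    one_le_rpow (one_le_exp zero_le_one) (Nat.cast_nonneg n)
  have a1 : (T - t) ^ κ ≤ 2 ^ κ * (T - t0) ^ κ := by
    rw [← mul_rpow (by norm_num) hl0.le]
    exact rpow_le_rpow (by linarith) hl2 hκ.le
  have a2 : (T - t0) ^ κ ≤ 2 ^ κ * (T - t) ^ κ := by
    have : (T - t0) ^ κ ≤ (T - t) ^ κ := rpow_le_rpow hl0.le hl1 hκ.le
    exact this.trans (le_mul_of_one_le_left (by positivity) h2)
  have b1 := cosh_b_le (n := n) h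
  have b2 := cosh_b_le (n := n) (r := R) (R := r) (by rwa [abs_sub_comm])
  have cr := rpow_pos_of_pos (cosh_pos r) (-(n:ℝ))
  have cR := rpow_pos_of_pos (cosh_pos R) (-(n:ℝ))
  have k1 : Kw n κ T r t ≤ 2 ^ κ * exp 1 ^ (n:ℝ) * Kw n κ T R t0 := by
    unfold Kw
    refine (mul_le_mul a1 b1 cr.le (by positivity)).trans_eq (by ring)
  have k2 : Kw n κ T R t0 ≤ 2 ^ κ * exp 1 ^ (n:ℝ) * Kw n κ T r t := by
    unfold Kw
    refine (mul_le_mul a2 b2 cR.le (by positivity)).trans_eq (by ring)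
  have hq : 1 ≤ 2 ^ κ * exp 1 ^ (n:ℝ) := by
    have := mul_le_mul h2 he zero_le_one (by linarith)
    linarith
  exact ⟨rpow_cmp (Kw_pos htT) (Kw_pos ht0) hq k1 k2 s, rpow_cmp (Kw_pos ht0) (Kw_pos htT) hq k2 k1 s⟩

lemma Kw_small {n : ℕ} {p κ T R t0 : ℝ} (hp : 1 < p) (hκ : (p - 1) * κ = 1) (ht0 : t0 < T) :
    Kw n κ T R t0 ^ (p - 1) ≤ T - t0 := by
  have hl0 : 0 < T - t0 := by linarith
  unfold Kw
  rw [mul_rpow (by positivity) (by have := cosh_pos R; positivity), ← rpow_mul hl0.le, mul_comm κ,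
    hκ, rpow_one]
  refine mul_le_of_le_one_right hl0.le ?_
  refine rpow_le_one (by have := cosh_pos R; positivity) ?_ (by linarith)
  exact Real.rpow_le_one_of_one_le_of_nonpos (one_le_cosh R) (by simp)

lemma ev_win {T : ℝ} {P : ℝ → Prop} (h : ∀ᶠ t in 𝓝[<] T, P t) :
    ∀ᶠ t0 in 𝓝[<] T, t0 < T ∧ ∀ t ∈ Icc (2 * t0 - T) t0, P t := by
  obtain ⟨l, hl, hP⟩ := (mem_nhdsLT_iff_exists_Ioo_subset).1 h
  have : Ioo ((l + T) / 2) T ∈ 𝓝[<] T := Ioo_mem_nhdsLT (by have : l < T := hl; linarith)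
  filter_upwards [this] with t0 h0
  exact ⟨h0.2, fun t ht => hP ⟨by linarith [ht.1, h0.1], ht.2.trans_lt h0.2⟩⟩

structure Ctx (n : ℕ) (p κ a T : ℝ) (f : ℝ → ℝ → ℝ) : Prop where
  sol : Sol n p a T f
  hκ : (p - 1) * κ = 1
  aT : a < T
  cmp : ∃ C ≥ 1, ∀ᶠ t in 𝓝[<] T, ∀ r > 0, f r t ≤ C * Kw n κ T r t ∧ Kw n κ T r t ≤ C * f r t
  osc : ∀ M > 0, ∃ ρ > 0, ρ ≤ 1 ∧ ∃ τ > 0, τ ≤ 1 ∧ ∀ᶠ t0 in 𝓝[<] T, ∀ R > 0, ∀ r > 0, |r - R| < ρ →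
    ∀ t ∈ Icc (t0 - τ * Kw n κ T R t0 ^ (p - 1)) t0, |f r t - f R t0| ≤ M * Kw n κ T R t0

def Ow (n : ℕ) (κ T : ℝ) (s : ℝ) (g : ℝ → ℝ → ℝ) : Prop :=
  ∃ C > 0, ∀ᶠ t in 𝓝[<] T, ∀ r > 0, |g r t| ≤ C * Kw n κ T r t ^ s

lemma ev_Ioo {a T : ℝ} (h : a < T) : ∀ᶠ t in 𝓝[<] T, t ∈ Ioo a T := Ioo_mem_nhdsLT h

lemma pr_cmul (c : ℝ) (z : ℝ → ℝ → ℝ) : pr (fun r t => c * z r t) = fun r t => c * pr z r t := by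
  funext r t; exact deriv_const_mul_field c
lemma pt_cmul (c : ℝ) (z : ℝ → ℝ → ℝ) : pt (fun r t => c * z r t) = fun r t => c * pt z r t := by
  funext r t; exact deriv_const_mul_field c
lemma lap_cmul (n : ℕ) (c : ℝ) (z : ℝ → ℝ → ℝ) :
    lap n (fun r t => c * z r t) = fun r t => c * lap n z r t := by
  funext r t; unfold lap; rw [pr_cmul, pr_cmul]; ring

section ctx
variable {n : ℕ} {p κ a T : ℝ} {f z E : ℝ → ℝ → ℝ}

noncomputable def Dc (p : ℝ) (f : ℝ → ℝ → ℝ) : ℝ → ℝ → ℝ := fun r t => p⁻¹ * f r t ^ (1 - p)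

lemma Ctx.κ0 (h : Ctx n p κ a T f) : 0 < κ := by
  have := h.hκ; have h1 := h.sol.hp
  by_contra! hc
  have := mul_nonneg (by linarith : 0 ≤ p - 1) (neg_nonneg.2 hc)
  linarith

lemma Sol.Dsm (h : Sol n p a T f) : Sm a T (Dc p f) := (Sm.const p⁻¹).mul (h.smq (1 - p))

lemma Sol.fq_r (h : Sol n p a T f) (q : ℝ) {r t : ℝ} (hr : 0 < r) (ht : t ∈ Ioo a T) :
    pr (fun r t => f r t ^ q) r t = q * f r t ^ (q - 1) * pr f r t :=
  (((h.sm.hr hr ht).rpow_const (p := q) (Or.inl (h.pos hr ht).ne')).congr_deriv (by ring)).deriv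
lemma Sol.fq_t (h : Sol n p a T f) (q : ℝ) {r t : ℝ} (hr : 0 < r) (ht : t ∈ Ioo a T) :
    pt (fun r t => f r t ^ q) r t = q * f r t ^ (q - 1) * pt f r t :=
  (((h.sm.ht hr ht).rpow_const (p := q) (Or.inl (h.pos hr ht).ne')).congr_deriv (by ring)).deriv

lemma Sol.D_r (h : Sol n p a T f) {r t : ℝ} (hr : 0 < r) (ht : t ∈ Ioo a T) :
    pr (Dc p f) r t = -((p - 1) / p) * f r t ^ (-p) * pr f r t := by
  unfold Dc
  rw [pr_cmul]; beta_reduce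
  rw [h.fq_r _ hr ht, show 1 - p - 1 = -p by ring]
  ring

lemma Ctx.fq (h : Ctx n p κ a T f) (q : ℝ) : ∃ C > 0, ∀ᶠ t in 𝓝[<] T, ∀ r > 0,
    f r t ^ q ≤ C * Kw n κ T r t ^ q ∧ Kw n κ T r t ^ q ≤ C * f r t ^ q := by
  obtain ⟨C, hC, hb⟩ := h.cmp
  refine ⟨C ^ |q|, by positivity, ?_⟩
  filter_upwards [hb, ev_Ioo h.aT] with t ht hta r hr
  obtain ⟨h1, h2⟩ := ht r hr
  have hf := h.sol.pos hr hta
  have hK := Kw_pos' n κ r hta.2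
  exact ⟨rpow_cmp hf hK hC h1 h2 q, rpow_cmp hK hf hC h2 h1 q⟩

lemma Ctx.win (h : Ctx n p κ a T f) {P : ℝ → Prop} (hP : ∀ᶠ t in 𝓝[<] T, P t) :
    ∀ᶠ t0 in 𝓝[<] T, t0 < T ∧ ∀ R τ, τ ≤ 1 →
      a < t0 - τ / Kw n κ T R t0 ^ (1 - p) ∧
      ∀ t ∈ Icc (t0 - τ / Kw n κ T R t0 ^ (1 - p)) t0, P t ∧ t ∈ Ioo a T ∧ t ∈ Icc (2 * t0 - T) t0 := by
  filter_upwards [ev_win (hP.and (ev_Ioo h.aT))] with t0 h0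
  refine ⟨h0.1, fun R τ hτ => ?_⟩
  have hK := Kw_pos' n κ R h0.1
  have e : τ / Kw n κ T R t0 ^ (1 - p) ≤ T - t0 := by
    rw [show 1 - p = -(p - 1) by ring, rpow_neg hK.le, div_inv_eq_mul]
    have h1 := Kw_small (n := n) (R := R) h.sol.hp h.hκ h0.1
    have h2 := mul_mono_r hτ (show 0 ≤ Kw n κ T R t0 ^ (p - 1) by positivity)
    linarith
  have hw := h0.2 (2 * t0 - T) ⟨le_rfl, by linarith⟩
  refine ⟨by linarith [hw.2.1], fun t ht => ?_⟩
  have ht' : t ∈ Icc (2 * t0 - T) t0 := ⟨by linarith [ht.1], ht.2⟩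
  exact ⟨(h0.2 t ht').1, (h0.2 t ht').2, ht'⟩

lemma Ctx.D_bd (h : Ctx n p κ a T f) : ∃ d > 0, d ≤ 1 ∧ ∀ᶠ t0 in 𝓝[<] T, ∀ R, ∀ r > 0, |r - R| ≤ 1 →
    ∀ t ∈ Icc (2 * t0 - T) t0, d * Kw n κ T R t0 ^ (1 - p) ≤ Dc p f r t ∧
      Dc p f r t ≤ Kw n κ T R t0 ^ (1 - p) / d := by
  obtain ⟨C, hC, hb⟩ := h.fq (1 - p)
  have hp := h.sol.p0
  set Q := (2 ^ κ * exp 1 ^ (n:ℝ)) ^ |1 - p| with hQ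
  have hQ0 : 0 < Q := by positivity
  refine ⟨min 1 (min (p⁻¹ / (C * Q)) (p / (C * Q))), by positivity, min_le_left _ _, ?_⟩
  filter_upwards [ev_win hb] with t0 h0 R r hr hrR t ht
  obtain ⟨k1, k2⟩ := Kw_win (n := n) h.κ0 hrR h0.1 ht (1 - p)
  rw [← hQ] at k1 k2
  obtain ⟨f1, f2⟩ := h0.2 t ht r hr
  have hK0 : 0 < Kw n κ T R t0 ^ (1 - p) := rpow_pos_of_pos (Kw_pos h0.1) _
  set Λ := Kw n κ T R t0 ^ (1 - p)
  set d := min 1 (min (p⁻¹ / (C * Q)) (p / (C * Q))) with hd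
  have hd0 : 0 < d := by positivity
  have d1 : d ≤ p⁻¹ / (C * Q) := (min_le_right _ _).trans (min_le_left _ _)
  have d2 : d ≤ p / (C * Q) := (min_le_right _ _).trans (min_le_right _ _)
  unfold Dc
  constructor
  · have u1 : Λ ≤ Q * (C * f r t ^ (1 - p)) := k2.trans (by gcongr)
    calc d * Λ ≤ p⁻¹ / (C * Q) * (Q * (C * f r t ^ (1 - p))) := by gcongr
      _ = _ := by field_simp
  · have u1 : f r t ^ (1 - p) ≤ C * (Q * Λ) := f1.trans (by gcongr)
    rw [le_div_iff₀ hd0]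
    calc p⁻¹ * f r t ^ (1 - p) * d ≤ p⁻¹ * (C * (Q * Λ)) * (p / (C * Q)) := by gcongr
      _ = _ := by field_simp
end ctx

section ctx
variable {n : ℕ} {p κ a T s s' : ℝ} {f z E g g' : ℝ → ℝ → ℝ}

noncomputable def Qw (n : ℕ) (κ s : ℝ) : ℝ := (2 ^ κ * exp 1 ^ (n:ℝ)) ^ |s|
lemma Qw_pos : 0 < Qw n κ s := by unfold Qw; positivity

lemma Ow.win (hκ : 0 < κ) (h : Ow n κ T s g) : ∃ C > 0, ∀ᶠ t0 in 𝓝[<] T, ∀ R, ∀ r > 0, |r - R| ≤ 1 →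
    ∀ t ∈ Icc (2 * t0 - T) t0, |g r t| ≤ C * Kw n κ T R t0 ^ s := by
  obtain ⟨C, hC, hb⟩ := h
  refine ⟨C * Qw n κ s, mul_pos hC Qw_pos, ?_⟩
  filter_upwards [ev_win hb] with t0 h0 R r hr hrR t ht
  have k1 := (Kw_win (n := n) hκ hrR h0.1 ht s).1
  calc _ ≤ _ := h0.2 t ht r hr
    _ ≤ C * (Qw n κ s * Kw n κ T R t0 ^ s) := mul_mono_l k1 hC.le
    _ = _ := by ring

lemma Ow.add (h : Ow n κ T s g) (h' : Ow n κ T s g') : Ow n κ T s (fun r t => g r t + g' r t) := by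
  obtain ⟨C, hC, hb⟩ := h
  obtain ⟨C', hC', hb'⟩ := h'
  refine ⟨C + C', by positivity, ?_⟩
  filter_upwards [hb, hb'] with t h1 h2 r hr
  refine (abs_add_le _ _).trans ((add_le_add (h1 r hr) (h2 r hr)).trans_eq (by ring))

lemma Ow.mul (h : Ow n κ T s g) (h' : Ow n κ T s' g') : Ow n κ T (s + s') (fun r t => g r t * g' r t) := by
  obtain ⟨C, hC, hb⟩ := h
  obtain ⟨C', hC', hb'⟩ := h'
  refine ⟨C * C', by positivity, ?_⟩
  filter_upwards [hb, hb', self_mem_nhdsWithin] with t h1 h2 ht r hr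
  have hK := Kw_pos' n κ r ht
  rw [abs_mul, rpow_add hK]
  refine (mul_le_mul (h1 r hr) (h2 r hr) (abs_nonneg _) (by positivity)).trans_eq (by ring)

lemma Ow.congr (haT : a < T) (h : Ow n κ T s g) (h' : ∀ r > (0:ℝ), ∀ t ∈ Ioo a T, g' r t = g r t) :
    Ow n κ T s g' := by
  obtain ⟨C, hC, hb⟩ := h
  refine ⟨C, hC, ?_⟩
  filter_upwards [hb, ev_Ioo haT] with t h1 ht r hr
  rw [h' r hr t ht]; exact h1 r hr

lemma Ow.const (c : ℝ) : Ow n κ T 0 (fun _ _ => c) := by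
  refine ⟨|c| + 1, by positivity, .of_forall fun t r hr => ?_⟩
  rw [rpow_zero]; linarith

lemma Ctx.Ofq (h : Ctx n p κ a T f) (q : ℝ) : Ow n κ T q (fun r t => f r t ^ q) := by
  obtain ⟨C, hC, hb⟩ := h.fq q
  refine ⟨C, hC, ?_⟩
  filter_upwards [hb, ev_Ioo h.aT] with t ht hta r hr
  rw [abs_of_pos (rpow_pos_of_pos (h.sol.pos hr hta) q)]
  exact (ht r hr).1

lemma Ctx.D_Or (h : Ctx n p κ a T f) (h1 : Ow n κ T 1 (pr f)) : Ow n κ T (1 - p) (pr (Dc p f)) := by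
  have := (((Ow.const (-((p - 1) / p))).mul (h.Ofq (-p))).mul h1).congr h.aT
    (fun r hr t ht => h.sol.D_r hr ht)
  rwa [show (0:ℝ) + -p + 1 = 1 - p by ring] at this

lemma Sol.feq (h : Sol n p a T f) {r t : ℝ} (hr : 0 < r) (ht : t ∈ Ioo a T) :
    p * f r t ^ (p - 1) * pt f r t = lap n f r t := by
  rw [← h.fq_t p hr ht, h.pde r hr t ht]; rfl

lemma Sol.feq' (h : Sol n p a T f) {r t : ℝ} (hr : 0 < r) (ht : t ∈ Ioo a T) :
    pt f r t = Dc p f r t * lap n f r t := by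
  rw [← h.feq hr ht]
  unfold Dc
  have hf := h.pos hr ht
  have hp := h.p0
  rw [show 1 - p = -(p - 1) by ring, rpow_neg hf.le]
  have : 0 < f r t ^ (p - 1) := by positivity
  field_simp

lemma scale_eq {D : ℝ → ℝ → ℝ} {c : ℝ} (he : ∀ r > (0:ℝ), ∀ t ∈ Ioo a T, pt z r t = D r t * lap n z r t + E r t) :
    ∀ r > (0:ℝ), ∀ t ∈ Ioo a T, pt (fun r t => c * z r t) r t =
      D r t * lap n (fun r t => c * z r t) r t + (fun r t => c * E r t) r t := by
  intro r hr t ht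
  rw [pt_cmul, lap_cmul]; beta_reduce; rw [he r hr t ht]; ring

lemma Ctx.A (h : Ctx n p κ a T f) (hz : Sm a T z) (hE : Sm a T E)
    (he : ∀ r > (0:ℝ), ∀ t ∈ Ioo a T, pt z r t = Dc p f r t * lap n z r t + E r t)
    (h1 : Ow n κ T 1 (pr f)) (hzo : Ow n κ T s z) (hEo : Ow n κ T (s + (1 - p)) E)
    (hEr : ∃ C > 0, ∀ᶠ t in 𝓝[<] T, ∀ r > 0,
      |pr E r t| ≤ C * (Kw n κ T r t ^ (s + (1 - p)) + Kw n κ T r t ^ (1 - p) * |pr z r t|)) :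
    Ow n κ T s (pr z) := by
  obtain ⟨d, hd, hd1, hD⟩ := h.D_bd
  obtain ⟨Cz, hCz, bz⟩ := hzo.win h.κ0
  obtain ⟨Ce, hCe, be⟩ := hEo.win h.κ0
  obtain ⟨Cd, hCd, bd⟩ := (h.D_Or h1).win h.κ0
  obtain ⟨C, hC, hb⟩ := hEr
  set Q1 := Qw n κ (s + (1 - p))
  set Q2 := Qw n κ (1 - p)
  have hQ1 : 0 < Q1 := Qw_pos
  have hQ2 : 0 < Q2 := Qw_pos
  set c := Cd + Ce + C * Q1 + C * Q2 with hc
  have hc0 : 0 < c := by positivity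
  have g1 : Cd ≤ c := by rw [hc]; linarith [mul_pos hC hQ1, mul_pos hC hQ2]
  have g2 : Ce ≤ c := by rw [hc]; linarith [mul_pos hC hQ1, mul_pos hC hQ2]
  have g3 : C * Q1 ≤ c := by rw [hc]; linarith [mul_pos hC hQ1, mul_pos hC hQ2]
  have g4 : C * Q2 ≤ c := by rw [hc]; linarith [mul_pos hC hQ1, mul_pos hC hQ2]
  clear_value c
  obtain ⟨lam, hlam, key⟩ := lemA (n := n) (d := d) (ρ := 1) (τ := 1) (M := Cz) (c := c) (c1 := 0)
    (k := d ^ 4 / (128 * Cz ^ 2)) h.sol.hn hd hd1 one_pos le_rfl one_pos hCz.le hc0.le (by positivity)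
    (by simp; positivity) (le_of_eq (by field_simp))
  refine ⟨lam, hlam, ?_⟩
  filter_upwards [hD, bz, be, bd, h.win (ev_win hb), ev_win hb] with t0 hD bz be bd hw hb' R hR
  obtain ⟨htT, hw⟩ := hw
  obtain ⟨w1, w2⟩ := hw R 1 le_rfl
  have hK := Kw_pos' n κ R htT
  have hΛ : 0 < Kw n κ T R t0 ^ (1 - p) := by positivity
  have hKs : 0 < Kw n κ T R t0 ^ s := by positivity
  have hsp := rpow_add hK s (1 - p)
  set K0s := Kw n κ T R t0 ^ s
  set Λ := Kw n κ T R t0 ^ (1 - p)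
  have hi : 0 < K0s⁻¹ := by positivity
  have main := key a T Λ R t0 (Dc p f) (fun r t => K0s⁻¹ * z r t) (fun r t => K0s⁻¹ * E r t) hΛ hR w1 htT
    ((Sm.const _).mul hz) h.sol.Dsm ((Sm.const _).mul hE) (scale_eq he) ?_
  · rw [pr_cmul] at main; beta_reduce at main
    rw [abs_mul, abs_of_pos hi, inv_mul_le_iff₀ hKs] at main
    linarith
  intro r hr hrR t ht
  obtain ⟨_, w3, w4⟩ := w2 t ht
  obtain ⟨d1, d2⟩ := hD R r hr hrR.le t w4
  have k1 := (Kw_win (n := n) h.κ0 hrR.le htT w4 (s + (1 - p))).1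
  have k2 := (Kw_win (n := n) h.κ0 hrR.le htT w4 (1 - p)).1
  have b1 := bz R r hr hrR.le t w4
  have b2 := be R r hr hrR.le t w4
  have b3 := bd R r hr hrR.le t w4
  have b4 := hb'.2 t w4 r hr
  rw [hsp] at b2 k1
  change _ ≤ Q1 * _ at k1
  change _ ≤ Q2 * _ at k2
  rw [pr_cmul, pr_cmul]; beta_reduce
  rw [abs_mul, abs_mul, abs_mul, abs_mul, abs_of_pos hi]
  refine ⟨d1, d2, ?_, ?_, ?_, ?_⟩
  · rw [inv_mul_le_iff₀ hKs]; linarith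
  · rw [zero_mul, add_zero]; refine b3.trans ?_; rw [mul_comm]; gcongr
  · rw [inv_mul_le_iff₀ hKs]
    refine b2.trans ?_
    rw [mul_comm Λ, mul_left_comm]; gcongr
  · rw [inv_mul_le_iff₀ hKs]
    refine b4.trans ?_
    calc _ ≤ C * (Q1 * (K0s * Λ) + Q2 * Λ * |pr z r t|) := by gcongr
      _ = C * Q1 * (K0s * Λ) + C * Q2 * (Λ * |pr z r t|) := by ring
      _ ≤ c * (K0s * Λ) + c * (Λ * |pr z r t|) := by gcongr
      _ = _ := by field_simp

lemma Ctx.B (h : Ctx n p κ a T f) (hz : Sm a T z) (hE : Sm a T E)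
    (he : ∀ r > (0:ℝ), ∀ t ∈ Ioo a T, pt z r t = Dc p f r t * lap n z r t + E r t)
    (h1 : Ow n κ T 1 (pr f)) (hzo : Ow n κ T s (pr z)) (hEo : Ow n κ T (s + (1 - p)) E)
    (hEr : Ow n κ T (s + (1 - p)) (pr E))
    (hEt : ∃ C > 0, ∀ᶠ t in 𝓝[<] T, ∀ r > 0,
      |pt (Dc p f) r t * lap n z r t + pt E r t| ≤
        C * (Kw n κ T r t ^ (s + (1 - p) + (1 - p)) + Kw n κ T r t ^ (-s) * pt z r t ^ 2)) :
    Ow n κ T (s + (1 - p)) (pt z) := by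
  obtain ⟨d, hd, hd1, hD⟩ := h.D_bd
  obtain ⟨Cz, hCz, bz⟩ := hzo.win h.κ0
  obtain ⟨Ce, hCe, be⟩ := hEo.win h.κ0
  obtain ⟨Cr, hCr, br⟩ := hEr.win h.κ0
  obtain ⟨Cd, hCd, bd⟩ := (h.D_Or h1).win h.κ0
  obtain ⟨C, hC, hb⟩ := hEt
  set Q1 := Qw n κ (s + (1 - p) + (1 - p))
  set Q2 := Qw n κ (-s)
  have hQ1 : 0 < Q1 := Qw_pos
  have hQ2 : 0 < Q2 := Qw_pos
  have hCQ1 := mul_pos hC hQ1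
  have hCQ2 := mul_pos hC hQ2
  set c := Cd + Ce + Cr + Cz + C * Q1 + C * Q2 with hc
  have hc0 : 0 < c := by positivity
  have g1 : Cd ≤ c := by rw [hc]; linarith
  have g2 : Ce ≤ c := by rw [hc]; linarith
  have g5 : Cr ≤ c := by rw [hc]; linarith
  have g6 : Cz ≤ c := by rw [hc]; linarith
  have g3 : C * Q1 ≤ c := by rw [hc]; linarith
  have g4 : C * Q2 ≤ c := by rw [hc]; linarith
  clear_value c
  obtain ⟨lam, hlam, key⟩ := lemB (n := n) (d := d) (ρ := 1) (τ := 1) (c := c)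
    h.sol.hn hd hd1 one_pos le_rfl one_pos hc0
  refine ⟨lam, hlam, ?_⟩
  filter_upwards [hD, bz, be, br, bd, h.win (ev_win hb), ev_win hb] with t0 hD bz be br bd hw hb' R hR
  obtain ⟨htT, hw⟩ := hw
  obtain ⟨w1, w2⟩ := hw R 1 le_rfl
  have hK := Kw_pos' n κ R htT
  have hΛ : 0 < Kw n κ T R t0 ^ (1 - p) := by positivity
  have hKs : 0 < Kw n κ T R t0 ^ s := by positivity
  have hsp := rpow_add hK s (1 - p)
  have hspp := rpow_add hK (s + (1 - p)) (1 - p)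
  have hsn := rpow_neg hK.le s
  rw [hsp] at hspp
  rw [hsp]
  set K0s := Kw n κ T R t0 ^ s
  set Λ := Kw n κ T R t0 ^ (1 - p)
  have hi : 0 < K0s⁻¹ := by positivity
  have main := key a T Λ R t0 (Dc p f) (fun r t => K0s⁻¹ * z r t) (fun r t => K0s⁻¹ * E r t) hΛ hR w1 htT
    ((Sm.const _).mul hz) h.sol.Dsm ((Sm.const _).mul hE) (scale_eq he) ?_
  · rw [pt_cmul] at main; beta_reduce at main
    rw [abs_mul, abs_of_pos hi, inv_mul_le_iff₀ hKs] at main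
    linarith
  intro r hr hrR t ht
  obtain ⟨_, w3, w4⟩ := w2 t ht
  obtain ⟨d1, d2⟩ := hD R r hr hrR.le t w4
  have k1 := (Kw_win (n := n) h.κ0 hrR.le htT w4 (s + (1 - p) + (1 - p))).1
  have k2 := (Kw_win (n := n) h.κ0 hrR.le htT w4 (-s)).1
  have b1 := bz R r hr hrR.le t w4
  have b2 := be R r hr hrR.le t w4
  have b5 := br R r hr hrR.le t w4
  have b3 := bd R r hr hrR.le t w4
  have b4 := hb'.2 t w4 r hr
  rw [hsp] at b2 b5
  rw [hspp] at k1
  rw [hsn] at k2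
  change _ ≤ Q1 * _ at k1
  change _ ≤ Q2 * _ at k2
  rw [pr_cmul, pr_cmul, pt_cmul, pt_cmul, lap_cmul]; beta_reduce
  rw [show pt (Dc p f) r t * (K0s⁻¹ * lap n z r t) + K0s⁻¹ * pt E r t =
    K0s⁻¹ * (pt (Dc p f) r t * lap n z r t + pt E r t) by ring]
  rw [abs_mul, abs_mul, abs_mul, abs_mul, abs_of_pos hi]
  refine ⟨d1, d2, ?_, ?_, ?_, ?_, ?_⟩
  · rw [inv_mul_le_iff₀ hKs, mul_comm]; refine b1.trans ?_; gcongr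
  · refine b3.trans ?_; rw [mul_comm]; gcongr
  · rw [inv_mul_le_iff₀ hKs]
    refine b2.trans ?_
    rw [mul_comm Λ, mul_left_comm]; gcongr
  · rw [inv_mul_le_iff₀ hKs]
    refine b5.trans ?_
    rw [mul_comm Λ, mul_left_comm]; gcongr
  · rw [inv_mul_le_iff₀ hKs]
    refine b4.trans ?_
    calc _ ≤ C * (Q1 * (K0s * Λ * Λ) + Q2 * K0s⁻¹ * pt z r t ^ 2) := by gcongr
      _ = C * Q1 * (K0s * Λ * Λ) + C * Q2 * (K0s⁻¹ * pt z r t ^ 2) := by ring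
      _ ≤ c * (K0s * Λ * Λ) + c * (K0s⁻¹ * pt z r t ^ 2) := by gcongr
      _ = _ := by field_simp

lemma Ctx.base (h : Ctx n p κ a T f) : Ow n κ T 1 (pr f) := by
  obtain ⟨d, hd, hd1, hD⟩ := h.D_bd
  obtain ⟨Cp, hCp, bp⟩ := (h.Ofq (-p)).win h.κ0
  have hp := h.sol.p0
  have hp1 : 0 < p - 1 := by linarith [h.sol.hp]
  set c1 := (p - 1) / p * Cp with hc1
  have hc10 : 0 < c1 := by positivity
  set k := 8 * (n + 1) * c1 ^ 2 / d ^ 2 with hk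
  have hk0 : 0 < k := by positivity
  set M := Real.sqrt (d ^ 4 / (128 * k)) with hM
  have hM0 : 0 < M := sqrt_pos.2 (by positivity)
  obtain ⟨ρ, hρ, hρ1, τ, hτ, hτ1, ho⟩ := h.osc M hM0
  obtain ⟨lam, hlam, key⟩ := lemA (n := n) (d := d) (ρ := ρ) (τ := τ) (M := M) (c := 0) (c1 := c1)
    (k := k) h.sol.hn hd hd1 hρ hρ1 hτ hM0.le le_rfl hk0
    (by rw [hk]; exact le_of_eq (by field_simp))
    (le_of_eq (by rw [hM, Real.sq_sqrt (by positivity)]; field_simp))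
  refine ⟨lam, hlam, ?_⟩
  filter_upwards [hD, bp, ho, h.win (Eventually.of_forall fun _ => trivial)] with t0 hD bp ho hw R hR
  obtain ⟨htT, hw⟩ := hw
  obtain ⟨w1, w2⟩ := hw R τ hτ1
  have hK := Kw_pos' n κ R htT
  have hΛ : 0 < Kw n κ T R t0 ^ (1 - p) := by positivity
  have eΛ : τ / Kw n κ T R t0 ^ (1 - p) = τ * Kw n κ T R t0 ^ (p - 1) := by
    rw [show 1 - p = -(p - 1) by ring, rpow_neg hK.le, div_inv_eq_mul]
  have eΛ2 : Kw n κ T R t0 ^ (-p) * Kw n κ T R t0 = Kw n κ T R t0 ^ (1 - p) := by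
    rw [← rpow_add_one hK.ne']; ring_nf
  rw [rpow_one]
  have ho' := ho R hR
  rw [← eΛ] at ho'
  set K0 := Kw n κ T R t0
  set Λ := K0 ^ (1 - p)
  have hi : 0 < K0⁻¹ := by positivity
  have prz : pr (fun r t => -(K0⁻¹ * f R t0) + K0⁻¹ * f r t) = fun r t => K0⁻¹ * pr f r t := by
    funext r t; unfold pr; rw [deriv_const_add, deriv_const_mul_field]
  have ptz : pt (fun r t => -(K0⁻¹ * f R t0) + K0⁻¹ * f r t) = fun r t => K0⁻¹ * pt f r t := by
    funext r t; unfold pt; rw [deriv_const_add, deriv_const_mul_field]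
  have main := key a T Λ R t0 (Dc p f) (fun r t => -(K0⁻¹ * f R t0) + K0⁻¹ * f r t) (fun _ _ => 0) hΛ hR w1 htT
    ((Sm.const _).add ((Sm.const _).mul h.sol.sm)) h.sol.Dsm (Sm.const _) ?_ ?_
  · rw [prz] at main; beta_reduce at main
    rw [abs_mul, abs_of_pos hi, inv_mul_le_iff₀ hK] at main
    linarith
  · intro r hr t ht
    have : lap n (fun r t => -(K0⁻¹ * f R t0) + K0⁻¹ * f r t) r t = K0⁻¹ * lap n f r t := by
      unfold lap; rw [prz, pr_cmul]; ring
    rw [this, ptz]; beta_reduce; rw [h.sol.feq' hr ht]; ring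
  intro r hr hrR t ht
  obtain ⟨_, w3, w4⟩ := w2 t ht
  obtain ⟨d1, d2⟩ := hD R r hr (hrR.le.trans hρ1) t w4
  have b1 := bp R r hr (hrR.le.trans hρ1) t w4
  have b2 := ho' r hr hrR t ht
  have hprE : pr (fun _ _ => (0:ℝ)) r t = 0 := by unfold pr; simp
  rw [prz, hprE]; beta_reduce
  refine ⟨d1, d2, ?_, ?_, by simp, by simp⟩
  · rw [show -(K0⁻¹ * f R t0) + K0⁻¹ * f r t = K0⁻¹ * (f r t - f R t0) by ring, abs_mul, abs_of_pos hi,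
      inv_mul_le_iff₀ hK]
    linarith
  · rw [h.sol.D_r hr w3, abs_mul, abs_mul, abs_mul, abs_neg, abs_of_pos (div_pos hp1 hp), abs_of_pos hi]
    calc (p - 1) / p * |f r t ^ (-p)| * |pr f r t| ≤ (p - 1) / p * (Cp * K0 ^ (-p)) * |pr f r t| := by
          gcongr
      _ = _ := by rw [zero_add, ← eΛ2, hc1]; field_simp
end ctx

noncomputable def zt (f : ℝ → ℝ → ℝ) : ℕ → ℝ → ℝ → ℝ
  | 0 => f
  | j + 1 => pt (zt f j)

inductive Gc (p a T : ℝ) (f : ℝ → ℝ → ℝ) (j : ℕ) : ℝ → (ℝ → ℝ → ℝ) → Prop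
  | pw (q : ℝ) : Gc p a T f j q (fun r t => f r t ^ q)
  | zz (i : ℕ) (hi : i ≤ j) : Gc p a T f j (1 - (p - 1) * i) (zt f i)
  | const (c : ℝ) : Gc p a T f j 0 (fun _ _ => c)
  | add {s : ℝ} {g g' : ℝ → ℝ → ℝ} (h : Gc p a T f j s g) (h' : Gc p a T f j s g') :
      Gc p a T f j s (fun r t => g r t + g' r t)
  | mul {s s' : ℝ} {g g' : ℝ → ℝ → ℝ} (h : Gc p a T f j s g) (h' : Gc p a T f j s' g') :
      Gc p a T f j (s + s') (fun r t => g r t * g' r t)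

section gc
variable {n : ℕ} {p κ a T s s' w : ℝ} {f z E g g' y : ℝ → ℝ → ℝ} {j : ℕ}

lemma Gc.cast (h : Gc p a T f j s g) (e : s = s') : Gc p a T f j s' g := e ▸ h

lemma Gc.zero (s : ℝ) : Gc p a T f j s (fun r t => 0 * f r t ^ s) :=
  ((Gc.const 0).mul (Gc.pw s)).cast (by ring)

lemma Gc.up (h : Gc p a T f j s g) : Gc p a T f (j + 1) s g := by
  induction h with
  | pw q => exact .pw q
  | zz i hi => exact .zz i (by omega)
  | const c => exact .const c
  | add _ _ h1 h2 => exact h1.add h2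
  | mul _ _ h1 h2 => exact h1.mul h2

lemma Sol.zsm (h : Sol n p a T f) (i : ℕ) : Sm a T (zt f i) := by
  induction i with
  | zero => exact h.sm
  | succ i ih => exact ih.Pt

lemma Gc.sm (hf : Sol n p a T f) (h : Gc p a T f j s g) : Sm a T g := by
  induction h with
  | pw q => exact hf.smq q
  | zz i hi => exact hf.zsm i
  | const c => exact Sm.const c
  | add _ _ h1 h2 => exact h1.add h2
  | mul _ _ h1 h2 => exact h1.mul h2

lemma Gc.Ow (hf : Ctx n p κ a T f) (hz : ∀ i ≤ j, Ow n κ T (1 - (p - 1) * i) (zt f i))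
    (h : Gc p a T f j s g) : Ow n κ T s g := by
  induction h with
  | pw q => exact hf.Ofq q
  | zz i hi => exact hz i hi
  | const c => exact Ow.const c
  | add _ _ h1 h2 => exact h1.add h2
  | mul _ _ h1 h2 => exact h1.mul h2

def Ob (n : ℕ) (κ T s w : ℝ) (y g : ℝ → ℝ → ℝ) : Prop := ∃ C > 0, ∀ᶠ t in 𝓝[<] T, ∀ r > 0,
  |g r t| ≤ C * (Kw n κ T r t ^ s + Kw n κ T r t ^ (s - w) * |y r t|)

lemma Ob.of (h : Ow n κ T s g) : Ob n κ T s w y g := by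
  obtain ⟨C, hC, hb⟩ := h
  refine ⟨C, hC, ?_⟩
  filter_upwards [hb, self_mem_nhdsWithin] with t h1 ht r hr
  have hK := Kw_pos' n κ r ht
  refine (h1 r hr).trans (mul_mono_l ?_ hC.le)
  have : 0 ≤ Kw n κ T r t ^ (s - w) * |y r t| := by positivity
  linarith

lemma Ob.add (h : Ob n κ T s w y g) (h' : Ob n κ T s w y g') :
    Ob n κ T s w y (fun r t => g r t + g' r t) := by
  obtain ⟨C, hC, hb⟩ := h
  obtain ⟨C', hC', hb'⟩ := h'
  refine ⟨C + C', by positivity, ?_⟩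
  filter_upwards [hb, hb'] with t h1 h2 r hr
  refine (abs_add_le _ _).trans ((add_le_add (h1 r hr) (h2 r hr)).trans_eq (by ring))

lemma Ob.mul (h : Ob n κ T s w y g) (h' : Ow n κ T s' g') :
    Ob n κ T (s + s') w y (fun r t => g r t * g' r t) := by
  obtain ⟨C, hC, hb⟩ := h
  obtain ⟨C', hC', hb'⟩ := h'
  refine ⟨C * C', by positivity, ?_⟩
  filter_upwards [hb, hb', self_mem_nhdsWithin] with t h1 h2 ht r hr
  have hK := Kw_pos' n κ r ht
  rw [abs_mul, show s + s' - w = (s - w) + s' by ring, rpow_add hK, rpow_add hK (s - w)]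
  refine (mul_le_mul (h1 r hr) (h2 r hr) (abs_nonneg _) (by positivity)).trans_eq (by ring)

lemma Ob.congr (haT : a < T) (h : Ob n κ T s w y g) (h' : ∀ r > (0:ℝ), ∀ t ∈ Ioo a T, g' r t = g r t) :
    Ob n κ T s w y g' := by
  obtain ⟨C, hC, hb⟩ := h
  refine ⟨C, hC, ?_⟩
  filter_upwards [hb, ev_Ioo haT] with t h1 ht r hr
  rw [h' r hr t ht]; exact h1 r hr

lemma Ob.out (h : Ob n κ T s w y g) (hy : Ow n κ T w y) : Ow n κ T s g := by
  obtain ⟨C, hC, hb⟩ := h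
  obtain ⟨C', hC', hb'⟩ := hy
  refine ⟨C * (1 + C'), by positivity, ?_⟩
  filter_upwards [hb, hb', self_mem_nhdsWithin] with t h1 h2 ht r hr
  have hK := Kw_pos' n κ r ht
  refine (h1 r hr).trans ?_
  have := mul_mono_l (h2 r hr) (show 0 ≤ Kw n κ T r t ^ (s - w) by positivity)
  have e : Kw n κ T r t ^ (s - w) * Kw n κ T r t ^ w = Kw n κ T r t ^ s := by
    rw [← rpow_add hK]; ring_nf
  rw [mul_assoc]
  refine mul_mono_l ?_ hC.le
  rw [mul_left_comm, e] at this
  linarith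

lemma Gc.Ob (hf : Ctx n p κ a T f) (hz : ∀ i ≤ j, _root_.Ow n κ T (1 - (p - 1) * i) (zt f i))
    (hr : ∀ i < j, _root_.Ow n κ T (1 - (p - 1) * i) (pr (zt f i))) (h1 : _root_.Ow n κ T 1 (pr f))
    (h : Gc p a T f j s g) : _root_.Ob n κ T s (1 - (p - 1) * j) (pr (zt f j)) (pr g) := by
  induction h with
  | pw q =>
    apply Ob.of
    have := (((Ow.const q).mul (hf.Ofq (q - 1))).mul h1).congr hf.aT (fun r hr t ht => hf.sol.fq_r q hr ht)
    rwa [show 0 + (q - 1) + 1 = q by ring] at this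
  | zz i hi =>
    rcases hi.lt_or_eq with hi | hi
    · exact .of (hr i hi)
    · subst hi
      refine ⟨1, one_pos, ?_⟩
      filter_upwards [self_mem_nhdsWithin] with t ht r hr
      have hK := Kw_pos' n κ r ht
      rw [sub_self, rpow_zero, one_mul, one_mul]
      have : 0 < Kw n κ T r t ^ (1 - (p - 1) * (i:ℝ)) := by positivity
      linarith
  | const c =>
    refine .of ((Ow.const 0).congr hf.aT (fun r hr t ht => ?_))
    unfold pr; simp
  | add h1 h2 i1 i2 =>
    exact (i1.add i2).congr hf.aT (fun r hr t ht => pr_add (h1.sm hf.sol) (h2.sm hf.sol) hr ht)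
  | @mul s s' g g' h1 h2 i1 i2 =>
    have e := (i2.mul (h1.Ow hf hz))
    rw [add_comm s' s] at e
    exact ((i1.mul (h2.Ow hf hz)).add e).congr hf.aT
      (fun r hr t ht => by rw [pr_mul (h1.sm hf.sol) (h2.sm hf.sol) hr ht, mul_comm (g r t)])

lemma Gc.pt (hf : Sol n p a T f) (h : Gc p a T f j s g) : ∃ g1 g2, Gc p a T f j (s + (1 - p)) g1 ∧
    Gc p a T f j (s - 1 + (p - 1) * j) g2 ∧
    ∀ r > (0:ℝ), ∀ t ∈ Ioo a T, pt g r t = g1 r t + g2 r t * zt f (j + 1) r t := by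
  induction h with
  | pw q =>
    rcases j with _ | j
    · refine ⟨_, _, Gc.zero _, ((Gc.const q).mul (Gc.pw (q - 1))).cast (by simp), fun r hr t ht => ?_⟩
      rw [hf.fq_t q hr ht]; simp [zt]
    · refine ⟨_, _, (((Gc.const q).mul (Gc.pw (q - 1))).mul (Gc.zz 1 (by omega))).cast (by push_cast; ring),
        Gc.zero _, fun r hr t ht => ?_⟩
      rw [hf.fq_t q hr ht]; simp [zt]
  | zz i hi =>
    rcases hi.lt_or_eq with hi | hi
    · refine ⟨_, _, (Gc.zz (i + 1) hi).cast (by push_cast; ring), Gc.zero _, fun r hr t ht => ?_⟩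
      simp [zt]
    · subst hi
      refine ⟨_, _, Gc.zero _, (Gc.const 1).cast (by ring), fun r hr t ht => ?_⟩
      simp [zt]
  | const c =>
    refine ⟨_, _, Gc.zero _, Gc.zero _, fun r hr t ht => ?_⟩
    simp [_root_.pt]
  | add h1 h2 i1 i2 =>
    obtain ⟨a1, a2, b1, b2, b3⟩ := i1
    obtain ⟨c1, c2, d1, d2, d3⟩ := i2
    refine ⟨_, _, b1.add d1, b2.add d2, fun r hr t ht => ?_⟩
    rw [pt_add (h1.sm hf) (h2.sm hf) hr ht, b3 r hr t ht, d3 r hr t ht]; ring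
  | mul h1 h2 i1 i2 =>
    obtain ⟨a1, a2, b1, b2, b3⟩ := i1
    obtain ⟨c1, c2, d1, d2, d3⟩ := i2
    refine ⟨_, _, ((b1.mul h2).cast (by ring)).add ((h1.mul d1).cast (by ring)),
      ((b2.mul h2).cast (by ring)).add ((h1.mul d2).cast (by ring)), fun r hr t ht => ?_⟩
    rw [pt_mul (h1.sm hf) (h2.sm hf) hr ht, b3 r hr t ht, d3 r hr t ht]; ring

lemma Sol.Dt (h : Sol n p a T f) {r t : ℝ} (hr : 0 < r) (ht : t ∈ Ioo a T) :
    pt (Dc p f) r t = (1 - p) * f r t ^ (-1:ℝ) * zt f 1 r t * Dc p f r t := by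
  unfold Dc
  have hf := h.pos hr ht
  rw [pt_cmul]; beta_reduce
  rw [h.fq_t _ hr ht, show 1 - p - 1 = -1 + (1 - p) by ring, rpow_add hf]
  simp only [zt]; ring

lemma Sol.Dt_lap (h : Sol n p a T f) (he : ∀ r > (0:ℝ), ∀ t ∈ Ioo a T,
      zt f (j + 1) r t = Dc p f r t * lap n (zt f j) r t + E r t) {r t : ℝ} (hr : 0 < r) (ht : t ∈ Ioo a T) :
    pt (Dc p f) r t * lap n (zt f j) r t =
      (1 - p) * f r t ^ (-1:ℝ) * zt f 1 r t * (zt f (j + 1) r t + (-1) * E r t) := by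
  rw [h.Dt hr ht, he r hr t ht]; ring

lemma Sol.Eex (h : Sol n p a T f) (j : ℕ) : ∃ E, Gc p a T f j (1 - (p - 1) * j + (1 - p)) E ∧
    ∀ r > (0:ℝ), ∀ t ∈ Ioo a T, zt f (j + 1) r t = Dc p f r t * lap n (zt f j) r t + E r t := by
  induction j with
  | zero => exact ⟨_, Gc.zero _, fun r hr t ht => by simpa [zt] using h.feq' hr ht⟩
  | succ j ih =>
    obtain ⟨E, hE, he⟩ := ih
    obtain ⟨g1, g2, h1, h2, h3⟩ := hE.pt h
    have z1 := Gc.zz (p := p) (a := a) (T := T) (f := f) (j := j + 1) 1 (by omega)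
    have zj := Gc.zz (p := p) (a := a) (T := T) (f := f) (j := j + 1) (j + 1) le_rfl
    have e1 := ((Gc.const (1 - p)).mul (Gc.pw (-1))).mul z1 |>.mul
      ((zj.cast (by push_cast; ring)).add (((Gc.const (-1)).mul hE.up).cast (zero_add _)))
    have e2 := h1.up.add ((h2.up.mul zj).cast (by push_cast; ring))
    refine ⟨_, e1.cast ?_ |>.add (e2.cast ?_), fun r hr t ht => ?_⟩
    · push_cast; ring
    · push_cast; ring
    rw [← h3 r hr t ht, ← h.Dt_lap he hr ht]
    have := eq_t (h.zsm j) h.Dsm (hE.sm h) he hr ht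
    simp only [zt] at this ⊢
    rw [this]; ring

lemma B_alg {k w σ x e g1 g2 y C1 C2 C3 C4 : ℝ} (hk : 0 < k) (h1 : 0 ≤ C1) (h2 : 0 ≤ C2)
    (h3 : 0 ≤ C3) (h4 : 0 ≤ C4) (hy : |y| ≤ C1 * (k ^ σ + k ^ (-w) * |x|)) (he : |e| ≤ C2 * k ^ (w + σ))
    (hg1 : |g1| ≤ C3 * k ^ (w + σ + σ)) (hg2 : |g2| ≤ C4 * k ^ σ) :
    |y * (x + (-1) * e) + (g1 + g2 * x)| ≤ (2 * C1 * (1 + C2) + C3 + C4) *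
      (k ^ (w + σ + σ) + k ^ (-w) * x ^ 2) := by
  rw [rpow_add hk, rpow_add hk] at *
  rw [rpow_neg hk.le] at *
  have hw : 0 < k ^ w := by positivity
  have hσ : 0 < k ^ σ := by positivity
  set W := k ^ w
  set S := k ^ σ
  obtain ⟨X, hX⟩ : ∃ X, |x| = X * (W * S) := ⟨|x| / (W * S), by field_simp⟩
  have hx2 : x ^ 2 = X ^ 2 * (W * S) ^ 2 := by rw [← sq_abs, hX]; ring
  have hX0 : 0 ≤ X := by
    by_contra! hc
    have := mul_pos (neg_pos.2 hc) (mul_pos hw hσ)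
    have := abs_nonneg x; linarith
  rw [hX] at hy
  have q1 : |y| ≤ C1 * (S * (1 + X)) := hy.trans_eq (by field_simp)
  have q2 : |x + (-1) * e| ≤ (X + C2) * (W * S) := by
    refine (abs_add_le _ _).trans ?_
    rw [abs_mul, hX]; norm_num; linarith
  have q3 : |y * (x + (-1) * e)| ≤ C1 * (S * (1 + X)) * ((X + C2) * (W * S)) := by
    rw [abs_mul]; exact mul_le_mul q1 q2 (abs_nonneg _) (by positivity)
  have q4 : |g2 * x| ≤ C4 * S * (X * (W * S)) := by
    rw [abs_mul, hX]; exact mul_mono_r hg2 (by positivity)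
  have t1 := abs_add_le (y * (x + (-1) * e)) (g1 + g2 * x)
  have t2 := abs_add_le g1 (g2 * x)
  have e1 : C1 * (S * (1 + X)) * ((X + C2) * (W * S)) = (C1 * ((1 + X) * (X + C2))) * (W * S * S) := by ring
  have e2 : C4 * S * (X * (W * S)) = (C4 * X) * (W * S * S) := by ring
  have e3 : (2 * C1 * (1 + C2) + C3 + C4) * (W * S * S + W⁻¹ * x ^ 2) =
      ((2 * C1 * (1 + C2) + C3 + C4) * (1 + X ^ 2)) * (W * S * S) := by
    rw [hx2]; field_simp
  rw [e3]
  have b1 : (1 + X) * (X + C2) ≤ 2 * (1 + C2) * (1 + X ^ 2) := by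
    nlinarith [sq_nonneg (X - 1), mul_nonneg h2 (sq_nonneg (X - 1)), mul_nonneg h2 (sq_nonneg X)]
  have b2 : X ≤ 1 + X ^ 2 := le_one_sq X
  have b3 := mul_mono_l b1 h1
  have b4 := mul_mono_l b2 h4
  have b5 : C3 ≤ C3 * (1 + X ^ 2) := le_mul_of_one_le_right h3 (by linarith [sq_nonneg X])
  have b6 : C1 * ((1 + X) * (X + C2)) + C3 + C4 * X ≤ (2 * C1 * (1 + C2) + C3 + C4) * (1 + X ^ 2) := by
    linarith
  have := mul_mono_r b6 (show 0 ≤ W * S * S by positivity)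
  linarith

lemma Ctx.time (h : Ctx n p κ a T f) (j : ℕ) : ∀ i ≤ j, Ow n κ T (1 - (p - 1) * i) (zt f i) ∧
    Ow n κ T (1 - (p - 1) * i) (pr (zt f i)) := by
  have hb := h.base
  induction j with
  | zero =>
    intro i hi
    obtain rfl : i = 0 := by omega
    simp only [zt, Nat.cast_zero, mul_zero, sub_zero]
    exact ⟨by simpa using h.Ofq 1, hb⟩
  | succ j ih =>
    have hOz : ∀ i ≤ j, Ow n κ T (1 - (p - 1) * i) (zt f i) := fun i hi => (ih i hi).1
    have hOr : ∀ i ≤ j, Ow n κ T (1 - (p - 1) * i) (pr (zt f i)) := fun i hi => (ih i hi).2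
    have sum : Ow n κ T (1 - (p - 1) * (j + 1 : ℕ)) (zt f (j + 1)) := by
      obtain ⟨E, hE, he⟩ := h.sol.Eex j
      obtain ⟨g1, g2, h1, h2, h3⟩ := hE.pt h.sol
      have hEO := hE.Ow h hOz
      have key := h.B (h.sol.zsm j) (hE.sm h.sol) he hb (hOr j le_rfl) hEO
        ((hE.Ob h hOz (fun i hi => hOr i hi.le) hb).out (hOr j le_rfl)) ?_
      · rwa [show 1 - (p - 1) * ((j + 1 : ℕ) : ℝ) = 1 - (p - 1) * j + (1 - p) by push_cast; ring]
      · obtain ⟨C2, hC2, b2⟩ := hEO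
        obtain ⟨C3, hC3, b3⟩ := h1.Ow h hOz
        obtain ⟨C4, hC4, b4⟩ := h2.Ow h hOz
        have hy : ∃ C > 0, ∀ᶠ t in 𝓝[<] T, ∀ r > 0, |(1 - p) * f r t ^ (-1:ℝ) * zt f 1 r t| ≤
            C * (Kw n κ T r t ^ (1 - p) + Kw n κ T r t ^ (-(1 - (p - 1) * (j:ℝ))) * |zt f (j + 1) r t|) := by
          rcases j with _ | j
          · obtain ⟨C, hC, bC⟩ := (Ow.const (1 - p)).mul (h.Ofq (-1))
            refine ⟨C, hC, ?_⟩
            filter_upwards [bC, self_mem_nhdsWithin] with t h1 ht r hr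
            have hK := Kw_pos' n κ r ht
            rw [abs_mul]
            have := mul_mono_r (h1 r hr) (abs_nonneg (zt f 1 r t))
            have e : 0 ≤ C * Kw n κ T r t ^ (1 - p) := by positivity
            norm_num at this ⊢
            linarith
          · obtain ⟨C, hC, bC⟩ := (((Gc.const (1 - p)).mul (Gc.pw (-1))).mul
              (Gc.zz (p := p) (a := a) (T := T) (f := f) (j := j + 1) 1 (by omega))).Ow h hOz
            rw [show 0 + -1 + (1 - (p - 1) * ((1:ℕ):ℝ)) = 1 - p by push_cast; ring] at bC
            refine ⟨C, hC, ?_⟩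
            filter_upwards [bC, self_mem_nhdsWithin] with t h1 ht r hr
            have hK := Kw_pos' n κ r ht
            refine (h1 r hr).trans (mul_mono_l (le_add_of_nonneg_right (by positivity)) hC.le)
        obtain ⟨C1, hC1, b1⟩ := hy
        refine ⟨2 * C1 * (1 + C2) + C3 + C4, by positivity, ?_⟩
        filter_upwards [b1, b2, b3, b4, ev_Ioo h.aT] with t b1 b2 b3 b4 ht r hr
        rw [h.sol.Dt_lap he hr ht, h3 r hr t ht]
        refine B_alg (Kw_pos ht.2) hC1.le hC2.le hC3.le hC4.le (b1 r hr) (b2 r hr) (b3 r hr) ?_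
        refine (b4 r hr).trans_eq ?_
        congr 2; ring
    have hOz' : ∀ i ≤ j + 1, Ow n κ T (1 - (p - 1) * i) (zt f i) := by
      intro i hi
      rcases hi.lt_or_eq with hi | rfl
      · exact hOz i (by omega)
      · exact sum
    obtain ⟨E, hE, he⟩ := h.sol.Eex (j + 1)
    have sum' := h.A (h.sol.zsm (j + 1)) (hE.sm h.sol) he hb sum (hE.Ow h hOz') (by
      obtain ⟨C, hC, hb⟩ := hE.Ob h hOz' (fun i hi => hOr i (by omega)) hb
      refine ⟨C, hC, ?_⟩
      filter_upwards [hb] with t hb r hr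
      refine (hb r hr).trans_eq ?_
      congr 4; ring)
    intro i hi
    rcases hi.lt_or_eq with hi | rfl
    · exact ih i (by omega)
    · exact ⟨sum, sum'⟩
end gc

def Rr (n : ℕ) (κ T : ℝ) : ℕ → ℝ → (ℝ → ℝ → ℝ) → Prop
  | 0, s, g => Ow n κ T s g
  | k + 1, s, g => Ow n κ T s g ∧ Rr n κ T k s (pr g)

section rr
variable {n : ℕ} {p κ a T s s' : ℝ} {f z g g' : ℝ → ℝ → ℝ} {j k : ℕ}

lemma Rr.ow (h : Rr n κ T k s g) : Ow n κ T s g := by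
  cases k with
  | zero => exact h
  | succ k => exact h.1

lemma Rr.down (h : Rr n κ T (k + 1) s g) : Rr n κ T k s g := by
  induction k generalizing g with
  | zero => exact h.1
  | succ k ih => exact ⟨h.1, ih h.2⟩

lemma Rr.congr (haT : a < T) (h : Rr n κ T k s g) (h' : ∀ r > (0:ℝ), ∀ t ∈ Ioo a T, g' r t = g r t) :
    Rr n κ T k s g' := by
  induction k generalizing g g' with
  | zero => exact Ow.congr haT h h'
  | succ k ih => exact ⟨h.1.congr haT h', ih h.2 fun r hr t ht => pr_congr h' hr ht⟩

lemma Rr.add (haT : a < T) (hg : Sm a T g) (hg' : Sm a T g') (h : Rr n κ T k s g) (h' : Rr n κ T k s g') :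
    Rr n κ T k s (fun r t => g r t + g' r t) := by
  induction k generalizing g g' with
  | zero => exact Ow.add h h'
  | succ k ih =>
    exact ⟨h.1.add h'.1, (ih hg.Pr hg'.Pr h.2 h'.2).congr haT fun r hr t ht => pr_add hg hg' hr ht⟩

lemma Rr.cast (h : Rr n κ T k s g) (e : s = s') : Rr n κ T k s' g := e ▸ h

lemma Rr.mul (haT : a < T) (hg : Sm a T g) (hg' : Sm a T g') (h : Rr n κ T k s g) (h' : Rr n κ T k s' g') :
    Rr n κ T k (s + s') (fun r t => g r t * g' r t) := by
  induction k generalizing g g' s s' with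
  | zero => exact Ow.mul h h'
  | succ k ih =>
    refine ⟨h.1.mul h'.1, ?_⟩
    exact ((ih hg.Pr hg' h.2 h'.down).add haT (hg.Pr.mul hg') (hg.mul hg'.Pr) (ih hg hg'.Pr h.down h'.2)).congr
      haT fun r hr t ht => pr_mul hg hg' hr ht

lemma Rr.const (c : ℝ) : Rr n κ T k 0 (fun _ _ => c) := by
  induction k generalizing c with
  | zero => exact Ow.const c
  | succ k ih =>
    refine ⟨Ow.const c, ?_⟩
    have : pr (fun _ _ => c) = fun _ _ => 0 := by funext r t; unfold pr; simp
    rw [this]; exact ih 0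

lemma Rr.cmul (haT : a < T) (hg : Sm a T g) (c : ℝ) (h : Rr n κ T k s g) :
    Rr n κ T k s (fun r t => c * g r t) :=
  ((Rr.const c).mul haT (Sm.const c) hg h).cast (zero_add s)

lemma Rr.fq (h : Ctx n p κ a T f) (hf : Rr n κ T k 1 f) (q : ℝ) : Rr n κ T k q (fun r t => f r t ^ q) := by
  induction k generalizing q with
  | zero => exact h.Ofq q
  | succ k ih =>
    refine ⟨h.Ofq q, Rr.congr h.aT ?_ (fun r hr t ht => h.sol.fq_r q hr ht)⟩
    exact (((ih hf.down (q - 1)).cmul h.aT (h.sol.smq _) q).mul h.aT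
      ((Sm.const q).mul (h.sol.smq _)) h.sol.sm.Pr hf.2).cast (by ring)

lemma Gc.Rr (h : Ctx n p κ a T f) (hz : ∀ i, Rr n κ T k (1 - (p - 1) * (i:ℕ)) (zt f i))
    (hg : Gc p a T f j s g) : Rr n κ T k s g := by
  induction hg with
  | pw q => exact Rr.fq h (by simpa [zt] using hz 0) q
  | zz i hi => exact hz i
  | const c => exact Rr.const c
  | add h1 h2 i1 i2 => exact i1.add h.aT (h1.sm h.sol) (h2.sm h.sol) i2
  | mul h1 h2 i1 i2 => exact i1.mul h.aT (h1.sm h.sol) (h2.sm h.sol) i2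

lemma Rr.shift (i : ℕ) (h : Rr n κ T (k + i) s z) : Rr n κ T k s (pr^[i] z) := by
  induction i generalizing z with
  | zero => exact h
  | succ i ih => rw [Function.iterate_succ_apply]; exact ih h.2

lemma Sm.Prn (h : Sm a T z) (i : ℕ) : Sm a T (pr^[i] z) := by
  induction i with
  | zero => exact h
  | succ i ih => rw [Function.iterate_succ_apply']; exact ih.Pr

lemma Sm.lap_eq (h : Sm a T z) : ∀ i : ℕ, ∃ A B : ℝ → ℝ → ℝ,
    (Sm a T (lap n z) → Sm a T A ∧ Sm a T B ∧ (∀ r > (0:ℝ), ∀ t ∈ Ioo a T,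
      sinh r * pr^[i + 2] z r t + (n + i) * cosh r * pr^[i + 1] z r t =
        sinh r * A r t + cosh r * B r t)
    ∧ ∀ k s, a < T → Rr n κ T (k + i) s z → Rr n κ T (k + i) s (lap n z) → Rr n κ T k s A ∧ Rr n κ T k s B)
  | 0 => by
    refine ⟨lap n z, fun _ _ => 0, fun hg => ⟨hg, Sm.const 0, fun r hr t ht => ?_, fun k s haT h1 h2 => ⟨h2, ?_⟩⟩⟩
    · have hs : 0 < sinh r := sinh_pos_iff.2 hr
      simp only [lap, Function.iterate_succ_apply, Function.iterate_zero_apply]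
      push_cast; field_simp; ring
    · exact (h1.cmul haT h 0).congr haT (fun r hr t ht => by simp)
  | i + 1 => by
    obtain ⟨A, B, hAB⟩ := h.lap_eq i
    refine ⟨fun r t => pr A r t + (B r t + (-(n + i : ℝ)) * pr^[i + 1] z r t), fun r t => A r t + pr B r t,
      fun hg => ?_⟩
    obtain ⟨sA, sB, he, hR⟩ := hAB hg
    have s1 : Sm a T (fun r t => (-(n + i : ℝ)) * pr^[i + 1] z r t) := (Sm.const _).mul (h.Prn _)
    refine ⟨sA.Pr.add (sB.add s1), sA.add sB.Pr, fun r hr t ht => ?_, fun k s haT h1 h2 => ?_⟩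
    · have y0 : HasDerivAt (fun ρ => pr^[i + 1] z ρ t) (pr^[i + 2] z r t) r := by
        rw [Function.iterate_succ_apply' _ (i + 1)]; exact (h.Prn (i + 1)).hr hr ht
      have y1 : HasDerivAt (fun ρ => pr^[i + 2] z ρ t) (pr^[i + 3] z r t) r := by
        rw [Function.iterate_succ_apply' _ (i + 2)]; exact (h.Prn (i + 2)).hr hr ht
      have l := ((hasDerivAt_sinh r).mul y1).add (((hasDerivAt_cosh r).const_mul (n + i : ℝ)).mul y0)
      have rr := ((hasDerivAt_sinh r).mul (sA.hr hr ht)).add ((hasDerivAt_cosh r).mul (sB.hr hr ht))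
      have := l.unique (rr.congr_of_eventuallyEq (by
        filter_upwards [Ioi_mem_nhds hr] with ρ hρ; exact he ρ hρ t ht))
      push_cast
      rw [show i + 1 + 2 = i + 3 by ring, show i + 1 + 1 = i + 2 by ring]
      linarith
    · obtain ⟨a1, a2⟩ := hR (k + 1) s haT (by rwa [show k + 1 + i = k + (i + 1) by ring])
        (by rwa [show k + 1 + i = k + (i + 1) by ring])
      exact ⟨a1.2.add haT sA.Pr (sB.add s1) (a2.down.add haT sB s1 ((h1.shift (i + 1)).cmul haT (h.Prn _) _)),
        a1.down.add haT sA sB.Pr a2.2⟩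

lemma cmp_zero {φ ψ φ' ψ' : ℝ → ℝ} {r : ℝ} (hr : 0 < r) (h1 : ∀ x ∈ Ioc 0 r, HasDerivAt φ (φ' x) x)
    (h2 : ∀ x ∈ Ioc 0 r, HasDerivAt ψ (ψ' x) x) (h : ∀ x ∈ Ioc 0 r, φ' x ≤ ψ' x)
    (t1 : Tendsto φ (𝓝[>] 0) (𝓝 0)) (t2 : Tendsto ψ (𝓝[>] 0) (𝓝 0)) : φ r ≤ ψ r := by
  have hm : MonotoneOn (fun x => ψ x - φ x) (Ioc 0 r) := by
    refine monotoneOn_of_deriv_nonneg (convex_Ioc 0 r)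
      (fun x hx => ((h2 x hx).sub (h1 x hx)).continuousAt.continuousWithinAt)
      (fun x hx => ?_) (fun x hx => ?_)
    · exact ((h2 x (interior_subset hx)).sub (h1 x (interior_subset hx))).differentiableAt.differentiableWithinAt
    · have hx' := interior_subset hx
      rw [((h2 x hx').fun_sub (h1 x hx')).deriv]
      linarith [h x hx']
  have ht := t2.sub t1
  rw [sub_zero] at ht
  have := le_of_tendsto ht (by
    filter_upwards [Ioc_mem_nhdsGT hr] with x hx
    exact hm hx ⟨hr, le_rfl⟩ hx.2)
  beta_reduce at this; linarith

lemma Ctx.space_step (h : Ctx n p κ a T f) (hz : Sm a T z) (hl : Sm a T (lap n z)) (hk : 1 ≤ k)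
    (h1 : Rr n κ T k s z) (h2 : Rr n κ T k s (lap n z)) : Ow n κ T s (pr^[k + 1] z) := by
  obtain ⟨i, rfl⟩ : ∃ i, k = i + 1 := ⟨k - 1, by omega⟩
  obtain ⟨A, B, hAB⟩ := hz.lap_eq (n := n) (κ := κ) (i + 1)
  obtain ⟨sA, sB, he, hR⟩ := hAB hl
  obtain ⟨oA, oB⟩ := hR 0 s h.aT (by rwa [zero_add]) (by rwa [zero_add])
  obtain ⟨A', B', hAB'⟩ := hz.lap_eq (n := n) (κ := κ) i
  obtain ⟨sA', sB', he', hR'⟩ := hAB' hl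
  obtain ⟨oA', oB'⟩ := hR' 1 s h.aT (by rwa [add_comm]) (by rwa [add_comm])
  have oy := Rr.shift (k := 0) (i + 1) (show Rr n κ T (0 + (i + 1)) s z by rwa [zero_add])
  obtain ⟨C1, hC1, b1⟩ := oA
  obtain ⟨C2, hC2, b2⟩ := oB
  obtain ⟨C3, hC3, b3⟩ := oA'.ow
  obtain ⟨C4, hC4, b4⟩ := oB'.ow
  obtain ⟨C5, hC5, b5⟩ := oy
  set Q := Qw n κ s
  have hQ : 0 < Q := Qw_pos
  have hn1 : (1:ℝ) ≤ n := by exact_mod_cast h.sol.hn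
  have hs1 : 0 < sinh 1 := sinh_pos_iff.2 one_pos
  set q := cosh 1 / sinh 1 with hq
  have hq0 : 0 < q := div_pos (cosh_pos 1) hs1
  refine ⟨(C1 + C2) * Q + (C3 + C4 * q + (n + i) * q * C5), by positivity, ?_⟩
  filter_upwards [b1, b2, b3, b4, b5, ev_Ioo h.aT] with t b1 b2 b3 b4 b5 ht r hr
  have hK := Kw_pos' n κ r ht.2
  have hKs : 0 < Kw n κ T r t ^ s := by positivity
  set Ks := Kw n κ T r t ^ s with hKs'
  have hS : 0 < sinh r := sinh_pos_iff.2 hr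
  rcases le_total r 1 with hr1 | hr1
  · -- near the origin
    set M := (C1 + C2) * Q * Ks with hM
    have hM0 : 0 < M := by positivity
    have e0 : ∀ x ∈ Ioc 0 r, |sinh x * A x t + cosh x * B x t| ≤ M * cosh x := by
      intro x hx
      have hSx : 0 < sinh x := sinh_pos_iff.2 hx.1
      have hk := (Kw_win (n := n) (r := x) (R := r) (t0 := t) (t := t) h.κ0
        (by rw [abs_sub_comm, abs_of_nonneg (by linarith [hx.2])]; linarith [hx.1]) ht.2
        ⟨by linarith [ht.2], le_rfl⟩ s).1
      change _ ≤ Q * Ks at hk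
      have a1 : |A x t| ≤ C1 * (Q * Ks) := (b1 x hx.1).trans (mul_mono_l hk hC1.le)
      have a2 : |B x t| ≤ C2 * (Q * Ks) := (b2 x hx.1).trans (mul_mono_l hk hC2.le)
      refine (abs_add_le _ _).trans ?_
      rw [abs_mul, abs_mul, abs_of_pos hSx, abs_of_pos (cosh_pos x)]
      have := (sinh_lt_cosh x).le
      calc _ ≤ cosh x * (C1 * (Q * Ks)) + cosh x * (C2 * (Q * Ks)) := by gcongr
        _ = _ := by rw [hM]; ring
    set m := n + i + 1 with hm
    have dφ : ∀ x ∈ Ioc 0 r, HasDerivAt (fun x => sinh x ^ (m + 1 - 1 : ℕ) * pr^[i + 2] z x t)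
        (sinh x ^ (n + i) * (sinh x * A x t + cosh x * B x t)) x := by
      intro x hx
      have y1 : HasDerivAt (fun ρ => pr^[i + 2] z ρ t) (pr^[i + 1 + 2] z x t) x := by
        rw [show i + 1 + 2 = (i + 2) + 1 by ring, Function.iterate_succ_apply' _ (i + 2)]
        exact (hz.Prn (i + 2)).hr hx.1 ht
      refine (((hasDerivAt_sinh x).pow (m + 1 - 1)).mul y1).congr_deriv ?_
      rw [← he x hx.1 t ht]
      simp only [Pi.pow_apply, Nat.add_sub_cancel, hm]
      push_cast; ring
    have dψ : ∀ x ∈ Ioc 0 r, HasDerivAt (fun x => M * sinh x ^ (m + 1 - 1 : ℕ))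
        (M * (((m + 1 - 1 : ℕ):ℝ) * sinh x ^ (m + 1 - 1 - 1) * cosh x)) x := fun x _ =>
      ((hasDerivAt_sinh x).pow (m + 1 - 1)).const_mul M
    simp only [Nat.add_sub_cancel] at dφ dψ
    have lt0 : Tendsto (fun x => sinh x ^ m) (𝓝[>] 0) (𝓝 0) := by
      have : Tendsto (fun x => sinh x ^ m) (𝓝 0) (𝓝 (sinh 0 ^ m)) :=
        (continuous_sinh.pow m).tendsto 0
      rw [sinh_zero, zero_pow (by omega)] at this
      exact this.mono_left nhdsWithin_le_nhds
    have lψ : Tendsto (fun x => M * sinh x ^ m) (𝓝[>] 0) (𝓝 0) := by simpa using lt0.const_mul M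
    have lφ : Tendsto (fun x => sinh x ^ m * pr^[i + 2] z x t) (𝓝[>] 0) (𝓝 0) := by
      obtain ⟨C, hC, hb⟩ := (hz.Prn (i + 2)).bdd 1 ht.1 ht.2
      refine squeeze_zero_norm' (a := fun x => sinh x ^ m * C) ?_ (by simpa using lt0.mul_const C)
      filter_upwards [Ioc_mem_nhdsGT one_pos] with x hx
      have hSx : 0 < sinh x := sinh_pos_iff.2 hx.1
      rw [Real.norm_eq_abs, abs_mul, abs_of_pos (pow_pos hSx m)]
      exact mul_mono_l (hb x hx t ⟨le_rfl, le_rfl⟩) (by positivity)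
    have key : ∀ x ∈ Ioc 0 r, |sinh x ^ (n + i) * (sinh x * A x t + cosh x * B x t)| ≤
        M * ((m:ℝ) * sinh x ^ (m - 1) * cosh x) := by
      intro x hx
      have hSx : 0 < sinh x := sinh_pos_iff.2 hx.1
      rw [abs_mul, abs_of_pos (pow_pos hSx _)]
      refine (mul_mono_l (e0 x hx) (by positivity)).trans ?_
      rw [show m - 1 = n + i by omega]
      have hm1 : (1:ℝ) ≤ m := by rw [hm]; push_cast; linarith [(Nat.cast_nonneg i : (0:ℝ) ≤ i)]
      have := le_mul_of_one_le_left (show 0 ≤ M * cosh x * sinh x ^ (n + i) by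
        have := cosh_pos x; positivity) hm1
      linarith
    have c1 := cmp_zero hr dφ dψ (fun x hx => (abs_le.1 (key x hx)).2) lφ lψ
    have c2 := cmp_zero hr (fun x hx => (dφ x hx).neg) dψ
      (fun x hx => by linarith [(abs_le.1 (key x hx)).1]) (by have := lφ.neg; rw [neg_zero] at this; exact this) lψ
    have hSm : 0 < sinh r ^ m := by positivity
    have f1 : pr^[i + 2] z r t ≤ M := by
      rw [mul_comm M] at c1; exact le_of_mul_le_mul_left c1 hSm
    have f2 : -pr^[i + 2] z r t ≤ M := by
      rw [mul_comm M] at c2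
      refine le_of_mul_le_mul_left (a := sinh r ^ m) ?_ hSm
      simpa using c2
    have f3 : |pr^[i + 2] z r t| ≤ M := abs_le.2 ⟨by linarith, f1⟩
    refine f3.trans ?_
    rw [add_mul]
    exact le_add_of_nonneg_right (by positivity)
  · have e := he' r hr t ht
    have hq1 : cosh r / sinh r ≤ q := by
      rw [hq, div_le_div_iff₀ hS hs1]
      have := sinh_nonneg_iff.2 (show 0 ≤ r - 1 by linarith)
      rw [Real.sinh_sub] at this; linarith
    have hco : 0 < cosh r / sinh r := div_pos (cosh_pos r) hS
    have e2 : pr^[i + 2] z r t = A' r t + cosh r / sinh r * B' r t +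
        -((n + i) * (cosh r / sinh r) * pr^[i + 1] z r t) := by
      field_simp; linarith
    rw [show i + 1 + 1 = i + 2 by ring, e2]
    have i1 := abs_add_le (A' r t + cosh r / sinh r * B' r t)
      (-((n + i) * (cosh r / sinh r) * pr^[i + 1] z r t))
    have i2 := abs_add_le (A' r t) (cosh r / sinh r * B' r t)
    rw [abs_neg, abs_mul _ (pr^[i + 1] z r t), abs_mul, abs_of_pos hco, abs_of_nonneg (show (0:ℝ) ≤ n + i by positivity)] at i1
    rw [abs_mul (cosh r / _), abs_of_pos hco] at i2
    have j1 : cosh r / sinh r * |B' r t| ≤ q * (C4 * Ks) :=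
      mul_le_mul hq1 (b4 r hr) (abs_nonneg _) hq0.le
    have j2 : (n + i) * (cosh r / sinh r) * |pr^[i + 1] z r t| ≤ (n + i) * q * (C5 * Ks) :=
      mul_le_mul (mul_mono_l hq1 (by positivity)) (b5 r hr) (abs_nonneg _) (by positivity)
    have j3 := b3 r hr
    have j4 : 0 < (C1 + C2) * Q * Ks := by positivity
    rw [show ((C1 + C2) * Q + (C3 + C4 * q + (n + i) * q * C5)) * Ks =
      (C1 + C2) * Q * Ks + C3 * Ks + q * (C4 * Ks) + (n + i) * q * (C5 * Ks) by ring]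
    linarith

lemma Rr.snoc (h : Rr n κ T k s z) (h' : Ow n κ T s (pr^[k + 1] z)) : Rr n κ T (k + 1) s z := by
  induction k generalizing z with
  | zero => exact ⟨h, h'⟩
  | succ k ih => exact ⟨h.1, ih h.2 h'⟩

lemma Ctx.space (h : Ctx n p κ a T f) (k : ℕ) : ∀ j : ℕ, Rr n κ T (k + 1) (1 - (p - 1) * j) (zt f j) := by
  induction k with
  | zero => intro j; exact h.time j j le_rfl
  | succ k ih =>
    intro j
    obtain ⟨E, hE, he⟩ := h.sol.Eex j
    have hG := ((Gc.const p).mul (Gc.pw (p - 1))).mul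
      (((Gc.zz (p := p) (a := a) (T := T) (f := f) (j := j + 1) (j + 1) le_rfl).cast
        (show _ = 1 - (p - 1) * (j:ℝ) + (1 - p) by push_cast; ring)).add
        (((Gc.const (-1)).mul hE.up).cast (zero_add _)))
    have hl : ∀ r > (0:ℝ), ∀ t ∈ Ioo a T, lap n (zt f j) r t =
        p * f r t ^ (p - 1) * (zt f (j + 1) r t + (-1) * E r t) := by
      intro r hr t ht
      rw [he r hr t ht]; unfold Dc
      have hf := h.sol.pos hr ht
      have hp := h.sol.p0
      rw [show 1 - p = -(p - 1) by ring, rpow_neg hf.le]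
      have : 0 < f r t ^ (p - 1) := by positivity
      field_simp; ring
    have hsm := (hG.sm h.sol).congr hl
    have hR := ((hG.Rr h ih).congr h.aT hl).cast (show _ = 1 - (p - 1) * (j:ℝ) by ring)
    exact (ih j).snoc (h.space_step (h.sol.zsm j) hsm (by omega) (ih j) hR)

lemma Ctx.fin (h : Ctx n p κ a T f) (k : ℕ) : Ow n κ T p (pr^[k] (fun r t => f r t ^ p)) := by
  have h1 : Rr n κ T (k + 1) 1 f := by simpa [zt] using h.space k 0
  have := Rr.fq h h1 p
  have := this.down
  exact Rr.shift (k := 0) k (by rwa [zero_add])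
end rr

def Os (n : ℕ) (κ T : ℝ) (s : ℝ) (g : ℝ → ℝ → ℝ) : Prop :=
  ∀ ε > 0, ∀ᶠ t in 𝓝[<] T, ∀ r > 0, |g r t| ≤ ε * Kw n κ T r t ^ s

section os
variable {n : ℕ} {p κ a T s c : ℝ} {f f' z g : ℝ → ℝ → ℝ} {v M : ℝ → ℝ}

lemma Kw_right (hκ : 0 < κ) {r x t : ℝ} (h : |x - r| ≤ 1) (ht : t < T) (s : ℝ) :
    Kw n κ T x t ^ s ≤ Qw n κ s * Kw n κ T r t ^ s :=
  (Kw_win (n := n) (r := x) (R := r) (t0 := t) (t := t) hκ h ht ⟨by linarith, le_rfl⟩ s).1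

lemma Os.landau (hκ : 0 < κ) (haT : a < T) (hg : Sm a T g) (h : Os n κ T s g)
    (h2 : Ow n κ T s (pr (pr g))) : Os n κ T s (pr g) := by
  intro ε hε
  obtain ⟨C, hC, hb⟩ := h2
  set Q := Qw n κ s
  have hQ : 0 < Q := Qw_pos
  set η := min 1 (ε / (2 * (C * Q))) with hη
  have hη0 : 0 < η := by positivity
  have hη1 : η ≤ 1 := min_le_left _ _
  have hη2 : C * Q * η ≤ ε / 2 := by
    have : η ≤ ε / (2 * (C * Q)) := min_le_right _ _
    calc C * Q * η ≤ C * Q * (ε / (2 * (C * Q))) := by gcongr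
      _ = _ := by field_simp
  clear_value η
  filter_upwards [hb, h (ε * η / (4 * Q)) (by positivity), ev_Ioo haT] with t b1 b2 ht r hr
  set Ks := Kw n κ T r t ^ s with hKs
  have hKs0 : 0 < Ks := rpow_pos_of_pos (Kw_pos ht.2) s
  have hd : ∀ x ∈ Icc r (r + η), HasDerivAt (fun ρ => g ρ t) (pr g x t) x := fun x hx =>
    hg.hr (hr.trans_le hx.1) ht
  have hd2 : ∀ x ∈ Icc r (r + η), HasDerivAt (fun ρ => pr g ρ t) (pr (pr g) x t) x := fun x hx =>
    hg.Pr.hr (hr.trans_le hx.1) ht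
  have hKx : ∀ x ∈ Icc r (r + η), Kw n κ T x t ^ s ≤ Q * Ks := fun x hx =>
    Kw_right hκ (by rw [abs_of_nonneg (by linarith [hx.1])]; linarith [hx.2]) ht.2 s
  obtain ⟨ξ, hξ, e1⟩ := exists_hasDerivAt_eq_slope (fun ρ => g ρ t) (fun x => pr g x t)
    (show r < r + η by linarith) (fun x hx => (hd x hx).continuousAt.continuousWithinAt)
    (fun x hx => hd x (Ioo_subset_Icc_self hx))
  have hsub : Icc r ξ ⊆ Icc r (r + η) := Icc_subset_Icc_right hξ.2.le
  obtain ⟨ζ, hζ, e2⟩ := exists_hasDerivAt_eq_slope (fun ρ => pr g ρ t) (fun x => pr (pr g) x t)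
    hξ.1 (fun x hx => (hd2 x (hsub hx)).continuousAt.continuousWithinAt)
    (fun x hx => hd2 x (hsub (Ioo_subset_Icc_self hx)))
  have hζ' := hsub (Ioo_subset_Icc_self hζ)
  have hξr : 0 < ξ - r := by linarith [hξ.1]
  rw [eq_div_iff (by linarith)] at e1
  rw [eq_div_iff hξr.ne'] at e2
  have k1 : |pr (pr g) ζ t| ≤ C * Q * Ks := (b1 ζ (hr.trans hζ.1)).trans
    ((mul_mono_l (hKx ζ hζ') hC.le).trans_eq (by ring))
  have k2 : |g (r + η) t| ≤ ε * η / 4 * Ks := (b2 (r + η) (by linarith)).trans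
    ((mul_mono_l (hKx (r + η) ⟨by linarith, le_rfl⟩) (by positivity)).trans_eq
      (by field_simp))
  have k3 : |g r t| ≤ ε * η / 4 * Ks := (b2 r hr).trans
    ((mul_mono_l (hKx r ⟨le_rfl, by linarith⟩) (by positivity)).trans_eq
      (by field_simp))
  have k4 : |pr g ξ t| ≤ ε / 2 * Ks := by
    have : |pr g ξ t| * η ≤ ε / 2 * Ks * η := by
      rw [← abs_of_pos hη0, ← abs_mul, abs_of_pos hη0]
      rw [show η = r + η - r by ring, e1]
      refine (abs_sub _ _).trans ?_
      rw [show r + η - r = η by ring]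
      linarith
    exact le_of_mul_le_mul_right this hη0
  have k5 : |pr g ξ t - pr g r t| ≤ ε / 2 * Ks := by
    rw [← e2, abs_mul, abs_of_pos hξr]
    calc _ ≤ C * Q * Ks * η := mul_le_mul k1 (by linarith [hξ.2]) hξr.le (by positivity)
      _ = C * Q * η * Ks := by ring
      _ ≤ _ := by gcongr
  have := abs_sub_abs_le_abs_sub (pr g r t) (pr g ξ t)
  rw [abs_sub_comm] at this
  linarith

lemma pow_tangent {x y p : ℝ} (hp : 1 ≤ p) (hx : 0 < x) (hy : 0 < y) :
    y ^ p - x ^ p ≤ p * y ^ (p - 1) * (y - x) := by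
  have := one_add_mul_self_le_rpow_one_add (s := x / y - 1) (by have := div_pos hx hy; linarith) hp
  rw [add_sub_cancel, div_rpow hx.le hy.le, le_div_iff₀ (by positivity)] at this
  have e : y ^ p = y ^ (p - 1) * y := by rw [← rpow_add_one hy.ne']; ring_nf
  rw [e] at this ⊢
  have e2 : (1 + p * (x / y - 1)) * (y ^ (p - 1) * y) = y ^ (p - 1) * y - p * y ^ (p - 1) * (y - x) := by
    field_simp; ring
  rw [e2] at this
  linarith

lemma Os.pow (h : Ctx n p κ a T f) (h' : Ctx n p κ a T f')
    (hs : Os n κ T 1 (fun r t => f r t - f' r t)) :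
    Os n κ T p (fun r t => f r t ^ p + (-1) * f' r t ^ p) := by
  intro ε hε
  obtain ⟨C, hC, b⟩ := h.fq (p - 1)
  obtain ⟨C', hC', b'⟩ := h'.fq (p - 1)
  have hp := h.sol.p0
  filter_upwards [b, b', ev_Ioo h.aT, hs (ε / (p * (C + C'))) (by positivity)] with t b b' ht hs r hr
  have hK := Kw_pos' n κ r ht.2
  have hf := h.sol.pos hr ht
  have hf' := h'.sol.pos hr ht
  have t1 := pow_tangent h.sol.hp.le hf' hf
  have t2 := pow_tangent h.sol.hp.le hf hf'
  have b1 := (b r hr).1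
  have b2 := (b' r hr).1
  have hd := hs r hr
  rw [rpow_one] at hd
  have e : Kw n κ T r t ^ p = Kw n κ T r t ^ (p - 1) * Kw n κ T r t := by
    rw [← rpow_add_one hK.ne']; ring_nf
  have hk1 : 0 < Kw n κ T r t ^ (p - 1) := by positivity
  set k1 := Kw n κ T r t ^ (p - 1)
  rw [e]
  set k := Kw n κ T r t
  have hd0 := abs_nonneg (f r t - f' r t)
  have m1 : p * f r t ^ (p - 1) * (f r t - f' r t) ≤ p * ((C + C') * k1) * |f r t - f' r t| := by
    refine (mul_mono_l (le_abs_self _) (by positivity)).trans ?_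
    refine mul_mono_r (mul_mono_l ?_ hp.le) hd0
    linarith [mul_pos hC' hk1]
  have m2 : p * f' r t ^ (p - 1) * (f' r t - f r t) ≤ p * ((C + C') * k1) * |f r t - f' r t| := by
    refine (mul_mono_l (neg_sub (f r t) _ ▸ neg_le_abs _) (by positivity)).trans ?_
    refine mul_mono_r (mul_mono_l ?_ hp.le) hd0
    linarith [mul_pos hC hk1]
  have m3 : p * ((C + C') * k1) * |f r t - f' r t| ≤ ε * (k1 * k) := by
    refine (mul_mono_l hd (by positivity)).trans_eq ?_
    field_simp
  exact abs_le.2 ⟨by linarith, by linarith⟩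

lemma pr_iter_add (hz : Sm a T z) (hg : Sm a T g) (k : ℕ) {r t : ℝ} (hr : 0 < r) (ht : t ∈ Ioo a T) :
    pr^[k] (fun r t => z r t + g r t) r t = pr^[k] z r t + pr^[k] g r t := by
  induction k generalizing r t with
  | zero => rfl
  | succ k ih =>
    simp only [Function.iterate_succ_apply']
    rw [← pr_add (hz.Prn k) (hg.Prn k) hr ht]
    exact pr_congr (fun r hr t ht => ih hr ht) hr ht

lemma pr_iter_cmul (c : ℝ) (z : ℝ → ℝ → ℝ) (k : ℕ) :
    pr^[k] (fun r t => c * z r t) = fun r t => c * pr^[k] z r t := by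
  induction k with
  | zero => rfl
  | succ k ih => simp only [Function.iterate_succ_apply']; rw [ih, pr_cmul]

lemma Os.iter (h : Ctx n p κ a T f) (h' : Ctx n p κ a T f')
    (hs : Os n κ T 1 (fun r t => f r t - f' r t)) (k : ℕ) :
    Os n κ T p (fun r t => pr^[k] (fun r t => f r t ^ p) r t + (-1) * pr^[k] (fun r t => f' r t ^ p) r t) := by
  have e1 : ∀ k, ∀ r > (0:ℝ), ∀ t ∈ Ioo a T, pr^[k] (fun r t => f r t ^ p + (-1) * f' r t ^ p) r t =
      pr^[k] (fun r t => f r t ^ p) r t + (-1) * pr^[k] (fun r t => f' r t ^ p) r t := by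
    intro k r hr t ht
    rw [pr_iter_add (h.sol.smq p) ((Sm.const (-1)).mul (h'.sol.smq p)) k hr ht, pr_iter_cmul]
  have key : Os n κ T p (pr^[k] (fun r t => f r t ^ p + (-1) * f' r t ^ p)) := by
    induction k with
    | zero => exact Os.pow h h' hs
    | succ k ih =>
      rw [Function.iterate_succ_apply']
      refine ih.landau h.κ0 h.aT
        (((h.sol.smq p).add ((Sm.const (-1)).mul (h'.sol.smq p))).Prn k) ?_
      rw [← Function.iterate_succ_apply' pr k, ← Function.iterate_succ_apply' pr (k + 1)]
      refine ((h.fin (k + 2)).add (((Ow.const (-1)).mul (h'.fin (k + 2))).congr (a := a) h.aT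
        (g' := fun r t => (-1) * pr^[k + 2] (fun r t => f' r t ^ p) r t)
        (fun _ _ _ _ => rfl) |> fun q => by rwa [zero_add] at q)).congr h.aT ?_
      exact e1 (k + 2)
  intro ε hε
  filter_upwards [key ε hε, ev_Ioo h.aT] with t hk ht r hr
  have := hk r hr
  rwa [e1 k r hr t ht] at this

lemma Em0 (r : ℝ) : Em 0 (-n) r = cosh r ^ (-(n:ℝ)) := by unfold Em; rw [rpow_zero, one_mul]

lemma Ctx.mk' (hs : Sol n p a T f) (hκ : (p - 1) * κ = 1) (haT : a < T) (hv : Prof n p c v M)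
    (hc : ∀ ε > 0, ∀ᶠ t in 𝓝[<] T, ∀ r > 0, |f r t - (T - t) ^ κ * v r| ≤ ε * (T - t) ^ κ * Em 0 (-n) r) :
    Ctx n p κ a T f := by
  have hκ0 : 0 < κ := by
    by_contra! hc
    have := mul_nonneg (by linarith [hs.hp] : 0 ≤ p - 1) (neg_nonneg.2 hc)
    linarith
  obtain ⟨C, hC, hw⟩ := hv.w_bd
  obtain ⟨l, hl, hlo⟩ := hv.v_lo
  have hc' : ∀ ε > 0, ∀ᶠ t in 𝓝[<] T, ∀ r > 0, |f r t - (T - t) ^ κ * v r| ≤ ε * Kw n κ T r t := by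
    intro ε hε
    filter_upwards [hc ε hε] with t h r hr
    refine (h r hr).trans_eq ?_
    rw [Em0]; unfold Kw; ring
  have vK : ∀ t < T, ∀ r > 0, l * Kw n κ T r t ≤ (T - t) ^ κ * v r ∧ (T - t) ^ κ * v r ≤ C * Kw n κ T r t := by
    intro t ht r hr
    have h1 := hlo r hr
    have h2 := (hw r hr).2
    rw [Em0] at h1 h2
    have : 0 < (T - t) ^ κ := rpow_pos_of_pos (by linarith) κ
    unfold Kw
    constructor
    · exact (mul_mono_l h1 this.le).trans' (by rw [mul_left_comm])
    · exact (mul_mono_l h2 this.le).trans (by rw [mul_left_comm])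
  refine ⟨hs, hκ, haT, ?_, ?_⟩
  · refine ⟨max 1 (max (C + l / 2) (2 / l)), le_max_left _ _, ?_⟩
    filter_upwards [hc' (l / 2) (by positivity), ev_Ioo haT] with t h ht r hr
    have hK := Kw_pos' n κ r ht.2
    have hf := hs.pos hr ht
    obtain ⟨v1, v2⟩ := vK t ht.2 r hr
    obtain ⟨h1, h2⟩ := abs_le.1 (h r hr)
    have m1 : C + l / 2 ≤ max 1 (max (C + l / 2) (2 / l)) := (le_max_left _ _).trans (le_max_right _ _)
    have m2 : 2 / l ≤ max 1 (max (C + l / 2) (2 / l)) := (le_max_right _ _).trans (le_max_right _ _)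
    constructor
    · refine le_trans ?_ (mul_mono_r m1 hK.le); linarith
    · refine le_trans ?_ (mul_mono_r m2 hf.le)
      rw [div_mul_eq_mul_div, le_div_iff₀ hl]; linarith
  · intro M0 hM
    set Q := Qw n κ 1
    have hQ : 0 < Q := Qw_pos
    set e := exp 1 ^ (n:ℝ) with he
    have he0 : 0 < e := by positivity
    obtain ⟨τ, hτ, hτ1, hτ2⟩ : ∃ τ > 0, τ ≤ 1 ∧ (1 + τ) ^ κ - 1 ≤ M0 / (4 * (C * e)) := by
      have hcont : Tendsto (fun x : ℝ => (1 + x) ^ κ - 1) (𝓝[>] 0) (𝓝 0) := by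
        have : ContinuousAt (fun x : ℝ => (1 + x) ^ κ - 1) 0 := by
          refine ContinuousAt.sub (ContinuousAt.rpow_const (by fun_prop) (Or.inl (by norm_num))) (by fun_prop)
        have h0 := this.tendsto
        norm_num at h0
        exact h0.mono_left nhdsWithin_le_nhds
      have h1 := hcont.eventually (gt_mem_nhds (show 0 < M0 / (4 * (C * e)) by positivity))
      obtain ⟨τ, h2, h3⟩ := (h1.and (Ioc_mem_nhdsGT one_pos)).exists
      exact ⟨τ, h3.1, h3.2, h2.le⟩
    refine ⟨min 1 (M0 / (4 * (C * e))), by positivity, min_le_left _ _, τ, hτ, hτ1, ?_⟩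
    set ε := M0 / (4 * (Q + 1)) with hε
    have hε0 : 0 < ε := by positivity
    filter_upwards [ev_win (hc' ε hε0)] with t0 h0 R hR r hr hrR t ht
    obtain ⟨h0T, h0⟩ := h0
    have hl0 : 0 < T - t0 := by linarith
    have hK0 := Kw_pos' n κ R h0T
    have hKs := Kw_small (n := n) (R := R) hs.hp hκ h0T
    have hτs : τ * Kw n κ T R t0 ^ (p - 1) ≤ τ * (T - t0) := mul_mono_l hKs hτ.le
    have hτl : τ * (T - t0) ≤ T - t0 := mul_le_of_le_one_left hl0.le hτ1
    have htw : t ∈ Icc (2 * t0 - T) t0 := ⟨by linarith [ht.1], ht.2⟩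
    have hr1 : |r - R| ≤ 1 := hrR.le.trans (min_le_left _ _)
    have g1 := h0 t htw r hr
    have g2 := h0 t0 ⟨by linarith, le_rfl⟩ R hR
    have kw := (Kw_win (n := n) hκ0 hr1 h0T htw 1).1
    change _ ≤ Q * _ at kw
    rw [rpow_one, rpow_one] at kw
    have g1' : |f r t - (T - t) ^ κ * v r| ≤ ε * Q * Kw n κ T R t0 :=
      g1.trans ((mul_mono_l kw hε0.le).trans_eq (by ring))
    have eK : Kw n κ T R t0 = (T - t0) ^ κ * cosh R ^ (-(n:ℝ)) := rfl
    have hL0 : 0 < (T - t0) ^ κ := by positivity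
    set K0 := Kw n κ T R t0
    set b := cosh R ^ (-(n:ℝ)) with hb
    have hb0 : 0 < b := rpow_pos_of_pos (cosh_pos R) _
    -- time difference
    have g3 : |(T - t) ^ κ * v r - (T - t0) ^ κ * v r| ≤ M0 / 4 * K0 := by
      have a1 : (T - t0) ^ κ ≤ (T - t) ^ κ := rpow_le_rpow hl0.le (by linarith [ht.2]) hκ0.le
      have a2 : (T - t) ^ κ ≤ (1 + τ) ^ κ * (T - t0) ^ κ := by
        rw [← mul_rpow (by linarith) hl0.le]
        exact rpow_le_rpow (by linarith [ht.2]) (by linarith [ht.1]) hκ0.le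
      have hvr := hv.pos r hr
      have a3 := (hw r hr).2
      rw [Em0] at a3
      have a4 := cosh_b_le (n := n) hr1
      have a5 : v r ≤ C * (e * b) := a3.trans (mul_mono_l a4 hC.le)
      rw [← sub_mul, abs_mul, abs_of_nonneg (sub_nonneg.2 a1), abs_of_pos hvr]
      calc _ ≤ (M0 / (4 * (C * e)) * (T - t0) ^ κ) * (C * (e * b)) := by
            refine mul_le_mul ?_ a5 hvr.le (by positivity)
            have := mul_mono_r hτ2 hL0.le
            linarith
        _ = _ := by rw [eK]; field_simp
    -- space difference
    have g4 : |(T - t0) ^ κ * v r - (T - t0) ^ κ * v R| ≤ M0 / 4 * K0 := by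
      have a1 : ‖v r - v R‖ ≤ C * (e * b) * ‖r - R‖ := by
        refine (convex_uIcc R r).norm_image_sub_le_of_norm_hasDerivWithin_le
          (f' := wv n c M) (fun x hx => ((hv.hv x ?_).hasDerivWithinAt)) (fun x hx => ?_)
          left_mem_uIcc right_mem_uIcc
        · exact (lt_min hR hr).trans_le hx.1
        · have hx0 : 0 < x := (lt_min hR hr).trans_le hx.1
          have hxR : |x - R| ≤ 1 := (abs_sub_left_of_mem_uIcc hx).trans hr1
          have w1 := (hw x hx0).1
          have w2 : Em 1 (-n) x ≤ Em 0 (-n) x := Em_le hx0 zero_le_one le_rfl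
          rw [Em0] at w2
          have w3 := cosh_b_le (n := n) hxR
          exact w1.trans (mul_mono_l (w2.trans w3) hC.le)
      rw [Real.norm_eq_abs, Real.norm_eq_abs] at a1
      rw [← mul_sub, abs_mul, abs_of_pos hL0]
      calc _ ≤ (T - t0) ^ κ * (C * (e * b) * (M0 / (4 * (C * e)))) := by
            refine mul_mono_l (a1.trans (mul_mono_l
              (hrR.le.trans (min_le_right _ _)) (by positivity))) hL0.le
        _ = _ := by rw [eK]; field_simp
    have q1 := abs_add_le (f r t - (T - t) ^ κ * v r) ((T - t) ^ κ * v r - (T - t0) ^ κ * v r)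
    have q2 := abs_add_le ((T - t0) ^ κ * v r - (T - t0) ^ κ * v R) ((T - t0) ^ κ * v R - f R t0)
    have q3 := abs_add_le (f r t - (T - t) ^ κ * v r + ((T - t) ^ κ * v r - (T - t0) ^ κ * v r))
      ((T - t0) ^ κ * v r - (T - t0) ^ κ * v R + ((T - t0) ^ κ * v R - f R t0))
    rw [show f r t - (T - t) ^ κ * v r + ((T - t) ^ κ * v r - (T - t0) ^ κ * v r) +
      ((T - t0) ^ κ * v r - (T - t0) ^ κ * v R + ((T - t0) ^ κ * v R - f R t0)) = f r t - f R t0 by ring] at q3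
    rw [abs_sub_comm] at g2
    have : ε * Q * K0 + ε * K0 = M0 / 4 * K0 := by rw [hε]; field_simp
    have := mul_pos hM hK0
    linarith
end os

inductive Pl (V : ℝ → ℝ) (n : ℝ) : (ℝ → ℝ) → ℝ → Prop
  | rat (j : ℕ) : Pl V n (fun r => iteratedDeriv j V r / V r) ((-n) ^ j)
  | cst (c : ℝ) : Pl V n (fun _ => c) c
  | add (g h : ℝ → ℝ) (c d : ℝ) : Pl V n g c → Pl V n h d → Pl V n (fun r => g r + h r) (c + d)
  | mul (g h : ℝ → ℝ) (c d : ℝ) : Pl V n g c → Pl V n h d → Pl V n (fun r => g r * h r) (c * d)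

section pl
variable {V : ℝ → ℝ} {n c q l : ℝ} {g : ℝ → ℝ}

lemma itd_smooth (hV : ContDiffOn ℝ ∞ V (Ioi 0)) (j : ℕ) : ContDiffOn ℝ ∞ (iteratedDeriv j V) (Ioi 0) := by
  induction j with
  | zero => simpa using hV
  | succ j ih =>
    rw [iteratedDeriv_succ]
    exact ih.deriv_of_isOpen isOpen_Ioi (by simp)

lemma itd_hd (hV : ContDiffOn ℝ ∞ V (Ioi 0)) (j : ℕ) {r : ℝ} (hr : 0 < r) :
    HasDerivAt (iteratedDeriv j V) (iteratedDeriv (j + 1) V r) r := by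
  rw [iteratedDeriv_succ]
  exact ((((itd_smooth hV j).contDiffAt (Ioi_mem_nhds hr)).differentiableAt (by simp))).hasDerivAt

lemma Pl.smooth (h : Pl V n g c) (hV : ContDiffOn ℝ ∞ V (Ioi 0)) (h0 : ∀ r > 0, 0 < V r) :
    ContDiffOn ℝ ∞ g (Ioi 0) := by
  induction h with
  | rat j => exact (itd_smooth hV j).div hV (fun r hr => (h0 r hr).ne')
  | cst c => exact contDiffOn_const
  | add g h c d _ _ h1 h2 => exact h1.add h2
  | mul g h c d _ _ h1 h2 => exact h1.mul h2

lemma Pl.hd (h : Pl V n g c) (hV : ContDiffOn ℝ ∞ V (Ioi 0)) (h0 : ∀ r > 0, 0 < V r) :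
    ∃ g', Pl V n g' 0 ∧ ∀ r > 0, HasDerivAt g (g' r) r := by
  induction h with
  | rat j =>
    refine ⟨fun r => iteratedDeriv (j + 1) V r / V r + (fun r => (fun _ => (-1 : ℝ)) r *
      (fun r => iteratedDeriv j V r / V r * (iteratedDeriv 1 V r / V r)) r) r, ?_, ?_⟩
    · have := Pl.add _ _ _ _ (Pl.rat (V := V) (n := n) (j + 1))
        (Pl.mul _ _ _ _ (Pl.cst (-1)) (Pl.mul _ _ _ _ (Pl.rat (V := V) (n := n) j) (Pl.rat 1)))
      rwa [show (-n) ^ (j + 1) + -1 * ((-n) ^ j * (-n) ^ 1) = 0 by ring] at this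
    · intro r hr
      have hv := itd_hd hV 0 hr
      rw [iteratedDeriv_zero] at hv
      refine ((itd_hd hV j hr).div hv (h0 r hr).ne').congr_deriv ?_
      have := (h0 r hr).ne'
      simp only [zero_add]
      field_simp
      ring
  | cst c => exact ⟨_, Pl.cst 0, fun r _ => hasDerivAt_const r c⟩
  | add g h c d _ _ h1 h2 =>
    obtain ⟨g1, a1, b1⟩ := h1
    obtain ⟨g2, a2, b2⟩ := h2
    refine ⟨_, by simpa using Pl.add _ _ _ _ a1 a2, fun r hr => (b1 r hr).add (b2 r hr)⟩
  | mul g h c d p1 p2 h1 h2 =>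
    obtain ⟨g1, a1, b1⟩ := h1
    obtain ⟨g2, a2, b2⟩ := h2
    refine ⟨_, by simpa using Pl.add _ _ _ _ (Pl.mul _ _ _ _ a1 p2) (Pl.mul _ _ _ _ p1 a2),
      fun r hr => (b1 r hr).mul (b2 r hr)⟩

lemma Pl.lim (h : Pl V n g c) (hl : 0 < l)
    (ha : ∀ k : ℕ, Tendsto (fun r => exp (n * r) * iteratedDeriv k V r) atTop
      (𝓝 ((-1 : ℝ) ^ k * n ^ k * l))) : Tendsto g atTop (𝓝 c) := by
  induction h with
  | rat j =>
    have h1 := ha 0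
    simp only [iteratedDeriv_zero, pow_zero, one_mul] at h1
    have h2 := (ha j).div h1 hl.ne'
    rw [mul_div_cancel_right₀ _ hl.ne', ← mul_pow, neg_one_mul] at h2
    refine h2.congr fun r => ?_
    simp only [Pi.div_apply]
    exact mul_div_mul_left _ _ (exp_pos _).ne'
  | cst c => exact tendsto_const_nhds
  | add g h c d _ _ h1 h2 => exact h1.add h2
  | mul g h c d _ _ h1 h2 => exact h1.mul h2

lemma Pl.pow (hV : ContDiffOn ℝ ∞ V (Ioi 0)) (h0 : ∀ r > 0, 0 < V r) (k : ℕ) :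
    ∃ g, Pl V n g ((-(n * q)) ^ k) ∧ ∀ r > 0, iteratedDeriv k (fun r => V r ^ q) r = g r * V r ^ q := by
  induction k with
  | zero => exact ⟨_, by simpa using Pl.cst 1, fun r _ => by simp⟩
  | succ k ih =>
    obtain ⟨g, hg, e⟩ := ih
    obtain ⟨g', hg', e'⟩ := hg.hd hV h0
    have hP := Pl.add _ _ _ _ hg' (Pl.mul _ _ _ _ (Pl.cst q) (Pl.mul _ _ _ _ hg (Pl.rat 1)))
    rw [show 0 + q * ((-(n * q)) ^ k * (-n) ^ 1) = (-(n * q)) ^ (k + 1) by ring] at hP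
    refine ⟨_, hP, fun r hr => ?_⟩
    · rw [iteratedDeriv_succ]
      have hE : iteratedDeriv k (fun r => V r ^ q) =ᶠ[𝓝 r] fun r => g r * V r ^ q := by
        filter_upwards [lt_mem_nhds hr] with x hx using e x hx
      rw [hE.deriv_eq]
      have hv := itd_hd hV 0 hr
      rw [iteratedDeriv_zero, zero_add] at hv
      have h3 := (e' r hr).mul (hv.rpow_const (p := q) (Or.inl (h0 r hr).ne'))
      refine h3.deriv.trans ?_
      rw [rpow_sub_one (h0 r hr).ne']
      ring

end pl

lemma itd_pr (φ : ℝ → ℝ → ℝ) (k : ℕ) (t : ℝ) : iteratedDeriv k (fun ρ => φ ρ t) = fun r => pr^[k] φ r t := by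
  induction k with
  | zero => rfl
  | succ k ih => rw [iteratedDeriv_succ, ih, Function.iterate_succ_apply']; rfl

lemma pr_iter_congr {a b : ℝ} {φ χ : ℝ → ℝ → ℝ} (h : ∀ r > (0:ℝ), ∀ t ∈ Ioo a b, φ r t = χ r t) (k : ℕ) :
    ∀ r > (0:ℝ), ∀ t ∈ Ioo a b, pr^[k] φ r t = pr^[k] χ r t := by
  induction k with
  | zero => exact h
  | succ k ih => intro r hr t ht; simp only [Function.iterate_succ_apply']; exact pr_congr ih hr ht

lemma pr_iter_sep (L v : ℝ → ℝ) (k : ℕ) :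
    pr^[k] (fun r t => L t * v r) = fun r t => L t * iteratedDeriv k v r := by
  induction k with
  | zero => simp
  | succ k ih =>
    rw [Function.iterate_succ_apply', ih, iteratedDeriv_succ]
    funext r t
    exact deriv_const_mul_field _

lemma conv_main {n : ℕ} (hn : 1 ≤ n) {m T : ℝ} (hm : ((n:ℝ) - 1) / (n + 3) < m) (hm1 : m < 1) (hT : 0 < T)
    {u : ℝ → ℝ → ℝ} (hu : IsRadialEnergySolution (n + 1) m T u) {V : ℝ → ℝ}
    (hV : IsStationaryProfile (n + 1) m T V) (k : ℕ) {ε : ℝ} (hε : 0 < ε) :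
    ∀ᶠ t in 𝓝[<] T, ∀ r > 0, |iteratedDeriv k (fun ρ => u ρ t) r
      - (1 - t / T) ^ (1 / (1 - m)) * iteratedDeriv k (fun r => V r ^ (1 / m)) r|
      ≤ ε * ((1 - t / T) ^ (1 / (1 - m)) * V r ^ (1 / m)) := by
  have hm0 : 0 < m := by
    have : (1:ℝ) ≤ n := by exact_mod_cast hn
    exact lt_of_le_of_lt (div_nonneg (by linarith) (by linarith)) hm
  obtain ⟨a, ha, hx⟩ := exs_of hn hm hm1 hT hu
  obtain ⟨W, hW⟩ := stat_prof hn hm hm0 hm1 hT hV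
  have hS := stat_sol (A := a) hn hm0 hm1 hT hV
  set κ := m / (1 - m) with hκ
  set v : ℝ → ℝ := fun r => T ^ (-κ) * V r with hv
  set p := 1 / m with hp
  have hp0 : 0 < p := by positivity
  have hpκ : p * κ = 1 / (1 - m) := by rw [hp, hκ]; field_simp
  have hcl := fun ε (hε : 0 < ε) => hx.fconv hW hε
  have h1 : Ctx n p κ a T _ := Ctx.mk' hx.sol hx.hκ hx.aT hW hcl
  have h2 : Ctx n p κ a T (fun r t => (T - t) ^ κ * v r) := by
    refine Ctx.mk' hS hx.hκ hx.aT hW ?_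
    intro ε hε
    filter_upwards [ev_Ioo hx.aT] with t ht r hr
    rw [sub_self, abs_zero, Em0]
    have : 0 ≤ T - t := by linarith [ht.2]
    have := cosh_pos r
    positivity
  have hO : Os n κ T 1 (fun r t => u r t ^ m - (T - t) ^ κ * v r) := by
    intro ε hε
    filter_upwards [hcl ε hε] with t h r hr
    refine (h r hr).trans_eq ?_
    rw [Em0, rpow_one]; unfold Kw; ring
  obtain ⟨l, hl, hlo⟩ := hW.v_lo
  have hIt := Os.iter h1 h2 hO k (ε * l ^ p) (by positivity)
  filter_upwards [hIt, ev_Ioo hx.aT] with t h ht r hr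
  have h := h r hr
  have hTt : 0 < T - t := by linarith [ht.2]
  have hV0 := hV.pos r hr.le
  have e0 : (1 - t / T) ^ (1 / (1 - m)) = (T - t) ^ (p * κ) * T ^ (-(p * κ)) := by
    rw [show 1 - t / T = (T - t) / T by field_simp, div_rpow hTt.le hT.le, hpκ, rpow_neg hT.le]
    rfl
  have e1 : pr^[k] (fun r t => (u r t ^ m) ^ p) r t = iteratedDeriv k (fun ρ => u ρ t) r := by
    rw [itd_pr]
    refine pr_iter_congr (a := a) (b := T) ?_ k r hr t ht
    intro r hr t ht
    rw [← rpow_mul (hu.pos r hr.le t ⟨ha.trans ht.1, ht.2⟩).le, hp, mul_one_div_cancel hm0.ne', rpow_one]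
  have e2 : pr^[k] (fun r t => ((T - t) ^ κ * v r) ^ p) r t
      = (1 - t / T) ^ (1 / (1 - m)) * iteratedDeriv k (fun r => V r ^ p) r := by
    rw [e0]
    have : pr^[k] (fun r t => ((T - t) ^ κ * v r) ^ p) r t =
      pr^[k] (fun r t => (fun t => (T - t) ^ (p * κ) * T ^ (-(p * κ))) t * (fun r => V r ^ p) r) r t := by
      refine pr_iter_congr (a := a) (b := T) ?_ k r hr t ht
      intro r hr t ht
      have h0 : 0 ≤ T - t := by linarith [ht.2]
      have hV0 := (hV.pos r (le_of_lt hr)).le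
      simp only [hv]
      rw [mul_rpow (by positivity) (by positivity), mul_rpow (by positivity) hV0, ← rpow_mul h0,
        ← rpow_mul hT.le, mul_comm κ p, show -κ * p = -(p * κ) by ring, mul_assoc]
    rw [this, pr_iter_sep]
  rw [e1, e2, neg_one_mul, ← sub_eq_add_neg] at h
  refine h.trans ?_
  rw [mul_assoc]
  refine mul_mono_l ?_ hε.le
  have h3 := hlo r hr
  rw [Em0] at h3
  have hK := Kw_pos' n κ r ht.2
  rw [← mul_rpow hl.le hK.le]
  have h4 : l * Kw n κ T r t ≤ (T - t) ^ κ * v r := by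
    unfold Kw
    exact (mul_mono_l h3 (by positivity)).trans' (by rw [mul_left_comm])
  refine (rpow_le_rpow (by positivity) h4 hp0.le).trans_eq ?_
  simp only [hv]
  rw [e0, mul_rpow (by positivity) (by positivity), mul_rpow (by positivity) hV0.le, ← rpow_mul hTt.le,
        ← rpow_mul hT.le, mul_comm κ p, show -κ * p = -(p * κ) by ring, mul_assoc]

/-- Convergence in relative error of the spatial derivatives of the solution. -/
theorem convergence_of_spatial_derivatives
    (N : ℕ) (hN : 2 ≤ N) (m T : ℝ)
    (hm : m ∈ Set.Ioo (((N : ℝ) - 2) / ((N : ℝ) + 2)) 1) (hT : 0 < T)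
    (u : ℝ → ℝ → ℝ) (hu : IsRadialEnergySolution N m T u)
    (V : ℝ → ℝ) (hV : IsStationaryProfile N m T V) :
    ∀ k : ℕ, 1 ≤ k → ∃ F : ℝ → ℝ, ContDiffOn ℝ (⊤ : ℕ∞) F (Set.Ioi 0) ∧
      Filter.Tendsto F Filter.atTop (nhds 1) ∧
      ∀ ε > (0:ℝ), ∃ t₀ ∈ Set.Ioo 0 T, ∀ t ∈ Set.Ico t₀ T, ∀ r > (0:ℝ),
        |iteratedDeriv k (fun ρ => u ρ t) r /
            ((-1 : ℝ) ^ k * (((N : ℝ) - 1) / m) ^ k *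
              (1 - t / T) ^ (1 / (1 - m)) * V r ^ (1 / m)) - F r| ≤ ε := by
  obtain ⟨n, rfl⟩ : ∃ n, N = n + 1 := ⟨N - 1, by omega⟩
  have hn : 1 ≤ n := by omega
  have hn1 : (1:ℝ) ≤ n := by exact_mod_cast hn
  have hc : ((n + 1 : ℕ) : ℝ) - 1 = n := by push_cast; ring
  obtain ⟨hm, hm1⟩ := hm
  rw [show ((n + 1 : ℕ) : ℝ) - 2 = n - 1 by push_cast; ring, show ((n + 1 : ℕ) : ℝ) + 2 = n + 3 by push_cast; ring] at hm
  have hm0 : 0 < m := lt_of_le_of_lt (div_nonneg (by linarith) (by linarith)) hm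
  intro k _
  have hVs : ContDiffOn ℝ ∞ V (Ioi 0) := hV.smooth.mono Ioi_subset_Ici_self
  have hV0 : ∀ r > 0, 0 < V r := fun r hr => hV.pos r (le_of_lt hr)
  obtain ⟨g, hg, e⟩ := Pl.pow (n := n) (q := 1 / m) hVs hV0 k
  obtain ⟨l, hl, ha⟩ := hV.asymp
  rw [hc] at *
  have hq : 0 < (n:ℝ) / m := by positivity
  have hA : (-((n:ℝ) * (1 / m))) ^ k = (-1) ^ k * (n / m) ^ k := by rw [← mul_pow]; congr 1; ring
  rw [hA] at hg
  set A : ℝ := (-1) ^ k * (n / m) ^ k with hAd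
  have hAabs : 0 < |A| := by
    rw [hAd, abs_pos]; exact mul_ne_zero (pow_ne_zero _ (by norm_num)) (pow_ne_zero _ hq.ne')
  have hA0 : A ≠ 0 := abs_pos.1 hAabs
  refine ⟨fun r => g r / A, (hg.smooth hVs hV0).div_const A, ?_, ?_⟩
  · have := (hg.lim hl ha).div_const A
    rwa [div_self hA0] at this
  intro ε hε
  have hev := (conv_main hn hm hm1 hT hu hV k (mul_pos hε hAabs)).and (ev_Ioo hT)
  obtain ⟨t1, ht1, hs⟩ := (mem_nhdsLT_iff_exists_Ioo_subset' (hT)).1 hev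
  have hM : max t1 0 < T := max_lt ht1 hT
  refine ⟨(max t1 0 + T) / 2, ⟨by linarith [le_max_right t1 0], by linarith⟩, ?_⟩
  intro t ht r hr
  obtain ⟨h, ht'⟩ := hs ⟨by linarith [ht.1, le_max_left t1 0], ht.2⟩
  have h := h r hr
  have hτ : 0 < 1 - t / T := by rw [sub_pos, div_lt_one hT]; exact ht.2
  have hp1 : 0 < (1 - t / T) ^ (1 / (1 - m)) := rpow_pos_of_pos hτ _
  have hp2 : 0 < V r ^ (1 / m) := rpow_pos_of_pos (hV0 r hr) _
  rw [e r hr] at h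
  generalize (1 - t / T) ^ (1 / (1 - m)) = x at *
  generalize V r ^ (1 / m) = y at *
  rw [show iteratedDeriv k (fun ρ => u ρ t) r / (A * x * y) - g r / A
    = (iteratedDeriv k (fun ρ => u ρ t) r - x * (g r * y)) / (A * x * y) by field_simp]
  rw [abs_div, abs_mul, abs_mul, abs_of_pos hp1, abs_of_pos hp2, div_le_iff₀ (by positivity)]
  refine h.trans_eq ?_
  ring
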